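/- Let K be a global function field of characteristic p containing a primitive q-th root of unity, where q ≠ p is prime, let 𝐊 be a q-bounded (possibly infinite) algebraic extension of K, and let S be a nonempty finite set of primes of K. For x ∈ 𝐊^×, the following are equivalent: (i) x ∈ O_{𝐊,S}; (ii) for all a ∈ 𝒱_{𝐊,S} and all b ∈ U_{𝐊,S} for which every element inverted below is nonzero, there exists y ∈ 𝐋_4(a^{1/q}) with N_{𝐋_4(a^{1/q})/𝐋_4}(y) = b x^q + b^q, where 𝐋_1 = 𝐊((1+(bx^q+b^q)^{-1})^{1/q}), 𝐋_3 = 𝐋_1((1+x^{-1})^{1/q}), and 𝐋_4 = 𝐋_3((1+(a+a^{-1})x^{-1})^{1/q}). -/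

import Mathlib

noncomputable section

/-- A normalized (surjective onto `ℤ`) discrete valuation on a field `K`, i.e. a
"prime" of a global function field. -/
structure FFPrime (K : Type) [Field K] where
  ord : K → WithTop ℤ
  ord_zero : ord 0 = ⊤
  ord_ne_top : ∀ x : K, x ≠ 0 → ord x ≠ ⊤
  ord_one : ord 1 = 0
  ord_mul : ∀ x y : K, ord (x * y) = ord x + ord y
  ord_add : ∀ x y : K, min (ord x) (ord y) ≤ ord (x + y)
  ord_surj : ∀ n : ℤ, ∃ x : K, ord x = (n : WithTop ℤ)

namespace FFPrime

variable {K L : Type} [Field K] [Field L]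

/-- `w` lies over `v` along `φ`, with ramification index `e`. -/
def LiesOverWith (w : FFPrime L) (v : FFPrime K) (φ : K →+* L) (e : ℕ) : Prop :=
  0 < e ∧ ∀ x : K, w.ord (φ x) = ((e : ℤ) : WithTop ℤ) * v.ord x

/-- `w` lies over `v` along `φ`. -/
def LiesOver (w : FFPrime L) (v : FFPrime K) (φ : K →+* L) : Prop :=
  ∃ e : ℕ, w.LiesOverWith v φ e

open Classical in
/-- The ramification index `e(w/v)`. -/
noncomputable def ramIdx (w : FFPrime L) (v : FFPrime K) (φ : K →+* L) : ℕ :=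
  if h : ∃ e : ℕ, w.LiesOverWith v φ e then h.choose else 0

/-- The residue field of `v` has exactly `n` elements. -/
def HasResidueCard (v : FFPrime K) (n : ℕ) : Prop :=
  ∃ s : Finset K, s.card = n ∧ (∀ x ∈ s, 0 ≤ v.ord x) ∧
    (∀ x ∈ s, ∀ y ∈ s, x ≠ y → ¬ 0 < v.ord (x - y)) ∧
    (∀ z : K, 0 ≤ v.ord z → ∃ x ∈ s, 0 < v.ord (z - x))

open Classical in
/-- The residue (relative) degree `f(w/v)`: the unique `f ≥ 1` with
`#κ_w = (#κ_v) ^ f` (residue fields of global function fields are finite). -/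
noncomputable def resDeg (w : FFPrime L) (v : FFPrime K) : ℕ :=
  if h : ∃ f : ℕ, 0 < f ∧ ∃ m n : ℕ, 1 < m ∧ v.HasResidueCard m ∧
      w.HasResidueCard n ∧ n = m ^ f then h.choose else 0

/-- `v` splits completely in the extension given by `φ`: every prime above it has
ramification index and residue degree `1`. -/
def SplitsCompletely (v : FFPrime K) (φ : K →+* L) : Prop :=
  ∀ w : FFPrime L, w.LiesOver v φ → w.ramIdx v φ = 1 ∧ w.resDeg v = 1

/-- `v` is inert in the finite extension `M/K`: there is a unique prime above it, with
ramification index `1` and residue degree `[M : K]`. -/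
def IsInert (v : FFPrime K) (M : Type) [Field M] [Algebra K M] : Prop :=
  (∃! w : FFPrime M, w.LiesOver v (algebraMap K M)) ∧
    ∀ w : FFPrime M, w.LiesOver v (algebraMap K M) →
      w.ramIdx v (algebraMap K M) = 1 ∧ w.resDeg v = Module.finrank K M

/-- `v` ramifies in the extension given by `φ`: some prime above it has ramification
index `> 1`. -/
def Ramifies (v : FFPrime K) (φ : K →+* L) : Prop :=
  ∃ w : FFPrime L, w.LiesOver v φ ∧ 2 ≤ w.ramIdx v φ

/-- `ord_v z ≡ 0 mod q`. -/
def OrdDvd (v : FFPrime K) (q : ℕ) (z : K) : Prop :=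
  ∃ n : ℤ, v.ord z = (((q : ℤ) * n : ℤ) : WithTop ℤ)

end FFPrime

/-- A nontrivial (rank one) valuation on a possibly infinite algebraic extension of a
global function field, with values in `ℚ ∪ {∞}`. -/
structure FFVal (B : Type) [Field B] where
  ord : B → WithTop ℚ
  ord_zero : ord 0 = ⊤
  ord_ne_top : ∀ x : B, x ≠ 0 → ord x ≠ ⊤
  ord_one : ord 1 = 0
  ord_mul : ∀ x y : B, ord (x * y) = ord x + ord y
  ord_add : ∀ x y : B, min (ord x) (ord y) ≤ ord (x + y)
  nontrivial : ∃ x : B, ord x ≠ 0 ∧ ord x ≠ ⊤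

/-- The valuation `V` of the big field restricts, up to a normalization factor `c`, to
the (normalized discrete) prime `v` of `K` along `φ`; i.e. `v` is the prime of `K`
lying below `V`. -/
def FFVal.RestrictsTo {K B : Type} [Field K] [Field B] (V : FFVal B) (v : FFPrime K)
    (φ : K →+* B) : Prop :=
  ∃ c : ℚ, 0 < c ∧
    ∀ x : K, V.ord (φ x) = ((c : ℚ) : WithTop ℚ) * WithTop.map (fun n : ℤ => (n : ℚ)) (v.ord x)

/-- The algebraic extension `B` of the rational function field `F0 = 𝔽_p(t)` is
`q`-bounded: for every valuation of `B`, the `q`-adic valuations of the ramification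
indices and residue degrees along every finite subextension are bounded. -/
def IsQBounded (q : ℕ) (F0 B : Type) [Field F0] [Field B] [Algebra F0 B] : Prop :=
  ∀ V : FFVal B, ∃ C : ℕ,
    ∀ L : IntermediateField F0 B, FiniteDimensional F0 L →
      ∀ v0 : FFPrime F0, ∀ vL : FFPrime L,
        V.RestrictsTo v0 (algebraMap F0 B) →
        V.RestrictsTo vL L.val.toRingHom →
        padicValNat q (vL.ramIdx v0 (algebraMap F0 L)) ≤ C ∧
        padicValNat q (vL.resDeg v0) ≤ C

/-- The prime `v` of `K` has uniformly `q`-bounded ramification in `B`. -/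
def UnifQBoundedRam (q : ℕ) {K : Type} [Field K] (B : Type) [Field B] [Algebra K B]
    (v : FFPrime K) : Prop :=
  ∃ C : ℕ, ∀ F : IntermediateField K B, FiniteDimensional K F →
    ∀ w : FFPrime F, w.LiesOver v (algebraMap K F) →
      padicValNat q (w.ramIdx v (algebraMap K F)) ≤ C

/-- The prime `v` of `K` has uniformly absolutely bounded ramification in `B`. -/
def UnifAbsBoundedRam {K : Type} [Field K] (B : Type) [Field B] [Algebra K B]
    (v : FFPrime K) : Prop :=
  ∃ C : ℕ, ∀ F : IntermediateField K B, FiniteDimensional K F →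
    ∀ w : FFPrime F, w.LiesOver v (algebraMap K F) →
      w.ramIdx v (algebraMap K F) ≤ C

/-- The prime `v` of `K` has uniformly `q`-bounded relative (residue) degree in `B`. -/
def UnifQBoundedRes (q : ℕ) {K : Type} [Field K] (B : Type) [Field B] [Algebra K B]
    (v : FFPrime K) : Prop :=
  ∃ C : ℕ, ∀ F : IntermediateField K B, FiniteDimensional K F →
    ∀ w : FFPrime F, w.LiesOver v (algebraMap K F) →
      padicValNat q (w.resDeg v) ≤ C

/-- The prime `v` of `K` is uniformly `q`-bounded in `B`. -/
def UniformlyQBoundedAt (q : ℕ) {K : Type} [Field K] (B : Type) [Field B] [Algebra K B]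
    (v : FFPrime K) : Prop :=
  UnifQBoundedRam q B v ∧ UnifQBoundedRes q B v

/-- The integral closure in `B` of the valuation ring `O_v = {x ∈ K : ord_v x ≥ 0}`. -/
def valIntegralClosure {K : Type} [Field K] (v : FFPrime K) (B : Type) [Field B]
    [Algebra K B] : Set B :=
  {x : B | ∃ P : Polynomial K, P.Monic ∧ (∀ n : ℕ, 0 ≤ v.ord (P.coeff n)) ∧
    Polynomial.aeval x P = 0}

/-- The integral closure in `B` of the ring `O_{K,S}` of `S`-integers of `K`. -/
def sIntegralClosure {K : Type} [Field K] (S : Set (FFPrime K)) (B : Type) [Field B]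
    [Algebra K B] : Set B :=
  {x : B | ∃ P : Polynomial K, P.Monic ∧
    (∀ n : ℕ, ∀ v : FFPrime K, v ∉ S → 0 ≤ v.ord (P.coeff n)) ∧
    Polynomial.aeval x P = 0}

/-- Elements of `B` that are units at every prime of `B` lying over a prime of `S`. -/
def unitsAtS {K : Type} [Field K] (S : Set (FFPrime K)) (B : Type) [Field B]
    [Algebra K B] : Set B :=
  {x : B | ∀ V : FFVal B, (∃ v ∈ S, V.RestrictsTo v (algebraMap K B)) → V.ord x = 0}

/-- Elements `x` of `B` with `ord (x - 1) > 0` at every prime of `B` lying over a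
prime of `S`. -/
def onesAtS {K : Type} [Field K] (S : Set (FFPrime K)) (B : Type) [Field B]
    [Algebra K B] : Set B :=
  {x : B | ∀ V : FFVal B, (∃ v ∈ S, V.RestrictsTo v (algebraMap K B)) → 0 < V.ord (x - 1)}

/-- A subset of a commutative ring is first-order definable in the language of rings
`{0, 1, +, ·}` with parameters from the ring. -/
def FODefinable {R : Type} [CommRing R] (X : Set R) : Prop :=
  letI : FirstOrder.Ring.CompatibleRing R := FirstOrder.Ring.compatibleRingOfRing R
  Set.Definable₁ (Set.univ : Set R) FirstOrder.Language.ring X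

/-- A subset of a commutative ring is existentially (diophantine) definable: it is cut
out by a block of existential quantifiers followed by a system of polynomial equations,
with parameters (coefficients) from the ring. -/
def ExistDefinable {R : Type} [CommRing R] (X : Set R) : Prop :=
  ∃ (k m : ℕ) (P : Fin m → MvPolynomial (Fin (k + 1)) R),
    ∀ x : R, x ∈ X ↔ ∃ y : Fin k → R, ∀ i : Fin m,
      MvPolynomial.eval (Fin.cons x y) (P i) = 0

/-- Solvability of the norm equation `N(y) = b·x^q + b^q` over (every realization of)
the tower `L₂(a^{1/q})/L₂`, where `L₁ = F((1+(b x^q+b^q)⁻¹)^{1/q})` and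
`L₂ = L₁((1+(a+a⁻¹)b⁻¹)^{1/q})`. -/
def NormTower2Solvable (q : ℕ) (F : Type) [Field F] (a b x : F) : Prop :=
  ∀ (M1 : Type) [Field M1] [Algebra F M1] (α1 : M1),
    α1 ^ q = algebraMap F M1 (1 + (b * x ^ q + b ^ q)⁻¹) →
    IntermediateField.adjoin F {α1} = ⊤ →
    ∀ (M2 : Type) [Field M2] [Algebra M1 M2] (α2 : M2),
      α2 ^ q = algebraMap M1 M2 (algebraMap F M1 (1 + (a + a⁻¹) * b⁻¹)) →
      IntermediateField.adjoin M1 {α2} = ⊤ →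
      ∀ (M3 : Type) [Field M3] [Algebra M2 M3] (α3 : M3),
        α3 ^ q = algebraMap M2 M3 (algebraMap M1 M2 (algebraMap F M1 a)) →
        IntermediateField.adjoin M2 {α3} = ⊤ →
        ∃ y : M3, Algebra.norm M2 y = algebraMap M1 M2 (algebraMap F M1 (b * x ^ q + b ^ q))

/-- Solvability of the norm equation `N(y) = b·x^q + b^q` over (every realization of)
the tower `L₄(a^{1/q})/L₄`, where `L₁ = F((1+(b x^q+b^q)⁻¹)^{1/q})`,
`L₃ = L₁((1+x⁻¹)^{1/q})` and `L₄ = L₃((1+(a+a⁻¹)x⁻¹)^{1/q})`. -/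
def NormTower4Solvable (q : ℕ) (F : Type) [Field F] (a b x : F) : Prop :=
  ∀ (M1 : Type) [Field M1] [Algebra F M1] (α1 : M1),
    α1 ^ q = algebraMap F M1 (1 + (b * x ^ q + b ^ q)⁻¹) →
    IntermediateField.adjoin F {α1} = ⊤ →
    ∀ (M3 : Type) [Field M3] [Algebra M1 M3] (α3 : M3),
      α3 ^ q = algebraMap M1 M3 (algebraMap F M1 (1 + x⁻¹)) →
      IntermediateField.adjoin M1 {α3} = ⊤ →
      ∀ (M4 : Type) [Field M4] [Algebra M3 M4] (α4 : M4),
        α4 ^ q = algebraMap M3 M4 (algebraMap M1 M3 (algebraMap F M1 (1 + (a + a⁻¹) * x⁻¹))) →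
        IntermediateField.adjoin M3 {α4} = ⊤ →
        ∀ (M5 : Type) [Field M5] [Algebra M4 M5] (α5 : M5),
          α5 ^ q = algebraMap M4 M5 (algebraMap M3 M4 (algebraMap M1 M3 (algebraMap F M1 a))) →
          IntermediateField.adjoin M4 {α5} = ⊤ →
          ∃ y : M5, Algebra.norm M4 y =
            algebraMap M3 M4 (algebraMap M1 M3 (algebraMap F M1 (b * x ^ q + b ^ q)))

/-- Unsolvability of the norm equation `N(y) = b·x^q + b^q` over (every realization of)
the tower `L₄(a^{1/q})/L₄` as in `NormTower4Solvable`. -/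
def NormTower4Unsolvable (q : ℕ) (F : Type) [Field F] (a b x : F) : Prop :=
  ∀ (M1 : Type) [Field M1] [Algebra F M1] (α1 : M1),
    α1 ^ q = algebraMap F M1 (1 + (b * x ^ q + b ^ q)⁻¹) →
    IntermediateField.adjoin F {α1} = ⊤ →
    ∀ (M3 : Type) [Field M3] [Algebra M1 M3] (α3 : M3),
      α3 ^ q = algebraMap M1 M3 (algebraMap F M1 (1 + x⁻¹)) →
      IntermediateField.adjoin M1 {α3} = ⊤ →
      ∀ (M4 : Type) [Field M4] [Algebra M3 M4] (α4 : M4),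
        α4 ^ q = algebraMap M3 M4 (algebraMap M1 M3 (algebraMap F M1 (1 + (a + a⁻¹) * x⁻¹))) →
        IntermediateField.adjoin M3 {α4} = ⊤ →
        ∀ (M5 : Type) [Field M5] [Algebra M4 M5] (α5 : M5),
          α5 ^ q = algebraMap M4 M5 (algebraMap M3 M4 (algebraMap M1 M3 (algebraMap F M1 a))) →
          IntermediateField.adjoin M4 {α5} = ⊤ →
          ¬ ∃ y : M5, Algebra.norm M4 y =
            algebraMap M3 M4 (algebraMap M1 M3 (algebraMap F M1 (b * x ^ q + b ^ q)))

noncomputable section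

namespace FFPrime
variable {L : Type} [Field L] (w : FFPrime L)

/-- additive valuation attached to a prime -/
def av : AddValuation L (WithTop ℤ) :=
  AddValuation.of w.ord w.ord_zero w.ord_one w.ord_add w.ord_mul

theorem av_apply (x : L) : w.av x = w.ord x := rfl

@[ext] theorem ext' {v w : FFPrime L} (h : ∀ x, v.ord x = w.ord x) : v = w := by
  cases v; cases w; congr; funext x; exact h x

/-- integer valued valuation, junk `0` at `0` -/
def val (x : L) : ℤ := (w.ord x).untopD 0

theorem ord_eq_top_iff {x : L} : w.ord x = ⊤ ↔ x = 0 :=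
  ⟨fun h => by by_contra hx; exact w.ord_ne_top x hx h, fun h => h ▸ w.ord_zero⟩

theorem ord_eq {x : L} (hx : x ≠ 0) : w.ord x = (w.val x : WithTop ℤ) := by
  have := w.ord_ne_top x hx
  unfold val
  cases h : w.ord x with
  | top => exact absurd h this
  | coe a => rfl

theorem val_of_ord {x : L} {n : ℤ} (h : w.ord x = n) : w.val x = n := by
  simp [val, h]

theorem ne_zero_of_ord {x : L} {n : ℤ} (h : w.ord x = n) : x ≠ 0 := by
  rintro rfl; rw [w.ord_zero] at h; exact WithTop.top_ne_coe h

theorem val_mul {x y : L} (hx : x ≠ 0) (hy : y ≠ 0) : w.val (x * y) = w.val x + w.val y := by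
  apply w.val_of_ord; rw [w.ord_mul, w.ord_eq hx, w.ord_eq hy]; rfl

@[simp] theorem val_one : w.val (1 : L) = 0 := w.val_of_ord w.ord_one

@[simp] theorem val_zero : w.val (0 : L) = 0 := by simp [val, w.ord_zero]

theorem val_inv (x : L) : w.val x⁻¹ = - w.val x := by
  by_cases hx : x = 0
  · simp [hx]
  have := w.val_mul hx (inv_ne_zero hx)
  rw [mul_inv_cancel₀ hx, val_one] at this; omega

theorem val_div {x y : L} (hx : x ≠ 0) (hy : y ≠ 0) : w.val (x / y) = w.val x - w.val y := by
  rw [div_eq_mul_inv, w.val_mul hx (inv_ne_zero hy), val_inv]; ring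

theorem val_pow (x : L) (n : ℕ) : w.val (x ^ n) = n * w.val x := by
  by_cases hx : x = 0
  · subst hx; cases n <;> simp
  induction n with
  | zero => simp
  | succ n ih => rw [pow_succ, w.val_mul (pow_ne_zero _ hx) hx, ih]; push_cast; ring

theorem val_zpow (x : L) (n : ℤ) : w.val (x ^ n) = n * w.val x := by
  cases n with
  | ofNat n => simp [val_pow]
  | negSucc n => rw [zpow_negSucc, val_inv, val_pow]; simp [Int.negSucc_eq]; ring

theorem val_neg (x : L) : w.val (-x) = w.val x := by
  have : w.ord (-x) = w.ord x := w.av.map_neg x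
  simp [val, this]

theorem ord_neg (x : L) : w.ord (-x) = w.ord x := w.av.map_neg x

theorem coe_le_ord {x : L} {n : ℤ} : (n : WithTop ℤ) ≤ w.ord x ↔ (x = 0 ∨ n ≤ w.val x) := by
  by_cases hx : x = 0
  · simp [hx, w.ord_zero]
  · rw [w.ord_eq hx]; simp [hx]

theorem zero_le_ord {x : L} : 0 ≤ w.ord x ↔ 0 ≤ w.val x := by
  by_cases hx : x = 0
  · simp [hx, w.ord_zero]
  · rw [w.ord_eq hx]; exact WithTop.coe_le_coe

theorem ord_pos_iff {x : L} : 0 < w.ord x ↔ (x = 0 ∨ 0 < w.val x) := by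
  by_cases hx : x = 0
  · simp [hx, w.ord_zero]
  · rw [w.ord_eq hx]; simp only [hx, false_or]; exact WithTop.coe_lt_coe

theorem ord_pos_iff_one_le {x : L} : 0 < w.ord x ↔ ((1 : ℤ) : WithTop ℤ) ≤ w.ord x := by
  rw [ord_pos_iff, coe_le_ord]; rfl

theorem val_add {x y : L} {n : ℤ} (hx : x = 0 ∨ n ≤ w.val x) (hy : y = 0 ∨ n ≤ w.val y) :
    x + y = 0 ∨ n ≤ w.val (x + y) := by
  rw [← coe_le_ord] at *
  exact (le_min hx hy).trans (w.ord_add x y)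

theorem val_add_eq {x y : L} (hx : x ≠ 0) (h : y = 0 ∨ w.val x < w.val y) :
    x + y ≠ 0 ∧ w.val (x + y) = w.val x := by
  have h1 : w.ord x < w.ord y := by
    rcases h with rfl | h
    · rw [w.ord_zero, w.ord_eq hx]; exact WithTop.coe_lt_top _
    · rcases eq_or_ne y 0 with rfl | hy
      · rw [w.ord_zero, w.ord_eq hx]; exact WithTop.coe_lt_top _
      · rw [w.ord_eq hx, w.ord_eq hy]; exact WithTop.coe_lt_coe.2 h
  have h2 : w.ord (x + y) = w.ord x := w.av.map_add_eq_of_lt_left h1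
  rw [w.ord_eq hx] at h2
  exact ⟨w.ne_zero_of_ord h2, w.val_of_ord h2⟩

theorem val_surj (n : ℤ) : ∃ x : L, x ≠ 0 ∧ w.val x = n := by
  obtain ⟨x, hx⟩ := w.ord_surj n
  exact ⟨x, w.ne_zero_of_ord hx, w.val_of_ord hx⟩

theorem ext_val {v w : FFPrime L} (h : ∀ x, x ≠ 0 → v.val x = w.val x) : v = w := by
  apply ext'; intro x
  by_cases hx : x = 0
  · rw [hx, v.ord_zero, w.ord_zero]
  · rw [v.ord_eq hx, w.ord_eq hx, h x hx]

/-- build a prime from an integer valued function -/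
def mk' (f : L → ℤ) (h1 : f 1 = 0) (hm : ∀ x y, x ≠ 0 → y ≠ 0 → f (x * y) = f x + f y)
    (ha : ∀ x y, x ≠ 0 → y ≠ 0 → x + y ≠ 0 → min (f x) (f y) ≤ f (x + y))
    (hs : ∃ x, x ≠ 0 ∧ f x = 1) : FFPrime L := by
  classical
  exact
  { ord := fun x => if x = 0 then ⊤ else (f x : WithTop ℤ)
    ord_zero := by simp
    ord_ne_top := fun x hx => by simp [hx]
    ord_one := by simp [h1]
    ord_mul := fun x y => by
      by_cases hx : x = 0
      · simp [hx]
      by_cases hy : y = 0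
      · simp [hy]
      simp [hx, hy, hm x y hx hy]
    ord_add := fun x y => by
      by_cases hx : x = 0
      · simp [hx]
      by_cases hy : y = 0
      · simp [hy]
      by_cases hxy : x + y = 0
      · simp [hxy]
      simp only [hx, hy, hxy, if_false]
      exact_mod_cast ha x y hx hy hxy
    ord_surj := fun n => by
      obtain ⟨x, hx, hx1⟩ := hs
      refine ⟨x ^ n, ?_⟩
      simp only [zpow_ne_zero n hx, if_false]
      have hp : ∀ k : ℕ, f (x ^ k) = k := by
        intro k
        induction k with
        | zero => simp [h1]
        | succ k ih => rw [pow_succ, hm _ _ (pow_ne_zero _ hx) hx, ih, hx1]; push_cast; ring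
      have hi : ∀ y, y ≠ 0 → f y⁻¹ = - f y := by
        intro y hy
        have := hm y y⁻¹ hy (inv_ne_zero hy)
        rw [mul_inv_cancel₀ hy, h1] at this; omega
      congr 1
      cases n with
      | ofNat n => simp [hp]
      | negSucc n =>
        rw [zpow_negSucc, hi _ (pow_ne_zero _ hx), hp]; simp [Int.negSucc_eq] }

theorem mk'_val (f : L → ℤ) (h1 hm ha hs) {x : L} (hx : x ≠ 0) :
    (mk' f h1 hm ha hs).val x = f x := by
  apply val_of_ord; simp [mk', hx]

/-- sums -/
theorem val_sum {ι : Type*} (s : Finset ι) (f : ι → L) (n : ℤ)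
    (h : ∀ i ∈ s, f i = 0 ∨ n ≤ w.val (f i)) :
    ∑ i ∈ s, f i = 0 ∨ n ≤ w.val (∑ i ∈ s, f i) := by
  simp only [← coe_le_ord] at *
  exact w.av.map_le_sum h

end FFPrime

namespace FFVal
variable {L : Type} [Field L] (w : FFVal L)

def av : AddValuation L (WithTop ℚ) :=
  AddValuation.of w.ord w.ord_zero w.ord_one w.ord_add w.ord_mul

theorem av_apply (x : L) : w.av x = w.ord x := rfl

def val (x : L) : ℚ := (w.ord x).untopD 0

theorem ord_eq_top_iff {x : L} : w.ord x = ⊤ ↔ x = 0 :=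
  ⟨fun h => by by_contra hx; exact w.ord_ne_top x hx h, fun h => h ▸ w.ord_zero⟩

theorem ord_eq {x : L} (hx : x ≠ 0) : w.ord x = (w.val x : WithTop ℚ) := by
  have := w.ord_ne_top x hx
  unfold val
  cases h : w.ord x with
  | top => exact absurd h this
  | coe a => rfl

theorem val_of_ord {x : L} {n : ℚ} (h : w.ord x = n) : w.val x = n := by
  simp [val, h]

theorem ne_zero_of_ord {x : L} {n : ℚ} (h : w.ord x = n) : x ≠ 0 := by
  rintro rfl; rw [w.ord_zero] at h; exact WithTop.top_ne_coe h

theorem val_mul {x y : L} (hx : x ≠ 0) (hy : y ≠ 0) : w.val (x * y) = w.val x + w.val y := by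
  apply w.val_of_ord; rw [w.ord_mul, w.ord_eq hx, w.ord_eq hy]; rfl

@[simp] theorem val_one : w.val (1 : L) = 0 := w.val_of_ord w.ord_one

@[simp] theorem val_zero : w.val (0 : L) = 0 := by simp [val, w.ord_zero]

theorem val_inv (x : L) : w.val x⁻¹ = - w.val x := by
  by_cases hx : x = 0
  · simp [hx]
  have := w.val_mul hx (inv_ne_zero hx)
  rw [mul_inv_cancel₀ hx, val_one] at this; linarith

theorem val_div {x y : L} (hx : x ≠ 0) (hy : y ≠ 0) : w.val (x / y) = w.val x - w.val y := by
  rw [div_eq_mul_inv, w.val_mul hx (inv_ne_zero hy), val_inv]; ring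

theorem val_pow (x : L) (n : ℕ) : w.val (x ^ n) = n * w.val x := by
  by_cases hx : x = 0
  · subst hx; cases n <;> simp
  induction n with
  | zero => simp
  | succ n ih => rw [pow_succ, w.val_mul (pow_ne_zero _ hx) hx, ih]; push_cast; ring

theorem val_neg (x : L) : w.val (-x) = w.val x := by
  have : w.ord (-x) = w.ord x := w.av.map_neg x
  simp [val, this]

theorem ord_neg (x : L) : w.ord (-x) = w.ord x := w.av.map_neg x

theorem coe_le_ord {x : L} {n : ℚ} : (n : WithTop ℚ) ≤ w.ord x ↔ (x = 0 ∨ n ≤ w.val x) := by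
  by_cases hx : x = 0
  · simp [hx, w.ord_zero]
  · rw [w.ord_eq hx]; simp [hx]

theorem coe_lt_ord {x : L} {n : ℚ} : (n : WithTop ℚ) < w.ord x ↔ (x = 0 ∨ n < w.val x) := by
  by_cases hx : x = 0
  · simp [hx, w.ord_zero]
  · rw [w.ord_eq hx]; simp [hx]

theorem zero_le_ord {x : L} : 0 ≤ w.ord x ↔ 0 ≤ w.val x := by
  by_cases hx : x = 0
  · simp [hx, w.ord_zero]
  · rw [w.ord_eq hx]; exact WithTop.coe_le_coe

theorem ord_pos_iff {x : L} : 0 < w.ord x ↔ (x = 0 ∨ 0 < w.val x) := by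
  exact w.coe_lt_ord (n := 0)

theorem val_add_eq {x y : L} (hx : x ≠ 0) (h : y = 0 ∨ w.val x < w.val y) :
    x + y ≠ 0 ∧ w.val (x + y) = w.val x := by
  have h1 : w.ord x < w.ord y := by rw [w.ord_eq hx]; exact w.coe_lt_ord.2 h
  have h2 : w.ord (x + y) = w.ord x := w.av.map_add_eq_of_lt_left h1
  rw [w.ord_eq hx] at h2
  exact ⟨w.ne_zero_of_ord h2, w.val_of_ord h2⟩

theorem val_sum_le {ι : Type*} (s : Finset ι) (f : ι → L) (n : ℚ)
    (h : ∀ i ∈ s, f i = 0 ∨ n ≤ w.val (f i)) :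
    ∑ i ∈ s, f i = 0 ∨ n ≤ w.val (∑ i ∈ s, f i) := by
  simp only [← coe_le_ord] at *
  exact w.av.map_le_sum h

theorem val_sum_lt {ι : Type*} (s : Finset ι) (f : ι → L) (n : ℚ)
    (h : ∀ i ∈ s, f i = 0 ∨ n < w.val (f i)) :
    ∑ i ∈ s, f i = 0 ∨ n < w.val (∑ i ∈ s, f i) := by
  simp only [← coe_lt_ord] at *
  exact w.av.map_lt_sum (WithTop.coe_ne_top) h

/-- build a valuation from a rational valued function -/
def mk' (f : L → ℚ) (h1 : f 1 = 0) (hm : ∀ x y, x ≠ 0 → y ≠ 0 → f (x * y) = f x + f y)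
    (ha : ∀ x y, x ≠ 0 → y ≠ 0 → x + y ≠ 0 → min (f x) (f y) ≤ f (x + y))
    (hs : ∃ x, x ≠ 0 ∧ f x ≠ 0) : FFVal L := by
  classical
  exact
  { ord := fun x => if x = 0 then ⊤ else (f x : WithTop ℚ)
    ord_zero := by simp
    ord_ne_top := fun x hx => by simp [hx]
    ord_one := by simp [h1]
    ord_mul := fun x y => by
      by_cases hx : x = 0
      · simp [hx]
      by_cases hy : y = 0
      · simp [hy]
      simp [hx, hy, hm x y hx hy]
    ord_add := fun x y => by
      by_cases hx : x = 0
      · simp [hx]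
      by_cases hy : y = 0
      · simp [hy]
      by_cases hxy : x + y = 0
      · simp [hxy]
      simp only [hx, hy, hxy, if_false]
      exact_mod_cast ha x y hx hy hxy
    nontrivial := by
      obtain ⟨x, hx, hx1⟩ := hs
      refine ⟨x, ?_⟩
      simp [hx, hx1] }

theorem mk'_val (f : L → ℚ) (h1 hm ha hs) {x : L} (hx : x ≠ 0) :
    (mk' f h1 hm ha hs).val x = f x := by
  apply val_of_ord; simp [mk', hx]

end FFVal

theorem ffval_restricts_iff {K B : Type} [Field K] [Field B] (V : FFVal B) (v : FFPrime K)
    (φ : K →+* B) : V.RestrictsTo v φ ↔ ∃ c : ℚ, 0 < c ∧ ∀ x, V.val (φ x) = c * v.val x := by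
  constructor
  · rintro ⟨c, hc, h⟩
    refine ⟨c, hc, fun x => ?_⟩
    by_cases hx : x = 0
    · simp [hx]
    · apply V.val_of_ord; rw [h, v.ord_eq hx]; rfl
  · rintro ⟨c, hc, h⟩
    refine ⟨c, hc, fun x => ?_⟩
    by_cases hx : x = 0
    · subst hx; simp only [map_zero, V.ord_zero, v.ord_zero, WithTop.map_top]
      rw [WithTop.mul_top]; simpa using hc.ne'
    · rw [V.ord_eq (by simpa using hx), v.ord_eq hx, h]; rfl

theorem ffprime_liesOverWith_iff {K B : Type} [Field K] [Field B] (w : FFPrime B) (v : FFPrime K)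
    (φ : K →+* B) (e : ℕ) : w.LiesOverWith v φ e ↔ 0 < e ∧ ∀ x, w.val (φ x) = e * v.val x := by
  constructor
  · rintro ⟨hc, h⟩
    refine ⟨hc, fun x => ?_⟩
    by_cases hx : x = 0
    · simp [hx]
    · apply w.val_of_ord; rw [h, v.ord_eq hx]; rfl
  · rintro ⟨hc, h⟩
    refine ⟨hc, fun x => ?_⟩
    by_cases hx : x = 0
    · subst hx; simp only [map_zero, w.ord_zero, v.ord_zero]
      rw [WithTop.mul_top]; simp; omega
    · rw [w.ord_eq (by simpa using hx), v.ord_eq hx, h]; rfl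

end

noncomputable section

/-- algebraic elements have, up to a power, the valuation of an element of the base -/
theorem exists_pow_val {F E Γ : Type*} [Field F] [Field E] [Algebra F E]
    [LinearOrderedCommGroupWithZero Γ] (v : Valuation E Γ) (x : E) (hx : x ≠ 0)
    (hi : IsIntegral F x) : ∃ n : ℕ, 0 < n ∧ n ≤ (minpoly F x).natDegree ∧ ∃ c : F, c ≠ 0 ∧
      v (x ^ n) = v (algebraMap F E c) := by
  classical
  set P := minpoly F x with hP
  have hP0 : P ≠ 0 := minpoly.ne_zero hi
  have hsum : ∑ i ∈ P.support, algebraMap F E (P.coeff i) * x ^ i = 0 := by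
    have := minpoly.aeval F x
    rw [Polynomial.aeval_eq_sum_range, ← hP] at this
    rw [← this]
    simp only [Algebra.smul_def]
    refine Finset.sum_subset Polynomial.supp_subset_range_natDegree_succ ?_
    intro i _ hi
    rw [Polynomial.notMem_support_iff.1 hi, map_zero, zero_mul]
  obtain ⟨j, hj, hmax⟩ := Finset.exists_max_image P.support
    (fun i => v (algebraMap F E (P.coeff i) * x ^ i)) (by simpa using hP0)
  have hnz : ∀ i ∈ P.support, algebraMap F E (P.coeff i) * x ^ i ≠ 0 := by
    intro i hi
    have := Polynomial.mem_support_iff.1 hi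
    exact mul_ne_zero (by simpa using this) (pow_ne_zero _ hx)
  have hex : ∃ i ∈ P.support, i ≠ j ∧ v (algebraMap F E (P.coeff i) * x ^ i) =
      v (algebraMap F E (P.coeff j) * x ^ j) := by
    by_contra hcon
    push Not at hcon
    have h1 : v (∑ i ∈ P.support \ {j}, algebraMap F E (P.coeff i) * x ^ i) <
        v (algebraMap F E (P.coeff j) * x ^ j) := by
      apply v.map_sum_lt
      · exact (v.ne_zero_iff).2 (hnz j hj)
      · intro i hi
        simp only [Finset.mem_sdiff, Finset.mem_singleton] at hi
        exact lt_of_le_of_ne (hmax i hi.1) (hcon i hi.1 hi.2)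
    rw [Finset.sum_eq_add_sum_sdiff_singleton_of_mem hj] at hsum
    rw [eq_neg_of_add_eq_zero_left hsum, Valuation.map_neg] at h1
    exact lt_irrefl _ h1
  obtain ⟨i, hi, hij, hv⟩ := hex
  have hi0 := Polynomial.mem_support_iff.1 hi
  have hj0 := Polynomial.mem_support_iff.1 hj
  have key : ∀ i j : ℕ, i ∈ P.support → j ∈ P.support → i < j →
      v (algebraMap F E (P.coeff i) * x ^ i) = v (algebraMap F E (P.coeff j) * x ^ j) →
      ∃ n : ℕ, 0 < n ∧ n ≤ P.natDegree ∧ ∃ c : F, c ≠ 0 ∧ v (x ^ n) = v (algebraMap F E c) := by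
    intro i j hi hj hij hv
    have hi0 := Polynomial.mem_support_iff.1 hi
    have hj0 := Polynomial.mem_support_iff.1 hj
    refine ⟨j - i, by omega, (Nat.sub_le _ _).trans (Polynomial.le_natDegree_of_mem_supp j hj),
      P.coeff i / P.coeff j, div_ne_zero hi0 hj0, ?_⟩
    have hxi : v x ^ i ≠ 0 := pow_ne_zero _ ((v.ne_zero_iff).2 hx)
    have hcj : v (algebraMap F E (P.coeff j)) ≠ 0 := (v.ne_zero_iff).2 (by simpa using hj0)
    have h2 : v x ^ j = v x ^ (j - i) * v x ^ i := by rw [← pow_add]; congr 1; omega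
    simp only [map_mul, map_pow, map_div₀] at hv ⊢
    rw [h2, ← mul_assoc] at hv
    have := mul_right_cancel₀ hxi hv
    rw [this, mul_div_cancel_left₀ _ hcj]
  rcases lt_or_gt_of_ne hij with h | h
  · exact key i j hi hj h hv
  · exact key j i hj hi h hv.symm

theorem FFVal.exists_pow_val {F E : Type} [Field F] [Field E] [Algebra F E] (V : FFVal E)
    (x : E) (hx : x ≠ 0) (hi : IsIntegral F x) :
    ∃ n : ℕ, 0 < n ∧ n ≤ (minpoly F x).natDegree ∧ ∃ c : F, c ≠ 0 ∧
      n * V.val x = V.val (algebraMap F E c) := by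
  have hx' : V.ord x ≠ ⊤ := V.ord_ne_top x hx
  obtain ⟨n, hn, hn', c, hc, h⟩ := _root_.exists_pow_val V.av x hx hi
  refine ⟨n, hn, hn', c, hc, ?_⟩
  have h' : V.ord (x ^ n) = V.ord (algebraMap F E c) := h
  rw [← V.val_pow]
  simp [FFVal.val, h']

/-- valuation ring of a prime -/
def FFPrime.vring {F : Type} [Field F] (v : FFPrime F) : Subring F where
  carrier := {x | 0 ≤ v.ord x}
  zero_mem' := by simp [v.ord_zero]
  one_mem' := by simp [v.ord_one]
  add_mem' {x y} hx hy := (le_min hx hy).trans (v.ord_add x y)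
  mul_mem' {x y} hx hy := by
    have hx : 0 ≤ v.ord x := hx
    have hy : 0 ≤ v.ord y := hy
    show 0 ≤ v.ord (x * y)
    rw [v.ord_mul]; exact add_nonneg hx hy
  neg_mem' {x} hx := by
    show 0 ≤ v.ord (-x)
    rw [v.ord_neg]; exact hx

theorem mem_valIntegralClosure_of_isIntegral {F E : Type} [Field F] [Field E] [Algebra F E] (v : FFPrime F) (x : E)
    (h : IsIntegral v.vring x) : x ∈ valIntegralClosure v E := by
  obtain ⟨P, hP, h0⟩ := h
  refine ⟨P.map v.vring.subtype, hP.map _, ?_, ?_⟩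
  · intro n; rw [Polynomial.coeff_map]; exact (P.coeff n).2
  · rw [Polynomial.aeval_def, Polynomial.eval₂_map]; exact h0

theorem base_notMem_valIntegralClosure {F E : Type} [Field F] [Field E] [Algebra F E] (v : FFPrime F) (x : F) (hx : v.val x < 0) :
    algebraMap F E x ∉ valIntegralClosure v E := by
  rintro ⟨P, hP, hc, h0⟩
  rw [Polynomial.aeval_algebraMap_apply, map_eq_zero, Polynomial.aeval_eq_sum_range,
    Finset.sum_range_succ] at h0
  have hx0 : x ≠ 0 := by rintro rfl; simp at hx
  simp only [smul_eq_mul] at h0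
  rw [Polynomial.coeff_natDegree, hP, one_mul, add_comm] at h0
  refine (v.val_add_eq (pow_ne_zero P.natDegree hx0) ?_).1 h0
  have := v.val_sum (Finset.range P.natDegree) (fun i => P.coeff i * x ^ i)
    (v.val (x ^ P.natDegree) + 1) ?_
  · rcases this with h | h
    · exact Or.inl h
    · right; omega
  · intro i hi
    by_cases hz : P.coeff i = 0
    · left; simp [hz]
    right
    rw [v.val_mul hz (pow_ne_zero _ hx0), v.val_pow, v.val_pow]
    have h1 : 0 ≤ v.val (P.coeff i) := v.zero_le_ord.1 (hc i)
    have h2 := Finset.mem_range.1 hi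
    have h3 : (i : ℤ) + 1 ≤ P.natDegree := by exact_mod_cast h2
    nlinarith

section subring
variable {F E : Type} [Field F] [Field E] [Algebra F E] [Algebra.IsAlgebraic F E]

theorem exists_ffval_of_subring (v : FFPrime F) (A : ValuationSubring E)
    (hA : ∀ x : F, algebraMap F E x ∈ A ↔ 0 ≤ v.val x) :
    ∃ V : FFVal E, (∀ x : F, V.val (algebraMap F E x) = v.val x) ∧
      (∀ x : E, x ≠ 0 → (x ∈ A ↔ 0 ≤ V.val x)) := by
  classical
  have hex : ∀ x : E, x ≠ 0 → ∃ n : ℕ, 0 < n ∧ ∃ c : F, c ≠ 0 ∧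
      A.valuation (x ^ n) = A.valuation (algebraMap F E c) := by
    intro x hx
    obtain ⟨n, hn, -, c, hc⟩ := exists_pow_val A.valuation x hx
      (Algebra.IsIntegral.isIntegral (R := F) x)
    exact ⟨n, hn, c, hc⟩
  choose! n hn c hc h using hex
  -- comparison on F
  have hF : ∀ x : F, A.valuation (algebraMap F E x) ≤ 1 ↔ 0 ≤ v.val x := by
    intro x; rw [ValuationSubring.valuation_le_one_iff, hA]
  have hF2 : ∀ x y : F, x ≠ 0 → y ≠ 0 → (A.valuation (algebraMap F E x) ≤
      A.valuation (algebraMap F E y) ↔ v.val y ≤ v.val x) := by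
    intro x y hx hy
    have h0 : A.valuation (algebraMap F E y) ≠ 0 := (Valuation.ne_zero_iff _).2 (by simpa using hy)
    have h1 := hF (x / y)
    rw [map_div₀, map_div₀, div_le_one₀ (zero_lt_iff.2 h0), v.val_div hx hy] at h1
    rw [h1]; constructor <;> intro h <;> linarith
  have hF3 : ∀ x y : F, x ≠ 0 → y ≠ 0 → A.valuation (algebraMap F E x) =
      A.valuation (algebraMap F E y) → v.val x = v.val y := by
    intro x y hx hy hxy
    apply le_antisymm
    · exact (hF2 y x hy hx).1 hxy.ge
    · exact (hF2 x y hx hy).1 hxy.le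
  let f : E → ℚ := fun x => if x = 0 then 0 else (v.val (c x) : ℚ) / n x
  have funi : ∀ x : E, x ≠ 0 → ∀ (m : ℕ) (d : F), 0 < m → d ≠ 0 →
      A.valuation (x ^ m) = A.valuation (algebraMap F E d) → f x = (v.val d : ℚ) / m := by
    intro x hx m d hm hd hmd
    simp only [f, if_neg hx]
    have e1 : A.valuation (algebraMap F E (c x ^ m)) =
        A.valuation (algebraMap F E (d ^ n x)) := by
      rw [map_pow, map_pow, ← h x hx, map_pow, map_pow, map_pow, ← hmd, map_pow, ← pow_mul,
        ← pow_mul, mul_comm]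
    have e2 := hF3 _ _ (pow_ne_zero _ (hc x hx)) (pow_ne_zero _ hd) e1
    rw [v.val_pow, v.val_pow] at e2
    have : (n x : ℚ) ≠ 0 := by exact_mod_cast (hn x hx).ne'
    have hm' : (m : ℚ) ≠ 0 := by exact_mod_cast hm.ne'
    rw [div_eq_div_iff this hm']
    have e3 : (m : ℚ) * v.val (c x) = n x * v.val d := by exact_mod_cast e2
    linarith
  have fbase : ∀ x : F, x ≠ 0 → f (algebraMap F E x) = v.val x := by
    intro x hx
    rw [funi _ (by simpa using hx) 1 x one_pos hx (by simp)]; simp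
  have fmul : ∀ x y, x ≠ 0 → y ≠ 0 → f (x * y) = f x + f y := by
    intro x y hx hy
    rw [funi (x * y) (mul_ne_zero hx hy) (n x * n y) (c x ^ n y * c y ^ n x)
      (Nat.mul_pos (hn x hx) (hn y hy))
      (mul_ne_zero (pow_ne_zero _ (hc x hx)) (pow_ne_zero _ (hc y hy)))]
    · simp only [f, if_neg hx, if_neg hy]
      rw [v.val_mul (pow_ne_zero _ (hc x hx)) (pow_ne_zero _ (hc y hy)), v.val_pow, v.val_pow]
      have h1 : (n x : ℚ) ≠ 0 := by exact_mod_cast (hn x hx).ne'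
      have h2 : (n y : ℚ) ≠ 0 := by exact_mod_cast (hn y hy).ne'
      push_cast
      field_simp
    · have e1 := h x hx
      have e2 := h y hy
      simp only [map_mul, map_pow] at e1 e2 ⊢
      rw [← e1, ← e2, mul_pow, ← pow_mul, ← pow_mul, mul_comm (n y) (n x)]
  have fA : ∀ x, x ≠ 0 → (x ∈ A ↔ 0 ≤ f x) := by
    intro x hx
    have h1 : (0 : ℚ) < n x := by exact_mod_cast hn x hx
    simp only [f, if_neg hx]
    rw [le_div_iff₀ h1, zero_mul, ← ValuationSubring.valuation_le_one_iff]
    have : (0 : ℚ) ≤ v.val (c x) ↔ 0 ≤ v.val (c x) := by norm_cast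
    rw [this, ← hF, ← h x hx, map_pow]
    rw [pow_le_one_iff (hn x hx).ne']
  have f1 : f 1 = 0 := by
    have := fmul 1 1 one_ne_zero one_ne_zero
    rw [mul_one] at this; linarith
  have finv : ∀ x, x ≠ 0 → f x⁻¹ = - f x := by
    intro x hx
    have := fmul x x⁻¹ hx (inv_ne_zero hx)
    rw [mul_inv_cancel₀ hx, f1] at this; linarith
  have faux : ∀ x y, x ≠ 0 → y ≠ 0 → x + y ≠ 0 → f x ≤ f y → f x ≤ f (x + y) := by
    intro x y hx hy hxy hle
    have h1 : y * x⁻¹ ∈ A := by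
      rw [fA _ (mul_ne_zero hy (inv_ne_zero hx)), fmul _ _ hy (inv_ne_zero hx), finv x hx]; linarith
    have h2 : (x + y) * x⁻¹ ∈ A := by
      rw [add_mul, mul_inv_cancel₀ hx]; exact A.add_mem _ _ A.one_mem h1
    rw [fA _ (mul_ne_zero hxy (inv_ne_zero hx)), fmul _ _ hxy (inv_ne_zero hx), finv x hx] at h2
    linarith
  have fadd : ∀ x y, x ≠ 0 → y ≠ 0 → x + y ≠ 0 → min (f x) (f y) ≤ f (x + y) := by
    intro x y hx hy hxy
    rcases le_total (f x) (f y) with hle | hle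
    · rw [min_eq_left hle]; exact faux x y hx hy hxy hle
    · rw [min_eq_right hle, add_comm]; exact faux y x hy hx (by rwa [add_comm]) hle
  obtain ⟨t, ht, ht1⟩ := v.val_surj 1
  refine ⟨FFVal.mk' f f1 fmul fadd ⟨algebraMap F E t, by simpa using ht, ?_⟩, ?_, ?_⟩
  · rw [fbase t ht, ht1]; norm_num
  · intro x
    by_cases hx : x = 0
    · simp [hx]
    · rw [FFVal.mk'_val _ _ _ _ _ (by simpa using hx), fbase x hx]
  · intro x hx
    rw [FFVal.mk'_val _ _ _ _ _ hx, fA x hx]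

theorem exists_subring_notMem (v : FFPrime F) (x : E) (hx : x ∉ valIntegralClosure v E) :
    ∃ A : ValuationSubring E, (∀ x : F, algebraMap F E x ∈ A ↔ 0 ≤ v.val x) ∧ x ∉ A := by
  let R : Subring E := (integralClosure v.vring E).toSubring
  have hxR : x ∉ R := fun h => hx (mem_valIntegralClosure_of_isIntegral v x h)
  have : IsIntegrallyClosedIn R E := by
    change IsIntegrallyClosedIn (integralClosure v.vring E) E
    infer_instance
  obtain ⟨A, hRA, hxA⟩ := Subring.exists_le_valuationSubring_of_isIntegrallyClosedIn hxR
  refine ⟨A, ?_, hxA⟩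
  have h1 : ∀ y : F, 0 ≤ v.val y → algebraMap F E y ∈ A := by
    intro y hy
    apply hRA
    have : algebraMap v.vring E ⟨y, v.zero_le_ord.2 hy⟩ ∈ integralClosure v.vring E :=
      Subalgebra.algebraMap_mem _ _
    exact this
  intro y
  refine ⟨fun hy => ?_, h1 y⟩
  by_contra hneg
  push Not at hneg
  have hy0 : y ≠ 0 := by rintro rfl; simp at hneg
  -- then A contains F
  have h2 : ∀ z : F, algebraMap F E z ∈ A := by
    intro z
    by_cases hz : z = 0
    · simp [hz]
    let N := (v.val z).natAbs
    have : z = y ^ N * (z / y ^ N) := by field_simp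
    rw [this, map_mul, map_pow]
    refine A.mul_mem _ _ (pow_mem hy N) (h1 _ ?_)
    rw [v.val_div hz (pow_ne_zero _ hy0), v.val_pow]
    have : (N : ℤ) = |v.val z| := Int.natCast_natAbs _
    have h3 : v.val y ≤ -1 := by omega
    have h4 : -|v.val z| ≤ v.val z := neg_abs_le _
    have h5 := abs_nonneg (v.val z)
    rw [this]; nlinarith
  apply hxA
  have hxint : IsIntegral F x := Algebra.IsIntegral.isIntegral x
  have : IsIntegral A x := by
    have := hxint
    obtain ⟨P, hP, h0⟩ := this
    let φ : F →+* A := (algebraMap F E).codRestrict A.toSubring h2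
    refine ⟨P.map φ, hP.map _, ?_⟩
    rw [Polynomial.eval₂_map]; exact h0
  obtain ⟨y, hy⟩ := IsIntegrallyClosed.isIntegral_iff.1 this
  rw [← hy]; exact y.2

theorem exists_subring (v : FFPrime F) :
    ∃ A : ValuationSubring E, (∀ x : F, algebraMap F E x ∈ A ↔ 0 ≤ v.val x) := by
  obtain ⟨x, hx, hx1⟩ := v.val_surj (-1)
  obtain ⟨A, hA, -⟩ := exists_subring_notMem (E := E) v (algebraMap F E x)
    (base_notMem_valIntegralClosure v x (by omega))
  exact ⟨A, hA⟩

end subring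

/-- discrete valuations come from primes -/
theorem FFVal.discrete {E : Type} [Field E] (V : FFVal E) (N : ℕ) (hN : 0 < N)
    (h : ∀ x, ∃ k : ℤ, N * V.val x = k) :
    ∃ (w : FFPrime E) (c : ℚ), 0 < c ∧ ∀ x, V.val x = c * w.val x := by
  choose k hk using h
  have hNQ : (0 : ℚ) < N := by exact_mod_cast hN
  let H : AddSubgroup ℤ :=
    { carrier := {m | ∃ x, x ≠ 0 ∧ k x = m}
      zero_mem' := ⟨1, one_ne_zero, by have := hk 1; simp at this; exact_mod_cast this.symm⟩
      add_mem' := by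
        rintro _ _ ⟨x, hx, rfl⟩ ⟨y, hy, rfl⟩
        refine ⟨x * y, mul_ne_zero hx hy, ?_⟩
        have := hk (x * y)
        rw [V.val_mul hx hy, mul_add, hk, hk] at this
        exact_mod_cast this.symm
      neg_mem' := by
        rintro _ ⟨x, hx, rfl⟩
        refine ⟨x⁻¹, inv_ne_zero hx, ?_⟩
        have := hk x⁻¹
        rw [V.val_inv, mul_neg, hk] at this
        exact_mod_cast this.symm }
  obtain ⟨g, hg⟩ := Int.subgroup_cyclic H
  have hgH : ∀ m, m ∈ H ↔ ∃ j : ℤ, m = j * g := by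
    intro m; rw [hg, AddSubgroup.mem_closure_singleton]; simp [eq_comm]
  have hg0 : g ≠ 0 := by
    rintro rfl
    obtain ⟨x, hx, hx'⟩ := V.nontrivial
    have hx0 : x ≠ 0 := fun h => hx' (h ▸ V.ord_zero)
    obtain ⟨j, hj⟩ := (hgH (k x)).1 ⟨x, hx0, rfl⟩
    have := hk x
    rw [hj] at this; simp at this
    rcases this with h | h
    · omega
    · apply hx; rw [V.ord_eq hx0, h]; rfl
  wlog hgpos : 0 < g generalizing g
  · refine this (-g) ?_ ?_ (by omega) (by omega)
    · rw [hg]; ext m; simp only [AddSubgroup.mem_closure_singleton, smul_neg]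
      constructor
      · rintro ⟨j, rfl⟩; exact ⟨-j, by simp⟩
      · rintro ⟨j, rfl⟩; exact ⟨-j, by simp⟩
    · intro m; rw [hgH]
      constructor
      · rintro ⟨j, rfl⟩; exact ⟨-j, by ring⟩
      · rintro ⟨j, rfl⟩; exact ⟨-j, by ring⟩
  have hdiv : ∀ x, x ≠ 0 → ∃ j : ℤ, k x = j * g := fun x hx => (hgH _).1 ⟨x, hx, rfl⟩
  choose! j hj using hdiv
  have hgQ : (0 : ℚ) < g := by exact_mod_cast hgpos
  have hV : ∀ x, x ≠ 0 → V.val x = (g : ℚ) / N * j x := by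
    intro x hx
    have := hk x
    rw [hj x hx] at this
    push_cast at this
    field_simp
    linarith
  have hcpos : (0 : ℚ) < g / N := by positivity
  refine ⟨FFPrime.mk' j ?_ ?_ ?_ ?_, g / N, hcpos, ?_⟩
  · have := hV 1 one_ne_zero
    rw [V.val_one] at this
    have h2 := (mul_eq_zero.1 this.symm).resolve_left hcpos.ne'
    exact_mod_cast h2
  · intro x y hx hy
    have := hV (x * y) (mul_ne_zero hx hy)
    rw [V.val_mul hx hy, hV x hx, hV y hy, ← mul_add] at this
    have h2 := mul_left_cancel₀ hcpos.ne' this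
    exact_mod_cast h2.symm
  · intro x y hx hy hxy
    have h1 := V.ord_add x y
    rw [V.ord_eq hx, V.ord_eq hy, V.ord_eq hxy] at h1
    have h2 : min (V.val x) (V.val y) ≤ V.val (x + y) := by exact_mod_cast h1
    rw [hV x hx, hV y hy, hV _ hxy, ← mul_min_of_nonneg _ _ hcpos.le] at h2
    have h3 := le_of_mul_le_mul_left h2 hcpos
    exact_mod_cast h3
  · obtain ⟨x, hx, hxg⟩ := (hgH g).2 ⟨1, by ring⟩
    refine ⟨x, hx, ?_⟩
    have := hj x hx
    rw [hxg] at this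
    have h2 : (1 : ℤ) * g = j x * g := by linarith
    exact (mul_right_cancel₀ hg0 h2).symm
  · intro x
    by_cases hx : x = 0
    · simp [hx]
    · rw [FFPrime.mk'_val _ _ _ _ _ hx, hV x hx]

theorem FFVal.exists_prime_of_base {F E : Type} [Field F] [Field E] [Algebra F E]
    [FiniteDimensional F E] (V : FFVal E) (v : FFPrime F) (c : ℚ) (hc : 0 < c)
    (hV : ∀ x : F, V.val (algebraMap F E x) = c * v.val x) :
    ∃ (w : FFPrime E) (c : ℚ), 0 < c ∧ ∀ x, V.val x = c * w.val x := by
  -- rescale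
  let V' : FFVal E := FFVal.mk' (fun x => V.val x / c) (by simp)
    (fun x y hx hy => by rw [V.val_mul hx hy]; ring)
    (fun x y hx hy hxy => by
      have h1 := V.ord_add x y
      rw [V.ord_eq hx, V.ord_eq hy, V.ord_eq hxy] at h1
      have h2 : min (V.val x) (V.val y) ≤ V.val (x + y) := by exact_mod_cast h1
      rw [min_div_div_right hc.le]
      exact div_le_div_of_nonneg_right h2 hc.le)
    (by
      obtain ⟨t, ht, ht1⟩ := v.val_surj 1
      exact ⟨algebraMap F E t, by simpa using ht, by rw [hV, ht1]; simp [hc.ne']⟩)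
  have hV' : ∀ x, V'.val x = V.val x / c := by
    intro x
    by_cases hx : x = 0
    · simp [hx]
    · exact FFVal.mk'_val _ _ _ _ _ hx
  obtain ⟨w, d, hd, hw⟩ := V'.discrete (Module.finrank F E).factorial (Nat.factorial_pos _) (by
    intro x
    by_cases hx : x = 0
    · exact ⟨0, by simp [hx]⟩
    have hInt : IsIntegral F x := Algebra.IsIntegral.isIntegral x
    obtain ⟨n, hn, hn', e, he, hne⟩ := V.exists_pow_val (F := F) x hx hInt
    have hn2 : n ≤ Module.finrank F E := hn'.trans (minpoly.natDegree_le x)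
    obtain ⟨m, hm⟩ := Nat.dvd_factorial hn hn2
    refine ⟨m * v.val e, ?_⟩
    rw [hm, hV', hV] at *
    push_cast
    have : (n : ℚ) * m * (V.val x / c) = m * (n * V.val x) / c := by ring
    rw [this, hne]; field_simp)
  refine ⟨w, c * d, by positivity, fun x => ?_⟩
  have := hw x
  rw [hV'] at this
  rw [mul_assoc, ← this]; field_simp

/-- restriction of a prime to a subfield -/
theorem FFPrime.exists_restrict {F E : Type} [Field F] [Field E] [Algebra F E]
    [Algebra.IsAlgebraic F E] (w : FFPrime E) :
    ∃ (v : FFPrime F) (e : ℕ), 0 < e ∧ ∀ x : F, w.val (algebraMap F E x) = e * v.val x := by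
  -- nontrivial
  have hnt : ∃ x : F, x ≠ 0 ∧ w.val (algebraMap F E x) ≠ 0 := by
    by_contra hcon
    push Not at hcon
    obtain ⟨x, hx, hx1⟩ := w.val_surj 1
    obtain ⟨n, hn, -, c, hc, h⟩ := _root_.exists_pow_val w.av x hx
      (Algebra.IsIntegral.isIntegral (R := F) x)
    have h' : w.ord (x ^ n) = w.ord (algebraMap F E c) := h
    have h2 : w.val (x ^ n) = w.val (algebraMap F E c) := by simp [FFPrime.val, h']
    rw [w.val_pow, hx1, hcon c hc] at h2
    omega
  let V : FFVal F := FFVal.mk' (fun x => (w.val (algebraMap F E x) : ℚ)) (by simp)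
    (fun x y hx hy => by
      simp only [map_mul]
      rw [w.val_mul (by simpa using hx) (by simpa using hy)]; push_cast; rfl)
    (fun x y hx hy hxy => by
      simp only [map_add]
      have hx' : algebraMap F E x ≠ 0 := by simpa using hx
      have hy' : algebraMap F E y ≠ 0 := by simpa using hy
      have hxy' : algebraMap F E x + algebraMap F E y ≠ 0 := by
        rw [← map_add]; exact (map_ne_zero _).2 hxy
      have h1 := w.ord_add (algebraMap F E x) (algebraMap F E y)
      rw [w.ord_eq hx', w.ord_eq hy', w.ord_eq hxy'] at h1
      exact_mod_cast h1)
    (by obtain ⟨x, hx, h⟩ := hnt; exact ⟨x, hx, by exact_mod_cast h⟩)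
  have hV : ∀ x, V.val x = w.val (algebraMap F E x) := by
    intro x
    by_cases hx : x = 0
    · simp [hx]
    · exact FFVal.mk'_val _ _ _ _ _ hx
  obtain ⟨v, c, hc, hv⟩ := V.discrete 1 one_pos (fun x => ⟨w.val (algebraMap F E x), by rw [hV]; simp⟩)
  obtain ⟨t, ht, ht1⟩ := v.val_surj 1
  have h1 := hv t
  rw [hV, ht1] at h1
  simp only [Int.cast_one, mul_one] at h1
  have hpos : 0 < w.val (algebraMap F E t) := by
    rw [← h1] at hc; exact_mod_cast hc
  refine ⟨v, (w.val (algebraMap F E t)).toNat, by omega, fun x => ?_⟩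
  have h2 := hv x
  rw [hV, ← h1] at h2
  rw [Int.toNat_of_nonneg hpos.le]
  exact_mod_cast h2

/-- existence of a prime above -/
theorem FFPrime.exists_above {F E : Type} [Field F] [Field E] [Algebra F E]
    [FiniteDimensional F E] (v : FFPrime F) :
    ∃ (w : FFPrime E) (e : ℕ), 0 < e ∧ ∀ x : F, w.val (algebraMap F E x) = e * v.val x := by
  obtain ⟨A, hA⟩ := exists_subring (E := E) v
  obtain ⟨V, hV, -⟩ := exists_ffval_of_subring v A hA
  obtain ⟨w, c, hc, hw⟩ := V.exists_prime_of_base v 1 one_pos (by simpa using hV)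
  obtain ⟨t, ht, ht1⟩ := v.val_surj 1
  have h1 := hw (algebraMap F E t)
  rw [hV, ht1] at h1
  have hpos : 0 < w.val (algebraMap F E t) := by
    by_contra hcon
    have : (w.val (algebraMap F E t) : ℚ) ≤ 0 := by exact_mod_cast not_lt.1 hcon
    push_cast at h1
    nlinarith
  refine ⟨w, (w.val (algebraMap F E t)).toNat, by omega, fun x => ?_⟩
  rw [Int.toNat_of_nonneg hpos.le]
  have h2 := hw (algebraMap F E x)
  rw [hV] at h2
  have h3 : (c : ℚ) * w.val (algebraMap F E x) = c * (w.val (algebraMap F E t) * v.val x) := by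
    rw [← h2, ← mul_assoc, ← h1]; simp
  have := mul_left_cancel₀ hc.ne' h3
  exact_mod_cast this

end

noncomputable section

namespace FFPrime
variable {L : Type} [Field L]

theorem exists_separate {v w : FFPrime L} (h : v ≠ w) :
    ∃ x, x ≠ 0 ∧ 0 ≤ v.val x ∧ w.val x < 0 := by
  by_contra hcon
  push Not at hcon
  apply h
  have h0 : ∀ x, x ≠ 0 → v.val x = 0 → w.val x = 0 := by
    intro x hx hv
    have h1 := hcon x hx hv.ge
    have h2 := hcon x⁻¹ (inv_ne_zero hx) (by rw [v.val_inv]; omega)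
    rw [w.val_inv] at h2
    omega
  obtain ⟨t, ht, ht1⟩ := v.val_surj 1
  have h1 : ∀ x, x ≠ 0 → w.val x = v.val x * w.val t := by
    intro x hx
    have := h0 (x / t ^ v.val x) (div_ne_zero hx (zpow_ne_zero _ ht)) (by
      rw [v.val_div hx (zpow_ne_zero _ ht), v.val_zpow, ht1]; ring)
    rw [w.val_div hx (zpow_ne_zero _ ht), w.val_zpow] at this
    linarith
  have ht0 : 0 ≤ w.val t := hcon t ht (by omega)
  obtain ⟨s, hs, hs1⟩ := w.val_surj 1
  have h2 := h1 s hs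
  rw [hs1] at h2
  have h3 : w.val t = 1 := by
    have := Int.eq_one_or_neg_one_of_mul_eq_one (u := w.val t) (v := v.val s) (by linarith)
    omega
  apply ext_val
  intro x hx
  rw [h1 x hx, h3, mul_one]

theorem exists_separate' {v w : FFPrime L} (h : v ≠ w) :
    ∃ x, x ≠ 0 ∧ v.val x < 0 ∧ 0 < w.val x := by
  obtain ⟨x, hx, hx1, hx2⟩ := exists_separate h
  obtain ⟨y, hy, hy1, hy2⟩ := exists_separate h.symm
  refine ⟨y / x, div_ne_zero hy hx, ?_, ?_⟩
  · rw [v.val_div hy hx]; omega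
  · rw [w.val_div hy hx]; omega

theorem val_one_add_pos (w : FFPrime L) {z : L} (hz : z ≠ 0) (h : 0 < w.val z) :
    1 + z ≠ 0 ∧ w.val (1 + z) = 0 := by
  have := w.val_add_eq (x := 1) (y := z) one_ne_zero (Or.inr (by simpa using h))
  simpa using this

theorem val_one_add_neg (w : FFPrime L) {z : L} (hz : z ≠ 0) (h : w.val z < 0) :
    1 + z ≠ 0 ∧ w.val (1 + z) = w.val z := by
  have := w.val_add_eq (x := z) (y := 1) hz (Or.inr (by simpa using h))
  rwa [add_comm] at this

theorem exists_sep_finset (w0 : FFPrime L) (W : Finset (FFPrime L)) (h : w0 ∉ W) :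
    ∃ z, z ≠ 0 ∧ w0.val z < 0 ∧ ∀ w ∈ W, 0 < w.val z := by
  classical
  induction W using Finset.induction_on with
  | empty =>
    obtain ⟨x, hx, h1⟩ := w0.val_surj (-1)
    exact ⟨x, hx, by omega, by simp⟩
  | insert w1 W hw1 ih =>
    simp only [Finset.mem_insert, not_or] at h
    obtain ⟨z, hz, hz0, hzW⟩ := ih h.2
    obtain ⟨y, hy, hy0, hy1⟩ := exists_separate' h.1
    -- a large exponent
    obtain ⟨n, hn0, hn⟩ : ∃ n : ℕ, 0 < n ∧ ∀ w ∈ W, 0 < (n : ℤ) * w.val z + w.val y := by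
      refine ⟨1 + ∑ w ∈ W, (w.val y).natAbs, by omega, fun w hw => ?_⟩
      have h1 : (w.val y).natAbs ≤ ∑ w ∈ W, (w.val y).natAbs :=
        Finset.single_le_sum (f := fun w => (w.val y).natAbs) (fun _ _ => Nat.zero_le _) hw
      have h2 := hzW w hw
      push_cast
      have h3 : ((w.val y).natAbs : ℤ) ≤ ∑ w ∈ W, ((w.val y).natAbs : ℤ) := by exact_mod_cast h1
      have h4 : -((w.val y).natAbs : ℤ) ≤ w.val y := by omega
      simp only [Int.natCast_natAbs] at h3 h4
      have h5 := abs_nonneg (w.val y)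
      have h6 : (1 + ∑ x ∈ W, |x.val y|) * 1 ≤ (1 + ∑ x ∈ W, |x.val y|) * w.val z :=
        mul_le_mul_of_nonneg_left (by omega) (by linarith)
      linarith
    have hzn : z ^ n ≠ 0 := pow_ne_zero _ hz
    rcases lt_trichotomy (w1.val z) 0 with hc | hc | hc
    · have hneg : ∀ w : FFPrime L, w.val z < 0 → 1 + z ^ n ≠ 0 ∧ w.val (1 + z ^ n) = w.val (z ^ n) := by
        intro w hw
        apply w.val_one_add_neg hzn
        rw [w.val_pow]
        have : (0 : ℤ) < n := by exact_mod_cast hn0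
        nlinarith
      have hne := (hneg w0 hz0).1
      refine ⟨y * (z ^ n / (1 + z ^ n)), mul_ne_zero hy (div_ne_zero hzn hne), ?_, ?_⟩
      · rw [w0.val_mul hy (div_ne_zero hzn hne), w0.val_div hzn hne, (hneg w0 hz0).2]; omega
      · intro w hw
        rw [w.val_mul hy (div_ne_zero hzn hne), w.val_div hzn hne]
        rcases Finset.mem_insert.1 hw with rfl | hw
        · rw [(hneg w hc).2]; omega
        · have h5 : w.val (1 + z ^ n) = 0 := by
            refine (w.val_one_add_pos hzn ?_).2
            rw [w.val_pow]
            have : (0 : ℤ) < n := by exact_mod_cast hn0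
            have := hzW w hw
            positivity
          rw [h5, w.val_pow]
          have := hn w hw
          omega
    · refine ⟨z ^ n * y, mul_ne_zero hzn hy, ?_, ?_⟩
      · rw [w0.val_mul hzn hy, w0.val_pow]
        have : (0 : ℤ) < n := by exact_mod_cast hn0
        nlinarith
      · intro w hw
        rw [w.val_mul hzn hy, w.val_pow]
        rcases Finset.mem_insert.1 hw with rfl | hw
        · rw [hc]; omega
        · exact hn w hw
    · refine ⟨z, hz, hz0, ?_⟩
      intro w hw
      rcases Finset.mem_insert.1 hw with rfl | hw
      · exact hc
      · exact hzW w hw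

theorem exists_idem (w0 : FFPrime L) (W : Finset (FFPrime L)) (h : w0 ∉ W) (N : ℕ) :
    ∃ e : L, ((N : ℤ) : WithTop ℤ) ≤ w0.ord (1 - e) ∧ ∀ w ∈ W, ((N : ℤ) : WithTop ℤ) ≤ w.ord e := by
  obtain ⟨z, hz, hz0, hzW⟩ := exists_sep_finset w0 W h
  have hzn : z ^ (N + 1) ≠ 0 := pow_ne_zero _ hz
  have h1 := w0.val_one_add_neg hzn (by rw [w0.val_pow]; push_cast; nlinarith)
  refine ⟨z ^ (N + 1) / (1 + z ^ (N + 1)), ?_, ?_⟩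
  · have : 1 - z ^ (N + 1) / (1 + z ^ (N + 1)) = (1 + z ^ (N + 1))⁻¹ := by
      have := h1.1
      field_simp; ring
    rw [this, coe_le_ord]; right
    rw [w0.val_inv, h1.2, w0.val_pow]; push_cast; nlinarith
  · intro w hw
    rw [coe_le_ord]; right
    have hp := hzW w hw
    rw [w.val_div hzn h1.1, (w.val_one_add_pos hzn (by rw [w.val_pow]; positivity)).2, w.val_pow]
    push_cast; nlinarith

theorem weak_approx (W : Finset (FFPrime L)) (x : FFPrime L → L) (N : ℤ) :
    ∃ y : L, ∀ w ∈ W, (N : WithTop ℤ) ≤ w.ord (y - x w) := by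
  classical
  let M : ℕ := N.natAbs + ∑ w ∈ W, ∑ u ∈ W, (w.val (x u)).natAbs
  have hM : ∀ w ∈ W, ∀ u ∈ W, N ≤ M + w.val (x u) := by
    intro w hw u hu
    have h1 : (w.val (x u)).natAbs ≤ ∑ u ∈ W, (w.val (x u)).natAbs :=
      Finset.single_le_sum (f := fun u => (w.val (x u)).natAbs) (fun _ _ => Nat.zero_le _) hu
    have h2 : ∑ u ∈ W, (w.val (x u)).natAbs ≤ ∑ w ∈ W, ∑ u ∈ W, (w.val (x u)).natAbs :=
      Finset.single_le_sum (f := fun w => ∑ u ∈ W, (w.val (x u)).natAbs)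
        (fun _ _ => Nat.zero_le _) hw
    have h3 : M = N.natAbs + ∑ w ∈ W, ∑ u ∈ W, (w.val (x u)).natAbs := rfl
    omega
  have hex : ∀ w : FFPrime L, ∃ e : L, ((M : ℤ) : WithTop ℤ) ≤ w.ord (1 - e) ∧
      ∀ u ∈ W.erase w, ((M : ℤ) : WithTop ℤ) ≤ u.ord e := fun w =>
    exists_idem w (W.erase w) (by simp) M
  choose e he1 he2 using hex
  have hle : ∀ w ∈ W, ∀ u ∈ W, ∀ c : L, ((M : ℤ) : WithTop ℤ) ≤ w.ord c →
      (N : WithTop ℤ) ≤ w.ord (c * x u) := by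
    intro w hw u hu c hc
    by_cases hx : x u = 0
    · simp [hx, w.ord_zero]
    rw [w.ord_mul, w.ord_eq hx]
    calc (N : WithTop ℤ) ≤ ((M + w.val (x u) : ℤ) : WithTop ℤ) :=
          WithTop.coe_le_coe.2 (hM w hw u hu)
      _ = ((M : ℤ) : WithTop ℤ) + (w.val (x u) : WithTop ℤ) := by push_cast; rfl
      _ ≤ _ := by gcongr
  refine ⟨∑ u ∈ W, e u * x u, fun w hw => ?_⟩
  have : ∑ u ∈ W, e u * x u - x w = ∑ u ∈ W.erase w, e u * x u + (-((1 - e w) * x w)) := by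
    rw [← Finset.add_sum_erase W _ hw]; ring
  rw [this]
  refine le_trans (le_min ?_ ?_) (w.ord_add _ _)
  · refine w.av.map_le_sum ?_
    intro u hu
    have hu' := Finset.mem_erase.1 hu
    exact hle w hw u hu'.2 _ (he2 u w (Finset.mem_erase.2 ⟨hu'.1.symm, hw⟩))
  · rw [w.ord_neg]; exact hle w hw w hw _ (he1 w)

end FFPrime

end

noncomputable section

section rl
variable {k V V' : Type*} [Field k] [AddCommGroup V] [Module k V] [AddCommGroup V'] [Module k V']

/-- length of `B / (A ∩ B)` -/
def rl (A B : Submodule k V) : ℕ∞ := Module.length k (B ⧸ A.submoduleOf B)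

theorem rl_le_of_inj (f : V →ₗ[k] V') (A B : Submodule k V) (A' B' : Submodule k V')
    (hB : ∀ b ∈ B, f b ∈ B') (hA : ∀ b ∈ B, (f b ∈ A' ↔ b ∈ A)) : rl A B ≤ rl A' B' := by
  let g : B →ₗ[k] B' := f.restrict hB
  have hg : A.submoduleOf B ≤ (A'.submoduleOf B').comap g := by
    rintro ⟨b, hb⟩ h
    exact (hA b hb).2 h
  refine Module.length_le_of_injective (Submodule.mapQ _ _ g hg) ?_
  rw [injective_iff_map_eq_zero]
  intro x hx
  obtain ⟨⟨b, hb⟩, rfl⟩ := Submodule.Quotient.mk_surjective _ x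
  rw [Submodule.mapQ_apply, Submodule.Quotient.mk_eq_zero] at hx
  rw [Submodule.Quotient.mk_eq_zero]
  exact (hA b hb).1 hx

theorem rl_le_of_surj (f : V →ₗ[k] V') (A B : Submodule k V) (A' B' : Submodule k V')
    (hB : ∀ b ∈ B, f b ∈ B') (hA : ∀ b ∈ B, b ∈ A → f b ∈ A')
    (hs : ∀ b' ∈ B', ∃ b ∈ B, f b - b' ∈ A') : rl A' B' ≤ rl A B := by
  let g : B →ₗ[k] B' := f.restrict hB
  have hg : A.submoduleOf B ≤ (A'.submoduleOf B').comap g := by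
    rintro ⟨b, hb⟩ h
    exact hA b hb h
  refine Module.length_le_of_surjective (Submodule.mapQ _ _ g hg) ?_
  intro y
  obtain ⟨⟨b', hb'⟩, rfl⟩ := Submodule.Quotient.mk_surjective _ y
  obtain ⟨b, hb, h⟩ := hs b' hb'
  refine ⟨Submodule.Quotient.mk ⟨b, hb⟩, ?_⟩
  rw [Submodule.mapQ_apply, Submodule.Quotient.eq]
  exact h

theorem rl_add {A B C : Submodule k V} (hAB : A ≤ B) (hBC : B ≤ C) :
    rl A C = rl A B + rl B C := by
  let g1 : B →ₗ[k] C := Submodule.inclusion hBC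
  have hg1 : A.submoduleOf B ≤ (A.submoduleOf C).comap g1 := fun b h => h
  have hg2 : A.submoduleOf C ≤ (B.submoduleOf C).comap LinearMap.id := fun b h => hAB h
  refine Module.length_eq_add_of_exact (Submodule.mapQ _ _ g1 hg1)
    (Submodule.mapQ _ _ LinearMap.id hg2) ?_ ?_ ?_
  · rw [injective_iff_map_eq_zero]
    intro x hx
    obtain ⟨⟨b, hb⟩, rfl⟩ := Submodule.Quotient.mk_surjective _ x
    rw [Submodule.mapQ_apply, Submodule.Quotient.mk_eq_zero] at hx
    rw [Submodule.Quotient.mk_eq_zero]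
    exact hx
  · intro y
    obtain ⟨y, rfl⟩ := Submodule.Quotient.mk_surjective _ y
    exact ⟨Submodule.Quotient.mk y, by rw [Submodule.mapQ_apply]; rfl⟩
  · intro y
    obtain ⟨y, rfl⟩ := Submodule.Quotient.mk_surjective _ y
    rw [Submodule.mapQ_apply, Submodule.Quotient.mk_eq_zero]
    constructor
    · intro h
      exact ⟨Submodule.Quotient.mk ⟨y.1, h⟩, by rw [Submodule.mapQ_apply]; rfl⟩
    · rintro ⟨x, hx⟩
      obtain ⟨⟨b, hb⟩, rfl⟩ := Submodule.Quotient.mk_surjective _ x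
      rw [Submodule.mapQ_apply, Submodule.Quotient.eq] at hx
      have h2 : (b : V) - y ∈ A := hx
      have : (y : V) = b - (b - y) := by abel
      show (y : V) ∈ B
      rw [this]
      exact B.sub_mem hb (hAB h2)

theorem rl_bot (B : Submodule k V) : rl ⊥ B = Module.length k B := by
  have h : (⊥ : Submodule k V).submoduleOf B = ⊥ := by
    rw [Submodule.submoduleOf]; simp
  unfold rl
  rw [h]
  exact (Submodule.quotEquivOfEqBot (⊥ : Submodule k B) rfl).length_eq

theorem rl_self (B : Submodule k V) : rl B B = 0 := by
  unfold rl
  rw [Module.length_eq_zero_iff, Submodule.submoduleOf_self]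
  exact Submodule.Quotient.subsingleton_iff.2 rfl

/-- bounding the relative length by independent families -/
theorem rl_le_nat (A B : Submodule k V) (m : ℕ)
    (h : ∀ (n : ℕ) (z : Fin n → V), (∀ i, z i ∈ B) →
      (∀ c : Fin n → k, ∑ i, c i • z i ∈ A → c = 0) → n ≤ m) : rl A B ≤ m := by
  unfold rl
  rw [Module.length_eq_rank]
  have hr : Module.rank k (B ⧸ A.submoduleOf B) ≤ m := by
    apply rank_le
    intro s hs
    let e := s.equivFin
    have hex : ∀ i : Fin s.card, ∃ b : B, Submodule.Quotient.mk b = ((e.symm i : s) : B ⧸ A.submoduleOf B) :=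
      fun i => Submodule.Quotient.mk_surjective _ _
    choose b hb using hex
    refine h s.card (fun i => (b i : V)) (fun i => (b i).2) ?_
    intro c hc
    have hli : LinearIndependent k (fun i : Fin s.card => ((e.symm i : s) : B ⧸ A.submoduleOf B)) :=
      hs.comp _ e.symm.injective
    have := Fintype.linearIndependent_iff.1 hli c ?_
    · funext i; exact this i
    · simp only [← hb]
      have h2 : ∑ i, c i • (Submodule.Quotient.mk (b i) : B ⧸ A.submoduleOf B) =
        (A.submoduleOf B).mkQ (∑ i, c i • b i) := by
        rw [map_sum]; simp
      rw [h2, Submodule.mkQ_apply, Submodule.Quotient.mk_eq_zero]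
      show ((∑ i, c i • b i : B) : V) ∈ A
      simpa using hc
  calc _ ≤ ((m : Cardinal)).toENat := OrderHomClass.mono _ hr
    _ = m := by simp

end rl

namespace FFPrime
variable (p : ℕ) [Fact p.Prime] {L : Type} [Field L] [Algebra (ZMod p) L] (w : FFPrime L)

theorem val_base (c : ZMod p) : w.val (algebraMap (ZMod p) L c) = 0 := by
  by_cases hc : c = 0
  · simp [hc]
  have h1 : c ^ (p - 1) = 1 := ZMod.pow_card_sub_one_eq_one hc
  have h2 := w.val_pow (algebraMap (ZMod p) L c) (p - 1)
  rw [← map_pow, h1, map_one, w.val_one] at h2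
  have h3 := (Fact.out : p.Prime).two_le
  have h4 : ((p - 1 : ℕ) : ℤ) ≠ 0 := by omega
  exact (mul_eq_zero.1 h2.symm).resolve_left h4

theorem val_of_algebraic {c : L} (hc : IsAlgebraic (ZMod p) c) : w.val c = 0 := by
  by_cases h0 : c = 0
  · simp [h0]
  obtain ⟨n, hn, -, d, hd, h⟩ := _root_.exists_pow_val w.av c h0 hc.isIntegral
  have h' : w.ord (c ^ n) = w.ord (algebraMap (ZMod p) L d) := h
  have h2 : w.val (c ^ n) = w.val (algebraMap (ZMod p) L d) := by simp [FFPrime.val, h']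
  rw [w.val_pow, val_base] at h2
  exact (mul_eq_zero.1 h2).resolve_left (by omega)

/-- the fractional ideals of a prime -/
def ball (n : ℤ) : Submodule (ZMod p) L where
  carrier := {x | (n : WithTop ℤ) ≤ w.ord x}
  zero_mem' := by simp [w.ord_zero]
  add_mem' {x y} hx hy := (le_min hx hy).trans (w.ord_add x y)
  smul_mem' c x hx := by
    have hx : (n : WithTop ℤ) ≤ w.ord x := hx
    show (n : WithTop ℤ) ≤ w.ord (c • x)
    rw [Algebra.smul_def, w.ord_mul]
    have : 0 ≤ w.ord (algebraMap (ZMod p) L c) := w.zero_le_ord.2 (w.val_base p c).ge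
    calc (n : WithTop ℤ) = 0 + n := by simp
      _ ≤ _ := add_le_add this hx

theorem mem_ball {n : ℤ} {x : L} : x ∈ w.ball p n ↔ (n : WithTop ℤ) ≤ w.ord x := Iff.rfl

theorem mem_ball' {n : ℤ} {x : L} : x ∈ w.ball p n ↔ x = 0 ∨ n ≤ w.val x := w.coe_le_ord

theorem ball_anti {m n : ℤ} (h : m ≤ n) : w.ball p n ≤ w.ball p m := by
  intro x hx
  exact le_trans (WithTop.coe_le_coe.2 h) hx

theorem mul_mem_ball {m n : ℤ} {x y : L} (hx : x ∈ w.ball p m) (hy : y ∈ w.ball p n) :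
    x * y ∈ w.ball p (m + n) := by
  rw [mem_ball] at *
  rw [w.ord_mul]
  push_cast
  exact add_le_add hx hy

/-- multiplication shifts balls -/
theorem mul_mem_ball_iff {n : ℤ} {y x : L} (hy : y ≠ 0) :
    y * x ∈ w.ball p n ↔ x ∈ w.ball p (n - w.val y) := by
  by_cases hx : x = 0
  · simp [hx]
  simp only [mem_ball', hx, mul_eq_zero, hy, w.val_mul hy hx, false_or]
  constructor <;> intro h <;> linarith

/-- residue quotients -/
def rq (n : ℤ) : Type := (w.ball p 0) ⧸ (w.ball p n).submoduleOf (w.ball p 0)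

instance (n : ℤ) : AddCommGroup (w.rq p n) :=
  inferInstanceAs (AddCommGroup ((w.ball p 0) ⧸ (w.ball p n).submoduleOf (w.ball p 0)))

instance (n : ℤ) : Module (ZMod p) (w.rq p n) :=
  inferInstanceAs (Module (ZMod p) ((w.ball p 0) ⧸ (w.ball p n).submoduleOf (w.ball p 0)))

/-- projection -/
def rqm (n : ℤ) : w.ball p 0 →ₗ[ZMod p] w.rq p n := Submodule.mkQ _

theorem rqm_eq_zero {n : ℤ} {x : w.ball p 0} : w.rqm p n x = 0 ↔ (x : L) ∈ w.ball p n :=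
  Submodule.Quotient.mk_eq_zero _

theorem rqm_surj (n : ℤ) : Function.Surjective (w.rqm p n) := Submodule.mkQ_surjective _

/-- extended degree -/
def degE : ℕ∞ := rl (w.ball p 1) (w.ball p 0)

theorem rl_ball_succ (n : ℤ) : rl (w.ball p (n + 1)) (w.ball p n) = w.degE p := by
  obtain ⟨t, ht, ht1⟩ := w.val_surj n
  apply le_antisymm
  · refine rl_le_of_inj (LinearMap.mulLeft (ZMod p) t⁻¹) _ _ _ _ ?_ ?_
    · intro b hb
      rw [LinearMap.mulLeft_apply, mul_mem_ball_iff p w (inv_ne_zero ht), w.val_inv, ht1]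
      simpa using hb
    · intro b _
      rw [LinearMap.mulLeft_apply, mul_mem_ball_iff p w (inv_ne_zero ht), w.val_inv, ht1]
      rw [sub_neg_eq_add, add_comm]
  · refine rl_le_of_inj (LinearMap.mulLeft (ZMod p) t) _ _ _ _ ?_ ?_
    · intro b hb
      rw [LinearMap.mulLeft_apply, mul_mem_ball_iff p w ht, ht1]
      simpa using hb
    · intro b _
      rw [LinearMap.mulLeft_apply, mul_mem_ball_iff p w ht, ht1]
      rw [add_sub_cancel_left]

theorem rl_ball_nat (n : ℕ) : rl (w.ball p n) (w.ball p 0) = n * w.degE p := by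
  induction n with
  | zero => simp [rl_self]
  | succ n ih =>
    rw [rl_add (B := w.ball p n) (w.ball_anti p (by push_cast; omega)) (w.ball_anti p (by omega)),
      ih]
    push_cast
    rw [rl_ball_succ]; ring

theorem degE_pos : w.degE p ≠ 0 := by
  unfold degE rl
  rw [Ne, Module.length_eq_zero_iff, Submodule.Quotient.subsingleton_iff]
  intro h
  have h1 : (⟨1, by rw [mem_ball, w.ord_one]; rfl⟩ : w.ball p 0) ∈
      (w.ball p 1).submoduleOf (w.ball p 0) := by rw [h]; trivial
  have h2 : (1 : L) ∈ w.ball p 1 := h1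
  rw [mem_ball'] at h2
  simp at h2

/-- the degree over the prime field -/
def deg : ℕ := (w.degE p).toNat

end FFPrime

section poles
variable (p : ℕ) [Fact p.Prime] {L : Type} [Field L] [Algebra (ZMod p) L]

open IntermediateField IntermediateField.algebraAdjoinAdjoin in
theorem rl_poles_le (t : L) [FiniteDimensional (ZMod p)⟮t⟯ L] (W : Finset (FFPrime L))
    (hW : ∀ w ∈ W, w.val t < 0) (A J : Submodule (ZMod p) L)
    (hA : ∀ x ∈ A, ∀ w ∈ W, x ∈ w.ball p 0)
    (hJ : ∀ x, (∀ w ∈ W, x ∈ w.ball p (-w.val t)) → x ∈ J) (hne : W.Nonempty) :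
    rl J A ≤ Module.finrank (ZMod p)⟮t⟯ L := by
  apply rl_le_nat
  intro n z hz hind
  have ht0 : t ≠ 0 := by
    rintro rfl
    obtain ⟨w, hw⟩ := hne
    have := hW w hw
    simp at this
  have hli : LinearIndependent (Algebra.adjoin (ZMod p) {t}) z := by
    rw [Fintype.linearIndependent_iff]
    intro g hg
    by_contra hcon
    push Not at hcon
    have hP : ∀ i, ∃ P : Polynomial (ZMod p), Polynomial.aeval t P = (g i : L) := by
      intro i
      have : (g i : L) ∈ (Polynomial.aeval (R := ZMod p) t).range := by
        rw [← Algebra.adjoin_singleton_eq_range_aeval]; exact (g i).2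
      exact this
    choose P hP using hP
    obtain ⟨i0, hi0⟩ := hcon
    have hP0 : P i0 ≠ 0 := by
      intro h
      have h2 := hP i0
      rw [h, map_zero] at h2
      exact hi0 (Subtype.ext h2.symm)
    obtain ⟨i1, hm1, hmax⟩ := Finset.exists_max_image (Finset.univ.filter (fun i => P i ≠ 0))
      (fun i => (P i).natDegree) ⟨i0, by simp [hP0]⟩
    have hi1 : P i1 ≠ 0 := (Finset.mem_filter.1 hm1).2
    set d := (P i1).natDegree with hd
    have hdeg : ∀ i, (P i).natDegree ≤ d := by
      intro i
      by_cases h : P i = 0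
      · simp [h]
      · exact hmax i (by simp [h])
    have := hind (fun i => (P i).coeff d) ?_
    · have h1 := congrFun this i1
      simp only [Pi.zero_apply] at h1
      rw [hd, Polynomial.coeff_natDegree, Polynomial.leadingCoeff_eq_zero] at h1
      exact hi1 h1
    · apply hJ
      intro w hw
      have hwt := hW w hw
      -- split off the top coefficient
      have hsum : ∑ i, (P i).coeff d • z i =
          -∑ i, (∑ j ∈ Finset.range d, algebraMap (ZMod p) L ((P i).coeff j) * t ^ ((j : ℤ) - d)) * z i := by
        have h1 : ∑ i, (g i : L) * z i = 0 := by
          rw [← hg]; rfl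
        have h2 : ∀ i, (g i : L) = t ^ d * (algebraMap (ZMod p) L ((P i).coeff d) +
            ∑ j ∈ Finset.range d, algebraMap (ZMod p) L ((P i).coeff j) * t ^ ((j : ℤ) - d)) := by
          intro i
          rw [← hP i, Polynomial.aeval_eq_sum_range' (n := d + 1) (by have := hdeg i; omega),
            Finset.sum_range_succ, mul_add, Finset.mul_sum, add_comm]
          congr 1
          · rw [Algebra.smul_def]; ring
          · apply Finset.sum_congr rfl
            intro j _
            rw [Algebra.smul_def, zpow_sub₀ ht0, zpow_natCast, zpow_natCast]
            field_simp
        have h3 : t ^ d * ∑ i, (algebraMap (ZMod p) L ((P i).coeff d) +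
            ∑ j ∈ Finset.range d, algebraMap (ZMod p) L ((P i).coeff j) * t ^ ((j : ℤ) - d)) * z i = 0 := by
          rw [← h1, Finset.mul_sum]
          apply Finset.sum_congr rfl
          intro i _
          rw [h2 i]; ring
        have h4 := (mul_eq_zero.1 h3).resolve_left (pow_ne_zero _ ht0)
        simp only [add_mul, Finset.sum_add_distrib] at h4
        rw [← eq_neg_iff_add_eq_zero] at h4
        rw [← h4]
        simp only [Algebra.smul_def]
      rw [hsum]
      apply Submodule.neg_mem
      apply Submodule.sum_mem
      intro i _
      have h5 : ∑ j ∈ Finset.range d, algebraMap (ZMod p) L ((P i).coeff j) * t ^ ((j : ℤ) - d) ∈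
          w.ball p (-w.val t) := by
        apply Submodule.sum_mem
        intro j hj
        rw [← Algebra.smul_def]
        apply Submodule.smul_mem
        rw [FFPrime.mem_ball']; right
        rw [w.val_zpow]
        have := Finset.mem_range.1 hj
        have h6 : (j : ℤ) - d ≤ -1 := by omega
        nlinarith
      have := w.mul_mem_ball p h5 (hA _ (hz i) w hw)
      simpa using this
  have hli2 : LinearIndependent (ZMod p)⟮t⟯ z :=
    (LinearIndependent.iff_fractionRing (Algebra.adjoin (ZMod p) {t}) (ZMod p)⟮t⟯).1 hli
  have := hli2.fintype_card_le_finrank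
  simpa using this

open IntermediateField in
/-- the degree of (a part of) the divisor of poles is at most the field degree -/
theorem sum_poles_le (t : L) [FiniteDimensional (ZMod p)⟮t⟯ L] (W : Finset (FFPrime L))
    (hW : ∀ w ∈ W, w.val t < 0) :
    ∑ w ∈ W, ((-w.val t).toNat : ℕ∞) * w.degE p ≤ Module.finrank (ZMod p)⟮t⟯ L := by
  classical
  rcases W.eq_empty_or_nonempty with rfl | hne
  · simp
  let A : Submodule (ZMod p) L := ⨅ w ∈ W, w.ball p 0
  have hAm : ∀ x, x ∈ A ↔ ∀ w ∈ W, x ∈ w.ball p 0 := by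
    intro x; simp [A, Submodule.mem_iInf]
  let J : Submodule (ZMod p) L := ⨅ w ∈ W, w.ball p (-w.val t)
  have hJm : ∀ x, x ∈ J ↔ ∀ w ∈ W, x ∈ w.ball p (-w.val t) := by
    intro x; simp [J, Submodule.mem_iInf]
  refine le_trans ?_ (rl_poles_le p t W hW A J (fun x hx => (hAm x).1 hx)
    (fun x hx => (hJm x).2 hx) hne)
  -- surjection
  have h1 : ∀ w ∈ W, ((-w.val t).toNat : ℕ∞) * w.degE p =
      rl (w.ball p (-w.val t)) (w.ball p 0) := by
    intro w hw
    rw [← w.rl_ball_nat p]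
    have := hW w hw
    rw [Int.toNat_of_nonneg (by omega)]
  rw [Finset.sum_congr rfl h1]
  have h2 : ∑ w ∈ W, rl (w.ball p (-w.val t)) (w.ball p 0) =
      Module.length (ZMod p) (∀ w : W, w.1.rq p (-w.1.val t)) := by
    rw [Module.length_pi_of_fintype, ← Finset.sum_coe_sort]
    rfl
  rw [h2]
  let G : A →ₗ[ZMod p] (∀ w : W, w.1.rq p (-w.1.val t)) :=
    LinearMap.pi (fun w => (w.1.rqm p (-w.1.val t)).comp
      (Submodule.inclusion (show A ≤ w.1.ball p 0 from fun x hx => (hAm x).1 hx w.1 w.2)))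
  have hG : J.submoduleOf A ≤ LinearMap.ker G := by
    rintro ⟨x, hx⟩ hxJ
    rw [LinearMap.mem_ker]
    funext w
    simp only [G, LinearMap.pi_apply, LinearMap.comp_apply, Pi.zero_apply]
    rw [FFPrime.rqm_eq_zero]
    exact (hJm x).1 hxJ w.1 w.2
  refine Module.length_le_of_surjective ((J.submoduleOf A).liftQ G hG) ?_
  intro y
  have hy : ∀ w : W, ∃ b : w.1.ball p 0, w.1.rqm p (-w.1.val t) b = y w := fun w =>
    w.1.rqm_surj p _ _
  choose b hb using hy
  let N : ℤ := ∑ w ∈ W, (-w.val t)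
  have hN : ∀ w ∈ W, -w.val t ≤ N := fun w hw =>
    Finset.single_le_sum (f := fun w : FFPrime L => -w.val t)
      (fun w hw => by have := hW w hw; omega) hw
  obtain ⟨x, hx⟩ := FFPrime.weak_approx W (fun w => if h : w ∈ W then (b ⟨w, h⟩ : L) else 0) N
  have hx' : ∀ w : W, x - b w ∈ w.1.ball p (-w.1.val t) := by
    intro w
    have := hx w.1 w.2
    simp only [w.2, dif_pos] at this
    exact w.1.ball_anti p (hN w.1 w.2) this
  have hxA : x ∈ A := by
    rw [hAm]
    intro w hw
    have h3 := hx' ⟨w, hw⟩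
    have h4 := w.ball_anti p (show (0 : ℤ) ≤ -w.val t by have := hW w hw; omega) h3
    have := Submodule.add_mem _ h4 (b ⟨w, hw⟩).2
    simpa using this
  refine ⟨Submodule.Quotient.mk ⟨x, hxA⟩, ?_⟩
  rw [Submodule.liftQ_apply]
  funext w
  rw [← hb w]
  simp only [G, LinearMap.pi_apply, LinearMap.comp_apply]
  rw [← sub_eq_zero, ← map_sub, FFPrime.rqm_eq_zero]
  exact hx' w

end poles

end

noncomputable section

/-- global function fields: finitely generated of transcendence degree one over `𝔽_p` -/
class GFF (p : ℕ) [Fact p.Prime] (L : Type) [Field L] [Algebra (ZMod p) L] : Prop where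
  ess : Algebra.EssFiniteType (ZMod p) L
  trdeg : Algebra.trdeg (ZMod p) L = 1

section
variable (p : ℕ) [Fact p.Prime] {L : Type} [Field L] [Algebra (ZMod p) L]

open IntermediateField in
theorem GFF.finite_adjoin [GFF p L] {f : L} (hf : Transcendental (ZMod p) f) :
    FiniteDimensional (ZMod p)⟮f⟯ L := by
  have h1 : AlgebraicIndependent (ZMod p) (fun _ : Unit => f) :=
    algebraicIndependent_unique_type_iff.2 hf
  have h2 : IsTranscendenceBasis (ZMod p) (fun _ : Unit => f) :=
    h1.isTranscendenceBasis_of_trdeg_le_of_finite (by rw [GFF.trdeg]; simp)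
  have h3 := h2.isAlgebraic
  have h4 : Set.range (fun _ : Unit => f) = {f} := by ext; simp [eq_comm]
  rw [h4] at h3
  have h5 : Algebra.IsAlgebraic (ZMod p)⟮f⟯ L := by
    let _ : Algebra (Algebra.adjoin (ZMod p) {f}) (ZMod p)⟮f⟯ :=
      (Subalgebra.inclusion (algebra_adjoin_le_adjoin (ZMod p) {f})).toAlgebra
    have : IsScalarTower (Algebra.adjoin (ZMod p) {f}) (ZMod p)⟮f⟯ L :=
      IsScalarTower.of_algebraMap_eq (fun x => rfl)
    exact Algebra.IsAlgebraic.extendScalars (R := Algebra.adjoin (ZMod p) {f}) (Subalgebra.inclusion_injective (algebra_adjoin_le_adjoin (ZMod p) {f}))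
  have := GFF.ess (p := p) (L := L)
  have : Algebra.EssFiniteType (ZMod p)⟮f⟯ L := .of_comp (ZMod p) _ _
  exact Algebra.finite_of_essFiniteType_of_isAlgebraic

theorem GFF.exists_transcendental [GFF p L] : ∃ t : L, Transcendental (ZMod p) t := by
  have h : Algebra.trdeg (ZMod p) L ≠ 0 := by rw [GFF.trdeg]; simp
  rw [trdeg_ne_zero_iff] at h
  exact h.transcendental

theorem GFF.extend [GFF p L] (M : Type) [Field M] [Algebra L M] [Algebra (ZMod p) M]
    [IsScalarTower (ZMod p) L M] [FiniteDimensional L M] : GFF p M where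
  ess := by
    have := GFF.ess (p := p) (L := L)
    exact .comp _ L _
  trdeg := by
    rw [← trdeg_add_eq (ZMod p) L, GFF.trdeg, trdeg_eq_zero, add_zero]

theorem FFPrime.transcendental (w : FFPrime L) {f : L} (h : w.val f ≠ 0) :
    Transcendental (ZMod p) f := fun ha => h (w.val_of_algebraic p ha)


theorem FFPrime.degE_ne_top [GFF p L] (w : FFPrime L) : w.degE p ≠ ⊤ := by
  obtain ⟨x, hx, hx1⟩ := w.val_surj (-1)
  have ht : Transcendental (ZMod p) x := w.transcendental p (by rw [hx1]; decide)
  have := GFF.finite_adjoin p ht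
  have h := sum_poles_le p x {w} (by simp [hx1])
  simp only [Finset.sum_singleton, hx1] at h
  norm_num at h
  intro h2
  rw [h2] at h
  exact absurd h (by simp)

theorem FFPrime.coe_deg [GFF p L] (w : FFPrime L) : ((w.deg p : ℕ) : ℕ∞) = w.degE p :=
  ENat.natCast_toNat (w.degE_ne_top p)

theorem FFPrime.deg_pos [GFF p L] (w : FFPrime L) : 0 < w.deg p := by
  have := w.degE_pos p
  rw [← w.coe_deg p] at this
  exact Nat.pos_of_ne_zero (by exact_mod_cast this)

open IntermediateField in
theorem sum_poles_le' [GFF p L] {t : L} (ht : Transcendental (ZMod p) t) (W : Finset (FFPrime L))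
    (hW : ∀ w ∈ W, w.val t < 0) :
    ∑ w ∈ W, (-w.val t) * w.deg p ≤ Module.finrank (ZMod p)⟮t⟯ L := by
  have := GFF.finite_adjoin p ht
  have h := sum_poles_le p t W hW
  simp only [← FFPrime.coe_deg] at h
  have h2 : ∑ w ∈ W, (-w.val t).toNat * w.deg p ≤ Module.finrank (ZMod p)⟮t⟯ L := by
    exact_mod_cast h
  have h3 : ((∑ w ∈ W, (-w.val t).toNat * w.deg p : ℕ) : ℤ) ≤ Module.finrank (ZMod p)⟮t⟯ L := by
    exact_mod_cast h2
  refine le_trans (le_of_eq ?_) h3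
  push_cast
  apply Finset.sum_congr rfl
  intro w hw
  rw [Int.toNat_of_nonneg (by have := hW w hw; omega)]

theorem finite_poles (p : ℕ) [Fact p.Prime] {L : Type} [Field L] [Algebra (ZMod p) L] [GFF p L] (f : L) : {w : FFPrime L | w.val f < 0}.Finite := by
  by_cases ht : Transcendental (ZMod p) f
  · by_contra hinf
    obtain ⟨W, hW, hc⟩ := Set.Infinite.exists_subset_card_eq hinf
      (Module.finrank (IntermediateField.adjoin (ZMod p) {f}) L + 1)
    have h := sum_poles_le' p ht W (fun w hw => hW hw)
    have h2 : ∑ w ∈ W, (1 : ℤ) ≤ ∑ w ∈ W, (-w.val f) * w.deg p := by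
      apply Finset.sum_le_sum
      intro w hw
      have h3 : w.val f < 0 := hW hw
      have h4 := w.deg_pos p
      nlinarith
    rw [Finset.sum_const, hc, nsmul_eq_mul] at h2
    push_cast at h2
    linarith
  · convert Set.finite_empty
    ext w
    simp only [Set.mem_ofPred_eq, Set.mem_empty_iff_false, iff_false, not_lt]
    by_contra h
    exact ht (w.transcendental p (by omega))

theorem finite_supp (p : ℕ) [Fact p.Prime] {L : Type} [Field L] [Algebra (ZMod p) L] [GFF p L] (f : L) : {w : FFPrime L | w.val f ≠ 0}.Finite := by
  refine ((finite_poles p f).union (finite_poles p f⁻¹)).subset ?_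
  intro w hw
  have hw : w.val f ≠ 0 := hw
  simp only [Set.mem_union, Set.mem_ofPred_eq, w.val_inv]
  omega

theorem finite_deg_le [GFF p L] (n : ℕ) : {w : FFPrime L | w.deg p ≤ n}.Finite := by
  obtain ⟨t, ht⟩ := GFF.exists_transcendental p (L := L)
  have hfin : {P : Polynomial (ZMod p) | P ∈ Polynomial.degreeLT (ZMod p) (n + 1)}.Finite := by
    have : Finite (Polynomial.degreeLT (ZMod p) (n + 1)) :=
      Finite.of_equiv _ (Polynomial.degreeLTEquiv (ZMod p) (n + 1)).toEquiv.symm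
    exact Set.toFinite (Polynomial.degreeLT (ZMod p) (n + 1) : Set (Polynomial (ZMod p)))
  have hf2 : (⋃ P ∈ {P : Polynomial (ZMod p) | P ∈ Polynomial.degreeLT (ZMod p) (n + 1)},
    {w : FFPrime L | w.val (Polynomial.aeval t P) ≠ 0}).Finite :=
    hfin.biUnion (fun P _ => finite_supp p _)
  refine ((finite_poles p t).union hf2).subset ?_
  intro w hw
  have hw : w.deg p ≤ n := hw
  by_cases h0 : w.val t < 0
  · left; exact h0
  right
  simp only [Set.mem_iUnion, Set.mem_ofPred_eq]
  have hmem : ∀ i : ℕ, t ^ i ∈ w.ball p 0 := by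
    intro i
    rw [FFPrime.mem_ball']; right
    rw [w.val_pow]
    have : 0 ≤ w.val t := by omega
    positivity
  have hlen : Module.length (ZMod p) (w.rq p 1) = w.deg p := (w.coe_deg p).symm
  have hfd : Module.Finite (ZMod p) (w.rq p 1) := by
    have h := Module.length_ne_top_iff (R := ZMod p) (M := w.rq p 1)
    have h2 : IsFiniteLength (ZMod p) (w.rq p 1) := h.1 (by rw [hlen]; simp)
    have h3 := (isFiniteLength_iff_isNoetherian_isArtinian.1 h2).1
    infer_instance
  have hfr : Module.finrank (ZMod p) (w.rq p 1) = w.deg p := by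
    rw [Module.length_eq_finrank] at hlen
    exact_mod_cast hlen
  have hnl : ¬ LinearIndependent (ZMod p)
      (fun i : Fin (n + 1) => w.rqm p 1 ⟨t ^ (i : ℕ), hmem i⟩) := by
    intro hli
    have := hli.fintype_card_le_finrank
    rw [hfr] at this
    simp at this
    omega
  rw [Fintype.not_linearIndependent_iff] at hnl
  obtain ⟨g, hg, i, hi⟩ := hnl
  let P : Polynomial (ZMod p) := ∑ i : Fin (n + 1), Polynomial.C (g i) * Polynomial.X ^ (i : ℕ)
  have hco : P.coeff i = g i := by
    simp only [P, Polynomial.finsetSum_coeff, Polynomial.coeff_C_mul, Polynomial.coeff_X_pow]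
    rw [Finset.sum_eq_single i]
    · simp
    · intro b _ hb
      rw [if_neg (by intro h; exact hb (Fin.ext h.symm))]; simp
    · simp
  have hP0 : P ≠ 0 := by
    intro h
    rw [h] at hco
    exact hi (by simpa using hco.symm)
  have hPt : Polynomial.aeval t P ≠ 0 := by
    intro h
    exact ht ⟨P, hP0, h⟩
  refine ⟨P, ?_, ?_⟩
  · apply Submodule.sum_mem
    intro j _
    rw [Polynomial.mem_degreeLT]
    exact (Polynomial.degree_C_mul_X_pow_le _ _).trans_lt (by exact_mod_cast j.2)
  · have h1 : ∑ i : Fin (n + 1), g i • (⟨t ^ (i : ℕ), hmem i⟩ : w.ball p 0) = 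
        (⟨Polynomial.aeval t P, by
          simp only [P, map_sum, map_mul, Polynomial.aeval_C, map_pow, Polynomial.aeval_X,
            ← Algebra.smul_def]
          exact Submodule.sum_mem _ (fun i _ => Submodule.smul_mem _ _ (hmem i))⟩ : w.ball p 0) := by
      apply Subtype.ext
      simp [P, Algebra.smul_def]
    have h2 : w.rqm p 1 (∑ i : Fin (n + 1), g i • (⟨t ^ (i : ℕ), hmem i⟩ : w.ball p 0)) = 0 := by
      rw [map_sum, ← hg]; simp only [map_smul]
    rw [h1, FFPrime.rqm_eq_zero, FFPrime.mem_ball'] at h2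
    have h3 : 1 ≤ w.val (Polynomial.aeval t P) := h2.resolve_left hPt
    omega

end

end

noncomputable section

section
variable (p : ℕ) [Fact p.Prime] {L : Type} [Field L] [Algebra (ZMod p) L]

open IntermediateField in
theorem exists_pole [GFF p L] {f : L} (hf : Transcendental (ZMod p) f) :
    ∃ w : FFPrime L, w.val f < 0 := by
  have := GFF.finite_adjoin p hf
  let e : (ZMod p)⟮f⟯ ≃ₐ[ZMod p] RatFunc (ZMod p) := (RatFunc.algEquivOfTranscendental f hf).symm
  have hef : e (AdjoinSimple.gen (ZMod p) f) = RatFunc.X := by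
    rw [AlgEquiv.symm_apply_eq, ← RatFunc.algebraMap_X, RatFunc.algEquivOfTranscendental_algebraMap]
    simp
  have he0 : ∀ x, e x ≠ 0 ↔ x ≠ 0 := by intro x; simp
  let v : FFPrime (ZMod p)⟮f⟯ := FFPrime.mk' (fun x => -(e x).intDegree) (by simp)
    (by intro x y hx hy
        simp only [map_mul]
        rw [RatFunc.intDegree_mul ((he0 x).2 hx) ((he0 y).2 hy)]; ring)
    (by intro x y hx hy hxy
        have h := RatFunc.intDegree_add_le ((he0 y).2 hy) (x := e x) (by rw [← map_add]; exact (he0 _).2 hxy)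
        simp only [map_add]
        rcases le_max_iff.1 h with h | h
        · exact (min_le_left _ _).trans (by linarith)
        · exact (min_le_right _ _).trans (by linarith))
    ⟨(AdjoinSimple.gen (ZMod p) f)⁻¹, by
      have h0 : AdjoinSimple.gen (ZMod p) f ≠ 0 := by
        rw [← he0, hef]; exact RatFunc.X_ne_zero
      exact inv_ne_zero h0, by
      rw [map_inv₀, hef, RatFunc.intDegree_inv, RatFunc.intDegree_X]; ring⟩
  obtain ⟨w, n, hn, h⟩ := v.exists_above (E := L)
  refine ⟨w, ?_⟩
  have h1 := h (AdjoinSimple.gen (ZMod p) f)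
  have h0 : AdjoinSimple.gen (ZMod p) f ≠ 0 := by
    rw [← he0, hef]; exact RatFunc.X_ne_zero
  rw [AdjoinSimple.algebraMap_gen, FFPrime.mk'_val _ _ _ _ _ h0, hef, RatFunc.intDegree_X] at h1
  rw [h1]
  have : (0 : ℤ) < n := by exact_mod_cast hn
  linarith

/-- divisors -/
abbrev Dv (L : Type) [Field L] := FFPrime L →₀ ℤ

/-- degree -/
def degD : Dv L →+ ℤ := Finsupp.liftAddHom (fun w => AddMonoidHom.mulRight (w.deg p : ℤ))

theorem degD_apply (D : Dv L) : degD p D = D.sum (fun w n => n * w.deg p) := rfl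

theorem degD_single (w : FFPrime L) (n : ℤ) : degD p (Finsupp.single w n) = n * w.deg p := by
  simp [degD]

theorem degD_nonneg {D : Dv L} (h : 0 ≤ D) : 0 ≤ degD p D := by
  rw [degD_apply]
  exact Finset.sum_nonneg (fun w _ => mul_nonneg (h w) (by positivity))

theorem degD_mono {D E : Dv L} (h : D ≤ E) : degD p D ≤ degD p E := by
  have := degD_nonneg p (sub_nonneg.2 h)
  rw [map_sub] at this; linarith

/-- principal divisors -/
def dv [GFF p L] (f : L) : Dv L := Finsupp.ofSupportFinite (fun w => w.val f) (finite_supp p f)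

theorem dv_apply [GFF p L] (f : L) (w : FFPrime L) : dv p f w = w.val f := rfl

theorem dv_mul [GFF p L] {f g : L} (hf : f ≠ 0) (hg : g ≠ 0) : dv p (f * g) = dv p f + dv p g := by
  ext w; simp [dv_apply, w.val_mul hf hg]

theorem dv_one [GFF p L] : dv p (1 : L) = 0 := by
  ext w; simp [dv_apply]

theorem dv_inv [GFF p L] (f : L) : dv p f⁻¹ = - dv p f := by
  ext w; simp [dv_apply, w.val_inv]

theorem dv_div [GFF p L] {f g : L} (hf : f ≠ 0) (hg : g ≠ 0) : dv p (f / g) = dv p f - dv p g := by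
  rw [div_eq_mul_inv, dv_mul p hf (inv_ne_zero hg), dv_inv, sub_eq_add_neg]

theorem dv_pow [GFF p L] (f : L) (n : ℕ) : dv p (f ^ n) = n • dv p f := by
  ext w; simp [dv_apply, w.val_pow]

/-- Riemann-Roch spaces -/
def RR (D : Dv L) : Submodule (ZMod p) L := ⨅ w : FFPrime L, w.ball p (-D w)

theorem mem_RR {D : Dv L} {x : L} : x ∈ RR p D ↔ ∀ w : FFPrime L, x ∈ w.ball p (-D w) := by
  simp [RR, Submodule.mem_iInf]

theorem mem_RR' [GFF p L] {D : Dv L} {x : L} (hx : x ≠ 0) : x ∈ RR p D ↔ 0 ≤ D + dv p x := by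
  rw [mem_RR, Finsupp.le_def]
  refine forall_congr' fun w => ?_
  rw [w.mem_ball' p]
  simp only [hx, false_or, Finsupp.coe_zero, Pi.zero_apply, Finsupp.coe_add, Pi.add_apply, dv_apply]
  constructor <;> intro h <;> linarith

theorem RR_mono {D E : Dv L} (h : D ≤ E) : RR p D ≤ RR p E := by
  intro x hx
  rw [mem_RR] at *
  intro w
  exact w.ball_anti p (by have := h w; linarith) (hx w)

theorem rl_RR_single (D : Dv L) (w : FFPrime L) :
    rl (RR p D) (RR p (D + Finsupp.single w 1)) ≤ w.degE p := by
  classical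
  rw [← w.rl_ball_succ p (-D w - 1)]
  refine rl_le_of_inj LinearMap.id _ _ _ _ ?_ ?_
  · intro b hb
    have := (mem_RR p).1 hb w
    simp only [Finsupp.add_apply, Finsupp.single_eq_same] at this
    rw [LinearMap.id_apply, show -D w - 1 = -(D w + 1) by ring]
    exact this
  · intro b hb
    rw [LinearMap.id_apply, sub_add_cancel]
    constructor
    · intro h
      rw [mem_RR]
      intro u
      by_cases hu : u = w
      · rw [hu]; exact h
      · have := (mem_RR p).1 hb u
        simpa [Finsupp.single_eq_of_ne (fun h => hu h)] using this
    · intro h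
      exact (mem_RR p).1 h w

variable [GFF p L]

theorem rl_RR_nat (D : Dv L) (w : FFPrime L) (n : ℕ) :
    rl (RR p D) (RR p (D + Finsupp.single w (n : ℤ))) ≤ ((n * w.deg p : ℕ) : ℕ∞) := by
  induction n with
  | zero => simp [rl_self]
  | succ n ih =>
    have h1 : RR p D ≤ RR p (D + Finsupp.single w (n : ℤ)) := RR_mono p (by simp)
    have h2 : D + Finsupp.single w ((n + 1 : ℕ) : ℤ) =
        D + Finsupp.single w (n : ℤ) + Finsupp.single w 1 := by
      rw [add_assoc, ← Finsupp.single_add]; norm_cast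
    rw [h2, rl_add h1 (RR_mono p (by simp))]
    refine (add_le_add ih (rl_RR_single p _ w)).trans (le_of_eq ?_)
    rw [← w.coe_deg p]
    push_cast; ring

theorem rl_RR_le (F : FFPrime L →₀ ℕ) (D : Dv L) :
    rl (RR p D) (RR p (D + F.mapRange (Nat.cast : ℕ → ℤ) rfl)) ≤
      ((F.sum (fun w n => n * w.deg p) : ℕ) : ℕ∞) := by
  induction F using Finsupp.induction_linear generalizing D with
  | zero => simp [rl_self]
  | add f g hf hg =>
    have h0 : ∀ f : FFPrime L →₀ ℕ, (0 : Dv L) ≤ f.mapRange (Nat.cast : ℕ → ℤ) rfl := by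
      intro f w; simp
    rw [Finsupp.mapRange_add (fun x y => by push_cast; rfl), ← add_assoc,
      rl_add (RR_mono p (le_add_of_nonneg_right (h0 f))) (RR_mono p (le_add_of_nonneg_right (h0 g)))]
    refine (add_le_add (hf D) (hg _)).trans (le_of_eq ?_)
    rw [Finsupp.sum_add_index' (by simp) (by intros; ring)]
    push_cast; rfl
  | single w n =>
    rw [Finsupp.mapRange_single, Finsupp.sum_single_index (by simp)]
    exact rl_RR_nat p D w n

theorem rl_RR_le' {D E : Dv L} (h : D ≤ E) :
    rl (RR p D) (RR p E) ≤ (((degD p (E - D)).toNat : ℕ) : ℕ∞) := by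
  let F : FFPrime L →₀ ℕ := (E - D).mapRange Int.toNat rfl
  have hF : F.mapRange (Nat.cast : ℕ → ℤ) rfl = E - D := by
    ext w
    simp only [F, Finsupp.mapRange_apply]
    rw [Int.toNat_of_nonneg]
    simpa using h w
  have h1 := rl_RR_le p F D
  rw [hF, add_sub_cancel] at h1
  refine h1.trans (le_of_eq ?_)
  congr 1
  rw [← Int.toNat_natCast (F.sum _)]
  congr 1
  have hgen : ∀ F : FFPrime L →₀ ℕ, ((F.sum (fun w n => n * w.deg p) : ℕ) : ℤ) =
      degD p (F.mapRange (Nat.cast : ℕ → ℤ) rfl) := by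
    intro F
    rw [degD_apply, Finsupp.sum_mapRange_index (by simp), Finsupp.sum, Finsupp.sum]
    push_cast
    rfl
  rw [hgen, hF]

theorem exists_place (p : ℕ) [Fact p.Prime] {L : Type} [Field L] [Algebra (ZMod p) L] [GFF p L] : Nonempty (FFPrime L) := by
  obtain ⟨t, ht⟩ := GFF.exists_transcendental p (L := L)
  obtain ⟨w, -⟩ := exists_pole p ht
  exact ⟨w⟩

theorem isAlgebraic_of_mem_RR {x : L} (hx : x ∈ RR p (0 : Dv L)) : IsAlgebraic (ZMod p) x := by
  by_contra h
  obtain ⟨w, hw⟩ := exists_pole p h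
  have := (mem_RR p).1 hx w
  rw [w.mem_ball' p] at this
  rcases this with h | h
  · simp [h] at hw
  · simp at h; linarith

theorem mem_RR_of_isAlgebraic {x : L} (hx : IsAlgebraic (ZMod p) x) : x ∈ RR p (0 : Dv L) := by
  rw [mem_RR]
  intro w
  rw [w.mem_ball' p]; right
  rw [w.val_of_algebraic p hx]; simp

theorem length_RR_zero : Module.length (ZMod p) (RR p (0 : Dv L)) ≠ ⊤ := by
  obtain ⟨w⟩ := exists_place p (L := L)
  rw [← rl_bot]
  refine ne_top_of_le_ne_top (w.degE_ne_top p) ?_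
  refine rl_le_of_inj LinearMap.id _ _ _ _ ?_ ?_
  · intro b hb
    simpa using (mem_RR p).1 hb w
  · intro b hb
    rw [LinearMap.id_apply, w.mem_ball' p, w.val_of_algebraic p (isAlgebraic_of_mem_RR p hb)]
    simp

theorem length_RR_ne_top (D : Dv L) : Module.length (ZMod p) (RR p D) ≠ ⊤ := by
  have h1 : Module.length (ZMod p) (RR p (D ⊔ 0)) ≠ ⊤ := by
    rw [← rl_bot, rl_add (B := RR p 0) bot_le (RR_mono p le_sup_right), rl_bot]
    have := rl_RR_le' p (D := 0) (E := D ⊔ 0) le_sup_right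
    exact WithTop.add_ne_top.2 ⟨length_RR_zero p, ne_top_of_le_ne_top (ENat.natCast_ne_top _) this⟩
  refine ne_top_of_le_ne_top h1 ?_
  exact Module.length_le_of_injective _ (Submodule.inclusion_injective (RR_mono p le_sup_left))

instance RR_finite (D : Dv L) : Module.Finite (ZMod p) (RR p D) := by
  have h2 : IsFiniteLength (ZMod p) (RR p D) := Module.length_ne_top_iff.1 (length_RR_ne_top p D)
  have h3 := (isFiniteLength_iff_isNoetherian_isArtinian.1 h2).1
  infer_instance

/-- dimension -/
def ell (D : Dv L) : ℕ := Module.finrank (ZMod p) (RR p D)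

theorem ell_mono {D E : Dv L} (h : D ≤ E) : ell p D ≤ ell p E :=
  Submodule.finrank_mono (RR_mono p h)

theorem ell_le {D E : Dv L} (h : D ≤ E) : (ell p E : ℤ) ≤ ell p D + degD p (E - D) := by
  have h1 := rl_RR_le' p h
  have h2 := rl_add (bot_le : ⊥ ≤ RR p D) (RR_mono p h)
  rw [rl_bot, rl_bot, Module.length_eq_finrank, Module.length_eq_finrank] at h2
  have h3 : ((Module.finrank (ZMod p) (RR p E) : ℕ) : ℕ∞) ≤
    ((Module.finrank (ZMod p) (RR p D) + (degD p (E - D)).toNat : ℕ) : ℕ∞) := by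
    rw [h2]; push_cast
    exact add_le_add le_rfl h1
  have h4 : Module.finrank (ZMod p) (RR p E) ≤
    Module.finrank (ZMod p) (RR p D) + (degD p (E - D)).toNat := by exact_mod_cast h3
  have h5 := degD_nonneg p (sub_nonneg.2 h)
  unfold ell
  zify at h4
  rw [Int.toNat_of_nonneg h5] at h4
  exact h4

theorem ell_add_dv (D : Dv L) {f : L} (hf : f ≠ 0) : ell p (D + dv p f) = ell p D := by
  have key : ∀ (D : Dv L) {f : L} (hf : f ≠ 0), ell p (D + dv p f) ≤ ell p D := by
    intro D f hf
    let g : RR p (D + dv p f) →ₗ[ZMod p] RR p D :=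
      (LinearMap.mulLeft (ZMod p) f).restrict (by
        intro x hx
        rw [LinearMap.mulLeft_apply]
        by_cases h0 : x = 0
        · simp [h0]
        · rw [mem_RR' p (mul_ne_zero hf h0), dv_mul p hf h0]
          rw [mem_RR' p h0] at hx
          rwa [← add_assoc])
    refine LinearMap.finrank_le_finrank_of_injective (f := g) ?_
    intro x y hxy
    have := congrArg Subtype.val hxy
    apply Subtype.ext
    exact mul_left_cancel₀ hf this
  apply le_antisymm (key D hf)
  have := key (D + dv p f) (inv_ne_zero hf)
  rwa [dv_inv, add_neg_cancel_right] at this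

theorem exists_of_ell_pos {D : Dv L} (h : 0 < ell p D) : ∃ f : L, f ≠ 0 ∧ 0 ≤ D + dv p f := by
  have : Nontrivial (RR p D) := Module.finrank_pos_iff.1 h
  obtain ⟨x, hx⟩ := exists_ne (0 : RR p D)
  have h0 : (x : L) ≠ 0 := by simpa using hx
  exact ⟨x, h0, (mem_RR' p h0).1 x.2⟩

end

end

noncomputable section

open IntermediateField in
theorem linIndep_pow_smul {k L : Type} [Field k] [Field L] [Algebra k L] {f : L}
    (hf : Transcendental k f) {ι : Type} (z : ι → L) (hz : LinearIndependent k⟮f⟯ z) (r : ℕ) :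
    LinearIndependent k (fun ij : Fin r × ι => f ^ (ij.1 : ℕ) * z ij.2) := by
  have h1 : Transcendental k (AdjoinSimple.gen k f) := by
    intro h
    apply hf
    have := h.algebraMap (A := L)
    rwa [AdjoinSimple.algebraMap_gen] at this
  have h2 := transcendental_iff_injective.1 h1
  have h3 : LinearIndependent k (fun j : ℕ => (AdjoinSimple.gen k f) ^ j) := by
    have h4 := (Polynomial.basisMonomials k).linearIndependent.map'
      (Polynomial.aeval (AdjoinSimple.gen k f)).toLinearMap
      (LinearMap.ker_eq_bot.2 h2)
    have h5 : (⇑(Polynomial.aeval (AdjoinSimple.gen k f)).toLinearMap ∘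
        ⇑(Polynomial.basisMonomials k)) = fun j : ℕ => (AdjoinSimple.gen k f) ^ j := by
      funext j
      simp [Polynomial.aeval_monomial]
    rw [h5] at h4
    exact h4
  have h5 := linearIndependent_smul (h3.comp (fun i : Fin r => (i : ℕ)) Fin.val_injective) hz
  convert h5 using 1
  funext ij
  simp [IntermediateField.smul_def]

section
variable (p : ℕ) [Fact p.Prime] {L : Type} [Field L] [Algebra (ZMod p) L] [GFF p L]

/-- pole divisor -/
def poleD (f : L) : Dv L := (-dv p f) ⊔ 0

theorem poleD_apply (f : L) (w : FFPrime L) : poleD p f w = max (-w.val f) 0 := by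
  simp [poleD, dv_apply]

theorem poleD_nonneg (f : L) : 0 ≤ poleD p f := le_sup_right

theorem dv_eq_poleD (f : L) : dv p f = poleD p f⁻¹ - poleD p f := by
  ext w
  simp only [Finsupp.sub_apply, poleD_apply, dv_apply, w.val_inv, neg_neg]
  rcases le_total 0 (w.val f) with h | h
  · rw [max_eq_left h, max_eq_right (by linarith)]; ring
  · rw [max_eq_right h, max_eq_left (by linarith)]; ring

open IntermediateField in
theorem degD_poleD_le {f : L} (hf : Transcendental (ZMod p) f) :
    degD p (poleD p f) ≤ Module.finrank (ZMod p)⟮f⟯ L := by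
  classical
  have h1 : ∀ w ∈ (poleD p f).support, w.val f < 0 := by
    intro w hw
    rw [Finsupp.mem_support_iff, poleD_apply] at hw
    by_contra h
    exact hw (max_eq_right (by linarith))
  refine le_trans (le_of_eq ?_) (sum_poles_le' p hf _ h1)
  rw [degD_apply, Finsupp.sum]
  apply Finset.sum_congr rfl
  intro w hw
  rw [poleD_apply, max_eq_left (by have := h1 w hw; linarith)]

/-- elements integral over `F_p[f]` have poles only at the poles of `f` -/
theorem val_nonneg_of_isIntegral {f z : L} (w : FFPrime L) (hw : 0 ≤ w.val f)
    (hz : IsIntegral (Algebra.adjoin (ZMod p) {f}) z) : 0 ≤ w.val z := by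
  have hA : ∀ x ∈ Algebra.adjoin (ZMod p) {f}, 0 ≤ w.ord x := by
    intro x hx
    induction hx using Algebra.adjoin_induction with
    | mem x hx => rw [Set.mem_singleton_iff] at hx; rw [hx]; exact w.zero_le_ord.2 hw
    | algebraMap c => exact w.zero_le_ord.2 (w.val_base p c).ge
    | add x y _ _ hx hy => exact (le_min hx hy).trans (w.ord_add x y)
    | mul x y _ _ hx hy => rw [w.ord_mul]; exact add_nonneg hx hy
  obtain ⟨P, hP, h⟩ := hz
  by_contra hneg
  push Not at hneg
  have hz0 : z ≠ 0 := by rintro rfl; simp at hneg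
  rw [Polynomial.eval₂_eq_sum_range, Finset.sum_range_succ, hP.coeff_natDegree, map_one, one_mul,
    add_comm] at h
  have h2 : z ^ P.natDegree ≠ 0 := pow_ne_zero _ hz0
  by_cases hd : P.natDegree = 0
  · simp [hd] at h
  have h3 := w.val_sum (Finset.range P.natDegree)
    (fun i => algebraMap (Algebra.adjoin (ZMod p) {f}) L (P.coeff i) * z ^ i)
    (w.val (z ^ P.natDegree) + 1) ?_
  · have h4 := w.val_add_eq h2 (y := ∑ i ∈ Finset.range P.natDegree,
      algebraMap (Algebra.adjoin (ZMod p) {f}) L (P.coeff i) * z ^ i)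
      (h3.imp_right (fun h => by linarith))
    exact h4.1 h
  · intro i hi
    rw [Finset.mem_range] at hi
    by_cases hc : algebraMap (Algebra.adjoin (ZMod p) {f}) L (P.coeff i) = 0
    · left; rw [hc, zero_mul]
    right
    rw [w.val_mul hc (pow_ne_zero _ hz0), w.val_pow, w.val_pow]
    have h5 : 0 ≤ w.val (algebraMap (Algebra.adjoin (ZMod p) {f}) L (P.coeff i)) :=
      w.zero_le_ord.1 (hA _ (P.coeff i).2)
    have h6 : (i : ℤ) + 1 ≤ P.natDegree := by exact_mod_cast hi
    nlinarith

open IntermediateField IntermediateField.algebraAdjoinAdjoin in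
theorem exists_integral_basis {f : L} (hf : Transcendental (ZMod p) f) :
    ∃ z : Fin (Module.finrank (ZMod p)⟮f⟯ L) → L, LinearIndependent (ZMod p)⟮f⟯ z ∧
      ∀ i, IsIntegral (Algebra.adjoin (ZMod p) {f}) (z i) := by
  have := GFF.finite_adjoin p hf
  let b := Module.finBasis (ZMod p)⟮f⟯ L
  have h : ∀ i, ∃ y : Algebra.adjoin (ZMod p) {f}, y ≠ 0 ∧
      IsIntegral (Algebra.adjoin (ZMod p) {f}) (algebraMap _ L y * b i) := by
    intro i
    have h1 : IsAlgebraic (Algebra.adjoin (ZMod p) {f}) (b i) :=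
      (IsFractionRing.isAlgebraic_iff (Algebra.adjoin (ZMod p) {f}) (ZMod p)⟮f⟯ L).2
        (Algebra.IsAlgebraic.isAlgebraic _)
    obtain ⟨y, hy, hy2⟩ := h1.exists_integral_multiple
    exact ⟨y, hy, by rwa [Algebra.smul_def] at hy2⟩
  choose y hy hy2 using h
  refine ⟨fun i => algebraMap _ L (y i) * b i, ?_, hy2⟩
  have hu : ∀ i, algebraMap (Algebra.adjoin (ZMod p) {f}) (ZMod p)⟮f⟯ (y i) ≠ 0 := by
    intro i h
    apply hy i
    exact (FaithfulSMul.algebraMap_injective (Algebra.adjoin (ZMod p) {f}) (ZMod p)⟮f⟯) (by simpa using h)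
  have := b.linearIndependent.units_smul (fun i => Units.mk0 _ (hu i))
  convert this using 1
  funext i
  simp only [Pi.smul_apply', Units.smul_def, Algebra.smul_def]
  rfl

open IntermediateField in
theorem exists_ell_ge {f : L} (hf : Transcendental (ZMod p) f) :
    ∃ r0 : ℕ, ∀ r : ℕ, (Module.finrank (ZMod p)⟮f⟯ L) * (r + 1) ≤ ell p ((r + r0) • poleD p f) := by
  classical
  obtain ⟨z, hz, hzi⟩ := exists_integral_basis p hf
  have hz0 : ∀ i, z i ≠ 0 := fun i => hz.ne_zero i
  have hf0 : f ≠ 0 := by rintro rfl; exact hf isAlgebraic_zero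
  let r0 : ℕ := ∑ i, ∑ w ∈ (poleD p f).support, (w.val (z i)).natAbs
  have hr0 : ∀ i, ∀ w ∈ (poleD p f).support, -w.val (z i) ≤ r0 := by
    intro i w hw
    have h1 : (w.val (z i)).natAbs ≤ ∑ w ∈ (poleD p f).support, (w.val (z i)).natAbs :=
      Finset.single_le_sum (f := fun w : FFPrime L => (w.val (z i)).natAbs) (fun _ _ => Nat.zero_le _) hw
    have h2 : ∑ w ∈ (poleD p f).support, (w.val (z i)).natAbs ≤ r0 :=
      Finset.single_le_sum (f := fun i => ∑ w ∈ (poleD p f).support, (w.val (z i)).natAbs)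
        (fun _ _ => Nat.zero_le _) (Finset.mem_univ i)
    omega
  refine ⟨r0, fun r => ?_⟩
  have hmem : ∀ ij : Fin (Module.finrank (ZMod p)⟮f⟯ L) × Fin (r + 1),
      f ^ (ij.2 : ℕ) * z ij.1 ∈ RR p ((r + r0) • poleD p f) := by
    rintro ⟨i, j⟩
    rw [mem_RR' p (mul_ne_zero (pow_ne_zero _ hf0) (hz0 i))]
    intro w
    simp only [Finsupp.coe_zero, Pi.zero_apply, Finsupp.add_apply, Finsupp.smul_apply, dv_apply]
    rw [w.val_mul (pow_ne_zero _ hf0) (hz0 i), w.val_pow, poleD_apply, nsmul_eq_mul]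
    have hj : ((j : ℕ) : ℤ) ≤ r := by have := j.2; omega
    rcases lt_or_ge (w.val f) 0 with h | h
    · have hw : w ∈ (poleD p f).support := by
        rw [Finsupp.mem_support_iff, poleD_apply, max_eq_left (by linarith)]; linarith
      rw [max_eq_left (by linarith)]
      have h1 := hr0 i w hw
      push_cast
      have h2 : (r0 : ℤ) ≤ r0 * (-w.val f) := by nlinarith
      have h3 : ((j : ℕ) : ℤ) * (-w.val f) ≤ r * (-w.val f) := by nlinarith
      nlinarith
    · rw [max_eq_right (by linarith)]
      have := val_nonneg_of_isIntegral p w h (hzi i)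
      have : 0 ≤ ((j : ℕ) : ℤ) * w.val f := by positivity
      linarith
  have hli := linIndep_pow_smul hf z hz (r + 1)
  have hli2 : LinearIndependent (ZMod p) (fun ij : Fin (r + 1) × Fin (Module.finrank (ZMod p)⟮f⟯ L) =>
      (⟨f ^ (ij.1 : ℕ) * z ij.2, hmem (ij.2, ij.1)⟩ : RR p ((r + r0) • poleD p f))) := by
    apply LinearIndependent.of_comp (RR p ((r + r0) • poleD p f)).subtype
    exact hli
  have := hli2.fintype_card_le_finrank
  simp only [Fintype.card_prod, Fintype.card_fin] at this
  rw [mul_comm]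
  exact this

open IntermediateField in
theorem degD_poleD {f : L} (hf : Transcendental (ZMod p) f) :
    degD p (poleD p f) = Module.finrank (ZMod p)⟮f⟯ L := by
  apply le_antisymm (degD_poleD_le p hf)
  obtain ⟨r0, h⟩ := exists_ell_ge p hf
  by_contra hlt
  push Not at hlt
  set m := Module.finrank (ZMod p)⟮f⟯ L
  set d := degD p (poleD p f) with hd
  have hd0 : 0 ≤ d := degD_nonneg p (poleD_nonneg p f)
  let r : ℕ := ell p (0 : Dv L) + r0 * m
  have h1 := h r
  have h2 := ell_le p (D := 0) (E := (r + r0) • poleD p f) (nsmul_nonneg (poleD_nonneg p f) _)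
  rw [sub_zero, map_nsmul, ← hd, nsmul_eq_mul] at h2
  have h3 : (m : ℤ) * (r + 1) ≤ ell p ((r + r0) • poleD p f) := by exact_mod_cast h1
  have h4 : (r : ℤ) = ell p (0 : Dv L) + r0 * m := by simp [r]
  push_cast at h2
  have h5 : (0 : ℤ) ≤ r := by positivity
  have h6 : (0 : ℤ) ≤ r0 := by positivity
  nlinarith

theorem degD_dv (f : L) : degD p (dv p f) = 0 := by
  by_cases hf : Transcendental (ZMod p) f
  · have hf2 : Transcendental (ZMod p) f⁻¹ := by
      intro h; exact hf (by simpa using h.inv)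
    rw [dv_eq_poleD, map_sub, degD_poleD p hf, degD_poleD p hf2]
    have : IntermediateField.adjoin (ZMod p) {f⁻¹} = IntermediateField.adjoin (ZMod p) {f} := by
      apply le_antisymm
      · rw [IntermediateField.adjoin_simple_le_iff]
        exact inv_mem (IntermediateField.mem_adjoin_simple_self _ _)
      · rw [IntermediateField.adjoin_simple_le_iff]
        have := inv_mem (IntermediateField.mem_adjoin_simple_self (ZMod p) f⁻¹)
        simpa using this
    rw [this, sub_self]
  · have : dv p f = 0 := by
      ext w
      rw [dv_apply]
      exact w.val_of_algebraic p (not_not.1 hf)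
    rw [this, map_zero]

/-- Riemann's theorem -/
theorem riemann : ∃ (γ n0 : ℤ), (∀ D : Dv L, degD p D - γ ≤ ell p D) ∧
    ∀ D : Dv L, n0 ≤ degD p D → (ell p D : ℤ) = degD p D - γ := by
  classical
  obtain ⟨f, hf⟩ := GFF.exists_transcendental p (L := L)
  obtain ⟨r0, h⟩ := exists_ell_ge p hf
  have hB := degD_poleD p hf
  set m := Module.finrank (IntermediateField.adjoin (ZMod p) {f}) L with hm
  have hm0 : 0 < m := by
    have := GFF.finite_adjoin p hf
    exact Module.finrank_pos
  let s : Dv L → ℤ := fun D => degD p D - ell p D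
  have smono : ∀ D E : Dv L, D ≤ E → s D ≤ s E := by
    intro D E hDE
    have := ell_le p hDE
    rw [map_sub] at this
    simp only [s]; linarith
  have sdv : ∀ (D : Dv L) (g : L), g ≠ 0 → s (D + dv p g) = s D := by
    intro D g hg
    simp only [s, map_add, degD_dv, ell_add_dv p D hg, add_zero]
  have sbd : ∀ D, s D ≤ m * r0 := by
    intro D
    let E : Dv L := D ⊔ 0
    let r : ℕ := (degD p E).toNat
    have h1 := h r
    have hE : 0 ≤ degD p E := degD_nonneg p le_sup_right
    have h2 := ell_le p (D := (r + r0) • poleD p f - E) (E := (r + r0) • poleD p f)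
      (sub_le_self _ le_sup_right)
    rw [sub_sub_cancel] at h2
    have h3 : (m : ℤ) * (r + 1) ≤ ell p ((r + r0) • poleD p f) := by exact_mod_cast h1
    have h4 : (r : ℤ) = degD p E := Int.toNat_of_nonneg hE
    have h5 : 0 < ell p ((r + r0) • poleD p f - E) := by
      zify
      have : (1 : ℤ) ≤ m := by exact_mod_cast hm0
      nlinarith
    obtain ⟨g, hg, hg2⟩ := exists_of_ell_pos p h5
    have h6 : E ≤ (r + r0) • poleD p f + dv p g := by
      rw [sub_add_eq_add_sub] at hg2
      exact sub_nonneg.1 hg2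
    calc s D ≤ s E := smono _ _ le_sup_left
      _ ≤ s ((r + r0) • poleD p f + dv p g) := smono _ _ h6
      _ = s ((r + r0) • poleD p f) := sdv _ _ hg
      _ ≤ m * r0 := by
        simp only [s, map_nsmul, hB, nsmul_eq_mul]
        push_cast
        nlinarith
  obtain ⟨D0, hD0⟩ : ∃ D0, ∀ D, s D ≤ s D0 := by
    obtain ⟨M, hM, hM2⟩ := Int.exists_greatest_of_bdd (P := fun n => ∃ D, s D = n)
      ⟨m * r0, by rintro n ⟨D, rfl⟩; exact sbd D⟩ ⟨s 0, 0, rfl⟩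
    obtain ⟨D0, hD0⟩ := hM
    exact ⟨D0, fun D => by rw [hD0]; exact hM2 _ ⟨D, rfl⟩⟩
  refine ⟨s D0, degD p D0 + s D0 + 1, ?_, ?_⟩
  · intro D
    have := hD0 D
    simp only [s] at *
    linarith
  · intro D hD
    have h1 := hD0 (D - D0)
    have h2 : 0 < ell p (D - D0) := by
      zify
      simp only [s, map_sub] at *
      linarith
    obtain ⟨g, hg, hg2⟩ := exists_of_ell_pos p h2
    have h3 : D0 ≤ D + dv p g := by
      rw [sub_add_eq_add_sub] at hg2
      exact sub_nonneg.1 hg2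
    have h4 := smono _ _ h3
    rw [sdv _ _ hg] at h4
    have h5 := hD0 D
    simp only [s] at *
    linarith

end

end

noncomputable section

section restr
variable {L M : Type} [Field L] [Field M] [Algebra L M] [Algebra.IsAlgebraic L M]

/-- restriction of a place -/
def FFPrime.rst (L : Type) {M : Type} [Field L] [Field M] [Algebra L M] [Algebra.IsAlgebraic L M]
    (w : FFPrime M) : FFPrime L := (FFPrime.exists_restrict (F := L) w).choose

/-- ramification index of a place -/
def FFPrime.rm (L : Type) {M : Type} [Field L] [Field M] [Algebra L M] [Algebra.IsAlgebraic L M]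
    (w : FFPrime M) : ℕ := (FFPrime.exists_restrict (F := L) w).choose_spec.choose

theorem FFPrime.rm_pos (w : FFPrime M) : 0 < w.rm L :=
  (FFPrime.exists_restrict (F := L) w).choose_spec.choose_spec.1

theorem FFPrime.val_algebraMap (w : FFPrime M) (x : L) :
    w.val (algebraMap L M x) = w.rm L * (w.rst L).val x :=
  (FFPrime.exists_restrict (F := L) w).choose_spec.choose_spec.2 x

theorem FFPrime.eq_of_proportional {v v' : FFPrime L} {e e' : ℕ} (he : 0 < e) (he' : 0 < e')
    (h : ∀ x, e * v.val x = e' * v'.val x) : v = v' ∧ e = e' := by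
  have key : e = e' := by
    obtain ⟨x, _, h1⟩ := v.val_surj 1
    obtain ⟨y, _, h2⟩ := v'.val_surj 1
    have h3 := h x
    have h4 := h y
    rw [h1] at h3
    rw [h2] at h4
    have h5 : (e' : ℤ) ∣ e := ⟨v'.val x, by linarith⟩
    have h6 : (e : ℤ) ∣ e' := ⟨v.val y, by linarith⟩
    exact Nat.dvd_antisymm (by exact_mod_cast h6) (by exact_mod_cast h5)
  subst key
  refine ⟨FFPrime.ext_val fun x _ => ?_, rfl⟩
  have h1 := h x
  have : (e : ℤ) ≠ 0 := by exact_mod_cast he.ne'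
  exact mul_left_cancel₀ this h1

theorem FFPrime.rst_eq {w : FFPrime M} {v : FFPrime L} {e : ℕ} (he : 0 < e)
    (h : ∀ x : L, w.val (algebraMap L M x) = e * v.val x) : w.rst L = v ∧ w.rm L = e :=
  FFPrime.eq_of_proportional w.rm_pos he (fun x => by rw [← w.val_algebraMap, h])

theorem FFPrime.exists_rst_eq [FiniteDimensional L M] (v : FFPrime L) :
    ∃ w : FFPrime M, w.rst L = v := by
  obtain ⟨w, e, he, h⟩ := FFPrime.exists_above (E := M) v
  exact ⟨w, (FFPrime.rst_eq he h).1⟩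

end restr

section act
variable {L M : Type} [Field L] [Field M] [Algebra L M]

/-- Galois action on places -/
def FFPrime.act (σ : M ≃ₐ[L] M) (w : FFPrime M) : FFPrime M where
  ord x := w.ord (σ.symm x)
  ord_zero := by simp [w.ord_zero]
  ord_ne_top x hx := w.ord_ne_top _ (by simpa using hx)
  ord_one := by simp [w.ord_one]
  ord_mul x y := by simp [w.ord_mul]
  ord_add x y := by simp [w.ord_add]
  ord_surj n := by
    obtain ⟨x, hx⟩ := w.ord_surj n
    exact ⟨σ x, by simpa using hx⟩

theorem FFPrime.act_ord (σ : M ≃ₐ[L] M) (w : FFPrime M) (x : M) :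
    (FFPrime.act σ w).ord x = w.ord (σ.symm x) := rfl

instance : MulAction (M ≃ₐ[L] M) (FFPrime M) where
  smul := FFPrime.act
  one_smul w := FFPrime.ext' fun x => rfl
  mul_smul σ τ w := FFPrime.ext' fun x => rfl

theorem FFPrime.smul_ord (σ : M ≃ₐ[L] M) (w : FFPrime M) (x : M) :
    (σ • w).ord x = w.ord (σ.symm x) := rfl

theorem FFPrime.smul_val (σ : M ≃ₐ[L] M) (w : FFPrime M) (x : M) :
    (σ • w).val x = w.val (σ.symm x) := rfl

theorem FFPrime.rst_smul [Algebra.IsAlgebraic L M] (σ : M ≃ₐ[L] M) (w : FFPrime M) :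
    (σ • w).rst L = w.rst L ∧ (σ • w).rm L = w.rm L :=
  FFPrime.rst_eq w.rm_pos (fun x => by rw [FFPrime.smul_val, AlgEquiv.commutes, w.val_algebraMap])

variable (p : ℕ) [Fact p.Prime] [Algebra (ZMod p) L] [Algebra (ZMod p) M] [IsScalarTower (ZMod p) L M]

theorem FFPrime.degE_smul_le (σ : M ≃ₐ[L] M) (w : FFPrime M) : (σ • w).degE p ≤ w.degE p := by
  refine rl_le_of_inj ((σ.symm.restrictScalars (ZMod p)).toLinearMap) _ _ _ _ ?_ ?_
  · intro b hb; exact hb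
  · intro b _; exact Iff.rfl

theorem FFPrime.degE_smul (σ : M ≃ₐ[L] M) (w : FFPrime M) : (σ • w).degE p = w.degE p := by
  apply le_antisymm (FFPrime.degE_smul_le p σ w)
  have := FFPrime.degE_smul_le p σ⁻¹ (σ • w)
  rwa [inv_smul_smul] at this

theorem FFPrime.deg_smul (σ : M ≃ₐ[L] M) (w : FFPrime M) : (σ • w).deg p = w.deg p := by
  rw [FFPrime.deg, FFPrime.deg, FFPrime.degE_smul]

variable [Algebra.IsAlgebraic L M]

theorem FFPrime.mem_ball_algebraMap (w : FFPrime M) (n : ℤ) (hn : n = 0 ∨ n = 1) (x : L) :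
    algebraMap L M x ∈ w.ball p n ↔ x ∈ (w.rst L).ball p n := by
  rw [FFPrime.mem_ball', FFPrime.mem_ball', w.val_algebraMap]
  have := w.rm_pos (L := L)
  simp only [map_eq_zero]
  apply or_congr Iff.rfl
  have h1 : (1 : ℤ) ≤ w.rm L := by exact_mod_cast this
  rcases hn with rfl | rfl
  · constructor
    · intro h; by_contra hc; nlinarith
    · intro h; positivity
  · constructor
    · intro h; by_contra hc; nlinarith
    · intro h; nlinarith

theorem FFPrime.degE_rst_le (w : FFPrime M) : (w.rst L).degE p ≤ w.degE p := by
  refine rl_le_of_inj ((IsScalarTower.toAlgHom (ZMod p) L M).toLinearMap) _ _ _ _ ?_ ?_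
  · intro b hb
    exact (w.mem_ball_algebraMap p 0 (Or.inl rfl) b).2 hb
  · intro b _
    exact (w.mem_ball_algebraMap p 1 (Or.inr rfl) b)

/-- inert lower bound -/
theorem FFPrime.degE_rst_mul_le (w : FFPrime M) (q : ℕ) (β : M) (hβ : w.val β = 0)
    (hβ0 : β ≠ 0)
    (hind : ∀ c : Fin q → L, (∀ i, c i ∈ (w.rst L).ball p 0) →
      ∑ i : Fin q, β ^ (i : ℕ) * algebraMap L M (c i) ∈ w.ball p 1 → ∀ i, c i ∈ (w.rst L).ball p 1) :
    q * (w.rst L).degE p ≤ w.degE p := by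
  have hm : ∀ (i : ℕ) (n : ℤ) (x : L), (n = 0 ∨ n = 1) → x ∈ (w.rst L).ball p n →
      β ^ i * algebraMap L M x ∈ w.ball p n := by
    intro i n x hn hx
    rw [FFPrime.mul_mem_ball_iff p w (pow_ne_zero _ hβ0), w.val_pow, hβ, mul_zero, sub_zero]
    exact (w.mem_ball_algebraMap p n hn x).2 hx
  let ψ : ℕ → L →ₗ[ZMod p] M := fun i =>
    (LinearMap.mulLeft (ZMod p) (β ^ i)) ∘ₗ (IsScalarTower.toAlgHom (ZMod p) L M).toLinearMap
  have hψ : ∀ i x, ψ i x = β ^ i * algebraMap L M x := fun i x => rfl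
  let ψ0 : ∀ i, (w.rst L).ball p 0 →ₗ[ZMod p] w.ball p 0 := fun i =>
    (ψ i).restrict (fun x hx => hm i 0 x (Or.inl rfl) hx)
  let Ψ : ∀ i, (w.rst L).rq p 1 →ₗ[ZMod p] w.rq p 1 := fun i =>
    Submodule.mapQ _ _ (ψ0 i) (fun x hx => hm i 1 x (Or.inr rfl) hx)
  have hΨ : ∀ i (x : (w.rst L).ball p 0), Ψ i ((w.rst L).rqm p 1 x) = w.rqm p 1 (ψ0 i x) :=
    fun i x => rfl
  let Φ : (Fin q → (w.rst L).rq p 1) →ₗ[ZMod p] w.rq p 1 :=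
    ∑ i : Fin q, (Ψ i) ∘ₗ LinearMap.proj i
  have hΦ : Function.Injective Φ := by
    rw [injective_iff_map_eq_zero]
    intro g hg
    choose x hx using fun i => FFPrime.rqm_surj p (w.rst L) 1 (g i)
    have h1 : Φ g = w.rqm p 1 (∑ i : Fin q, ψ0 i (x i)) := by
      simp only [Φ, LinearMap.sum_apply, LinearMap.comp_apply, LinearMap.proj_apply, map_sum]
      exact Finset.sum_congr rfl (fun i _ => by rw [← hx i, hΨ])
    rw [h1, FFPrime.rqm_eq_zero] at hg
    have h2 := hind (fun i => (x i : L)) (fun i => (x i).2) (by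
      convert hg using 1
      rw [Submodule.coe_sum]
      rfl)
    funext i
    rw [← hx i, Pi.zero_apply, FFPrime.rqm_eq_zero]
    exact h2 i
  have := Module.length_le_of_injective Φ hΦ
  rw [Module.length_pi] at this
  rw [ENat.card_eq_coe_fintype_card, Fintype.card_fin] at this
  exact this

end act

end

noncomputable section

/-- unramified cyclic Kummer extension data -/
structure UK (q : ℕ) (L M : Type) [Field L] [Field M] [Algebra L M] where
  hq : q.Prime
  σ : M ≃ₐ[L] M
  hσ : σ ^ q = 1
  ζ : L
  hζ : IsPrimitiveRoot ζ q
  α : M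
  a : L
  ha : α ^ q = algebraMap L M a
  ha0 : a ≠ 0
  hα : σ α = algebraMap L M ζ * α
  hrank : Module.finrank L M = q
  hunr : ∀ v : FFPrime L, (q : ℤ) ∣ v.val a

section
variable {q : ℕ} {L M : Type} [Field L] [Field M] [Algebra L M] [FiniteDimensional L M] (U : UK q L M)

namespace UK

theorem sig_pow_alpha (j : ℕ) : (U.σ ^ j) U.α = algebraMap L M (U.ζ ^ j) * U.α := by
  induction j with
  | zero => simp
  | succ j ih =>
    rw [pow_succ', AlgEquiv.mul_apply, ih, map_mul, AlgEquiv.commutes, U.hα, pow_succ, map_mul]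
    ring

theorem alpha_ne : U.α ≠ 0 := by
  intro h
  have := U.ha
  rw [h, zero_pow U.hq.ne_zero] at this
  exact U.ha0 ((map_eq_zero _).1 this.symm)

theorem orderOf_sig : orderOf U.σ = q := by
  refine orderOf_eq_prime (hp := ⟨U.hq⟩) U.hσ ?_
  intro h
  have h1 := U.hα
  rw [h, AlgEquiv.one_apply] at h1
  have h2 : algebraMap L M U.ζ = 1 := by
    have h3 : 1 * U.α = algebraMap L M U.ζ * U.α := by rw [one_mul]; exact h1
    exact (mul_right_cancel₀ U.alpha_ne h3).symm
  have h3 : U.ζ = 1 := (algebraMap L M).injective (by rw [h2, map_one])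
  exact U.hζ.ne_one U.hq.one_lt h3

theorem zpowers_top : ∀ τ : M ≃ₐ[L] M, τ ∈ Subgroup.zpowers U.σ := by
  have h1 : Nat.card (M ≃ₐ[L] M) ≤ q := by
    rw [← U.hrank]
    rw [Nat.card_eq_fintype_card]
    exact AlgEquiv.card_le
  have h2 : Nat.card (Subgroup.zpowers U.σ) = q := by rw [Nat.card_zpowers, U.orderOf_sig]
  have h3 : Subgroup.zpowers U.σ = ⊤ := by
    apply Subgroup.eq_top_of_le_card
    rw [h2]; exact h1
  intro τ; rw [h3]; trivial

theorem galois {q : ℕ} {L M : Type} [Field L] [Field M] [Algebra L M] [FiniteDimensional L M]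
    (U : UK q L M) : IsGalois L M := by
  apply IsGalois.of_card_aut_eq_finrank
  rw [U.hrank, ← U.orderOf_sig, ← Nat.card_zpowers]
  have h3 : Subgroup.zpowers U.σ = ⊤ := eq_top_iff.2 fun τ _ => U.zpowers_top τ
  rw [h3, Subgroup.card_top]

theorem exists_pow (τ : M ≃ₐ[L] M) : ∃ i < q, τ = U.σ ^ i := by
  classical
  have h := U.zpowers_top τ
  have hfo : IsOfFinOrder U.σ := isOfFinOrder_iff_pow_eq_one.2 ⟨q, U.hq.pos, U.hσ⟩
  rw [hfo.mem_zpowers_iff_mem_range_orderOf] at h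
  rw [U.orderOf_sig, Finset.mem_image] at h
  obtain ⟨i, hi, h⟩ := h
  exact ⟨i, Finset.mem_range.1 hi, h.symm⟩

theorem exists_of_fixed {x : M} (hx : U.σ x = x) : ∃ y : L, algebraMap L M y = x := by
  have := U.galois
  have h := (IsGalois.mem_range_algebraMap_iff_fixed (F := L) x).2 (fun τ => by
    obtain ⟨i, hi, rfl⟩ := U.exists_pow τ
    clear this
    induction i with
    | zero => rfl
    | succ i ih => rw [pow_succ, AlgEquiv.mul_apply, hx]; exact ih (by omega))
  exact h

theorem norm_eq (x : M) : algebraMap L M (Algebra.norm L x) = ∏ i ∈ Finset.range q, (U.σ ^ i) x := by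
  have := U.galois
  rw [Algebra.norm_eq_prod_automorphisms]
  symm
  refine Finset.prod_bij (fun i _ => U.σ ^ i) (fun _ _ => Finset.mem_univ _) ?_ ?_ (fun _ _ => rfl)
  · intro i hi j hj h
    have := U.orderOf_sig
    rw [Finset.mem_range] at hi hj
    exact pow_injOn_Iio_orderOf (by simpa [this] using hi) (by simpa [this] using hj) h
  · intro τ _
    obtain ⟨i, hi, h⟩ := U.exists_pow τ
    exact ⟨i, Finset.mem_range.2 hi, h.symm⟩

theorem q_ne {q : ℕ} {L M : Type} [Field L] [Field M] [Algebra L M]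
    (U : UK q L M) : (q : L) ≠ 0 := by
  have := U.hq.pos
  have : NeZero q := ⟨U.hq.ne_zero⟩
  exact U.hζ.neZero'.out

variable (p : ℕ) [Fact p.Prime] [Algebra (ZMod p) L] [Algebra (ZMod p) M] [IsScalarTower (ZMod p) L M]

theorem degE_of_fixed (w : FFPrime M) (hw : U.σ • w = w) :
    q * (w.rst L).degE p ≤ w.degE p := by
  obtain ⟨m, hm⟩ := U.hunr (w.rst L)
  obtain ⟨t, ht, ht1⟩ := (w.rst L).val_surj m
  have htM : algebraMap L M t ≠ 0 := by simpa using ht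
  have hq0 : (q : ℤ) ≠ 0 := by exact_mod_cast U.hq.ne_zero
  have hpw : ∀ j : ℕ, U.σ ^ j • w = w := by
    intro j
    induction j with
    | zero => simp
    | succ j ih => rw [pow_succ, mul_smul, hw, ih]
  have hβ0 : U.α / algebraMap L M t ≠ 0 := div_ne_zero U.alpha_ne htM
  have hσβ : ∀ j : ℕ, (U.σ ^ j) (U.α / algebraMap L M t) = algebraMap L M (U.ζ ^ j) * (U.α / algebraMap L M t) := by
    intro j
    rw [map_div₀, AlgEquiv.commutes, U.sig_pow_alpha]
    ring
  refine w.degE_rst_mul_le p q (U.α / algebraMap L M t) ?_ hβ0 ?_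
  · have h1 : (q : ℤ) * w.val U.α = w.rm L * (q * m) := by
      rw [← w.val_pow, U.ha, w.val_algebraMap, hm]
    rw [w.val_div U.alpha_ne htM, w.val_algebraMap, ht1]
    have : (q : ℤ) * (w.val U.α - w.rm L * m) = 0 := by linarith
    exact (mul_eq_zero.1 this).resolve_left hq0
  · set β := U.α / algebraMap L M t with hβ
    intro c hc hsum k
    have hβv : w.val β = 0 := by
      have h1 : (q : ℤ) * w.val U.α = w.rm L * (q * m) := by
        rw [← w.val_pow, U.ha, w.val_algebraMap, hm]
      rw [hβ, w.val_div U.alpha_ne htM, w.val_algebraMap, ht1]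
      have : (q : ℤ) * (w.val U.α - w.rm L * m) = 0 := by linarith
      exact (mul_eq_zero.1 this).resolve_left hq0
    -- apply powers of sigma
    have h1 : ∀ j : ℕ, ∑ i : Fin q, algebraMap L M (U.ζ ^ (j * i)) * (β ^ (i : ℕ) * algebraMap L M (c i)) ∈ w.ball p 1 := by
      intro j
      have h2 : (U.σ ^ j) (∑ i : Fin q, β ^ (i : ℕ) * algebraMap L M (c i)) ∈ w.ball p 1 := by
        rw [FFPrime.mem_ball] at hsum ⊢
        have h3 := FFPrime.smul_ord (U.σ ^ j) w ((U.σ ^ j) (∑ i : Fin q, β ^ (i : ℕ) * algebraMap L M (c i)))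
        rw [hpw j, AlgEquiv.symm_apply_apply] at h3
        rw [h3]; exact hsum
      convert h2 using 1
      rw [map_sum]
      refine Finset.sum_congr rfl fun i _ => ?_
      rw [map_mul (U.σ ^ j), map_pow (U.σ ^ j), hσβ, AlgEquiv.commutes, mul_pow, ← map_pow (algebraMap L M), ← pow_mul]
      ring
    have hz : ∀ (j : ℕ) (x : M), x ∈ w.ball p 1 → algebraMap L M (U.ζ⁻¹ ^ j) * x ∈ w.ball p 1 := by
      intro j x hx
      have hz0 : algebraMap L M (U.ζ⁻¹ ^ j) ≠ 0 := by
        simp [U.hζ.ne_zero U.hq.ne_zero]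
      rw [FFPrime.mul_mem_ball_iff p w hz0]
      have : w.val (algebraMap L M (U.ζ⁻¹ ^ j)) = 0 := by
        have h5 : (q : ℤ) * w.val (algebraMap L M (U.ζ⁻¹ ^ j)) = 0 := by
          rw [← w.val_pow, ← map_pow, ← pow_mul, mul_comm, pow_mul, inv_pow, U.hζ.pow_eq_one]
          simp [w.val_one]
        exact (mul_eq_zero.1 h5).resolve_left hq0
      rw [this, sub_zero]; exact hx
    have h4 : ∑ j ∈ Finset.range q, algebraMap L M (U.ζ⁻¹ ^ (j * k)) * ∑ i : Fin q, algebraMap L M (U.ζ ^ (j * i)) * (β ^ (i : ℕ) * algebraMap L M (c i)) ∈ w.ball p 1 :=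
      Submodule.sum_mem _ fun j _ => hz _ _ (h1 j)
    have h5 : ∑ j ∈ Finset.range q, algebraMap L M (U.ζ⁻¹ ^ (j * k)) * ∑ i : Fin q, algebraMap L M (U.ζ ^ (j * i)) * (β ^ (i : ℕ) * algebraMap L M (c i)) = β ^ (k : ℕ) * algebraMap L M (q * c k) := by
      simp_rw [Finset.mul_sum]
      rw [Finset.sum_comm]
      rw [Finset.sum_eq_single k]
      · have : ∀ j ∈ Finset.range q, algebraMap L M (U.ζ⁻¹ ^ (j * k)) * (algebraMap L M (U.ζ ^ (j * k)) * (β ^ (k : ℕ) * algebraMap L M (c k))) = β ^ (k : ℕ) * algebraMap L M (c k) := by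
          intro j _
          rw [← mul_assoc, ← map_mul, ← mul_pow, inv_mul_cancel₀ (U.hζ.ne_zero U.hq.ne_zero), one_pow, map_one, one_mul]
        rw [Finset.sum_congr rfl this, Finset.sum_const, Finset.card_range, nsmul_eq_mul, map_mul, map_natCast]
        ring
      · intro i _ hik
        have hg : ∀ j ∈ Finset.range q, algebraMap L M (U.ζ⁻¹ ^ (j * k)) * (algebraMap L M (U.ζ ^ (j * i)) * (β ^ (i : ℕ) * algebraMap L M (c i))) = algebraMap L M ((U.ζ⁻¹ ^ (k : ℕ) * U.ζ ^ (i : ℕ)) ^ j) * (β ^ (i : ℕ) * algebraMap L M (c i)) := by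
          intro j _
          rw [← mul_assoc, ← map_mul, mul_pow, ← pow_mul, ← pow_mul, mul_comm j, mul_comm j]
        rw [Finset.sum_congr rfl hg, ← Finset.sum_mul, ← map_sum]
        have hne : U.ζ⁻¹ ^ (k : ℕ) * U.ζ ^ (i : ℕ) ≠ 1 := by
          intro h
          rw [inv_pow, inv_mul_eq_one₀ (pow_ne_zero _ (U.hζ.ne_zero U.hq.ne_zero))] at h
          exact hik (Fin.ext (U.hζ.pow_inj k.2 i.2 h).symm)
        have := geom_sum_eq hne q
        rw [this, mul_pow, ← pow_mul, mul_comm (k : ℕ), pow_mul, inv_pow, U.hζ.pow_eq_one, ← pow_mul, mul_comm (i : ℕ), pow_mul, U.hζ.pow_eq_one]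
        simp
      · simp
    rw [h5, FFPrime.mul_mem_ball_iff p w (pow_ne_zero _ hβ0), w.val_pow, hβv, mul_zero, sub_zero,
      w.mem_ball_algebraMap p 1 (Or.inr rfl), FFPrime.mul_mem_ball_iff p _ U.q_ne] at h4
    have h6 : (w.rst L).val (q : L) = 0 := by
      have := (w.rst L).val_base p (q : ZMod p)
      rwa [map_natCast] at this
    rwa [h6, sub_zero] at h4

end UK
end
end

noncomputable section

section

open IntermediateField in
theorem finrank_adjoin_algebraMap (p : ℕ) [Fact p.Prime] {L M : Type} [Field L] [Field M] [Algebra L M] [Algebra (ZMod p) L] [Algebra (ZMod p) M] [IsScalarTower (ZMod p) L M] (f : L) :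
    Module.finrank (ZMod p)⟮algebraMap L M f⟯ M = Module.finrank (ZMod p)⟮f⟯ L * Module.finrank L M := by
  rw [Module.finrank_mul_finrank (ZMod p)⟮f⟯ L M]
  have hmap : ((ZMod p)⟮f⟯).map (IsScalarTower.toAlgHom (ZMod p) L M) = (ZMod p)⟮algebraMap L M f⟯ := by
    rw [IntermediateField.adjoin_map, Set.image_singleton]
    rfl
  let e1 := ((ZMod p)⟮f⟯).equivMap (IsScalarTower.toAlgHom (ZMod p) L M)
  let e2 := IntermediateField.equivOfEq hmap
  symm
  refine Algebra.finrank_eq_of_equiv_equiv (e1.trans e2).toRingEquiv (RingEquiv.refl M) ?_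
  ext x
  rfl

theorem finite_fib (p : ℕ) [Fact p.Prime] {L M : Type} [Field L] [Field M] [Algebra L M] [Algebra (ZMod p) L] [Algebra (ZMod p) M] [IsScalarTower (ZMod p) L M] [FiniteDimensional L M] [GFF p L] [GFF p M] (v : FFPrime L) : {w : FFPrime M | w.rst L = v}.Finite := by
  obtain ⟨f, _, hf⟩ := v.val_surj (-1)
  apply (finite_poles p (algebraMap L M f)).subset
  intro w hw
  have hw : w.rst L = v := hw
  show w.val _ < 0
  rw [w.val_algebraMap, hw, hf]
  have : (0 : ℤ) < w.rm L := by exact_mod_cast w.rm_pos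
  linarith

/-- fibre -/
def fib (p : ℕ) [Fact p.Prime] {L M : Type} [Field L] [Field M] [Algebra L M] [Algebra (ZMod p) L] [Algebra (ZMod p) M] [IsScalarTower (ZMod p) L M] [FiniteDimensional L M] [GFF p L] [GFF p M] (v : FFPrime L) : Finset (FFPrime M) := (finite_fib p (M := M) v).toFinset

theorem mem_fib (p : ℕ) [Fact p.Prime] {L M : Type} [Field L] [Field M] [Algebra L M] [Algebra (ZMod p) L] [Algebra (ZMod p) M] [IsScalarTower (ZMod p) L M] [FiniteDimensional L M] [GFF p L] [GFF p M] {v : FFPrime L} {w : FFPrime M} : w ∈ fib p v ↔ w.rst L = v := by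
  simp [fib]

theorem degD_poleD_algebraMap (p : ℕ) [Fact p.Prime] {L M : Type} [Field L] [Field M] [Algebra L M] [Algebra (ZMod p) L] [Algebra (ZMod p) M] [IsScalarTower (ZMod p) L M] [FiniteDimensional L M] [GFF p L] [GFF p M] (f : L) :
    degD p (poleD p (algebraMap L M f)) =
      ∑ v ∈ (poleD p f).support, (-v.val f) * ∑ w ∈ fib p (M := M) v, (w.rm L : ℤ) * w.deg p := by
  classical
  have hsupp : ∀ w : FFPrime M, w ∈ (poleD p (algebraMap L M f)).support ↔ w.rst L ∈ (poleD p f).support := by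
    intro w
    rw [Finsupp.mem_support_iff, Finsupp.mem_support_iff, poleD_apply, poleD_apply, w.val_algebraMap]
    have h0 : (0 : ℤ) < w.rm L := by exact_mod_cast w.rm_pos
    apply not_congr
    rw [max_eq_right_iff, max_eq_right_iff]
    constructor
    · intro h; by_contra hc; nlinarith
    · intro h; nlinarith
  rw [degD_apply, Finsupp.sum]
  have h1 := Finset.sum_fiberwise_of_maps_to (s := (poleD p (algebraMap L M f)).support)
    (t := (poleD p f).support) (g := fun w : FFPrime M => w.rst L) (fun w hw => (hsupp w).1 hw)
    (f := fun w => poleD p (algebraMap L M f) w * (w.deg p : ℤ))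
  rw [← h1]
  refine Finset.sum_congr rfl fun v hv => ?_
  rw [Finset.mul_sum]
  have h2 : (poleD p (algebraMap L M f)).support.filter (fun w : FFPrime M => w.rst L = v) = fib p v := by
    ext w
    rw [Finset.mem_filter, mem_fib, hsupp]
    constructor
    · exact fun h => h.2
    · intro h; exact ⟨by rw [h]; exact hv, h⟩
  rw [h2]
  refine Finset.sum_congr rfl fun w hw => ?_
  rw [mem_fib] at hw
  rw [Finsupp.mem_support_iff, poleD_apply] at hv
  have hv2 : v.val f < 0 := by
    by_contra h
    exact hv (max_eq_right (by linarith))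
  rw [poleD_apply, w.val_algebraMap, hw, max_eq_left]
  · ring
  · have h0 : (0 : ℤ) < w.rm L := by exact_mod_cast w.rm_pos
    nlinarith

namespace UK

/-- orbit -/
def orb {q : ℕ} {L M : Type} [Field L] [Field M] [Algebra L M] (U : UK q L M) (w : FFPrime M) : Finset (FFPrime M) := by
  classical
  exact (Finset.range q).image (fun i => U.σ ^ i • w)

theorem mem_orb {q : ℕ} {L M : Type} [Field L] [Field M] [Algebra L M] (U : UK q L M) {w w' : FFPrime M} : w' ∈ U.orb w ↔ ∃ i < q, U.σ ^ i • w = w' := by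
  simp [orb]

theorem fixed_or {q : ℕ} {L M : Type} [Field L] [Field M] [Algebra L M] (U : UK q L M) (w : FFPrime M) : (U.σ • w = w) ∨ Set.InjOn (fun i : ℕ => U.σ ^ i • w) (Finset.range q) := by
  have h1 : Function.minimalPeriod (fun w => U.σ • w) w ∣ q := by
    apply Function.IsPeriodicPt.minimalPeriod_dvd
    show (fun w => U.σ • w)^[q] w = w
    rw [smul_iterate, U.hσ]; exact one_smul _ _
  rcases (Nat.dvd_prime U.hq).1 h1 with h | h
  · left
    exact Function.minimalPeriod_eq_one_iff_isFixedPt.1 h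
  · right
    have := Function.iterate_injOn_Iio_minimalPeriod (f := fun w => U.σ • w) (x := w)
    rw [h] at this
    intro i hi j hj hij
    apply this (by simpa using hi) (by simpa using hj)
    simpa [smul_iterate] using hij

theorem orb_fixed {q : ℕ} {L M : Type} [Field L] [Field M] [Algebra L M] (U : UK q L M) {w : FFPrime M} (h : U.σ • w = w) : U.orb w = {w} := by
  have hpw : ∀ j : ℕ, U.σ ^ j • w = w := by
    intro j
    induction j with
    | zero => simp
    | succ j ih => rw [pow_succ, mul_smul, h, ih]
  ext w'
  rw [U.mem_orb, Finset.mem_singleton]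
  constructor
  · rintro ⟨i, _, rfl⟩; exact hpw i
  · rintro rfl; exact ⟨0, U.hq.pos, by simp⟩

theorem le_sum_orb {q : ℕ} {L M : Type} [Field L] [Field M] [Algebra L M] (U : UK q L M) (p : ℕ) [Fact p.Prime] [Algebra (ZMod p) L] [Algebra (ZMod p) M] [IsScalarTower (ZMod p) L M] [FiniteDimensional L M] [GFF p L] [GFF p M] (w : FFPrime M) :
    (q : ℤ) * (w.rst L).deg p ≤ ∑ w' ∈ U.orb w, (w'.deg p : ℤ) := by
  classical
  rcases U.fixed_or w with h | h
  · rw [U.orb_fixed h, Finset.sum_singleton]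
    have := U.degE_of_fixed p w h
    rw [← FFPrime.coe_deg, ← FFPrime.coe_deg] at this
    exact_mod_cast this
  · rw [orb, Finset.sum_image h]
    have h2 : ∀ i ∈ Finset.range q, ((U.σ ^ i • w).deg p : ℤ) = w.deg p := by
      intro i _; rw [FFPrime.deg_smul p]
    rw [Finset.sum_congr rfl h2, Finset.sum_const, Finset.card_range, nsmul_eq_mul]
    have := w.degE_rst_le p (L := L)
    rw [← FFPrime.coe_deg, ← FFPrime.coe_deg] at this
    have h3 : (w.rst L).deg p ≤ w.deg p := by exact_mod_cast this
    have : ((w.rst L).deg p : ℤ) ≤ w.deg p := by exact_mod_cast h3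
    nlinarith

theorem orb_subset {q : ℕ} {L M : Type} [Field L] [Field M] [Algebra L M] (U : UK q L M) (p : ℕ) [Fact p.Prime] [Algebra (ZMod p) L] [Algebra (ZMod p) M] [IsScalarTower (ZMod p) L M] [FiniteDimensional L M] [GFF p L] [GFF p M] (w : FFPrime M) : U.orb w ⊆ fib p (w.rst L) := by
  intro w' h
  obtain ⟨i, _, rfl⟩ := U.mem_orb.1 h
  rw [mem_fib]
  exact (FFPrime.rst_smul _ _).1

theorem le_sum_fib {q : ℕ} {L M : Type} [Field L] [Field M] [Algebra L M] (U : UK q L M) (p : ℕ) [Fact p.Prime] [Algebra (ZMod p) L] [Algebra (ZMod p) M] [IsScalarTower (ZMod p) L M] [FiniteDimensional L M] [GFF p L] [GFF p M] (v : FFPrime L) :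
    (q : ℤ) * v.deg p ≤ ∑ w ∈ fib p (M := M) v, (w.rm L : ℤ) * w.deg p := by
  obtain ⟨w, rfl⟩ := FFPrime.exists_rst_eq (M := M) v
  refine (U.le_sum_orb p w).trans ?_
  calc ∑ w' ∈ U.orb w, (w'.deg p : ℤ) ≤ ∑ w' ∈ U.orb w, (w'.rm L : ℤ) * w'.deg p := by
        refine Finset.sum_le_sum fun w' _ => ?_
        have h0 : (0 : ℤ) < w'.rm L := by exact_mod_cast w'.rm_pos
        have : (0 : ℤ) ≤ w'.deg p := by positivity
        nlinarith
    _ ≤ _ := Finset.sum_le_sum_of_subset_of_nonneg (U.orb_subset p w) (fun _ _ _ => by positivity)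

theorem sum_fib {q : ℕ} {L M : Type} [Field L] [Field M] [Algebra L M] (U : UK q L M) (p : ℕ) [Fact p.Prime] [Algebra (ZMod p) L] [Algebra (ZMod p) M] [IsScalarTower (ZMod p) L M] [FiniteDimensional L M] [GFF p L] [GFF p M] (v : FFPrime L) :
    ∑ w ∈ fib p (M := M) v, (w.rm L : ℤ) * w.deg p = q * v.deg p := by
  apply le_antisymm _ (U.le_sum_fib p v)
  obtain ⟨f, hf0, hf⟩ := v.val_surj (-1)
  have htr : Transcendental (ZMod p) f := FFPrime.transcendental p v (by rw [hf]; decide)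
  have htr2 : Transcendental (ZMod p) (algebraMap L M f) := by
    obtain ⟨w, rfl⟩ := FFPrime.exists_rst_eq (M := M) v
    apply FFPrime.transcendental p w
    rw [w.val_algebraMap, hf]
    have := w.rm_pos (L := L)
    simp; omega
  have h1 := degD_poleD_algebraMap p (M := M) f
  rw [degD_poleD p htr2, finrank_adjoin_algebraMap, U.hrank] at h1
  have h2 := degD_poleD p htr
  rw [degD_apply, Finsupp.sum] at h2
  have h3 : ∀ v ∈ (poleD p f).support, poleD p f v = -v.val f ∧ v.val f < 0 := by
    intro v hv
    rw [Finsupp.mem_support_iff, poleD_apply] at hv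
    rw [poleD_apply]
    have hv2 : v.val f < 0 := by
      by_contra h
      exact hv (max_eq_right (by linarith))
    exact ⟨max_eq_left (by linarith), hv2⟩
  rw [Finset.sum_congr rfl (fun v hv => by rw [(h3 v hv).1])] at h2
  push_cast at h1
  rw [← h2, Finset.sum_mul] at h1
  have hv : v ∈ (poleD p f).support := by
    rw [Finsupp.mem_support_iff, poleD_apply, hf]; decide
  have h4 := (Finset.sum_eq_sum_iff_of_le (fun v hv => by
    have := U.le_sum_fib p v
    have h5 := (h3 v hv).2
    show -v.val f * (v.deg p : ℤ) * q ≤ -v.val f * ∑ w ∈ fib p (M := M) v, (w.rm L : ℤ) * w.deg p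
    nlinarith)).1 h1 v hv
  rw [hf] at h4
  linarith

theorem fib_eq_orb {q : ℕ} {L M : Type} [Field L] [Field M] [Algebra L M] (U : UK q L M) (p : ℕ) [Fact p.Prime] [Algebra (ZMod p) L] [Algebra (ZMod p) M] [IsScalarTower (ZMod p) L M] [FiniteDimensional L M] [GFF p L] [GFF p M] (w : FFPrime M) : fib p (w.rst L) = U.orb w ∧ w.rm L = 1 := by
  have h1 := U.sum_fib p (w.rst L)
  have h2 := U.le_sum_orb p w
  have h3 : ∀ w : FFPrime M, (0 : ℤ) < w.rm L := fun w => by exact_mod_cast w.rm_pos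
  have h4 : ∀ w : FFPrime M, (0 : ℤ) < w.deg p := fun w => by exact_mod_cast w.deg_pos p
  have h5 : ∑ w' ∈ U.orb w, (w'.deg p : ℤ) ≤ ∑ w' ∈ U.orb w, (w'.rm L : ℤ) * w'.deg p :=
    Finset.sum_le_sum fun w' _ => by nlinarith [h3 w', h4 w']
  have h6 : ∑ w' ∈ U.orb w, (w'.rm L : ℤ) * w'.deg p ≤ ∑ w ∈ fib p (M := M) (w.rst L), (w.rm L : ℤ) * w.deg p :=
    Finset.sum_le_sum_of_subset_of_nonneg (U.orb_subset p w) (fun w' _ _ => by nlinarith [h3 w', h4 w'])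
  constructor
  · apply Finset.Subset.antisymm _ (U.orb_subset p w)
    by_contra hn
    obtain ⟨w', hw', hw2⟩ := Finset.not_subset.1 hn
    have := Finset.sum_lt_sum_of_subset (U.orb_subset p w) hw' hw2
      (f := fun w : FFPrime M => (w.rm L : ℤ) * w.deg p) (mul_pos (h3 _) (h4 _))
      (fun w' _ _ => by nlinarith [h3 w', h4 w'])
    linarith
  · have h7 := (Finset.sum_eq_sum_iff_of_le (s := U.orb w) (f := fun w' : FFPrime M => (w'.deg p : ℤ))
      (g := fun w' : FFPrime M => (w'.rm L : ℤ) * w'.deg p) (fun w' _ => by nlinarith [h3 w', h4 w'])).1 (by linarith)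
      w (U.mem_orb.2 ⟨0, U.hq.pos, by simp⟩)
    have h8 : ((w.rm L : ℤ) - 1) * w.deg p = 0 := by linarith
    rcases mul_eq_zero.1 h8 with h | h
    · have : (w.rm L : ℤ) = 1 := by linarith
      exact_mod_cast this
    · exact absurd h (h4 w).ne'

theorem val_algebraMap' {q : ℕ} {L M : Type} [Field L] [Field M] [Algebra L M] (U : UK q L M) (p : ℕ) [Fact p.Prime] [Algebra (ZMod p) L] [Algebra (ZMod p) M] [IsScalarTower (ZMod p) L M] [FiniteDimensional L M] [GFF p L] [GFF p M] (w : FFPrime M) (x : L) : w.val (algebraMap L M x) = (w.rst L).val x := by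
  rw [w.val_algebraMap, (U.fib_eq_orb p w).2]; simp

theorem exists_smul {q : ℕ} {L M : Type} [Field L] [Field M] [Algebra L M] (U : UK q L M) (p : ℕ) [Fact p.Prime] [Algebra (ZMod p) L] [Algebra (ZMod p) M] [IsScalarTower (ZMod p) L M] [FiniteDimensional L M] [GFF p L] [GFF p M] {w w' : FFPrime M} (h : w'.rst L = w.rst L) : ∃ i < q, U.σ ^ i • w = w' := by
  rw [← U.mem_orb, ← (U.fib_eq_orb p w).1, mem_fib, h]

theorem sum_fib' {q : ℕ} {L M : Type} [Field L] [Field M] [Algebra L M] (U : UK q L M) (p : ℕ) [Fact p.Prime] [Algebra (ZMod p) L] [Algebra (ZMod p) M] [IsScalarTower (ZMod p) L M] [FiniteDimensional L M] [GFF p L] [GFF p M] (v : FFPrime L) : ∑ w ∈ fib p (M := M) v, (w.deg p : ℤ) = q * v.deg p := by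
  rw [← U.sum_fib p v]
  refine Finset.sum_congr rfl fun w _ => ?_
  rw [(U.fib_eq_orb p w).2]; simp

/-- inert or split -/
theorem inert_or_split {q : ℕ} {L M : Type} [Field L] [Field M] [Algebra L M] (U : UK q L M) (p : ℕ) [Fact p.Prime] [Algebra (ZMod p) L] [Algebra (ZMod p) M] [IsScalarTower (ZMod p) L M] [FiniteDimensional L M] [GFF p L] [GFF p M] (v : FFPrime L) :
    (∃ w : FFPrime M, fib p v = {w} ∧ w.deg p = q * v.deg p ∧ U.σ • w = w) ∨
    (∃ w : FFPrime M, w.rst L = v ∧ Set.InjOn (fun i : ℕ => U.σ ^ i • w) (Finset.range q) ∧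
      ((fib p (M := M) v).card = q) ∧ ∀ w' ∈ fib p (M := M) v, w'.deg p = v.deg p) := by
  classical
  obtain ⟨w, rfl⟩ := FFPrime.exists_rst_eq (M := M) v
  have h0 := (U.fib_eq_orb p w).1
  have h1 := U.sum_fib' p (w.rst L)
  rw [h0] at h1 ⊢
  rcases U.fixed_or w with h | h
  · left
    rw [U.orb_fixed h] at h1 ⊢
    rw [Finset.sum_singleton] at h1
    exact ⟨w, rfl, by exact_mod_cast h1, h⟩
  · right
    refine ⟨w, rfl, h, ?_, ?_⟩
    · rw [orb, Finset.card_image_of_injOn h, Finset.card_range]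
    · have h2 : ∀ w' ∈ U.orb w, w'.deg p = w.deg p := by
        intro w' hw'
        obtain ⟨i, _, rfl⟩ := U.mem_orb.1 hw'
        rw [FFPrime.deg_smul p]
      rw [Finset.sum_congr rfl (fun w' hw' => by rw [h2 w' hw']), Finset.sum_const, orb,
        Finset.card_image_of_injOn h, Finset.card_range, nsmul_eq_mul] at h1
      have hq0 : (q : ℤ) ≠ 0 := by exact_mod_cast U.hq.ne_zero
      have h3 := mul_left_cancel₀ hq0 h1
      intro w' hw'
      rw [h2 w' hw']; exact_mod_cast h3

end UK
end
end

noncomputable section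

/-- pull-back of divisors -/
def pb (p : ℕ) [Fact p.Prime] {L M : Type} [Field L] [Field M] [Algebra L M] [Algebra (ZMod p) L] [Algebra (ZMod p) M] [IsScalarTower (ZMod p) L M] [FiniteDimensional L M] [GFF p L] [GFF p M] : Dv L →+ Dv M where
  toFun D := by
    classical
    exact Finsupp.onFinset (D.support.biUnion (fun v => fib p v)) (fun w => D (w.rst L)) (by
      intro w hw
      rw [Finset.mem_biUnion]
      exact ⟨w.rst L, Finsupp.mem_support_iff.2 hw, (mem_fib p).2 rfl⟩)
  map_zero' := by ext; simp
  map_add' D E := by ext; simp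

theorem pb_apply (p : ℕ) [Fact p.Prime] {L M : Type} [Field L] [Field M] [Algebra L M] [Algebra (ZMod p) L] [Algebra (ZMod p) M] [IsScalarTower (ZMod p) L M] [FiniteDimensional L M] [GFF p L] [GFF p M] (D : Dv L) (w : FFPrime M) : pb p D w = D (w.rst L) := by
  simp [pb]

theorem pb_inj (p : ℕ) [Fact p.Prime] {L M : Type} [Field L] [Field M] [Algebra L M] [Algebra (ZMod p) L] [Algebra (ZMod p) M] [IsScalarTower (ZMod p) L M] [FiniteDimensional L M] [GFF p L] [GFF p M] {D E : Dv L} (h : pb p (M := M) D = pb p E) : D = E := by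
  ext v
  obtain ⟨w, rfl⟩ := FFPrime.exists_rst_eq (M := M) v
  rw [← pb_apply p, h, pb_apply]

theorem pb_single (p : ℕ) [Fact p.Prime] {L M : Type} [Field L] [Field M] [Algebra L M] [Algebra (ZMod p) L] [Algebra (ZMod p) M] [IsScalarTower (ZMod p) L M] [FiniteDimensional L M] [GFF p L] [GFF p M] (v : FFPrime L) (n : ℤ) : pb p (M := M) (Finsupp.single v n) = ∑ w ∈ fib p v, Finsupp.single w n := by
  classical
  ext w
  rw [pb_apply, Finsupp.finset_sum_apply, Finsupp.single_apply]
  simp only [Finsupp.single_apply]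
  rw [Finset.sum_ite_eq']
  simp only [mem_fib, eq_comm]

namespace UK

/-- action on divisors -/
def sg {q : ℕ} {L M : Type} [Field L] [Field M] [Algebra L M] (U : UK q L M) : Dv M ≃+ Dv M :=
  Finsupp.domCongr (MulAction.toPerm U.σ)

theorem sg_apply {q : ℕ} {L M : Type} [Field L] [Field M] [Algebra L M] (U : UK q L M) (B : Dv M) (w : FFPrime M) :
    U.sg B w = B (U.σ⁻¹ • w) := by
  simp [sg]

theorem sg_apply' {q : ℕ} {L M : Type} [Field L] [Field M] [Algebra L M] (U : UK q L M) (B : Dv M) (w : FFPrime M) :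
    U.sg B (U.σ • w) = B w := by
  rw [sg_apply, inv_smul_smul]

theorem sg_single {q : ℕ} {L M : Type} [Field L] [Field M] [Algebra L M] (U : UK q L M) (w : FFPrime M) (n : ℤ) :
    U.sg (Finsupp.single w n) = Finsupp.single (U.σ • w) n := by
  simp [sg]

theorem deg_sg {q : ℕ} {L M : Type} [Field L] [Field M] [Algebra L M] (U : UK q L M) (p : ℕ) [Fact p.Prime] [Algebra (ZMod p) L] [Algebra (ZMod p) M] [IsScalarTower (ZMod p) L M] [FiniteDimensional L M] [GFF p L] [GFF p M] (B : Dv M) : degD p (U.sg B) = degD p B := by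
  have : (degD p).comp U.sg.toAddMonoidHom = degD p := by
    apply Finsupp.addHom_ext
    intro w n
    show degD p (U.sg _) = _
    rw [sg_single, degD_single, degD_single, FFPrime.deg_smul p]
  exact DFunLike.congr_fun this B

theorem dv_sg {q : ℕ} {L M : Type} [Field L] [Field M] [Algebra L M] (U : UK q L M) (p : ℕ) [Fact p.Prime] [Algebra (ZMod p) L] [Algebra (ZMod p) M] [IsScalarTower (ZMod p) L M] [FiniteDimensional L M] [GFF p L] [GFF p M] (y : M) : U.sg (dv p y) = dv p (U.σ y) := by
  ext w
  rw [sg_apply, dv_apply, dv_apply, FFPrime.smul_val]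
  rfl

theorem sum_shift {q : ℕ} (f : ℕ → ℤ) (hf : ∀ i, f (i + q) = f i) (j : ℕ) :
    ∑ i ∈ Finset.range q, f (i + j) = ∑ i ∈ Finset.range q, f i := by
  induction j with
  | zero => rfl
  | succ j ih =>
    rw [← ih]
    have h1 := Finset.sum_range_succ (fun i => f (i + j)) q
    have h2 := Finset.sum_range_succ' (fun i => f (i + j)) q
    rw [h1] at h2
    simp only [zero_add] at h2
    rw [show f (q + j) = f j by rw [add_comm, hf]] at h2
    have h3 := add_right_cancel h2
    rw [h3]
    refine Finset.sum_congr rfl fun i _ => ?_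
    congr 1; ring

/-- chosen place above -/
def up {q : ℕ} {L M : Type} [Field L] [Field M] [Algebra L M] (U : UK q L M) [FiniteDimensional L M] (v : FFPrime L) : FFPrime M :=
  (FFPrime.exists_rst_eq (M := M) v).choose

theorem up_rst {q : ℕ} {L M : Type} [Field L] [Field M] [Algebra L M] (U : UK q L M) [FiniteDimensional L M] (v : FFPrime L) :
    (U.up v).rst L = v := (FFPrime.exists_rst_eq (M := M) v).choose_spec

/-- norm of divisors -/
def nm {q : ℕ} {L M : Type} [Field L] [Field M] [Algebra L M] (U : UK q L M) [FiniteDimensional L M] : Dv M →+ Dv L where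
  toFun B := by
    classical
    exact Finsupp.onFinset (B.support.image (fun w => w.rst L))
      (fun v => ∑ i ∈ Finset.range q, B (U.σ ^ i • U.up v)) (by
      intro v hv
      rw [Finset.mem_image]
      obtain ⟨i, _, hi⟩ := Finset.exists_ne_zero_of_sum_ne_zero hv
      refine ⟨_, Finsupp.mem_support_iff.2 hi, ?_⟩
      rw [(FFPrime.rst_smul _ _).1, U.up_rst])
  map_zero' := by ext; simp
  map_add' D E := by ext; simp [Finset.sum_add_distrib]

theorem nm_apply {q : ℕ} {L M : Type} [Field L] [Field M] [Algebra L M] (U : UK q L M) (p : ℕ) [Fact p.Prime] [Algebra (ZMod p) L] [Algebra (ZMod p) M] [IsScalarTower (ZMod p) L M] [FiniteDimensional L M] [GFF p L] [GFF p M] (B : Dv M) (w : FFPrime M) :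
    U.nm B (w.rst L) = ∑ i ∈ Finset.range q, B (U.σ ^ i • w) := by
  have h0 : U.nm B (w.rst L) = ∑ i ∈ Finset.range q, B (U.σ ^ i • U.up (w.rst L)) := by
    simp [nm]
  obtain ⟨j, _, hj⟩ := U.exists_smul p (w := U.up (w.rst L)) (w' := w) (U.up_rst _).symm
  rw [h0, ← sum_shift (fun i => B (U.σ ^ i • U.up (w.rst L))) _ j]
  · refine Finset.sum_congr rfl fun i _ => ?_
    show B (U.σ ^ (i + j) • _) = _
    rw [pow_add, mul_smul, hj]
  · intro i
    show B (U.σ ^ (i + q) • _) = B (U.σ ^ i • _)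
    rw [pow_add, U.hσ, mul_one]

theorem nm_pb {q : ℕ} {L M : Type} [Field L] [Field M] [Algebra L M] (U : UK q L M) (p : ℕ) [Fact p.Prime] [Algebra (ZMod p) L] [Algebra (ZMod p) M] [IsScalarTower (ZMod p) L M] [FiniteDimensional L M] [GFF p L] [GFF p M] (D : Dv L) : U.nm (pb p D) = q • D := by
  ext v
  obtain ⟨w, rfl⟩ := FFPrime.exists_rst_eq (M := M) v
  rw [U.nm_apply p]
  rw [Finset.sum_congr rfl (g := fun _ => D (w.rst L))]
  · simp
  · intro i _
    rw [pb_apply, (FFPrime.rst_smul _ _).1]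

theorem nm_sg {q : ℕ} {L M : Type} [Field L] [Field M] [Algebra L M] (U : UK q L M) (p : ℕ) [Fact p.Prime] [Algebra (ZMod p) L] [Algebra (ZMod p) M] [IsScalarTower (ZMod p) L M] [FiniteDimensional L M] [GFF p L] [GFF p M] (B : Dv M) : U.nm (U.sg B) = U.nm B := by
  ext v
  obtain ⟨w, rfl⟩ := FFPrime.exists_rst_eq (M := M) v
  rw [U.nm_apply p, U.nm_apply p, ← sum_shift (fun i => U.sg B (U.σ ^ i • w)) _ 1]
  · refine Finset.sum_congr rfl fun i _ => ?_
    show U.sg B (U.σ ^ (i + 1) • w) = _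
    rw [pow_succ', mul_smul, sg_apply']
  · intro i
    show U.sg B (U.σ ^ (i + q) • _) = U.sg B (U.σ ^ i • _)
    rw [pow_add, U.hσ, mul_one]

theorem exists_pb {q : ℕ} {L M : Type} [Field L] [Field M] [Algebra L M] (U : UK q L M) (p : ℕ) [Fact p.Prime] [Algebra (ZMod p) L] [Algebra (ZMod p) M] [IsScalarTower (ZMod p) L M] [FiniteDimensional L M] [GFF p L] [GFF p M] {B : Dv M} (h : U.sg B = B) : ∃ D : Dv L, pb p D = B := by
  have h1 : ∀ w, B (U.σ • w) = B w := fun w => by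
    rw [← h, sg_apply', h]
  have h2 : ∀ (i : ℕ) w, B (U.σ ^ i • w) = B w := by
    intro i
    induction i with
    | zero => simp
    | succ i ih => intro w; rw [pow_succ, mul_smul, ih, h1]
  classical
  refine ⟨Finsupp.onFinset (B.support.image (fun w => w.rst L)) (fun v => B (U.up v)) ?_, ?_⟩
  · intro v hv
    rw [Finset.mem_image]
    exact ⟨_, Finsupp.mem_support_iff.2 hv, U.up_rst v⟩
  · ext w
    rw [pb_apply, Finsupp.onFinset_apply]
    obtain ⟨j, _, hj⟩ := U.exists_smul p (w := U.up (w.rst L)) (w' := w) (U.up_rst _).symm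
    rw [← hj, h2, hj]

theorem pb_dv {q : ℕ} {L M : Type} [Field L] [Field M] [Algebra L M] (U : UK q L M) (p : ℕ) [Fact p.Prime] [Algebra (ZMod p) L] [Algebra (ZMod p) M] [IsScalarTower (ZMod p) L M] [FiniteDimensional L M] [GFF p L] [GFF p M] (f : L) : pb p (M := M) (dv p f) = dv p (algebraMap L M f) := by
  ext w
  rw [pb_apply, dv_apply, dv_apply, U.val_algebraMap' p]

theorem nm_dv {q : ℕ} {L M : Type} [Field L] [Field M] [Algebra L M] (U : UK q L M) (p : ℕ) [Fact p.Prime] [Algebra (ZMod p) L] [Algebra (ZMod p) M] [IsScalarTower (ZMod p) L M] [FiniteDimensional L M] [GFF p L] [GFF p M] {y : M} (hy : y ≠ 0) : U.nm (dv p y) = dv p (Algebra.norm L y) := by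
  ext v
  obtain ⟨w, rfl⟩ := FFPrime.exists_rst_eq (M := M) v
  rw [U.nm_apply p, dv_apply, ← U.val_algebraMap' p, U.norm_eq,
    ← sum_shift (fun i => dv p y (U.σ ^ i • w)) _ 0]
  · simp only [dv_apply, FFPrime.smul_val, add_zero]
    have hprod : ∀ n : ℕ, w.val (∏ i ∈ Finset.range n, (U.σ ^ i) y) = ∑ i ∈ Finset.range n, w.val ((U.σ ^ i) y) := by
      intro n
      induction n with
      | zero => simp [FFPrime.val_one]
      | succ n ih =>
        rw [Finset.prod_range_succ, Finset.sum_range_succ, FFPrime.val_mul, ih]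
        · rw [Finset.prod_ne_zero_iff]; intro i _; exact (map_ne_zero_iff _ (U.σ ^ i).injective).2 hy
        · exact (map_ne_zero_iff _ (U.σ ^ n).injective).2 hy
    rw [hprod]
    -- reflect
    have hinv : ∀ i ∈ Finset.range q, (U.σ ^ i).symm y = (U.σ ^ (q - i)) y := by
      intro i hi
      rw [Finset.mem_range] at hi
      have : (U.σ ^ i).symm = U.σ ^ (q - i) := by
        show (U.σ ^ i)⁻¹ = _
        rw [inv_eq_iff_mul_eq_one, ← pow_add, Nat.add_sub_cancel' hi.le, U.hσ]
      rw [this]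
    rw [Finset.sum_congr rfl (fun i hi => by rw [hinv i hi]), ← Finset.sum_range_reflect,
      ← sum_shift (fun i => w.val ((U.σ ^ i) y)) _ 1]
    · refine Finset.sum_congr rfl fun i hi => ?_
      rw [Finset.mem_range] at hi
      rw [show q - (q - 1 - i) = i + 1 by omega]
    · intro i
      show w.val ((U.σ ^ (i + q)) y) = w.val ((U.σ ^ i) y)
      rw [pow_add, U.hσ, mul_one]
  · intro i
    show dv p y (U.σ ^ (i + q) • _) = dv p y (U.σ ^ i • _)
    rw [pow_add, U.hσ, mul_one]

theorem deg_pb {q : ℕ} {L M : Type} [Field L] [Field M] [Algebra L M] (U : UK q L M) (p : ℕ) [Fact p.Prime] [Algebra (ZMod p) L] [Algebra (ZMod p) M] [IsScalarTower (ZMod p) L M] [FiniteDimensional L M] [GFF p L] [GFF p M] (D : Dv L) : degD p (pb p (M := M) D) = q * degD p D := by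
  have : (degD p).comp (pb p (M := M)) = (AddMonoidHom.mulLeft (q : ℤ)).comp (degD p (L := L)) := by
    apply Finsupp.addHom_ext
    intro v n
    show degD p (pb p _) = q * degD p _
    rw [pb_single, map_sum, degD_single]
    simp only [degD_single]
    rw [← Finset.mul_sum, U.sum_fib' p]
    ring
  exact DFunLike.congr_fun this D

theorem pb_nm {q : ℕ} {L M : Type} [Field L] [Field M] [Algebra L M] (U : UK q L M) (p : ℕ) [Fact p.Prime] [Algebra (ZMod p) L] [Algebra (ZMod p) M] [IsScalarTower (ZMod p) L M] [FiniteDimensional L M] [GFF p L] [GFF p M] (B : Dv M) : pb p (U.nm B) = ∑ i ∈ Finset.range q, (U.sg)^[i] B := by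
  ext w
  rw [pb_apply, U.nm_apply p, Finsupp.finset_sum_apply]
  have hs : ∀ (i : ℕ) w, (U.sg)^[i] B (U.σ ^ i • w) = B w := by
    intro i
    induction i with
    | zero => simp
    | succ i ih => intro w; rw [Function.iterate_succ_apply', pow_succ', mul_smul, sg_apply', ih]
  rw [← sum_shift (fun i => B (U.σ ^ i • w)) _ 1, ← Finset.sum_range_reflect]
  · refine Finset.sum_congr rfl fun i hi => ?_
    rw [Finset.mem_range] at hi
    rw [← hs i, ← mul_smul, ← pow_add, show i + (q - 1 - i + 1) = q by omega, U.hσ, one_smul]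
  · intro i
    show B (U.σ ^ (i + q) • _) = B (U.σ ^ i • _)
    rw [pow_add, U.hσ, mul_one]

theorem deg_nm {q : ℕ} {L M : Type} [Field L] [Field M] [Algebra L M] (U : UK q L M) (p : ℕ) [Fact p.Prime] [Algebra (ZMod p) L] [Algebra (ZMod p) M] [IsScalarTower (ZMod p) L M] [FiniteDimensional L M] [GFF p L] [GFF p M] (B : Dv M) : degD p (U.nm B) = degD p B := by
  have h1 := U.deg_pb p (U.nm B)
  have hs : ∀ i : ℕ, degD p ((U.sg)^[i] B) = degD p B := by
    intro i
    induction i with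
    | zero => rfl
    | succ i ih => rw [Function.iterate_succ_apply', U.deg_sg p, ih]
  rw [U.pb_nm p, map_sum, Finset.sum_congr rfl (fun i _ => hs i)] at h1
  simp only [Finset.sum_const, Finset.card_range, nsmul_eq_mul] at h1
  exact (mul_left_cancel₀ (by exact_mod_cast U.hq.ne_zero) h1).symm

theorem nm_single {q : ℕ} {L M : Type} [Field L] [Field M] [Algebra L M] (U : UK q L M) (p : ℕ) [Fact p.Prime] [Algebra (ZMod p) L] [Algebra (ZMod p) M] [IsScalarTower (ZMod p) L M] [FiniteDimensional L M] [GFF p L] [GFF p M] {w : FFPrime M} (h : Set.InjOn (fun i : ℕ => U.σ ^ i • w) (Finset.range q)) :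
    U.nm (Finsupp.single w 1) = Finsupp.single (w.rst L) 1 := by
  classical
  ext v
  by_cases hv : v = w.rst L
  · subst hv
    rw [U.nm_apply p, Finset.sum_eq_single 0]
    · simp
    · intro i hi hi0
      rw [Finsupp.single_apply, if_neg]
      intro he
      apply hi0
      exact (h (by simpa using U.hq.pos) (by simpa using hi) (by simpa using he)).symm
    · simp [U.hq.ne_zero]
  · obtain ⟨w', rfl⟩ := FFPrime.exists_rst_eq (M := M) v
    rw [U.nm_apply p, Finsupp.single_apply, if_neg (Ne.symm hv)]
    apply Finset.sum_eq_zero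
    intro i _
    rw [Finsupp.single_apply, if_neg]
    intro he
    apply hv
    rw [he, (FFPrime.rst_smul _ _).1]

end UK
end

noncomputable section

theorem finite_eff (p : ℕ) [Fact p.Prime] {L : Type} [Field L] [Algebra (ZMod p) L] [GFF p L] (n : ℤ) : {D : Dv L | 0 ≤ D ∧ degD p D = n}.Finite := by
  classical
  let W := (finite_deg_le p (L := L) n.toNat).toFinset
  apply (Set.finite_Icc (0 : Dv L) (∑ w ∈ W, Finsupp.single w n)).subset
  rintro D ⟨h0, hn⟩
  refine ⟨h0, ?_⟩
  have key : ∀ w, D w * w.deg p ≤ n := by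
    intro w
    have h1 : Finsupp.single w (D w) ≤ D := by
      rw [Finsupp.le_def]
      intro w'
      rw [Finsupp.single_apply]
      split_ifs with h
      · rw [h]
      · exact h0 w'
    have := degD_mono p h1
    rwa [degD_single, hn] at this
  rw [Finsupp.le_def]
  intro w
  rw [Finsupp.finset_sum_apply]
  simp only [Finsupp.single_apply]
  rw [Finset.sum_ite_eq']
  have hw := key w
  have h2 : (0 : ℤ) < w.deg p := by exact_mod_cast w.deg_pos p
  have h3 : 0 ≤ D w := h0 w
  split_ifs with h
  · nlinarith
  · by_contra hc
    push Not at hc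
    apply h
    simp only [W, Set.Finite.mem_toFinset, Set.mem_setOf_eq]
    have : (w.deg p : ℤ) ≤ n := by nlinarith
    omega

/-- effective divisors of degree n -/
def Eff (p : ℕ) [Fact p.Prime] {L : Type} [Field L] [Algebra (ZMod p) L] [GFF p L] (n : ℤ) : Finset (Dv L) := (finite_eff p n).toFinset

theorem mem_Eff (p : ℕ) [Fact p.Prime] {L : Type} [Field L] [Algebra (ZMod p) L] [GFF p L] {n : ℤ} {D : Dv L} : D ∈ Eff p n ↔ 0 ≤ D ∧ degD p D = n := by
  simp [Eff]

/-- principal divisors -/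
def PD (p : ℕ) [Fact p.Prime] (L : Type) [Field L] [Algebra (ZMod p) L] [GFF p L] : AddSubgroup (Dv L) where
  carrier := {D | ∃ f : L, f ≠ 0 ∧ dv p f = D}
  zero_mem' := ⟨1, one_ne_zero, dv_one p⟩
  add_mem' := by
    rintro _ _ ⟨f, hf, rfl⟩ ⟨g, hg, rfl⟩
    exact ⟨f * g, mul_ne_zero hf hg, dv_mul p hf hg⟩
  neg_mem' := by
    rintro _ ⟨f, hf, rfl⟩
    exact ⟨f⁻¹, inv_ne_zero hf, dv_inv p f⟩

theorem mem_PD (p : ℕ) [Fact p.Prime] {L : Type} [Field L] [Algebra (ZMod p) L] [GFF p L] {D : Dv L} : D ∈ PD p L ↔ ∃ f : L, f ≠ 0 ∧ dv p f = D := Iff.rfl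

/-- class group -/
abbrev Cl (p : ℕ) [Fact p.Prime] (L : Type) [Field L] [Algebra (ZMod p) L] [GFF p L] : Type := Dv L ⧸ PD p L

/-- class of a divisor -/
def cl (p : ℕ) [Fact p.Prime] {L : Type} [Field L] [Algebra (ZMod p) L] [GFF p L] : Dv L →+ Cl p L := QuotientAddGroup.mk' (PD p L)

theorem cl_surj (p : ℕ) [Fact p.Prime] {L : Type} [Field L] [Algebra (ZMod p) L] [GFF p L] (c : Cl p L) : ∃ D, cl p D = c := QuotientAddGroup.mk'_surjective _ c

theorem cl_eq (p : ℕ) [Fact p.Prime] {L : Type} [Field L] [Algebra (ZMod p) L] [GFF p L] {D E : Dv L} : cl p D = cl p E ↔ ∃ f : L, f ≠ 0 ∧ D + dv p f = E := by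
  rw [cl, QuotientAddGroup.mk'_eq_mk']
  constructor
  · rintro ⟨z, ⟨f, hf, rfl⟩, h⟩; exact ⟨f, hf, h⟩
  · rintro ⟨f, hf, h⟩; exact ⟨_, ⟨f, hf, rfl⟩, h⟩

/-- degree of a class -/
def dgC (p : ℕ) [Fact p.Prime] {L : Type} [Field L] [Algebra (ZMod p) L] [GFF p L] : Cl p L →+ ℤ := QuotientAddGroup.lift _ (degD p) (by
  rintro _ ⟨f, hf, rfl⟩; exact degD_dv p f)

theorem dgC_cl (p : ℕ) [Fact p.Prime] {L : Type} [Field L] [Algebra (ZMod p) L] [GFF p L] (D : Dv L) : dgC p (cl p D) = degD p D := rfl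

theorem exists_big (p : ℕ) [Fact p.Prime] {L : Type} [Field L] [Algebra (ZMod p) L] [GFF p L] (n : ℤ) : ∃ E : Dv L, 0 ≤ E ∧ n ≤ degD p E := by
  obtain ⟨w⟩ := exists_place p (L := L)
  refine ⟨Finsupp.single w |n|, Finsupp.single_nonneg.2 (abs_nonneg _), ?_⟩
  rw [degD_single]
  have h2 : (0 : ℤ) < w.deg p := by exact_mod_cast w.deg_pos p
  nlinarith [le_abs_self n, abs_nonneg n]

theorem finite_cl (p : ℕ) [Fact p.Prime] {L : Type} [Field L] [Algebra (ZMod p) L] [GFF p L] (n : ℤ) : {c : Cl p L | dgC p c = n}.Finite := by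
  obtain ⟨γ, n0, h1, -⟩ := riemann p (L := L)
  obtain ⟨E, hE0, hE⟩ := exists_big p (L := L) (γ + 1 - n)
  apply Set.Finite.of_finite_image (f := fun c => c + cl p E) _ (add_left_injective _).injOn
  apply ((Eff p (n + degD p E)).finite_toSet.image (cl p (L := L))).subset
  rintro _ ⟨c, hc, rfl⟩
  obtain ⟨D, rfl⟩ := cl_surj p c
  have hc : degD p D = n := hc
  have h2 := h1 (D + E)
  rw [map_add, hc] at h2
  obtain ⟨f, hf, hD⟩ := exists_of_ell_pos p (D := D + E) (by omega)
  refine ⟨D + E + dv p f, ?_, ?_⟩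
  · rw [Finset.mem_coe, mem_Eff]
    refine ⟨hD, ?_⟩
    rw [map_add, map_add, degD_dv, hc, add_zero]
  · show _ = cl p D + cl p E
    rw [← map_add]
    exact ((cl_eq p).2 ⟨f, hf, rfl⟩).symm

/-- classes of given degree -/
def ClN (p : ℕ) [Fact p.Prime] {L : Type} [Field L] [Algebra (ZMod p) L] [GFF p L] (n : ℤ) : Finset (Cl p L) := (finite_cl p n).toFinset

theorem mem_ClN (p : ℕ) [Fact p.Prime] {L : Type} [Field L] [Algebra (ZMod p) L] [GFF p L] {n : ℤ} {c : Cl p L} : c ∈ ClN p n ↔ dgC p c = n := by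
  simp [ClN]

theorem card_ClN_le (p : ℕ) [Fact p.Prime] {L : Type} [Field L] [Algebra (ZMod p) L] [GFF p L] (n : ℤ) : (ClN p (L := L) n).card ≤ (ClN p (L := L) 0).card := by
  rcases (ClN p (L := L) n).eq_empty_or_nonempty with h | ⟨c0, hc0⟩
  · simp [h]
  · refine Finset.card_le_card_of_injOn (fun c => c - c0) ?_ (sub_left_injective).injOn
    intro c hc
    rw [Finset.mem_coe, mem_ClN] at *
    rw [map_sub, hc, hc0, sub_self]

/-- constants (nonzero) -/
theorem const_iff (p : ℕ) [Fact p.Prime] {L : Type} [Field L] [Algebra (ZMod p) L] [GFF p L] {x : L} (hx : x ≠ 0) : x ∈ RR p (0 : Dv L) ↔ dv p x = 0 := by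
  rw [mem_RR' p hx, zero_add]
  constructor
  · intro h
    have h1 := degD_dv p x
    have h2 : x⁻¹ ∈ RR p (0 : Dv L) := by
      apply mem_RR_of_isAlgebraic
      apply IsAlgebraic.inv
      apply isAlgebraic_of_mem_RR
      rwa [mem_RR' p hx, zero_add]
    rw [mem_RR' p (inv_ne_zero hx), zero_add, dv_inv] at h2
    exact le_antisymm (by simpa using h2) h
  · intro h; rw [h]

theorem card_RR (p : ℕ) [Fact p.Prime] {L : Type} [Field L] [Algebra (ZMod p) L] [GFF p L] (D : Dv L) : Nat.card {x : RR p D // x ≠ 0} = p ^ ell p D - 1 := by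
  classical
  have : Finite (RR p D) := Module.finite_of_finite (ZMod p)
  have := Fintype.ofFinite (RR p D)
  rw [Nat.card_eq_fintype_card, Fintype.card_subtype_compl, Fintype.card_subtype_eq]
  congr 1
  rw [Module.card_eq_pow_finrank (K := ZMod p), ZMod.card]
  rfl

theorem card_eff_cl (p : ℕ) [Fact p.Prime] {L : Type} [Field L] [Algebra (ZMod p) L] [GFF p L] (D : Dv L) :
    Nat.card {E : Dv L // 0 ≤ E ∧ cl p D = cl p E} * (p ^ ell p (0 : Dv L) - 1) = p ^ ell p D - 1 := by
  rw [← card_RR, ← card_RR, ← Nat.card_prod]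
  have hs : ∀ E : {E : Dv L // 0 ≤ E ∧ cl p D = cl p E}, ∃ f : L, f ≠ 0 ∧ D + dv p f = E.1 :=
    fun E => (cl_eq p).1 E.2.2
  choose s hs0 hs using hs
  apply Nat.card_eq_of_bijective (f := fun x : {E : Dv L // 0 ≤ E ∧ cl p D = cl p E} × {x : RR p (0 : Dv L) // x ≠ 0} =>
    (⟨⟨x.2.1.1 * s x.1, by
      have h0 : x.2.1.1 ≠ 0 := by simpa using x.2.2
      rw [mem_RR' p (mul_ne_zero h0 (hs0 _)), dv_mul p h0 (hs0 _), (const_iff p h0).1 x.2.1.2, zero_add, hs]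
      exact x.1.2.1⟩, by
      have h0 : x.2.1.1 ≠ 0 := by simpa using x.2.2
      have := mul_ne_zero h0 (hs0 x.1)
      intro h
      exact this (congrArg Subtype.val h)⟩ : {x : RR p D // x ≠ 0}))
  constructor
  · rintro ⟨E, x⟩ ⟨E', x'⟩ h
    have h1 : x.1.1 * s E = x'.1.1 * s E' := congrArg (fun y => y.1.1) h
    have hx : x.1.1 ≠ 0 := by simpa using x.2
    have hx' : x'.1.1 ≠ 0 := by simpa using x'.2
    have hE : E = E' := by
      apply Subtype.ext
      rw [← hs E, ← hs E']
      have h2 := congrArg (dv p) h1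
      rw [dv_mul p hx (hs0 _), dv_mul p hx' (hs0 _), (const_iff p hx).1 x.1.2, (const_iff p hx').1 x'.1.2,
        zero_add, zero_add] at h2
      rw [h2]
    subst hE
    have h3 := mul_right_cancel₀ (hs0 E) h1
    rw [Subtype.ext (Subtype.ext h3)]
  · rintro ⟨y, hy⟩
    have hy0 : y.1 ≠ 0 := by simpa using hy
    have hyR := (mem_RR' p hy0).1 y.2
    let E : {E : Dv L // 0 ≤ E ∧ cl p D = cl p E} := ⟨D + dv p y.1, hyR, (cl_eq p).2 ⟨_, hy0, rfl⟩⟩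
    have hc : dv p (y.1 / s E) = 0 := by
      rw [dv_div p hy0 (hs0 _)]
      have : D + dv p (s E) = D + dv p y.1 := hs E
      rw [add_left_cancel this, sub_self]
    have hc0 : y.1 / s E ≠ 0 := div_ne_zero hy0 (hs0 _)
    refine ⟨(E, ⟨⟨y.1 / s E, (const_iff p hc0).2 hc⟩, ?_⟩), ?_⟩
    · intro h; exact hc0 (congrArg Subtype.val h)
    · apply Subtype.ext; apply Subtype.ext
      exact div_mul_cancel₀ _ (hs0 _)

theorem ell_zero_pos (p : ℕ) [Fact p.Prime] {L : Type} [Field L] [Algebra (ZMod p) L] [GFF p L] : 0 < ell p (0 : Dv L) := by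
  apply Module.finrank_pos_iff.2
  refine ⟨⟨⟨1, mem_RR_of_isAlgebraic p isAlgebraic_one⟩, 0, ?_⟩⟩
  intro h
  exact one_ne_zero (congrArg Subtype.val h)

open Classical in
/-- number of effective divisors in class -/
theorem card_filter (p : ℕ) [Fact p.Prime] {L : Type} [Field L] [Algebra (ZMod p) L] [GFF p L] {n : ℤ} (D : Dv L) (hD : degD p D = n) :
    ((Eff p n).filter (fun E => cl p E = cl p D)).card * (p ^ ell p (0 : Dv L) - 1) = p ^ ell p D - 1 := by
  rw [← card_eff_cl p D]
  congr 1
  rw [← Nat.card_eq_finsetCard]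
  apply Nat.card_congr
  refine Equiv.subtypeEquivRight fun E => ?_
  rw [Finset.mem_filter, mem_Eff]
  constructor
  · rintro ⟨⟨h1, h2⟩, h3⟩; exact ⟨h1, h3.symm⟩
  · rintro ⟨h1, h2⟩
    refine ⟨⟨h1, ?_⟩, h2.symm⟩
    rw [← dgC_cl, ← h2, dgC_cl, hD]

theorem card_Eff_le (p : ℕ) [Fact p.Prime] {L : Type} [Field L] [Algebra (ZMod p) L] [GFF p L] (n : ℕ) : (Eff p (L := L) n).card ≤ (ClN p (L := L) 0).card * p ^ ell p (0 : Dv L) * p ^ n := by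
  classical
  have hp := (Fact.out : p.Prime)
  rw [Finset.card_eq_sum_card_fiberwise (f := cl p (L := L)) (t := ClN p (L := L) n)]
  · refine (Finset.sum_le_card_nsmul _ _ (p ^ ell p (0 : Dv L) * p ^ n) ?_).trans ?_
    · intro c hc
      rcases ((Eff p (n : ℤ)).filter (fun E => cl p E = c)).eq_empty_or_nonempty with h | ⟨D, hD⟩
      · rw [h]; simp
      · obtain ⟨hD1, rfl⟩ := Finset.mem_filter.1 hD
        rw [mem_Eff] at hD1
        have h1 := card_filter p D hD1.2
        have h2 := ell_le p hD1.1
        rw [sub_zero, hD1.2] at h2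
        have h3 : ell p D ≤ ell p (0 : Dv L) + n := by exact_mod_cast h2
        have h4 : 1 ≤ p ^ ell p (0 : Dv L) - 1 := by
          have := Nat.one_lt_pow (ell_zero_pos p (L := L)).ne' hp.one_lt
          omega
        calc _ ≤ _ * (p ^ ell p (0 : Dv L) - 1) := Nat.le_mul_of_pos_right _ h4
          _ ≤ p ^ ell p D := by rw [h1]; exact Nat.sub_le _ _
          _ ≤ p ^ (ell p (0 : Dv L) + n) := Nat.pow_le_pow_right hp.pos h3
          _ = _ := pow_add _ _ _
    · rw [smul_eq_mul, mul_assoc]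
      exact Nat.mul_le_mul_right _ (card_ClN_le p _)
  · intro D hD
    rw [Finset.mem_coe, mem_Eff] at hD
    rw [Finset.mem_coe, mem_ClN, dgC_cl, hD.2]

end

noncomputable section

/-- unitary characters of divisors -/
structure Ch (L : Type) [Field L] where
  f : Dv L → ℂ
  map_add : ∀ D E, f (D + E) = f D * f E
  norm_one : ∀ D, ‖f D‖ = 1

namespace Ch
theorem ne_zero {L : Type} [Field L] (ψ : Ch L) (D : Dv L) : ψ.f D ≠ 0 := by
  intro h
  have := ψ.norm_one D
  rw [h] at this; simp at this

theorem zero {L : Type} [Field L] (ψ : Ch L) : ψ.f 0 = 1 := by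
  have h := ψ.map_add 0 0
  rw [add_zero] at h
  exact (mul_eq_left₀ (ψ.ne_zero 0)).1 h.symm

theorem neg {L : Type} [Field L] (ψ : Ch L) (D : Dv L) : ψ.f (-D) = (ψ.f D)⁻¹ := by
  have h := ψ.map_add D (-D)
  rw [add_neg_cancel, ψ.zero] at h
  exact eq_inv_of_mul_eq_one_right h.symm

/-- trivial character -/
def triv (L : Type) [Field L] : Ch L := ⟨fun _ => 1, by simp, by simp⟩
end Ch

open Classical in
/-- real zeta term -/
def ztm (p : ℕ) [Fact p.Prime] {L : Type} [Field L] [Algebra (ZMod p) L] [GFF p L] (T : ℝ) (D : Dv L) : ℝ := if 0 ≤ D then T ^ (degD p D).toNat else 0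

theorem ztm_nonneg (p : ℕ) [Fact p.Prime] {L : Type} [Field L] [Algebra (ZMod p) L] [GFF p L] {T : ℝ} (hT : 0 ≤ T) (D : Dv L) : 0 ≤ ztm p T D := by
  unfold ztm; split_ifs <;> positivity

theorem zsum_le (p : ℕ) [Fact p.Prime] {L : Type} [Field L] [Algebra (ZMod p) L] [GFF p L] : ∃ C : ℝ, 0 ≤ C ∧ ∀ T : ℝ, 0 < T → T * p < 1 → ∀ u : Finset (Dv L), ∑ D ∈ u, ztm p T D ≤ C * (1 - T * p)⁻¹ := by
  classical
  refine ⟨((ClN p (L := L) 0).card * p ^ ell p (0 : Dv L) : ℕ), by positivity, ?_⟩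
  intro T hT hTp u
  set C : ℝ := (((ClN p (L := L) 0).card * p ^ ell p (0 : Dv L) : ℕ) : ℝ) with hC
  have hC0 : 0 ≤ C := by positivity
  let N := (u.sup (fun D => (degD p D).toNat)) + 1
  let W := (Finset.range N).biUnion (fun n : ℕ => Eff p (L := L) n)
  have h1 : ∑ D ∈ u, ztm p T D ≤ ∑ D ∈ W, ztm p T D := by
    rw [← Finset.sum_filter_add_sum_filter_not u (fun D => 0 ≤ D)]
    have h2 : ∑ D ∈ u.filter (fun D => ¬ 0 ≤ D), ztm p T D = 0 := by
      apply Finset.sum_eq_zero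
      intro D hD
      rw [ztm, if_neg (Finset.mem_filter.1 hD).2]
    rw [h2, add_zero]
    apply Finset.sum_le_sum_of_subset_of_nonneg
    · intro D hD
      obtain ⟨hD1, hD2⟩ := Finset.mem_filter.1 hD
      rw [Finset.mem_biUnion]
      refine ⟨(degD p D).toNat, ?_, ?_⟩
      · rw [Finset.mem_range]
        exact Nat.lt_succ_of_le (Finset.le_sup (f := fun D => (degD p D).toNat) hD1)
      · rw [mem_Eff]
        exact ⟨hD2, (Int.toNat_of_nonneg (degD_nonneg p hD2)).symm⟩
    · intro D _ _; exact ztm_nonneg p hT.le D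
  refine h1.trans ?_
  have h3 : ∑ D ∈ W, ztm p T D = ∑ n ∈ Finset.range N, ∑ D ∈ Eff p (L := L) (n : ℤ), ztm p T D := by
    apply Finset.sum_biUnion
    intro m _ n _ hmn
    rw [Function.onFun, Finset.disjoint_left]
    intro D hD hD'
    rw [mem_Eff] at hD hD'
    apply hmn
    have := hD.2.symm.trans hD'.2
    exact_mod_cast this
  rw [h3]
  have h4 : ∀ n ∈ Finset.range N, ∑ D ∈ Eff p (L := L) (n : ℤ), ztm p T D ≤ C * (T * p) ^ n := by
    intro n _
    have h5 : ∀ D ∈ Eff p (L := L) (n : ℤ), ztm p T D = T ^ n := by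
      intro D hD
      rw [mem_Eff] at hD
      rw [ztm, if_pos hD.1, hD.2, Int.toNat_natCast]
    rw [Finset.sum_congr rfl h5, Finset.sum_const, nsmul_eq_mul, mul_pow]
    have h6 : ((Eff p (L := L) (n : ℤ)).card : ℝ) ≤ C * p ^ n := by
      have := card_Eff_le p (L := L) n
      rw [hC]
      exact_mod_cast this
    have h7 : (0 : ℝ) ≤ T ^ n := by positivity
    calc _ ≤ (C * p ^ n) * T ^ n := mul_le_mul_of_nonneg_right h6 h7
      _ = _ := by ring
  refine (Finset.sum_le_sum h4).trans ?_
  rw [← Finset.mul_sum]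
  apply mul_le_mul_of_nonneg_left _ hC0
  rw [← tsum_geometric_of_lt_one (by positivity) hTp]
  exact (summable_geometric_of_lt_one (by positivity) hTp).sum_le_tsum _ (fun _ _ => by positivity)

theorem z_summable (p : ℕ) [Fact p.Prime] {L : Type} [Field L] [Algebra (ZMod p) L] [GFF p L] {T : ℝ} (hT : 0 < T) (hTp : T * p < 1) : Summable (ztm p (L := L) T) := by
  obtain ⟨C, _, h⟩ := zsum_le p (L := L)
  exact summable_of_sum_le (fun D => ztm_nonneg p hT.le D) (h T hT hTp)

theorem z_le (p : ℕ) [Fact p.Prime] {L : Type} [Field L] [Algebra (ZMod p) L] [GFF p L] : ∃ C : ℝ, 0 ≤ C ∧ ∀ T : ℝ, 0 < T → T * p < 1 → ∑' D : Dv L, ztm p T D ≤ C * (1 - T * p)⁻¹ := by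
  obtain ⟨C, hC, h⟩ := zsum_le p (L := L)
  exact ⟨C, hC, fun T hT hTp => (z_summable p hT hTp).tsum_le_of_sum_le (h T hT hTp)⟩

theorem z_ge (p : ℕ) [Fact p.Prime] {L : Type} [Field L] [Algebra (ZMod p) L] [GFF p L] : ∃ c : ℝ, 0 < c ∧ ∀ T : ℝ, 0 < T → 1 ≤ 2 * (T * p) → T * p < 1 →
    c * (1 - T * p)⁻¹ ≤ ∑' D : Dv L, ztm p T D := by
  classical
  have hp := (Fact.out : p.Prime)
  obtain ⟨γ, n0, -, hR⟩ := riemann p (L := L)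
  obtain ⟨w⟩ := exists_place p (L := L)
  have hδ : 0 < w.deg p := w.deg_pos p
  set δ := w.deg p with hδd
  set l := ell p (0 : Dv L) with hl
  have hl0 : 0 < l := ell_zero_pos p
  set m0 : ℕ := n0.toNat + (γ + l).toNat with hm0
  set c1 : ℝ := (p : ℝ) ^ (-γ - l) with hc1
  have hp0 : (0 : ℝ) < p := by exact_mod_cast hp.pos
  have hc1p : 0 < c1 := by positivity
  -- count
  have hcount : ∀ m : ℕ, m0 ≤ m → c1 * (p : ℝ) ^ (m * δ) ≤ (Eff p (L := L) ((m * δ : ℕ) : ℤ)).card := by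
    intro m hm
    let D : Dv L := Finsupp.single w (m : ℤ)
    have hD : degD p D = ((m * δ : ℕ) : ℤ) := by rw [degD_single]; push_cast; rfl
    have hmd : m ≤ m * δ := Nat.le_mul_of_pos_right _ hδ
    have h1 := hR D (by rw [hD]; omega)
    have h2 := card_filter p D hD
    have h3 := Finset.card_filter_le (Eff p (L := L) ((m * δ : ℕ) : ℤ)) (fun E => cl p E = cl p D)
    set X := ((Eff p (L := L) ((m * δ : ℕ) : ℤ)).filter (fun E => cl p E = cl p D)).card
    set e := ell p D with he
    rw [hD] at h1
    have hle : l ≤ e := by omega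
    obtain ⟨r, hr⟩ := Nat.exists_eq_add_of_le hle
    have h4 : p ^ r ≤ X := by
      have h5 : p ^ r * (p ^ l - 1) ≤ X * (p ^ l - 1) := by
        rw [h2, hr, pow_add, Nat.mul_sub, mul_one, mul_comm]
        apply Nat.sub_le_sub_left
        exact Nat.one_le_pow _ _ hp.pos
      have h6 : 0 < p ^ l - 1 := by
        have := Nat.one_lt_pow hl0.ne' hp.one_lt
        omega
      exact Nat.le_of_mul_le_mul_right h5 h6
    have h7 : c1 * (p : ℝ) ^ (m * δ) = ((p ^ r : ℕ) : ℝ) := by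
      rw [hc1, ← zpow_natCast, ← zpow_add₀ hp0.ne', Nat.cast_pow, ← zpow_natCast]
      congr 1
      omega
    rw [h7]
    exact_mod_cast h4.trans h3
  refine ⟨c1 * (1 / 2) ^ (δ * m0) / δ, by positivity, ?_⟩
  intro T hT hT2 hTp
  set x := (T * p) ^ δ with hx
  have hx0 : 0 ≤ x := by positivity
  have hx1 : x < 1 := pow_lt_one₀ (by positivity) hTp hδ.ne'
  have hpart : ∀ K : ℕ, ∑ m ∈ Finset.range K, c1 * x ^ m0 * x ^ m ≤ ∑' D : Dv L, ztm p T D := by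
    intro K
    have h1 : ∑ m ∈ Finset.range K, c1 * x ^ m0 * x ^ m ≤
        ∑ m ∈ Finset.range K, ∑ D ∈ Eff p (L := L) (((m0 + m) * δ : ℕ) : ℤ), ztm p T D := by
      refine Finset.sum_le_sum fun m _ => ?_
      have h5 : ∀ D ∈ Eff p (L := L) (((m0 + m) * δ : ℕ) : ℤ), ztm p T D = T ^ ((m0 + m) * δ) := by
        intro D hD
        rw [mem_Eff] at hD
        rw [ztm, if_pos hD.1, hD.2, Int.toNat_natCast]
      rw [Finset.sum_congr rfl h5, Finset.sum_const, nsmul_eq_mul]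
      have := hcount (m0 + m) (by omega)
      calc c1 * x ^ m0 * x ^ m = (c1 * (p : ℝ) ^ ((m0 + m) * δ)) * T ^ ((m0 + m) * δ) := by
            rw [hx]; ring
        _ ≤ _ := mul_le_mul_of_nonneg_right this (by positivity)
    refine h1.trans ?_
    rw [← Finset.sum_biUnion]
    · exact (z_summable p hT hTp).sum_le_tsum _ (fun D _ => ztm_nonneg p hT.le D)
    · intro m _ n _ hmn
      rw [Function.onFun, Finset.disjoint_left]
      intro D hD hD'
      rw [mem_Eff] at hD hD'
      apply hmn
      have h := hD.2.symm.trans hD'.2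
      have h : (m0 + m) * δ = (m0 + n) * δ := by exact_mod_cast h
      have := Nat.eq_of_mul_eq_mul_right hδ h
      omega
  have hs : HasSum (fun m : ℕ => c1 * x ^ m0 * x ^ m) (c1 * x ^ m0 * (1 - x)⁻¹) :=
    (hasSum_geometric_of_lt_one hx0 hx1).mul_left _
  have h8 : c1 * x ^ m0 * (1 - x)⁻¹ ≤ ∑' D : Dv L, ztm p T D :=
    le_of_tendsto' hs.tendsto_sum_nat hpart
  refine le_trans ?_ h8
  have h9 : 1 - x ≤ δ * (1 - T * p) := by
    have := one_add_mul_le_pow (a := T * p - 1) (by linarith) δ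
    rw [show 1 + (T * p - 1) = T * p by ring] at this
    rw [hx]; linarith
  have h10 : (δ * (1 - T * p))⁻¹ ≤ (1 - x)⁻¹ := inv_anti₀ (by linarith) h9
  have h11 : (1 / 2 : ℝ) ^ (δ * m0) ≤ x ^ m0 := by
    rw [hx, ← pow_mul]
    exact pow_le_pow_left₀ (by norm_num) (by linarith) _
  calc c1 * (1 / 2) ^ (δ * m0) / δ * (1 - T * p)⁻¹ = c1 * (1 / 2) ^ (δ * m0) * (δ * (1 - T * p))⁻¹ := by
        rw [mul_inv]; ring
    _ ≤ c1 * x ^ m0 * (1 - x)⁻¹ := by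
        have : 0 < 1 - T * p := by linarith
        gcongr

end

noncomputable section

/-- twisted term -/
def ltm (p : ℕ) [Fact p.Prime] {L : Type} [Field L] [Algebra (ZMod p) L] [GFF p L] (ψ : Ch L) (T : ℝ) (D : Dv L) : ℂ := ψ.f D * (ztm p T D : ℝ)

theorem norm_ltm (p : ℕ) [Fact p.Prime] {L : Type} [Field L] [Algebra (ZMod p) L] [GFF p L] (ψ : Ch L) {T : ℝ} (hT : 0 ≤ T) (D : Dv L) : ‖ltm p ψ T D‖ = ztm p T D := by
  rw [ltm, norm_mul, ψ.norm_one, one_mul, Complex.norm_real, Real.norm_of_nonneg (ztm_nonneg p hT D)]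

theorem l_summable (p : ℕ) [Fact p.Prime] {L : Type} [Field L] [Algebra (ZMod p) L] [GFF p L] (ψ : Ch L) {T : ℝ} (hT : 0 < T) (hTp : T * p < 1) : Summable (ltm p ψ T) := by
  apply Summable.of_norm
  simp only [norm_ltm p ψ hT.le]
  exact z_summable p hT hTp

/-- coefficients -/
def coefa (p : ℕ) [Fact p.Prime] {L : Type} [Field L] [Algebra (ZMod p) L] [GFF p L] (ψ : Ch L) (n : ℕ) : ℂ := ∑ D ∈ Eff p (L := L) (n : ℤ), ψ.f D

theorem l_hasSum (p : ℕ) [Fact p.Prime] {L : Type} [Field L] [Algebra (ZMod p) L] [GFF p L] (ψ : Ch L) {T : ℝ} (hT : 0 < T) (hTp : T * p < 1) :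
    HasSum (fun n : ℕ => coefa p ψ n * (T : ℂ) ^ n) (∑' D, ltm p ψ T D) := by
  classical
  have h := HasSum.tsum_fiberwise (l_summable p ψ hT hTp).hasSum (fun D => (degD p D).toNat)
  have hfun : (fun n : ℕ => coefa p ψ n * (T : ℂ) ^ n) =
      fun n : ℕ => ∑' b : ((fun D : Dv L => (degD p D).toNat) ⁻¹' {n}), ltm p ψ T b.1 := by
   funext n
   rw [_root_.tsum_subtype, tsum_eq_sum (s := Eff p (L := L) (n : ℤ)), coefa, Finset.sum_mul]
   · refine Finset.sum_congr rfl fun D hD => ?_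
     rw [mem_Eff] at hD
     rw [Set.indicator_of_mem, ltm, ztm, if_pos hD.1, hD.2]
     · simp
     · show (degD p D).toNat = n
       rw [hD.2]; simp
   · intro D hD
     by_cases hD0 : 0 ≤ D
     · rw [Set.indicator_of_notMem]
       intro hn
       have hn : (degD p D).toNat = n := hn
       apply hD
       rw [mem_Eff]
       refine ⟨hD0, ?_⟩
       rw [← hn, Int.toNat_of_nonneg (degD_nonneg p hD0)]
     · rw [Set.indicator_apply]
       split_ifs
       · rw [ltm, ztm, if_neg hD0]; simp
       · rfl
  rw [hfun]; exact h

/-- value on classes -/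
def chC (p : ℕ) [Fact p.Prime] {L : Type} [Field L] [Algebra (ZMod p) L] [GFF p L] (ψ : Ch L) (c : Cl p L) : ℂ := ψ.f (cl_surj p c).choose

theorem chC_cl (p : ℕ) [Fact p.Prime] {L : Type} [Field L] [Algebra (ZMod p) L] [GFF p L] (ψ : Ch L) (hψ : ∀ f : L, f ≠ 0 → ψ.f (dv p f) = 1) (D : Dv L) : chC p ψ (cl p D) = ψ.f D := by
  obtain ⟨f, hf, h⟩ := (cl_eq p).1 (cl_surj p (cl p D)).choose_spec
  have h2 := ψ.map_add (cl_surj p (cl p D)).choose (dv p f)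
  rw [h, hψ f hf, mul_one] at h2
  exact h2.symm

/-- sums over classes -/
def sumC (p : ℕ) [Fact p.Prime] {L : Type} [Field L] [Algebra (ZMod p) L] [GFF p L] (ψ : Ch L) (n : ℕ) : ℂ := ∑ c ∈ ClN p (L := L) (n : ℤ), chC p ψ c

theorem norm_sumC (p : ℕ) [Fact p.Prime] {L : Type} [Field L] [Algebra (ZMod p) L] [GFF p L] (ψ : Ch L) (n : ℕ) : ‖sumC p ψ n‖ ≤ (ClN p (L := L) 0).card := by
  refine (norm_sum_le _ _).trans ?_
  rw [Finset.sum_congr rfl (fun c _ => show ‖chC p ψ c‖ = 1 from ψ.norm_one _)]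
  simp only [Finset.sum_const, nsmul_eq_mul, mul_one]
  exact_mod_cast card_ClN_le p _

theorem sumC_shift (p : ℕ) [Fact p.Prime] {L : Type} [Field L] [Algebra (ZMod p) L] [GFF p L] (ψ : Ch L) (hψ : ∀ f : L, f ≠ 0 → ψ.f (dv p f) = 1) (E : Dv L) (e : ℕ) (hE : degD p E = e) (n : ℕ) :
    sumC p ψ (n + e) = ψ.f E * sumC p ψ n := by
  rw [sumC, sumC, Finset.mul_sum]
  symm
  refine Finset.sum_bij (fun c _ => c + cl p E) ?_ ?_ ?_ ?_
  · intro c hc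
    rw [mem_ClN] at *
    rw [map_add, hc, dgC_cl, hE]; push_cast; rfl
  · intro c _ c' _ h; exact add_right_cancel h
  · intro c hc
    refine ⟨c - cl p E, ?_, by simp⟩
    rw [mem_ClN] at *
    rw [map_sub, hc, dgC_cl, hE]; push_cast; ring
  · intro c _
    obtain ⟨D, rfl⟩ := cl_surj p c
    rw [← map_add, chC_cl p ψ hψ, chC_cl p ψ hψ, ψ.map_add, mul_comm]

theorem coefa_eq (p : ℕ) [Fact p.Prime] {L : Type} [Field L] [Algebra (ZMod p) L] [GFF p L] (ψ : Ch L) (hψ : ∀ f : L, f ≠ 0 → ψ.f (dv p f) = 1) {γ n0 : ℤ}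
    (hR : ∀ D : Dv L, n0 ≤ degD p D → (ell p D : ℤ) = degD p D - γ) (n : ℕ) (hn : n0 ≤ n) :
    ((p : ℂ) ^ ell p (0 : Dv L) - 1) * coefa p ψ n = ((p : ℂ) ^ ((n : ℤ) - γ) - 1) * sumC p ψ n := by
  classical
  have hp := (Fact.out : p.Prime)
  rw [coefa, ← Finset.sum_fiberwise_of_maps_to (g := cl p (L := L)) (t := ClN p (L := L) (n : ℤ)), sumC,
    Finset.mul_sum, Finset.mul_sum]
  · refine Finset.sum_congr rfl fun c hc => ?_
    obtain ⟨D, rfl⟩ := cl_surj p c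
    rw [mem_ClN, dgC_cl] at hc
    have h1 := card_filter p D hc
    have h2 := hR D (by rw [hc]; exact hn)
    have h3 : ∀ E ∈ (Eff p (L := L) (n : ℤ)).filter (fun E => cl p E = cl p D), ψ.f E = chC p ψ (cl p D) := by
      intro E hE
      rw [← (Finset.mem_filter.1 hE).2, chC_cl p ψ hψ]
    rw [Finset.sum_congr rfl h3, Finset.sum_const, nsmul_eq_mul, ← mul_assoc]
    congr 1
    rw [hc] at h2
    rw [← h2, zpow_natCast, mul_comm]
    have h4 : 1 ≤ p ^ ell p (0 : Dv L) := Nat.one_le_pow _ _ hp.pos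
    have h5 : 1 ≤ p ^ ell p D := Nat.one_le_pow _ _ hp.pos
    have h6 := congrArg (Nat.cast : ℕ → ℂ) h1
    push_cast [Nat.cast_sub h4, Nat.cast_sub h5] at h6
    exact h6
  · intro D hD
    rw [mem_Eff] at hD
    rw [mem_ClN, dgC_cl, hD.2]

theorem exists_sep_circle {η : ℂ} (h1 : ‖η‖ = 1) (h : η ≠ 1) : ∃ ε : ℝ, 0 < ε ∧ ∀ x : ℝ, 0 ≤ x → x ≤ 1 → ε ≤ ‖1 - η * x‖ := by
  obtain ⟨x0, hx0, hmin⟩ := (isCompact_Icc (a := (0 : ℝ)) (b := 1)).exists_isMinOn (Set.nonempty_Icc.2 zero_le_one)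
    (f := fun x : ℝ => ‖1 - η * (x : ℂ)‖) (by fun_prop)
  refine ⟨‖1 - η * (x0 : ℂ)‖, ?_, fun x hx hx1 => hmin ⟨hx, hx1⟩⟩
  rw [norm_pos_iff]
  intro h0
  have h2 : η * (x0 : ℂ) = 1 := (sub_eq_zero.1 h0).symm
  have h3 := congrArg norm h2
  rw [norm_mul, h1, one_mul, Complex.norm_real, Real.norm_of_nonneg hx0.1, norm_one] at h3
  rw [h3] at h2
  exact h (by simpa using h2)

theorem l_bounded (p : ℕ) [Fact p.Prime] {L : Type} [Field L] [Algebra (ZMod p) L] [GFF p L] (ψ : Ch L) (hψ : ∀ f : L, f ≠ 0 → ψ.f (dv p f) = 1) (hnt : ∃ E, ψ.f E ≠ 1) :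
    ∃ C : ℝ, 0 ≤ C ∧ ∀ T : ℝ, 0 < T → T * p < 1 → ‖∑' D, ltm p ψ T D‖ ≤ C := by
  classical
  have hp := (Fact.out : p.Prime)
  have hp2 : (2 : ℝ) ≤ p := by exact_mod_cast hp.two_le
  have hpC : (p : ℂ) ≠ 0 := by exact_mod_cast hp.ne_zero
  obtain ⟨E, hE, e, he⟩ : ∃ E, ψ.f E ≠ 1 ∧ ∃ e : ℕ, degD p E = e := by
    obtain ⟨E, hE⟩ := hnt
    rcases le_total 0 (degD p E) with h | h
    · exact ⟨E, hE, _, (Int.toNat_of_nonneg h).symm⟩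
    · refine ⟨-E, ?_, (-degD p E).toNat, ?_⟩
      · rw [ψ.neg]; simpa using hE
      · rw [map_neg, Int.toNat_of_nonneg (by linarith)]
  obtain ⟨γ, n0, -, hR⟩ := riemann p (L := L)
  set η := ψ.f E with hη
  obtain ⟨ε, hε, hsep⟩ := exists_sep_circle (ψ.norm_one E) hE
  let d : ℕ → ℂ := fun n => coefa p ψ (n + e) - η * p ^ e * coefa p ψ n
  set h := (ClN p (L := L) 0).card
  have hd : ∀ n : ℕ, n0 ≤ n → ‖d n‖ ≤ p ^ e * h := by
    intro n hn
    have h1 := coefa_eq p ψ hψ hR n hn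
    have h2 := coefa_eq p ψ hψ hR (n + e) (by push_cast; linarith)
    rw [sumC_shift p ψ hψ E e he] at h2
    set κ := (p : ℂ) ^ ell p (0 : Dv L) - 1 with hκ
    have h3 : κ * d n = η * (p ^ e - 1) * sumC p ψ n := by
      have : (p : ℂ) ^ (((n + e : ℕ) : ℤ) - γ) = p ^ e * (p : ℂ) ^ ((n : ℤ) - γ) := by
        rw [← zpow_natCast (p : ℂ) e, ← zpow_add₀ hpC]; congr 1; push_cast; ring
      rw [this] at h2
      calc κ * d n = κ * coefa p ψ (n + e) - η * p ^ e * (κ * coefa p ψ n) := by simp only [d]; ring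
        _ = _ := by rw [h1, h2]; ring
    have h4 : 1 ≤ ‖κ‖ := by
      have h5 : κ = ((p ^ ell p (0 : Dv L) - 1 : ℕ) : ℂ) := by
        rw [Nat.cast_sub (Nat.one_le_pow _ _ hp.pos)]; push_cast; rfl
      rw [h5, Complex.norm_natCast]
      have := Nat.one_lt_pow (ell_zero_pos p (L := L)).ne' hp.one_lt
      exact_mod_cast (by omega : 1 ≤ p ^ ell p (0 : Dv L) - 1)
    have h6 : ‖(p : ℂ) ^ e - 1‖ ≤ p ^ e := by
      have h5 : (p : ℂ) ^ e - 1 = ((p ^ e - 1 : ℕ) : ℂ) := by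
        rw [Nat.cast_sub (Nat.one_le_pow _ _ hp.pos)]; push_cast; rfl
      rw [h5, Complex.norm_natCast]
      exact_mod_cast Nat.sub_le _ _
    calc ‖d n‖ ≤ ‖κ‖ * ‖d n‖ := le_mul_of_one_le_left (norm_nonneg _) h4
      _ = ‖η * (p ^ e - 1) * sumC p ψ n‖ := by rw [← norm_mul, h3]
      _ = ‖(p : ℂ) ^ e - 1‖ * ‖sumC p ψ n‖ := by rw [norm_mul, norm_mul, ψ.norm_one, one_mul]
      _ ≤ p ^ e * h := mul_le_mul h6 (norm_sumC p ψ n) (norm_nonneg _) (by positivity)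
  set C1 : ℝ := p ^ e * h + ∑ n ∈ Finset.range n0.toNat, ‖d n‖ with hC1
  have hC10 : 0 ≤ C1 := by positivity
  have hd2 : ∀ n, ‖d n‖ ≤ C1 := by
    intro n
    by_cases hn : n0 ≤ n
    · refine (hd n hn).trans ?_
      rw [hC1]
      have : 0 ≤ ∑ n ∈ Finset.range n0.toNat, ‖d n‖ := by positivity
      linarith
    · have h1 : ‖d n‖ ≤ ∑ n ∈ Finset.range n0.toNat, ‖d n‖ :=
        Finset.single_le_sum (f := fun n => ‖d n‖) (fun _ _ => norm_nonneg _) (Finset.mem_range.2 (by omega))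
      have : (0 : ℝ) ≤ p ^ e * h := by positivity
      linarith
  set C0 : ℝ := ∑ n ∈ Finset.range e, ‖coefa p ψ n‖
  have hC00 : 0 ≤ C0 := by positivity
  refine ⟨(C0 + C1 * 2) / ε, by positivity, ?_⟩
  intro T hT hTp
  have hT1 : T ≤ 1 / 2 := by nlinarith
  set Λ := ∑' D, ltm p ψ T D
  have hs := l_hasSum p ψ hT hTp
  have h1 := hs.summable.sum_add_tsum_nat_add e
  rw [hs.tsum_eq] at h1
  have hs1 : HasSum (fun n : ℕ => η * p ^ e * (T : ℂ) ^ e * (coefa p ψ n * (T : ℂ) ^ n)) (η * p ^ e * (T : ℂ) ^ e * Λ) :=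
    hs.mul_left _
  have hs2 : Summable (fun n : ℕ => coefa p ψ (n + e) * (T : ℂ) ^ (n + e)) :=
    (summable_nat_add_iff (f := fun n : ℕ => coefa p ψ n * (T : ℂ) ^ n) e).2 hs.summable
  have hs3 := hs2.hasSum.sub hs1
  have h2 : (1 - η * ((T * p) ^ e : ℝ)) * Λ = ∑ n ∈ Finset.range e, coefa p ψ n * (T : ℂ) ^ n +
      ∑' n : ℕ, d n * (T : ℂ) ^ (n + e) := by
    have h3 : ∑' n : ℕ, d n * (T : ℂ) ^ (n + e) = (∑' n : ℕ, coefa p ψ (n + e) * (T : ℂ) ^ (n + e)) - η * p ^ e * (T : ℂ) ^ e * Λ := by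
      rw [← hs3.tsum_eq]
      congr 1
      funext n
      simp only [d]
      ring
    rw [h3]
    push_cast
    linear_combination -h1
  have hb1 : ‖∑ n ∈ Finset.range e, coefa p ψ n * (T : ℂ) ^ n‖ ≤ C0 := by
    refine (norm_sum_le _ _).trans (Finset.sum_le_sum fun n _ => ?_)
    rw [norm_mul, norm_pow, Complex.norm_real, Real.norm_of_nonneg hT.le]
    exact mul_le_of_le_one_right (norm_nonneg _) (pow_le_one₀ hT.le (by linarith))
  have hb2 : ‖∑' n : ℕ, d n * (T : ℂ) ^ (n + e)‖ ≤ C1 * 2 := by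
    have hg : HasSum (fun n : ℕ => C1 * (1 / 2 : ℝ) ^ n) (C1 * (1 - 1 / 2)⁻¹) :=
      (hasSum_geometric_of_lt_one (by norm_num) (by norm_num)).mul_left _
    rw [show C1 * 2 = C1 * (1 - 1 / 2)⁻¹ by norm_num]
    refine tsum_of_norm_bounded hg fun n => ?_
    rw [norm_mul, norm_pow, Complex.norm_real, Real.norm_of_nonneg hT.le]
    refine mul_le_mul (hd2 n) ?_ (by positivity) hC10
    calc T ^ (n + e) ≤ T ^ n := pow_le_pow_of_le_one hT.le (by linarith) (by omega)
      _ ≤ (1 / 2) ^ n := pow_le_pow_left₀ hT.le hT1 n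
  have h3 := hsep ((T * p) ^ e) (by positivity) (pow_le_one₀ (by positivity) hTp.le)
  rw [le_div_iff₀ hε]
  calc ‖Λ‖ * ε ≤ ‖Λ‖ * ‖1 - η * ((T * p) ^ e : ℝ)‖ := mul_le_mul_of_nonneg_left h3 (norm_nonneg _)
    _ = ‖(1 - η * ((T * p) ^ e : ℝ)) * Λ‖ := by rw [norm_mul, mul_comm]
    _ ≤ C0 + C1 * 2 := by rw [h2]; exact (norm_add_le _ _).trans (add_le_add hb1 hb2)

end

noncomputable section

open Classical in
/-- partial sums -/
def ltV (p : ℕ) [Fact p.Prime] {L : Type} [Field L] [Algebra (ZMod p) L] [GFF p L] (ψ : Ch L) (T : ℝ) (V : Finset (FFPrime L)) (D : Dv L) : ℂ :=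
  if D.support ⊆ V then ltm p ψ T D else 0

theorem norm_ltV_le (p : ℕ) [Fact p.Prime] {L : Type} [Field L] [Algebra (ZMod p) L] [GFF p L] (ψ : Ch L) {T : ℝ} (hT : 0 ≤ T) (V : Finset (FFPrime L)) (D : Dv L) :
    ‖ltV p ψ T V D‖ ≤ ztm p T D := by
  rw [ltV]
  split_ifs
  · rw [norm_ltm p ψ hT]
  · simpa using ztm_nonneg p hT D

theorem ltV_summable (p : ℕ) [Fact p.Prime] {L : Type} [Field L] [Algebra (ZMod p) L] [GFF p L] (ψ : Ch L) {T : ℝ} (hT : 0 < T) (hTp : T * p < 1) (V : Finset (FFPrime L)) :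
    Summable (ltV p ψ T V) :=
  Summable.of_norm_bounded (z_summable p hT hTp) (norm_ltV_le p ψ hT.le V)

theorem euler_step (p : ℕ) [Fact p.Prime] {L : Type} [Field L] [Algebra (ZMod p) L] [GFF p L] (ψ : Ch L) {T : ℝ} (hT : 0 < T) (hTp : T * p < 1) {V V' : Finset (FFPrime L)} {v : FFPrime L} (hv : v ∉ V)
    (hV' : ∀ w, w ∈ V' ↔ w = v ∨ w ∈ V) :
    (1 - ψ.f (Finsupp.single v 1) * (T : ℂ) ^ v.deg p) * ∑' D, ltV p ψ T V' D = ∑' D, ltV p ψ T V D := by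
  classical
  let g : Dv L → ℂ := fun D => if 1 ≤ D v then ltV p ψ T V' D else 0
  have hg : ∀ D, g (D + Finsupp.single v 1) = ψ.f (Finsupp.single v 1) * (T : ℂ) ^ v.deg p * ltV p ψ T V' D := by
    intro D
    simp only [g, Finsupp.add_apply, Finsupp.single_eq_same, ltV, ltm, ztm]
    by_cases h1 : 0 ≤ D
    · have h2 : 0 ≤ D + Finsupp.single v (1 : ℤ) := add_nonneg h1 (Finsupp.single_nonneg.2 zero_le_one)
      have h3 : 1 ≤ D v + 1 := by have : 0 ≤ D v := h1 v; linarith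
      have h4 : (D + Finsupp.single v (1 : ℤ)).support ⊆ V' ↔ D.support ⊆ V' := by
        simp only [Finset.subset_iff, Finsupp.mem_support_iff, Finsupp.add_apply, Finsupp.single_apply]
        refine forall_congr' fun w => ?_
        by_cases hw : v = w
        · subst hw; simp [(hV' v).2 (Or.inl rfl)]
        · simp [hw]
      rw [if_pos h3, if_pos h1, if_pos h2]
      by_cases h5 : D.support ⊆ V'
      · rw [if_pos h5, if_pos (h4.2 h5), ψ.map_add, map_add, degD_single, one_mul]
        have h6 := degD_nonneg p h1
        rw [show (degD p D + (v.deg p : ℤ)).toNat = (degD p D).toNat + v.deg p by omega]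
        push_cast
        ring
      · rw [if_neg h5, if_neg (fun h => h5 (h4.1 h)), mul_zero]
    · rw [if_neg h1]
      have h7 : ¬ (1 ≤ D v + 1 ∧ 0 ≤ D + Finsupp.single v (1 : ℤ)) := by
        rintro ⟨h2, h3⟩
        apply h1
        rw [Finsupp.le_def] at *
        intro w
        have := h3 w
        by_cases hw : v = w
        · subst hw; simpa using h2
        · simpa [Finsupp.single_apply, hw] using this
      by_cases h8 : 1 ≤ D v + 1
      · rw [if_pos h8, if_neg (fun h => h7 ⟨h8, h⟩)]; simp
      · rw [if_neg h8]; simp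
  have hsum : Summable (ltV p ψ T V') := ltV_summable p ψ hT hTp V'
  have hgs : Summable g := by
    refine Summable.of_norm_bounded (z_summable p hT hTp) fun D => ?_
    simp only [g]
    split_ifs
    · exact norm_ltV_le p ψ hT.le V' D
    · simpa using ztm_nonneg p hT.le D
  have h1 : ∑' D, g D = ψ.f (Finsupp.single v 1) * (T : ℂ) ^ v.deg p * ∑' D, ltV p ψ T V' D := by
    rw [← (Equiv.addRight (Finsupp.single v (1 : ℤ))).tsum_eq g, ← tsum_mul_left]
    exact tsum_congr fun D => hg D
  have h2 : ∑' D, ltV p ψ T V D = ∑' D, ltV p ψ T V' D - ∑' D, g D := by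
    rw [← hsum.tsum_sub hgs]
    refine tsum_congr fun D => ?_
    simp only [g, ltV]
    by_cases h0 : 0 ≤ D
    · have hDv : 0 ≤ D v := h0 v
      have hvV' : v ∈ V' := (hV' v).2 (Or.inl rfl)
      by_cases h3 : 1 ≤ D v
      · rw [if_pos h3, if_neg (c := D.support ⊆ V), sub_self]
        intro h
        exact hv (h (Finsupp.mem_support_iff.2 (by omega)))
      · rw [if_neg h3, sub_zero]
        have : D.support ⊆ V ↔ D.support ⊆ V' := by
          simp only [Finset.subset_iff]
          refine forall_congr' fun w => ?_
          rw [hV']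
          by_cases hw : w = v
          · subst hw
            have : D w = 0 := by omega
            simp [this]
          · simp [hw]
        simp only [this]
    · have : ltm p ψ T D = 0 := by rw [ltm, ztm, if_neg h0]; simp
      simp [this]
  rw [h2, h1]; ring

theorem euler_empty (p : ℕ) [Fact p.Prime] {L : Type} [Field L] [Algebra (ZMod p) L] [GFF p L] (ψ : Ch L) {T : ℝ} : ∑' D, ltV p ψ T ∅ D = 1 := by
  classical
  rw [tsum_eq_single 0]
  · simp [ltV, ltm, ztm, ψ.zero]
  · intro D hD
    rw [ltV, if_neg]
    rw [Finset.subset_empty, Finsupp.support_eq_empty]; exact hD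

theorem T_lt (p : ℕ) [Fact p.Prime] {L : Type} [Field L] [Algebra (ZMod p) L] [GFF p L] {T : ℝ} (hT : 0 < T) (hTp : T * p < 1) (v : FFPrime L) : T ^ v.deg p < 1 := by
  have hp2 : (2 : ℝ) ≤ p := by exact_mod_cast (Fact.out : p.Prime).two_le
  exact pow_lt_one₀ hT.le (by nlinarith) (v.deg_pos p).ne'

theorem euler_fin (p : ℕ) [Fact p.Prime] {L : Type} [Field L] [Algebra (ZMod p) L] [GFF p L] (ψ : Ch L) {T : ℝ} (hT : 0 < T) (hTp : T * p < 1) (V : Finset (FFPrime L)) :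
    (∏ v ∈ V, (1 - ψ.f (Finsupp.single v 1) * (T : ℂ) ^ v.deg p)) * ∑' D, ltV p ψ T V D = 1 := by
  classical
  induction V using Finset.induction_on with
  | empty => rw [euler_empty]; simp
  | insert v V hv ih =>
    rw [Finset.prod_insert hv, mul_comm (1 - _), mul_assoc,
      euler_step p ψ hT hTp hv (V' := insert v V) (by simp), ih]

theorem euler_lim (p : ℕ) [Fact p.Prime] {L : Type} [Field L] [Algebra (ZMod p) L] [GFF p L] (ψ : Ch L) {T : ℝ} (hT : 0 < T) (hTp : T * p < 1) {ι : Type} (l : Filter ι) (W : ι → Finset (FFPrime L))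
    (hW : ∀ v, ∀ᶠ i in l, v ∈ W i) :
    Filter.Tendsto (fun i => ∑' D, ltV p ψ T (W i) D) l (nhds (∑' D, ltm p ψ T D)) := by
  classical
  refine tendsto_tsum_of_dominated_convergence (z_summable p (L := L) hT hTp) (fun D => ?_)
    (Filter.Eventually.of_forall fun i D => norm_ltV_le p ψ hT.le _ D)
  apply tendsto_const_nhds.congr'
  have : ∀ᶠ i in l, ∀ v ∈ D.support, v ∈ W i := (Filter.eventually_all_finset _).2 fun v _ => hW v
  filter_upwards [this] with i hi
  rw [ltV, if_pos (show D.support ⊆ W i from hi)]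

/-- character values product -/
theorem prod_std {q : ℕ} [NeZero q] (X : ℂ) : ∏ k : ZMod q, (1 - ZMod.stdAddChar k * X) = 1 - X ^ q := by
  classical
  have hq := Nat.pos_of_ne_zero (NeZero.ne q)
  have h := (Complex.isPrimitiveRoot_exp q (NeZero.ne q)).pow_sub_pow_eq_prod_sub_mul 1 X hq
  rw [one_pow] at h
  rw [h, ← Finset.prod_image (s := Finset.univ) (g := fun k : ZMod q => (ZMod.stdAddChar k : ℂ)) (f := fun z => 1 - z * X)
    (fun a _ b _ hab => ZMod.injective_stdAddChar hab)]
  congr 1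
  apply Finset.eq_of_subset_of_card_le
  · intro z hz
    obtain ⟨k, -, rfl⟩ := Finset.mem_image.1 hz
    rw [Polynomial.mem_nthRootsFinset hq]
    rw [← AddChar.map_nsmul_eq_pow]
    simp
  · rw [(Complex.isPrimitiveRoot_exp q (NeZero.ne q)).card_nthRootsFinset,
      Finset.card_image_of_injective _ ZMod.injective_stdAddChar, Finset.card_univ, ZMod.card]

theorem prod_std2 {q : ℕ} [Fact q.Prime] (α β : ZMod q) (h : α ≠ 0 ∨ β ≠ 0) (X : ℂ) :
    ∏ ij : ZMod q × ZMod q, (1 - ZMod.stdAddChar (ij.1 * α + ij.2 * β) * X) = (1 - X ^ q) ^ q := by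
  have key : ∀ α β : ZMod q, α ≠ 0 → ∏ i : ZMod q, ∏ j : ZMod q, (1 - ZMod.stdAddChar (j * α + i * β) * X) = (1 - X ^ q) ^ q := by
    intro α β hα
    rw [Finset.prod_congr rfl (g := fun _ => 1 - X ^ q)]
    · rw [Finset.prod_const, Finset.card_univ, ZMod.card]
    · intro i _
      rw [← prod_std]
      exact Fintype.prod_equiv ((Equiv.mulRight₀ α hα).trans (Equiv.addRight (i * β))) _ _ (fun j => rfl)
  rcases h with h | h
  · rw [Fintype.prod_prod_type_right]
    exact key α β h
  · rw [Fintype.prod_prod_type]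
    rw [← key β α h]
    simp only [add_comm]

/-- characters from pairs -/
def chi {q : ℕ} [NeZero q] {L : Type} [Field L] (χ : Dv L →+ ZMod q × ZMod q) (ij : ZMod q × ZMod q) : Ch L where
  f D := ZMod.stdAddChar (ij.1 * (χ D).1 + ij.2 * (χ D).2)
  map_add D E := by
    rw [← AddChar.map_add_eq_mul]
    congr 1
    simp; ring
  norm_one D := by simp

end

noncomputable section
namespace UK

theorem local_ineq {q : ℕ} {L M : Type} [Field L] [Field M] [Algebra L M] (U : UK q L M) (p : ℕ) [Fact p.Prime] [Algebra (ZMod p) L] [Algebra (ZMod p) M] [IsScalarTower (ZMod p) L M] [FiniteDimensional L M] [GFF p L] [GFF p M] [Fact q.Prime] (χ : Dv L →+ ZMod q × ZMod q) (hN : ∀ B, χ (U.nm B) = 0)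
    {T : ℝ} (hT : 0 < T) (hTp : T * p < 1) (v : FFPrime L) :
    ‖∏ ij : ZMod q × ZMod q, (1 - (chi χ ij).f (Finsupp.single v 1) * (T : ℂ) ^ v.deg p)‖ ≤
      (∏ w ∈ fib p (M := M) v, (1 - T ^ w.deg p)) ^ q := by
  set X := T ^ v.deg p with hX
  have hX0 : 0 ≤ X := by positivity
  have hX1 : X < 1 := T_lt p hT hTp v
  have hcast : (T : ℂ) ^ v.deg p = ((X : ℝ) : ℂ) := by rw [hX]; push_cast; rfl
  have htriv : χ (Finsupp.single v 1) = 0 → ∏ ij : ZMod q × ZMod q, (1 - (chi χ ij).f (Finsupp.single v 1) * (T : ℂ) ^ v.deg p)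
      = (((1 - X) ^ (q * q) : ℝ) : ℂ) := by
    intro h
    simp only [chi, h, hcast]
    simp [ZMod.card]
  rcases U.inert_or_split p v with ⟨w, hw, hdeg, -⟩ | ⟨w, hw, hinj, hcard, hdeg⟩
  · rw [hw, Finset.prod_singleton, hdeg, mul_comm q, pow_mul, ← hX]
    have hXq : X ^ q ≤ X := pow_le_of_le_one hX0 hX1.le U.hq.ne_zero
    by_cases h : χ (Finsupp.single v 1) = 0
    · rw [htriv h, Complex.norm_real, Real.norm_of_nonneg (pow_nonneg (by linarith) _)]
      calc (1 - X) ^ (q * q) ≤ (1 - X) ^ q :=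
            pow_le_pow_of_le_one (by linarith) (by linarith) (Nat.le_mul_of_pos_left _ U.hq.pos)
        _ ≤ _ := pow_le_pow_left₀ (by linarith) (by linarith) _
    · have h2 : (χ (Finsupp.single v 1)).1 ≠ 0 ∨ (χ (Finsupp.single v 1)).2 ≠ 0 := by
        by_contra hc
        push Not at hc
        exact h (Prod.ext hc.1 hc.2)
      have h3 := prod_std2 _ _ h2 (X : ℂ)
      simp only [chi, hcast]
      rw [h3]
      have h4 : (1 - (X : ℂ) ^ q) ^ q = (((1 - X ^ q) ^ q : ℝ) : ℂ) := by push_cast; rfl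
      rw [h4, Complex.norm_real, Real.norm_of_nonneg]
      apply pow_nonneg
      have : X ^ q ≤ 1 := pow_le_one₀ hX0 hX1.le
      linarith
  · have h : χ (Finsupp.single v 1) = 0 := by
      rw [← hw, ← U.nm_single p hinj, hN]
    rw [htriv h, Complex.norm_real, Real.norm_of_nonneg (pow_nonneg (by linarith) _)]
    rw [Finset.prod_congr rfl (g := fun _ => 1 - X) (fun w hw => by rw [hdeg w hw]), Finset.prod_const, hcard, ← pow_mul]

theorem zeta_ineq {q : ℕ} {L M : Type} [Field L] [Field M] [Algebra L M] (U : UK q L M) (p : ℕ) [Fact p.Prime] [Algebra (ZMod p) L] [Algebra (ZMod p) M] [IsScalarTower (ZMod p) L M] [FiniteDimensional L M] [GFF p L] [GFF p M] [Fact q.Prime] (χ : Dv L →+ ZMod q × ZMod q) (hN : ∀ B, χ (U.nm B) = 0)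
    {T : ℝ} (hT : 0 < T) (hTp : T * p < 1) :
    (∑' B : Dv M, ztm p T B) ^ q ≤ ∏ ij : ZMod q × ZMod q, ‖∑' D : Dv L, ltm p (chi χ ij) T D‖ := by
  classical
  let W : Finset (FFPrime L) → Finset (FFPrime M) := fun V => V.biUnion (fun v => fib p v)
  have hfin : ∀ V : Finset (FFPrime L), ‖∑' B : Dv M, ltV p (Ch.triv M) T (W V) B‖ ^ q ≤
      ∏ ij : ZMod q × ZMod q, ‖∑' D : Dv L, ltV p (chi χ ij) T V D‖ := by
    intro V
    have h1 := euler_fin p (Ch.triv M) hT hTp (W V)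
    have h2 := fun ij => euler_fin p (chi χ ij) hT hTp V
    have hA : ∏ w ∈ W V, (1 - (Ch.triv M).f (Finsupp.single w 1) * (T : ℂ) ^ w.deg p) =
        ((∏ v ∈ V, ∏ w ∈ fib p (M := M) v, (1 - T ^ w.deg p) : ℝ) : ℂ) := by
      rw [← Finset.prod_biUnion]
      · push_cast
        refine Finset.prod_congr rfl fun w _ => ?_
        simp [Ch.triv]
      · intro v _ v' _ hvv
        rw [Function.onFun, Finset.disjoint_left]
        intro w hw hw'
        rw [mem_fib] at hw hw'
        exact hvv (hw.symm.trans hw')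
    set A : ℝ := ∏ v ∈ V, ∏ w ∈ fib p (M := M) v, (1 - T ^ w.deg p) with hAd
    have hpos : ∀ v : FFPrime L, 0 < ∏ w ∈ fib p (M := M) v, (1 - T ^ w.deg p) := fun v =>
      Finset.prod_pos fun (w : FFPrime M) _ => by
        have := T_lt p hT hTp w
        linarith
    have hA0 : 0 < A := Finset.prod_pos fun v _ => hpos v
    rw [hA] at h1
    have h3 := congrArg norm h1
    rw [norm_mul, norm_one, Complex.norm_real, Real.norm_of_nonneg hA0.le] at h3
    set Z := ‖∑' B : Dv M, ltV p (Ch.triv M) T (W V) B‖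
    set R := ∏ ij : ZMod q × ZMod q, ‖∑' D : Dv L, ltV p (chi χ ij) T V D‖ with hR
    have h4 : ‖∏ v ∈ V, ∏ ij : ZMod q × ZMod q, (1 - (chi χ ij).f (Finsupp.single v 1) * (T : ℂ) ^ v.deg p)‖ * R = 1 := by
      rw [Finset.prod_comm, hR, norm_prod, ← Finset.prod_mul_distrib]
      apply Finset.prod_eq_one
      intro ij _
      rw [← norm_mul, h2, norm_one]
    have h5 : ‖∏ v ∈ V, ∏ ij : ZMod q × ZMod q, (1 - (chi χ ij).f (Finsupp.single v 1) * (T : ℂ) ^ v.deg p)‖ ≤ A ^ q := by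
      rw [norm_prod, hAd, ← Finset.prod_pow]
      exact Finset.prod_le_prod (fun _ _ => norm_nonneg _) fun v _ => U.local_ineq p χ hN hT hTp v
    have hR0 : 0 ≤ R := Finset.prod_nonneg fun _ _ => norm_nonneg _
    have h6 : 1 ≤ A ^ q * R := by rw [← h4]; exact mul_le_mul_of_nonneg_right h5 hR0
    have h7 : A ^ q * Z ^ q = 1 := by rw [← mul_pow, h3, one_pow]
    have h8 : 0 < A ^ q := by positivity
    rw [← h7] at h6
    exact le_of_mul_le_mul_left h6 h8
  have hl1 := euler_lim p (Ch.triv M) hT hTp Filter.atTop W (by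
    intro w
    filter_upwards [Filter.eventually_ge_atTop {w.rst L}] with V hV
    rw [Finset.mem_biUnion]
    exact ⟨w.rst L, hV (Finset.mem_singleton_self _), (mem_fib p).2 rfl⟩)
  have hl2 : ∀ ij, Filter.Tendsto (fun V => ‖∑' D : Dv L, ltV p (chi χ ij) T V D‖) Filter.atTop
      (nhds ‖∑' D : Dv L, ltm p (chi χ ij) T D‖) := fun ij => (euler_lim p (chi χ ij) hT hTp Filter.atTop id (by
    intro v
    filter_upwards [Filter.eventually_ge_atTop {v}] with V hV
    exact hV (Finset.mem_singleton_self _))).norm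
  have h9 := le_of_tendsto_of_tendsto' (hl1.norm.pow q) (tendsto_finset_prod Finset.univ fun ij _ => hl2 ij) hfin
  have h10 : ∑' B : Dv M, ltm p (Ch.triv M) T B = ((∑' B : Dv M, ztm p T B : ℝ) : ℂ) := by
    rw [Complex.ofReal_tsum]
    refine tsum_congr fun B => ?_
    simp [ltm, Ch.triv]
  rw [h10, Complex.norm_real, Real.norm_of_nonneg (tsum_nonneg fun B => ztm_nonneg p hT.le B)] at h9
  exact h9

theorem second_ineq {q : ℕ} {L M : Type} [Field L] [Field M] [Algebra L M] (U : UK q L M) (p : ℕ) [Fact p.Prime] [Algebra (ZMod p) L] [Algebra (ZMod p) M] [IsScalarTower (ZMod p) L M] [FiniteDimensional L M] [GFF p L] [GFF p M] [Fact q.Prime] (χ : Dv L →+ ZMod q × ZMod q) (hs : Function.Surjective χ)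
    (hP : ∀ f : L, f ≠ 0 → χ (dv p f) = 0) (hN : ∀ B, χ (U.nm B) = 0) : False := by
  classical
  have hp := (Fact.out : p.Prime)
  obtain ⟨c, hc, hge⟩ := z_ge p (L := M)
  obtain ⟨C, hC, hle⟩ := z_le p (L := L)
  have hbd : ∀ ij : ZMod q × ZMod q, ij ≠ 0 → ∃ C : ℝ, 0 ≤ C ∧ ∀ T : ℝ, 0 < T → T * p < 1 → ‖∑' D, ltm p (chi χ ij) T D‖ ≤ C := by
    intro ij hij
    apply l_bounded p (chi χ ij)
    · intro f hf
      simp [chi, hP f hf]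
    · have : ∃ z : ZMod q × ZMod q, ij.1 * z.1 + ij.2 * z.2 ≠ 0 := by
        by_contra hc
        push Not at hc
        apply hij
        have h1 := hc (1, 0)
        have h2 := hc (0, 1)
        simp at h1 h2
        exact Prod.ext h1 h2
      obtain ⟨z, hz⟩ := this
      obtain ⟨E, rfl⟩ := hs z
      refine ⟨E, fun h => hz ?_⟩
      apply ZMod.injective_stdAddChar
      rw [AddChar.map_zero_eq_one]
      exact h
  choose! K hK0 hK using hbd
  set P := ∏ ij ∈ Finset.univ.erase (0 : ZMod q × ZMod q), K ij with hPd
  have hP0 : 0 ≤ P := Finset.prod_nonneg fun ij hij => hK0 ij (Finset.ne_of_mem_erase hij)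
  have hmain : ∀ T : ℝ, 0 < T → 1 ≤ 2 * (T * p) → T * p < 1 → c ^ q ≤ C * P * (1 - T * p) ^ (q - 1) := by
    intro T hT hT2 hTp
    have h1 := U.zeta_ineq p χ hN hT hTp
    rw [← Finset.mul_prod_erase _ _ (Finset.mem_univ (0 : ZMod q × ZMod q))] at h1
    have hu : 0 < 1 - T * p := by linarith
    have h2 : ‖∑' D : Dv L, ltm p (chi χ 0) T D‖ ≤ C * (1 - T * p)⁻¹ := by
      refine le_trans ?_ (hle T hT hTp)
      refine (norm_tsum_le_tsum_norm ?_).trans (le_of_eq ?_)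
      · simp only [norm_ltm p _ hT.le]
        exact z_summable p hT hTp
      · simp only [norm_ltm p _ hT.le]
    have h3 : ∏ ij ∈ Finset.univ.erase (0 : ZMod q × ZMod q), ‖∑' D : Dv L, ltm p (chi χ ij) T D‖ ≤ P :=
      Finset.prod_le_prod (fun _ _ => norm_nonneg _) fun ij hij => hK ij (Finset.ne_of_mem_erase hij) T hT hTp
    have h4 : (c * (1 - T * p)⁻¹) ^ q ≤ C * (1 - T * p)⁻¹ * P := by
      refine (pow_le_pow_left₀ (by positivity) (hge T hT hT2 hTp) q).trans (h1.trans ?_)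
      exact mul_le_mul h2 h3 (Finset.prod_nonneg fun _ _ => norm_nonneg _) (by positivity)
    have h5 := mul_le_mul_of_nonneg_right h4 (pow_nonneg hu.le q)
    rw [← mul_pow, mul_assoc c, inv_mul_cancel₀ hu.ne', mul_one] at h5
    obtain ⟨r, hr⟩ := Nat.exists_eq_succ_of_ne_zero U.hq.ne_zero
    refine h5.trans (le_of_eq ?_)
    rw [hr, Nat.succ_sub_one, pow_succ]
    field_simp
  -- limit
  have hp0 : (0 : ℝ) < p := by exact_mod_cast hp.pos
  have hq1 : q - 1 ≠ 0 := by have := U.hq.two_le; omega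
  have hlim : Filter.Tendsto (fun n : ℕ => C * P * (1 / ((n : ℝ) + 1)) ^ (q - 1)) Filter.atTop (nhds (C * P * 0 ^ (q - 1))) :=
    (tendsto_one_div_add_atTop_nhds_zero_nat.pow _).const_mul _
  rw [zero_pow hq1, mul_zero] at hlim
  have h6 : c ^ q ≤ 0 := by
    refine ge_of_tendsto hlim ?_
    filter_upwards [Filter.eventually_ge_atTop 1] with n hn
    have hn1 : (1 : ℝ) ≤ n := by exact_mod_cast hn
    set ε : ℝ := 1 / ((n : ℝ) + 1) with hε
    have he0 : 0 < ε := by positivity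
    have he1 : ε ≤ 1 / 2 := by
      rw [hε]; exact one_div_le_one_div_of_le (by norm_num) (by linarith)
    have hTT : (1 - ε) / p * p = 1 - ε := div_mul_cancel₀ _ hp0.ne'
    have := hmain ((1 - ε) / p) (div_pos (by linarith) hp0) (by rw [hTT]; linarith) (by rw [hTT]; linarith)
    rw [hTT] at this
    simpa using this
  have : 0 < c ^ q := by positivity
  linarith

end UK
end

noncomputable section

theorem add_relIndex_le {G : Type} [AddCommGroup G] {Q : Type} [Finite Q] (J F : AddSubgroup G) (f : F → Q)
    (h : ∀ a b : F, f a = f b → (a : G) - b ∈ J) : J.relIndex F ≤ Nat.card Q := by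
  rw [AddSubgroup.relIndex, AddSubgroup.index]
  refine Nat.card_le_card_of_injective (fun c : F ⧸ J.addSubgroupOf F => f c.out) ?_
  intro c d hcd
  have := h _ _ hcd
  rw [← QuotientAddGroup.out_eq' c, ← QuotientAddGroup.out_eq' d]
  refine (QuotientAddGroup.eq.2 ?_)
  rw [AddSubgroup.mem_addSubgroupOf, ← neg_mem_iff]
  simpa [sub_eq_add_neg, add_comm] using this

theorem mul_relIndex_le {G : Type} [CommGroup G] {Q : Type} [Finite Q] (J F : Subgroup G) (f : F → Q)
    (h : ∀ a b : F, f a = f b → (a : G) / b ∈ J) : J.relIndex F ≤ Nat.card Q := by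
  rw [Subgroup.relIndex, Subgroup.index]
  refine Nat.card_le_card_of_injective (fun c : F ⧸ J.subgroupOf F => f c.out) ?_
  intro c d hcd
  have := h _ _ hcd
  rw [← QuotientGroup.out_eq' c, ← QuotientGroup.out_eq' d]
  refine (QuotientGroup.eq.2 ?_)
  rw [Subgroup.mem_subgroupOf, ← inv_mem_iff]
  simpa [div_eq_mul_inv, mul_comm] using this

theorem card_le_q {V : Type} [AddCommGroup V] (q : ℕ) [hq : Fact q.Prime] (hk : ∀ x : V, q • x = 0)
    (hno : ∀ χ : V →+ ZMod q × ZMod q, Function.Surjective χ → False) :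
    Nat.card V ≤ q := by
  let _ : Module (ZMod q) V := AddCommGroup.zmodModule (n := q) hk
  by_cases h2 : (2 : ℕ) ≤ Module.rank (ZMod q) V
  · exfalso
    obtain ⟨f, hf⟩ := Module.le_rank_iff_exists_linearMap.1 h2
    obtain ⟨g, hg⟩ := f.exists_leftInverse_of_injective (LinearMap.ker_eq_bot.2 hf)
    let e : (Fin 2 → ZMod q) →+ ZMod q × ZMod q :=
      AddMonoidHom.prod (Pi.evalAddMonoidHom _ 0) (Pi.evalAddMonoidHom _ 1)
    refine hno (e.comp g.toAddMonoidHom) ?_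
    intro ⟨x, y⟩
    refine ⟨f ![x, y], ?_⟩
    have h1 : g (f ![x, y]) = ![x, y] := LinearMap.congr_fun hg _
    change e (g (f ![x, y])) = _
    rw [h1]
    simp [e]
  · have h3 : Module.rank (ZMod q) V < 2 := by simpa using h2
    have hfin : Module.rank (ZMod q) V < Cardinal.aleph0 := h3.trans (by exact_mod_cast Cardinal.nat_lt_aleph0 2)
    have : FiniteDimensional (ZMod q) V := Module.rank_lt_aleph0_iff.1 hfin
    have h4 : Module.finrank (ZMod q) V < 2 := by
      rw [← Module.finrank_eq_rank] at h3
      exact_mod_cast h3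
    rw [Module.natCard_eq_pow_finrank (K := ZMod q), Nat.card_zmod]
    calc q ^ _ ≤ q ^ 1 := Nat.pow_le_pow_right hq.out.pos (by omega)
      _ = q := pow_one q

theorem index_le_q {G : Type} [AddCommGroup G] (q : ℕ) [hq : Fact q.Prime] (H : AddSubgroup G) (hk : ∀ x, q • x ∈ H)
    (hno : ∀ χ : G →+ ZMod q × ZMod q, Function.Surjective χ → (∀ x ∈ H, χ x = 0) → False) :
    H.index ≤ q := by
  refine card_le_q q ?_ ?_
  · intro x
    obtain ⟨x, rfl⟩ := QuotientAddGroup.mk'_surjective _ x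
    rw [← map_nsmul]
    exact (QuotientAddGroup.eq_zero_iff _).2 (hk x)
  · intro χ hχ
    refine hno (χ.comp (QuotientAddGroup.mk' H)) (hχ.comp (QuotientAddGroup.mk'_surjective H)) ?_
    intro x hx
    have : QuotientAddGroup.mk' H x = 0 := (QuotientAddGroup.eq_zero_iff x).2 hx
    rw [AddMonoidHom.comp_apply, this, map_zero]

theorem ker_coker {X : Type} [AddCommGroup X] (R : AddSubgroup X) (s : X →+ X) (hR : R.index ≠ 0)
    (hs : R ≤ R.comap s) : R.relIndex (R.comap s) = (R ⊔ s.range).index := by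
  have h1 : (R.comap s).index = R.relIndex (R ⊔ s.range) := by
    rw [AddSubgroup.index_comap, AddSubgroup.relIndex_sup_left]
  have h2 := AddSubgroup.relIndex_mul_index hs
  have h3 := AddSubgroup.relIndex_mul_index (le_sup_left : R ≤ R ⊔ s.range)
  have h4 : (R.comap s).index ≠ 0 := fun h => hR (by rw [← h2, h, mul_zero])
  have h5 : R.relIndex (R.comap s) * (R.comap s).index = (R ⊔ s.range).index * (R.comap s).index := by
    rw [h2, ← h3, h1, mul_comm]
  exact Nat.eq_of_mul_eq_mul_right (Nat.pos_of_ne_zero h4) h5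

theorem index_PD_ne_zero (p : ℕ) [Fact p.Prime] {L : Type} [Field L] [Algebra (ZMod p) L] [GFF p L] (z : Dv L) (hz : 0 < degD p z) : (PD p L ⊔ AddSubgroup.zmultiples z).index ≠ 0 := by
  classical
  set R := PD p L ⊔ AddSubgroup.zmultiples z with hR
  rw [AddSubgroup.index_ne_zero_iff_finite]
  let n := (degD p z).toNat
  have hn : (n : ℤ) = degD p z := Int.toNat_of_nonneg hz.le
  let T : Set (Cl p L) := ⋃ i ∈ Finset.range n, {c | dgC p c = (i : ℤ)}
  have hT : T.Finite := Set.Finite.biUnion (Finset.finite_toSet _) fun i _ => finite_cl p _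
  have hle : PD p L ≤ R := le_sup_left
  let g : Cl p L →+ Dv L ⧸ R := QuotientAddGroup.map _ _ (AddMonoidHom.id _) (by simpa using hle)
  have hsub : (Set.univ : Set (Dv L ⧸ R)) ⊆ Set.image g T := by
    intro x _
    obtain ⟨D, rfl⟩ := QuotientAddGroup.mk'_surjective _ x
    refine ⟨cl p (D - (degD p D / degD p z) • z), ?_, ?_⟩
    · have h0 := Int.emod_nonneg (degD p D) hz.ne'
      have h1 := Int.emod_lt_of_pos (degD p D) hz
      simp only [T, Set.mem_iUnion, Finset.mem_range, Set.mem_setOf_eq]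
      refine ⟨(degD p D % degD p z).toNat, by omega, ?_⟩
      rw [dgC_cl, map_sub, map_zsmul, Int.toNat_of_nonneg h0, smul_eq_mul]
      have := Int.emod_add_mul_ediv (degD p D) (degD p z)
      linarith
    · change ((_ : Dv L) : Dv L ⧸ R) = ((D : Dv L) : Dv L ⧸ R)
      refine QuotientAddGroup.eq.2 ?_
      simp only [AddMonoidHom.id_apply, neg_sub]
      rw [sub_add_cancel]
      exact (le_sup_right : AddSubgroup.zmultiples z ≤ R) ⟨_, rfl⟩
  exact Set.finite_univ_iff.1 ((hT.image g).subset hsub)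

/-- constants -/
def kk (p : ℕ) [Fact p.Prime] (L : Type) [Field L] [Algebra (ZMod p) L] [GFF p L] : Subgroup Lˣ where
  carrier := {u | dv p (u : L) = 0}
  one_mem' := by simp [dv_one]
  mul_mem' := by
    intro a b ha hb
    simp only [Set.mem_setOf_eq] at *
    rw [Units.val_mul, dv_mul p a.ne_zero b.ne_zero, ha, hb, add_zero]
  inv_mem' := by
    intro a ha
    simp only [Set.mem_setOf_eq] at *
    rw [Units.val_inv_eq_inv_val, dv_inv, ha, neg_zero]

theorem mem_kk (p : ℕ) [Fact p.Prime] {L : Type} [Field L] [Algebra (ZMod p) L] [GFF p L] {u : Lˣ} : u ∈ kk p L ↔ dv p (u : L) = 0 := Iff.rfl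

instance kk_finite (p : ℕ) [Fact p.Prime] {L : Type} [Field L] [Algebra (ZMod p) L] [GFF p L] : Finite (kk p L) := by
  have := RR_finite p (0 : Dv L)
  have : Finite (RR p (0 : Dv L)) := Module.finite_of_finite (ZMod p)
  refine Finite.of_injective (fun u : kk p L => (⟨(u : Lˣ), (const_iff p (u : Lˣ).ne_zero).2 u.2⟩ : RR p (0 : Dv L))) ?_
  intro u v huv
  simp only [Subtype.mk.injEq] at huv
  exact Subtype.ext (Units.ext huv)

theorem exists_D0 (p : ℕ) [Fact p.Prime] {L : Type} [Field L] [Algebra (ZMod p) L] [GFF p L] : ∃ D0 : Dv L, 0 < degD p D0 ∧ ∀ D : Dv L, degD p D0 ∣ degD p D := by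
  obtain ⟨g, hg⟩ := Int.subgroup_cyclic (degD p (L := L)).range
  have hg' : (degD p (L := L)).range = AddSubgroup.zmultiples g := by
    rw [hg, AddSubgroup.zmultiples_eq_closure]
  have h0 : g ≠ 0 := by
    rintro rfl
    obtain ⟨E, -, hE⟩ := exists_big p (L := L) 1
    have : degD p E ∈ (degD p (L := L)).range := ⟨E, rfl⟩
    rw [hg'] at this
    simp at this
    omega
  have h1 : |g| ∈ (degD p (L := L)).range := by
    rw [hg', Int.mem_zmultiples_iff]
    exact (dvd_abs _ _).2 dvd_rfl
  obtain ⟨D0, hD0⟩ := h1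
  refine ⟨D0, hD0 ▸ abs_pos.2 h0, fun D => ?_⟩
  rw [hD0, abs_dvd, ← Int.mem_zmultiples_iff, ← hg']
  exact ⟨D, rfl⟩

namespace UK

/-- Hilbert 90 -/
theorem h90 {q : ℕ} {L M : Type} [Field L] [Field M] [Algebra L M] [FiniteDimensional L M] (U : UK q L M) {x : M} (hx : Algebra.norm L x = 1) :
    ∃ y : Mˣ, U.σ y / y = x := by
  have := U.galois
  have hc : IsCyclic (M ≃ₐ[L] M) := ⟨U.σ, U.zpowers_top⟩
  obtain ⟨y, hy⟩ := groupCohomology.exists_div_of_norm_eq_one (K := L) (L := M) U.zpowers_top hx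
  refine ⟨y⁻¹, ?_⟩
  rw [← hy, Units.val_inv_eq_inv_val, map_inv₀]
  have h1 : (y : M) ≠ 0 := y.ne_zero
  have h2 : U.σ (y : M) ≠ 0 := by simp
  field_simp

def Nu {q : ℕ} {L M : Type} [Field L] [Field M] [Algebra L M] (U : UK q L M) : Mˣ →* Lˣ := Units.map (Algebra.norm L)

def su {q : ℕ} {L M : Type} [Field L] [Field M] [Algebra L M] (U : UK q L M) : Mˣ →* Mˣ :=
  Units.map (U.σ : M →* M) / MonoidHom.id _

theorem su_apply {q : ℕ} {L M : Type} [Field L] [Field M] [Algebra L M] (U : UK q L M) (x : Mˣ) : ((U.su x : Mˣ) : M) = U.σ x / x := by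
  simp [su]

theorem Nu_apply {q : ℕ} {L M : Type} [Field L] [Field M] [Algebra L M] (U : UK q L M) (x : Mˣ) : ((U.Nu x : Lˣ) : L) = Algebra.norm L (x : M) := rfl

theorem norm_sig {q : ℕ} {L M : Type} [Field L] [Field M] [Algebra L M] (U : UK q L M) (x : M) : Algebra.norm L (U.σ x) = Algebra.norm L x :=
  Algebra.norm_eq_of_algEquiv U.σ x

theorem kk_card {q : ℕ} {L M : Type} [Field L] [Field M] [Algebra L M] (U : UK q L M) (p : ℕ) [Fact p.Prime] [Algebra (ZMod p) L] [Algebra (ZMod p) M] [IsScalarTower (ZMod p) L M] [FiniteDimensional L M] [GFF p L] [GFF p M] : Nat.card ((U.su.ker ⊓ kk p M : Subgroup Mˣ)) = Nat.card (kk p L) := by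
  have h : (U.su.ker ⊓ kk p M : Subgroup Mˣ) = (kk p L).map (Units.map (algebraMap L M : L →* M)) := by
    ext u
    rw [Subgroup.mem_inf, MonoidHom.mem_ker, Subgroup.mem_map, mem_kk]
    constructor
    · rintro ⟨h1, h2⟩
      have h3 : U.σ (u : M) = u := by
        have := congrArg (fun z : Mˣ => (z : M)) h1
        simp only [su_apply, Units.val_one] at this
        exact (div_eq_one_iff_eq u.ne_zero).1 this
      obtain ⟨y, hy⟩ := U.exists_of_fixed h3
      have hy0 : y ≠ 0 := by rintro rfl; exact u.ne_zero (by rw [← hy, map_zero])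
      refine ⟨Units.mk0 y hy0, ?_, Units.ext (by simpa using hy)⟩
      rw [mem_kk]
      refine pb_inj p (M := M) ?_
      rw [U.pb_dv p, map_zero, Units.val_mk0, hy, h2]
    · rintro ⟨y, hy, rfl⟩
      refine ⟨Units.ext ?_, ?_⟩
      · rw [su_apply]
        simp
      · rw [mem_kk] at hy
        have := U.pb_dv p (y : L)
        rw [hy, map_zero] at this
        exact this.symm
  rw [h]
  refine (Nat.card_congr (Equiv.ofBijective (fun y : kk p L => (⟨Units.map (algebraMap L M : L →* M) y, y, y.2, rfl⟩ : (kk p L).map (Units.map (algebraMap L M : L →* M)))) ?_)).symm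
  · constructor
    · intro a b hab
      exact Subtype.ext (Units.map_injective (algebraMap L M).injective (congrArg Subtype.val hab))
    · rintro ⟨_, y, hy, rfl⟩
      exact ⟨⟨y, hy⟩, rfl⟩

theorem map_N_le {q : ℕ} {L M : Type} [Field L] [Field M] [Algebra L M] (U : UK q L M) (p : ℕ) [Fact p.Prime] [Algebra (ZMod p) L] [Algebra (ZMod p) M] [IsScalarTower (ZMod p) L M] [FiniteDimensional L M] [GFF p L] [GFF p M] : (kk p M).map U.Nu ≤ kk p L := by
  rintro _ ⟨u, hu, rfl⟩
  rw [mem_kk, Nu_apply, ← U.nm_dv p u.ne_zero, (mem_kk p).1 hu, map_zero]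

theorem map_s_le {q : ℕ} {L M : Type} [Field L] [Field M] [Algebra L M] (U : UK q L M) (p : ℕ) [Fact p.Prime] [Algebra (ZMod p) L] [Algebra (ZMod p) M] [IsScalarTower (ZMod p) L M] [FiniteDimensional L M] [GFF p L] [GFF p M] : (kk p M).map U.su ≤ U.Nu.ker ⊓ kk p M := by
  rintro _ ⟨u, hu, rfl⟩
  refine ⟨?_, ?_⟩
  · change U.Nu _ = 1
    refine Units.ext ?_
    have h0 : Algebra.norm L (u : M) ≠ 0 := Algebra.norm_ne_zero_iff.2 u.ne_zero
    rw [Nu_apply, su_apply, Units.val_one]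
    refine mul_right_cancel₀ h0 ?_
    rw [← map_mul, div_mul_cancel₀ _ u.ne_zero, U.norm_sig, one_mul]
  · change dv p _ = 0
    have : U.σ (u : M) ≠ 0 := by simp
    rw [su_apply, dv_div p this u.ne_zero, ← U.dv_sg p, (mem_kk p).1 hu, map_zero, sub_zero]

theorem card_map_aux {G G' : Type} [CommGroup G] [CommGroup G'] (f : G →* G') (k : Subgroup G) :
    Nat.card (f.ker ⊓ k : Subgroup G) * Nat.card (k.map f) = Nat.card k := by
  have h := (f.ker.subgroupOf k).card_mul_index
  have h2 : (f.ker.subgroupOf k).index = Nat.card (k.map f) := Subgroup.relIndex_ker k f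
  rw [← h, h2]
  congr 1
  refine Nat.card_congr (Equiv.ofBijective (fun x : (f.ker ⊓ k : Subgroup G) =>
    (⟨⟨x.1, x.2.2⟩, Subgroup.mem_subgroupOf.2 x.2.1⟩ : f.ker.subgroupOf k)) ⟨?_, ?_⟩)
  · intro a b hab
    simp only [Subtype.mk.injEq] at hab
    exact Subtype.ext hab
  · rintro ⟨⟨x, hx⟩, hx2⟩
    exact ⟨⟨x, Subgroup.mem_subgroupOf.1 hx2, hx⟩, rfl⟩

theorem card_mul_relIndex' {G : Type} [CommGroup G] {H K : Subgroup G} (h : H ≤ K) :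
    Nat.card H * H.relIndex K = Nat.card K := by
  have := Subgroup.relIndex_mul_relIndex _ _ _ (bot_le : ⊥ ≤ H) h
  simpa [Subgroup.relIndex_bot_left] using this

theorem herbrand {q : ℕ} {L M : Type} [Field L] [Field M] [Algebra L M] (U : UK q L M) (p : ℕ) [Fact p.Prime] [Algebra (ZMod p) L] [Algebra (ZMod p) M] [IsScalarTower (ZMod p) L M] [FiniteDimensional L M] [GFF p L] [GFF p M] : ((kk p M).map U.su).relIndex (U.Nu.ker ⊓ kk p M) = ((kk p M).map U.Nu).relIndex (kk p L) := by
  have h1 := card_map_aux U.su (kk p M)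
  have h2 := card_map_aux U.Nu (kk p M)
  rw [U.kk_card p] at h1
  have h3 := card_mul_relIndex' (U.map_s_le p)
  have h4 := card_mul_relIndex' (U.map_N_le p)
  have hk : 0 < Nat.card (kk p M) := Nat.card_pos
  set A := Nat.card (kk p M)
  set n := ((kk p M).map U.su).relIndex (U.Nu.ker ⊓ kk p M)
  set n' := ((kk p M).map U.Nu).relIndex (kk p L)
  set S := Nat.card ((kk p M).map U.su)
  set T := Nat.card ((kk p M).map U.Nu)
  have hS : 0 < S := Nat.pos_of_ne_zero fun h => by simp [h] at h1; omega
  have hT : 0 < T := Nat.pos_of_ne_zero fun h => by simp [h] at h2; omega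
  have : (S * T) * n = (S * T) * n' := by
    rw [← h3] at h2; rw [← h4] at h1
    nlinarith
  exact Nat.eq_of_mul_eq_mul_left (Nat.mul_pos hS hT) this

end UK
end

noncomputable section

/-- principal divisors together with multiples of a divisor -/
def RZ (p : ℕ) [Fact p.Prime] {L : Type} [Field L] [Algebra (ZMod p) L] [GFF p L] (z : Dv L) : AddSubgroup (Dv L) := PD p L ⊔ AddSubgroup.zmultiples z

theorem mem_RZ (p : ℕ) [Fact p.Prime] {L : Type} [Field L] [Algebra (ZMod p) L] [GFF p L] {z D : Dv L} : D ∈ RZ p z ↔ ∃ f : L, f ≠ 0 ∧ ∃ m : ℤ, dv p f + m • z = D := by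
  rw [RZ, AddSubgroup.mem_sup]
  constructor
  · rintro ⟨y, hy, w, hw, rfl⟩
    obtain ⟨f, hf, rfl⟩ := (mem_PD p).1 hy
    obtain ⟨m, rfl⟩ := AddSubgroup.mem_zmultiples_iff.1 hw
    exact ⟨f, hf, m, rfl⟩
  · rintro ⟨f, hf, m, rfl⟩
    exact ⟨_, (mem_PD p).2 ⟨f, hf, rfl⟩, _, AddSubgroup.mem_zmultiples_iff.2 ⟨m, rfl⟩, rfl⟩

theorem dv_mem_RZ (p : ℕ) [Fact p.Prime] {L : Type} [Field L] [Algebra (ZMod p) L] [GFF p L] (z : Dv L) {f : L} (hf : f ≠ 0) : dv p f ∈ RZ p z := (mem_RZ p).2 ⟨f, hf, 0, by simp⟩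

theorem z_mem_RZ (p : ℕ) [Fact p.Prime] {L : Type} [Field L] [Algebra (ZMod p) L] [GFF p L] (z : Dv L) : z ∈ RZ p z := (mem_RZ p).2 ⟨1, one_ne_zero, 1, by simp [dv_one]⟩

theorem RZ_le (p : ℕ) [Fact p.Prime] {L : Type} [Field L] [Algebra (ZMod p) L] [GFF p L] {z : Dv L} {A : AddSubgroup (Dv L)} (h1 : ∀ f : L, f ≠ 0 → dv p f ∈ A) (h2 : z ∈ A) : RZ p z ≤ A := by
  intro D hD
  obtain ⟨f, hf, m, rfl⟩ := (mem_RZ p).1 hD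
  exact A.add_mem (h1 f hf) (A.zsmul_mem h2 m)

theorem index_RZ (p : ℕ) [Fact p.Prime] {L : Type} [Field L] [Algebra (ZMod p) L] [GFF p L] {z : Dv L} (hz : 0 < degD p z) : (RZ p z).index ≠ 0 := index_PD_ne_zero p z hz

theorem mem_RZ_deg (p : ℕ) [Fact p.Prime] {L : Type} [Field L] [Algebra (ZMod p) L] [GFF p L] {z D : Dv L} (hz : 0 < degD p z) (hD : degD p D = 0) (h : D ∈ RZ p z) : ∃ f : L, f ≠ 0 ∧ dv p f = D := by
  obtain ⟨f, hf, m, rfl⟩ := (mem_RZ p).1 h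
  rw [map_add, degD_dv, map_zsmul, zero_add, smul_eq_mul] at hD
  have : m = 0 := by
    rcases mul_eq_zero.1 hD with h | h
    · exact h
    · omega
  subst this
  exact ⟨f, hf, by simp⟩

theorem index_RZ_q (p : ℕ) [Fact p.Prime] {L : Type} [Field L] [Algebra (ZMod p) L] [GFF p L] {q : ℕ} (hq : 0 < q) {D0 : Dv L} (h0 : 0 < degD p D0) (hd : ∀ D : Dv L, degD p D0 ∣ degD p D) :
    (RZ p (q • D0)).index = q * (RZ p D0).index := by
  let d : Dv L →+ ℤ := AddMonoidHom.mk' (fun D => degD p D / degD p D0) (by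
    intro a b
    rw [map_add, Int.add_ediv_of_dvd_left (hd a)])
  have hdd : ∀ D, d D * degD p D0 = degD p D := fun D => Int.ediv_mul_cancel (hd D)
  have hdD : d D0 = 1 := Int.ediv_self h0.ne'
  have hsurj : Function.Surjective d := fun n => ⟨n • D0, by rw [map_zsmul, hdD]; simp⟩
  let E := (AddSubgroup.zmultiples (q : ℤ)).comap d
  have hE : E.index = q := by
    rw [AddSubgroup.index_comap_of_surjective _ hsurj, Int.index_zmultiples]
    simp
  have hle : RZ p (q • D0) ≤ RZ p D0 := RZ_le p (fun f hf => dv_mem_RZ p _ hf) (AddSubgroup.nsmul_mem _ (z_mem_RZ p _) _)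
  have hinf : RZ p (q • D0) = RZ p D0 ⊓ E := by
    refine le_antisymm (le_inf hle ?_) ?_
    · refine RZ_le p (fun f hf => ?_) ?_
      · rw [AddSubgroup.mem_comap]
        have : d (dv p f) = 0 := by
          change degD p (dv p f) / _ = 0
          rw [degD_dv, Int.zero_ediv]
        rw [this]; exact AddSubgroup.zero_mem _
      · rw [AddSubgroup.mem_comap, map_nsmul, hdD, Int.mem_zmultiples_iff]
        simp
    · rintro D ⟨h1, h2⟩
      obtain ⟨f, hf, m, rfl⟩ := (mem_RZ p).1 h1
      have h3 : d (dv p f + m • D0) ∈ AddSubgroup.zmultiples (q : ℤ) := h2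
      have : d (dv p f) = 0 := by
        change degD p (dv p f) / _ = 0
        rw [degD_dv, Int.zero_ediv]
      rw [map_add, this, map_zsmul, hdD, Int.mem_zmultiples_iff] at h3
      simp only [smul_eq_mul, mul_one, zero_add] at h3
      obtain ⟨k, rfl⟩ := h3
      refine (mem_RZ p).2 ⟨f, hf, k, ?_⟩
      rw [mul_comm, mul_zsmul, natCast_zsmul]
  have htop : RZ p D0 ⊔ E = ⊤ := by
    rw [eq_top_iff]
    intro D _
    rw [AddSubgroup.mem_sup]
    refine ⟨d D • D0, AddSubgroup.zsmul_mem _ (z_mem_RZ p _) _, D - d D • D0, ?_, by abel⟩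
    rw [AddSubgroup.mem_comap, map_sub, map_zsmul, hdD]
    simp
  have h1 := AddSubgroup.relIndex_mul_index hle
  rw [← h1]
  congr 1
  rw [hinf, AddSubgroup.inf_relIndex_left, ← AddSubgroup.relIndex_sup_right, htop, AddSubgroup.relIndex_top_right, hE]

namespace UK

def sd {q : ℕ} {L M : Type} [Field L] [Field M] [Algebra L M] (U : UK q L M) : Dv M →+ Dv M := U.sg.toAddMonoidHom - AddMonoidHom.id _

theorem sd_apply {q : ℕ} {L M : Type} [Field L] [Field M] [Algebra L M] (U : UK q L M) (B : Dv M) : U.sd B = U.sg B - B := rfl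

theorem sg_pb {q : ℕ} {L M : Type} [Field L] [Field M] [Algebra L M] (U : UK q L M) (p : ℕ) [Fact p.Prime] [Algebra (ZMod p) L] [Algebra (ZMod p) M] [IsScalarTower (ZMod p) L M] [FiniteDimensional L M] [GFF p L] [GFF p M] (D : Dv L) : U.sg (pb p D) = pb p D := by
  ext w
  rw [sg_apply, pb_apply, pb_apply, (FFPrime.rst_smul _ _).1]

theorem deg_sd {q : ℕ} {L M : Type} [Field L] [Field M] [Algebra L M] (U : UK q L M) (p : ℕ) [Fact p.Prime] [Algebra (ZMod p) L] [Algebra (ZMod p) M] [IsScalarTower (ZMod p) L M] [FiniteDimensional L M] [GFF p L] [GFF p M] (B : Dv M) : degD p (U.sd B) = 0 := by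
  rw [sd_apply, map_sub, U.deg_sg p, sub_self]

theorem sd_dv {q : ℕ} {L M : Type} [Field L] [Field M] [Algebra L M] (U : UK q L M) (p : ℕ) [Fact p.Prime] [Algebra (ZMod p) L] [Algebra (ZMod p) M] [IsScalarTower (ZMod p) L M] [FiniteDimensional L M] [GFF p L] [GFF p M] {x : M} (hx : x ≠ 0) : U.sd (dv p x) = dv p (U.σ x / x) := by
  rw [sd_apply, U.dv_sg p, dv_div p (by simpa using hx) hx]

/-- step 5a -/
theorem relJF {q : ℕ} {L M : Type} [Field L] [Field M] [Algebra L M] (U : UK q L M) (p : ℕ) [Fact p.Prime] [Algebra (ZMod p) L] [Algebra (ZMod p) M] [IsScalarTower (ZMod p) L M] [FiniteDimensional L M] [GFF p L] [GFF p M] {D0 : Dv L} (h0 : 0 < degD p D0) :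
    ((pb p (M := M) (L := L)).range ⊔ RZ p (pb p D0)).relIndex ((RZ p (pb p (M := M) D0)).comap U.sd) ≤
      ((kk p M).map U.Nu).relIndex (kk p L ⊓ U.Nu.range) := by
  have hz : 0 < degD p (pb p (M := M) D0) := by
    rw [U.deg_pb p]; exact mul_pos (by exact_mod_cast U.hq.pos) h0
  set F := (RZ p (pb p (M := M) D0)).comap U.sd
  have hch : ∀ B : F, ∃ y : Mˣ, dv p (y : M) = U.sd B := by
    intro B
    obtain ⟨f, hf, hfB⟩ := mem_RZ_deg p hz (U.deg_sd p B) B.2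
    exact ⟨Units.mk0 f hf, hfB⟩
  choose y hy using hch
  have hN : ∀ B : F, U.Nu (y B) ∈ kk p L ⊓ U.Nu.range := by
    intro B
    refine ⟨?_, y B, rfl⟩
    change dv p _ = 0
    rw [Nu_apply, ← U.nm_dv p (y B).ne_zero, hy, sd_apply, map_sub, U.nm_sg p, sub_self]
  have hfin : Finite ((kk p L ⊓ U.Nu.range : Subgroup Lˣ)) :=
    Finite.of_injective (fun x => (⟨x.1, x.2.1⟩ : kk p L)) fun a b hab => Subtype.ext (Subtype.mk.inj hab)
  rw [Subgroup.relIndex, Subgroup.index]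
  refine add_relIndex_le (Q := (kk p L ⊓ U.Nu.range : Subgroup Lˣ) ⧸ ((kk p M).map U.Nu).subgroupOf (kk p L ⊓ U.Nu.range)) _ _
    (fun B => QuotientGroup.mk ⟨U.Nu (y B), hN B⟩) ?_
  intro B C hBC
  have h1 := QuotientGroup.eq.1 hBC
  rw [Subgroup.mem_subgroupOf] at h1
  obtain ⟨u, hu, hu2⟩ := h1
  simp only [Subgroup.coe_mul, Subgroup.coe_inv] at hu2
  have h2 : U.Nu ((y B) / (y C) * u) = 1 := by
    rw [map_mul, map_div, hu2, div_eq_mul_inv, mul_assoc, inv_mul_cancel_comm_assoc, mul_inv_cancel]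
  have h3 : Algebra.norm L (((y B) / (y C) * u : Mˣ) : M) = 1 := by
    rw [← Nu_apply, h2, Units.val_one]
  obtain ⟨x, hx⟩ := U.h90 h3
  have h4 : U.sd ((B : Dv M) - (C : Dv M) - dv p (x : M)) = 0 := by
    rw [map_sub, map_sub, U.sd_dv p x.ne_zero, hx, Units.val_mul, Units.val_div_eq_div_val,
      dv_mul p (div_ne_zero (Units.ne_zero _) (Units.ne_zero _)) (Units.ne_zero _),
      dv_div p (Units.ne_zero _) (Units.ne_zero _), hy, hy, (mem_kk p).1 hu, add_zero, sub_self]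
  obtain ⟨D, hD⟩ := U.exists_pb p (sub_eq_zero.1 h4)
  have h5 : (B : Dv M) - (C : Dv M) = pb p D + dv p (x : M) := by rw [hD]; abel
  rw [h5]
  exact AddSubgroup.add_mem _ (AddSubgroup.mem_sup_left ⟨D, rfl⟩) (AddSubgroup.mem_sup_right (dv_mem_RZ p _ x.ne_zero))

theorem RZ_le_comap {q : ℕ} {L M : Type} [Field L] [Field M] [Algebra L M] (U : UK q L M) (p : ℕ) [Fact p.Prime] [Algebra (ZMod p) L] [Algebra (ZMod p) M] [IsScalarTower (ZMod p) L M] [FiniteDimensional L M] [GFF p L] [GFF p M] (D0 : Dv L) : RZ p D0 ≤ (RZ p (pb p (M := M) D0)).comap (pb p) := by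
  refine RZ_le p (fun f hf => ?_) (z_mem_RZ p _)
  rw [AddSubgroup.mem_comap, U.pb_dv p]
  exact dv_mem_RZ p _ (by simpa using hf)

/-- step 5b -/
theorem relR0K {q : ℕ} {L M : Type} [Field L] [Field M] [Algebra L M] (U : UK q L M) (p : ℕ) [Fact p.Prime] [Algebra (ZMod p) L] [Algebra (ZMod p) M] [IsScalarTower (ZMod p) L M] [FiniteDimensional L M] [GFF p L] [GFF p M] {D0 : Dv L} (h0 : 0 < degD p D0) :
    ((kk p M).map U.su).relIndex (U.Nu.ker ⊓ kk p M) ≤ (RZ p D0).relIndex ((RZ p (pb p (M := M) D0)).comap (pb p)) := by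
  set K := (RZ p (pb p (M := M) D0)).comap (pb p (L := L))
  have hch : ∀ c : (U.Nu.ker ⊓ kk p M : Subgroup Mˣ), ∃ (x : Mˣ) (D : Dv L), U.su x = c ∧ dv p (x : M) = pb p D := by
    rintro ⟨c, hc1, hc2⟩
    have h1 : Algebra.norm L (c : M) = 1 := by
      rw [← Nu_apply, (MonoidHom.mem_ker).1 hc1, Units.val_one]
    obtain ⟨x, hx⟩ := U.h90 h1
    have h2 : U.sd (dv p (x : M)) = 0 := by
      rw [U.sd_dv p x.ne_zero, hx]; exact hc2
    obtain ⟨D, hD⟩ := U.exists_pb p (sub_eq_zero.1 h2)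
    exact ⟨x, D, Units.ext (by rw [su_apply, hx]), hD.symm⟩
  choose x D hx hD using hch
  have hDK : ∀ c, D c ∈ K := by
    intro c
    rw [AddSubgroup.mem_comap, ← hD]
    exact dv_mem_RZ p _ (Units.ne_zero _)
  have hne : (RZ p D0).relIndex K ≠ 0 := fun h => index_RZ p h0 (AddSubgroup.index_eq_zero_of_relIndex_eq_zero h)
  have hfin : Finite (K ⧸ (RZ p D0).addSubgroupOf K) := AddSubgroup.index_ne_zero_iff_finite.1 hne
  rw [AddSubgroup.relIndex, AddSubgroup.index]
  refine mul_relIndex_le _ _ (fun c => (QuotientAddGroup.mk ⟨D c, hDK c⟩ : K ⧸ (RZ p D0).addSubgroupOf K)) ?_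
  intro c d hcd
  have h1 := QuotientAddGroup.eq.1 hcd.symm
  rw [AddSubgroup.mem_addSubgroupOf] at h1
  have h1' : D c - D d ∈ RZ p D0 := by
    have : D c - D d = -D d + D c := by abel
    rw [this]; exact h1
  have hdeg : ∀ c, degD p (D c) = 0 := by
    intro c
    have h2 := U.deg_pb p (D c)
    rw [← hD, degD_dv] at h2
    rcases mul_eq_zero.1 h2.symm with h | h
    · exact absurd (by exact_mod_cast h) U.hq.ne_zero
    · exact h
  obtain ⟨f, hf, hfD⟩ := mem_RZ_deg p h0 (by rw [map_sub, hdeg, hdeg, sub_self]) h1'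
  let fM : Mˣ := Units.map (algebraMap L M : L →* M) (Units.mk0 f hf)
  have hfM : (fM : M) = algebraMap L M f := rfl
  refine ⟨x c / x d / fM, ?_, ?_⟩
  · change dv p _ = 0
    rw [Units.val_div_eq_div_val, Units.val_div_eq_div_val, dv_div p (div_ne_zero (Units.ne_zero _) (Units.ne_zero _)) (Units.ne_zero _),
      dv_div p (Units.ne_zero _) (Units.ne_zero _), hD, hD, hfM, ← U.pb_dv p, hfD, map_sub, sub_self]
  · rw [map_div, map_div, hx, hx]
    have : U.su fM = 1 := Units.ext (by rw [su_apply, hfM]; simp [hf])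
    rw [this, div_one]

theorem ineqA {q : ℕ} {L M : Type} [Field L] [Field M] [Algebra L M] (U : UK q L M) (p : ℕ) [Fact p.Prime] [Algebra (ZMod p) L] [Algebra (ZMod p) M] [IsScalarTower (ZMod p) L M] [FiniteDimensional L M] [GFF p L] [GFF p M] {D0 : Dv L} (h0 : 0 < degD p D0) :
    (RZ p (pb p (M := M) D0)).relIndex ((RZ p (pb p (M := M) D0)).comap U.sd) *
      ((kk p M).map U.su).relIndex (U.Nu.ker ⊓ kk p M) ≤
    (RZ p D0).index * ((kk p M).map U.Nu).relIndex (kk p L ⊓ U.Nu.range) := by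
  set R := RZ p (pb p (M := M) D0)
  have hRJ : R ≤ (pb p (M := M) (L := L)).range ⊔ R := le_sup_right
  have hJF : (pb p (M := M) (L := L)).range ⊔ R ≤ R.comap U.sd := by
    refine sup_le ?_ ?_
    · rintro _ ⟨D, rfl⟩
      rw [AddSubgroup.mem_comap, sd_apply, U.sg_pb p, sub_self]
      exact AddSubgroup.zero_mem _
    · refine RZ_le p (fun f hf => ?_) ?_
      · rw [AddSubgroup.mem_comap, U.sd_dv p hf]
        exact dv_mem_RZ p _ (div_ne_zero (by simpa using hf) hf)
      · rw [AddSubgroup.mem_comap, sd_apply, U.sg_pb p, sub_self]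
        exact AddSubgroup.zero_mem _
  have h1 := AddSubgroup.relIndex_mul_relIndex _ _ _ hRJ hJF
  have h2 : R.relIndex ((pb p (M := M) (L := L)).range ⊔ R) = (R.comap (pb p (L := L))).index := by
    rw [AddSubgroup.relIndex_sup_right, AddSubgroup.index_comap]
  have h3 := AddSubgroup.relIndex_mul_index (U.RZ_le_comap p D0)
  have h4 := U.relJF p h0
  have h5 := U.relR0K p h0
  rw [← h1, h2, ← h3]
  calc _ ≤ (AddSubgroup.comap (pb p) R).index * ((kk p M).map U.Nu).relIndex (kk p L ⊓ U.Nu.range) *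
        (RZ p D0).relIndex (AddSubgroup.comap (pb p) R) := Nat.mul_le_mul (Nat.mul_le_mul_left _ h4) h5
    _ = _ := by ring

theorem eqB {q : ℕ} {L M : Type} [Field L] [Field M] [Algebra L M] (U : UK q L M) (p : ℕ) [Fact p.Prime] [Algebra (ZMod p) L] [Algebra (ZMod p) M] [IsScalarTower (ZMod p) L M] [FiniteDimensional L M] [GFF p L] [GFF p M] (D0 : Dv L) : (RZ p (pb p (M := M) D0) ⊔ U.sd.range) ≤ (RZ p (q • D0)).comap U.nm ∧
    ((RZ p (q • D0)).comap U.nm).index * (PD p L ⊔ U.nm.range).index = (RZ p (q • D0)).index := by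
  constructor
  · refine sup_le (RZ_le p (fun f hf => ?_) ?_) ?_
    · rw [AddSubgroup.mem_comap, U.nm_dv p hf]
      exact dv_mem_RZ p _ (Algebra.norm_ne_zero_iff.2 hf)
    · rw [AddSubgroup.mem_comap, U.nm_pb p]
      exact z_mem_RZ p _
    · rintro _ ⟨B, rfl⟩
      rw [AddSubgroup.mem_comap, sd_apply, map_sub, U.nm_sg p, sub_self]
      exact AddSubgroup.zero_mem _
  · have h : PD p L ⊔ U.nm.range = RZ p (q • D0) ⊔ U.nm.range := by
      refine le_antisymm (sup_le_sup_right (le_sup_left) _) (sup_le (RZ_le p (fun f hf => ?_) ?_) le_sup_right)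
      · exact AddSubgroup.mem_sup_left ((mem_PD p).2 ⟨f, hf, rfl⟩)
      · exact AddSubgroup.mem_sup_right ⟨pb p D0, U.nm_pb p D0⟩
    rw [h, AddSubgroup.index_comap, ← AddSubgroup.relIndex_sup_left]
    exact AddSubgroup.relIndex_mul_index le_sup_left

theorem index_H {q : ℕ} {L M : Type} [Field L] [Field M] [Algebra L M] (U : UK q L M) (p : ℕ) [Fact p.Prime] [Algebra (ZMod p) L] [Algebra (ZMod p) M] [IsScalarTower (ZMod p) L M] [FiniteDimensional L M] [GFF p L] [GFF p M] : (PD p L ⊔ U.nm.range).index ≤ q := by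
  have : Fact q.Prime := ⟨U.hq⟩
  refine index_le_q q _ (fun D => AddSubgroup.mem_sup_right ⟨pb p D, U.nm_pb p D⟩) ?_
  intro χ hs hχ
  exact U.second_ineq p χ hs (fun f hf => hχ _ (AddSubgroup.mem_sup_left ((mem_PD p).2 ⟨f, hf, rfl⟩)))
    (fun B => hχ _ (AddSubgroup.mem_sup_right ⟨B, rfl⟩))

theorem counting {q : ℕ} {L M : Type} [Field L] [Field M] [Algebra L M] (U : UK q L M) (p : ℕ) [Fact p.Prime] [Algebra (ZMod p) L] [Algebra (ZMod p) M] [IsScalarTower (ZMod p) L M] [FiniteDimensional L M] [GFF p L] [GFF p M] : kk p L ≤ U.Nu.range ∧ ∃ D0 : Dv L, 0 < degD p D0 ∧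
    (RZ p (q • D0)).comap U.nm ≤ RZ p (pb p (M := M) D0) ⊔ U.sd.range := by
  obtain ⟨D0, h0, hd⟩ := exists_D0 p (L := L)
  have hz : 0 < degD p (pb p (M := M) D0) := by
    rw [U.deg_pb p]; exact mul_pos (by exact_mod_cast U.hq.pos) h0
  have hRF : RZ p (pb p (M := M) D0) ≤ (RZ p (pb p (M := M) D0)).comap U.sd := by
    refine RZ_le p (fun f hf => ?_) ?_
    · rw [AddSubgroup.mem_comap, U.sd_dv p hf]
      exact dv_mem_RZ p _ (div_ne_zero (by simpa using hf) hf)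
    · rw [AddSubgroup.mem_comap, sd_apply, U.sg_pb p, sub_self]
      exact AddSubgroup.zero_mem _
  have hA := U.ineqA p h0
  have hkc := ker_coker _ U.sd (index_RZ p hz) hRF
  obtain ⟨hle, hB⟩ := U.eqB p D0
  have hH := U.index_H p
  rw [index_RZ_q p U.hq.pos h0 hd] at hB
  have hC := AddSubgroup.relIndex_mul_index hle
  rw [hkc, ← hC, U.herbrand p] at hA
  have hD := Subgroup.relIndex_mul_relIndex ((kk p M).map U.Nu) (kk p L ⊓ U.Nu.range) (kk p L)
    (le_inf (U.map_N_le p) (by rintro _ ⟨u, -, rfl⟩; exact ⟨u, rfl⟩)) inf_le_left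
  rw [← hD] at hA
  have hh' : 0 < (RZ p D0).index := Nat.pos_of_ne_zero (index_RZ p h0)
  have hY : (RZ p (pb p (M := M) D0) ⊔ U.sd.range).index ≠ 0 := fun h => index_RZ p hz
    (by rw [← AddSubgroup.relIndex_mul_index (le_sup_left : RZ p (pb p (M := M) D0) ≤ RZ p (pb p (M := M) D0) ⊔ U.sd.range), h, mul_zero])
  set t := (RZ p (pb p (M := M) D0) ⊔ U.sd.range).relIndex ((RZ p (q • D0)).comap U.nm) with ht
  set Z := ((RZ p (q • D0)).comap U.nm).index
  set n1 := ((kk p M).map U.Nu).relIndex (kk p L ⊓ U.Nu.range)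
  set r := (kk p L ⊓ U.Nu.range).relIndex (kk p L) with hr
  have ht0 : 0 < t := Nat.pos_of_ne_zero fun h => hY (by rw [← hC, h, zero_mul])
  have hkk : 0 < n1 * r := by
    rw [hD]
    refine Nat.pos_of_ne_zero fun h => ?_
    have := UK.card_mul_relIndex' (U.map_N_le p)
    rw [h, mul_zero] at this
    have h2 : 0 < Nat.card (kk p L) := Nat.card_pos
    omega
  have hn1 : 0 < n1 := Nat.pos_of_mul_pos_right hkk
  have hr0 : 0 < r := Nat.pos_of_mul_pos_left hkk
  have hZ : (RZ p D0).index ≤ Z := by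
    have h1 : q * (RZ p D0).index ≤ Z * q := by
      rw [← hB]; exact Nat.mul_le_mul_left _ hH
    rw [mul_comm] at h1
    exact Nat.le_of_mul_le_mul_right h1 U.hq.pos
  have h6 : (t * r) * ((RZ p D0).index * n1) ≤ 1 * ((RZ p D0).index * n1) := by
    calc _ = t * (RZ p D0).index * (n1 * r) := by ring
      _ ≤ t * Z * (n1 * r) := Nat.mul_le_mul_right _ (Nat.mul_le_mul_left _ hZ)
      _ ≤ _ := hA
      _ = _ := (one_mul _).symm
  have h7 : t * r ≤ 1 := Nat.le_of_mul_le_mul_right h6 (Nat.mul_pos hh' hn1)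
  have ht1 : t = 1 := by nlinarith
  have hr1 : r = 1 := by nlinarith
  refine ⟨?_, D0, h0, ?_⟩
  · exact (Subgroup.relIndex_eq_one.1 hr1).trans inf_le_right
  · exact AddSubgroup.relIndex_eq_one.1 ht1

/-- Hasse norm theorem in the everywhere locally trivial unramified case. -/
theorem is_norm {q : ℕ} {L M : Type} [Field L] [Field M] [Algebra L M] (U : UK q L M) (p : ℕ) [Fact p.Prime] [Algebra (ZMod p) L] [Algebra (ZMod p) M] [IsScalarTower (ZMod p) L M] [FiniteDimensional L M] [GFF p L] [GFF p M] {c : L} (hc0 : c ≠ 0) (hc : ∀ v : FFPrime L, (q : ℤ) ∣ v.val c) : ∃ y : M, Algebra.norm L y = c := by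
  obtain ⟨hk, D0, h0, hle⟩ := U.counting p
  have hz : 0 < degD p (pb p (M := M) D0) := by
    rw [U.deg_pb p]; exact mul_pos (by exact_mod_cast U.hq.pos) h0
  obtain ⟨C, hC⟩ : ∃ C : Dv L, q • C = dv p c := by
    refine ⟨(dv p c).mapRange (fun n => n / (q : ℤ)) (by simp), ?_⟩
    ext v
    rw [Finsupp.smul_apply, Finsupp.mapRange_apply, dv_apply, nsmul_eq_mul]
    exact Int.mul_ediv_cancel' (hc v)
  have hdC : degD p C = 0 := by
    have h := congrArg (degD p) hC
    rw [map_nsmul, degD_dv, nsmul_eq_mul] at h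
    rcases mul_eq_zero.1 h with h | h
    · exact absurd (by exact_mod_cast h) U.hq.ne_zero
    · exact h
  have h1 : pb p (M := M) C ∈ (RZ p (q • D0)).comap U.nm := by
    rw [AddSubgroup.mem_comap, U.nm_pb p, hC]
    exact dv_mem_RZ p _ hc0
  obtain ⟨B, hB, _, ⟨B', rfl⟩, hBB⟩ := AddSubgroup.mem_sup.1 (hle h1)
  have hdB : degD p B = 0 := by
    have h := congrArg (degD p) hBB
    rw [map_add, U.deg_sd p, U.deg_pb p, hdC] at h
    simpa using h
  obtain ⟨y, hy, rfl⟩ := mem_RZ_deg p hz hdB hB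
  have h2 := congrArg U.nm hBB
  rw [map_add, sd_apply, map_sub, U.nm_sg p, sub_self, add_zero, U.nm_dv p hy, U.nm_pb p, hC] at h2
  have hNy : Algebra.norm L y ≠ 0 := Algebra.norm_ne_zero_iff.2 hy
  have h3 : Units.mk0 c hc0 / U.Nu (Units.mk0 y hy) ∈ kk p L := by
    rw [mem_kk, Units.val_div_eq_div_val, Nu_apply, Units.val_mk0, Units.val_mk0, dv_div p hc0 hNy, h2, sub_self]
  obtain ⟨u, hu⟩ := hk h3
  refine ⟨(u : M) * y, ?_⟩
  rw [map_mul, ← Nu_apply, hu, Units.val_div_eq_div_val, Nu_apply, Units.val_mk0, Units.val_mk0, div_mul_cancel₀ _ hNy]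

end UK
end

noncomputable section

section loc
variable {L : Type} [Field L] (w : FFPrime L)

theorem pow_val_eq {q : ℕ} {al s : L} (h : al ^ q = 1 + s) (hs0 : s ≠ 0) (hs : w.val s < 0) : w.val s = q * w.val al := by
  have h1 := w.val_add_eq (x := s) (y := 1) hs0 (Or.inr (by rw [w.val_one]; exact hs))
  have h2 := w.val_pow al q
  rw [h, add_comm, h1.2] at h2
  exact h2

/-- local divisibility of `c` -/
theorem loc_c {q : ℕ} (hq : 2 ≤ q) {b x c al1 : L} (hb : b ≠ 0) (hx : x ≠ 0) (hc : c = b * x ^ q + b ^ q) (hc0 : c ≠ 0)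
    (h1 : al1 ^ q = 1 + c⁻¹) (hw : 0 ≤ w.val x ∨ w.val b = 0) : (q : ℤ) ∣ w.val c := by
  rcases lt_trichotomy (w.val c) 0 with h | h | h
  · have hbx : w.val (b * x ^ q) = w.val b + q * w.val x := by
      rw [w.val_mul hb (pow_ne_zero _ hx), w.val_pow]
    have hbq : w.val (b ^ q) = q * w.val b := w.val_pow _ _
    have hbx0 : b * x ^ q ≠ 0 := mul_ne_zero hb (pow_ne_zero _ hx)
    have hbq0 : b ^ q ≠ 0 := pow_ne_zero _ hb
    have hq2 : (2 : ℤ) ≤ q := by exact_mod_cast hq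
    have hmin : min (w.val (b * x ^ q)) (w.val (b ^ q)) ≤ w.val c := by
      rw [hc]
      exact (w.val_add (Or.inr (min_le_left _ _)) (Or.inr (min_le_right _ _))).resolve_left (hc ▸ hc0)
    by_cases hx0 : 0 ≤ w.val x
    · have hb0 : w.val b < 0 := by
        by_contra hcon
        push Not at hcon
        have : 0 ≤ min (w.val (b * x ^ q)) (w.val (b ^ q)) := by
          rw [hbx, hbq]
          exact le_min (by positivity) (by positivity)
        omega
      have := w.val_add_eq (x := b ^ q) (y := b * x ^ q) hbq0 (Or.inr (by rw [hbx, hbq]; nlinarith))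
      rw [hc, add_comm, this.2, hbq]
      exact dvd_mul_right _ _
    · have hb0 : w.val b = 0 := hw.resolve_left hx0
      have := w.val_add_eq (x := b * x ^ q) (y := b ^ q) hbx0 (Or.inr (by rw [hbx, hbq, hb0]; nlinarith))
      rw [hc, this.2, hbx, hb0, zero_add]
      exact dvd_mul_right _ _
  · rw [h]; exact dvd_zero _
  · have := pow_val_eq w h1 (inv_ne_zero hc0) (by rw [w.val_inv]; omega)
    rw [w.val_inv] at this
    rw [← dvd_neg, this]
    exact dvd_mul_right _ _

/-- local divisibility of `a` -/
theorem loc_a {q : ℕ} {a x al3 al4 : L} (ha : a ≠ 0) (hx : x ≠ 0)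
    (h3 : al3 ^ q = 1 + x⁻¹) (h4 : al4 ^ q = 1 + (a + a⁻¹) * x⁻¹) (hw : 0 ≤ w.val x ∨ w.val a = 0) : (q : ℤ) ∣ w.val a := by
  by_cases h0 : w.val a = 0
  · rw [h0]; exact dvd_zero _
  have hx0 := hw.resolve_right h0
  have hxd : (q : ℤ) ∣ w.val x := by
    rcases hx0.eq_or_lt with h | h
    · rw [← h]; exact dvd_zero _
    · have := pow_val_eq w h3 (inv_ne_zero hx) (by rw [w.val_inv]; omega)
      rw [w.val_inv] at this
      rw [← dvd_neg, this]
      exact dvd_mul_right _ _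
  have hs : a + a⁻¹ ≠ 0 ∧ w.val (a + a⁻¹) < 0 ∧ (w.val (a + a⁻¹) = w.val a ∨ w.val (a + a⁻¹) = - w.val a) := by
    rcases lt_or_gt_of_ne h0 with h | h
    · have := w.val_add_eq (x := a) (y := a⁻¹) ha (Or.inr (by rw [w.val_inv]; omega))
      exact ⟨this.1, by omega, by omega⟩
    · have := w.val_add_eq (x := a⁻¹) (y := a) (inv_ne_zero ha) (Or.inr (by rw [w.val_inv]; omega))
      rw [w.val_inv, add_comm] at this
      exact ⟨this.1, by omega, by omega⟩
  obtain ⟨hs0, hs1, hs2⟩ := hs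
  have hm : w.val ((a + a⁻¹) * x⁻¹) = w.val (a + a⁻¹) - w.val x := by
    rw [w.val_mul hs0 (inv_ne_zero hx), w.val_inv]; ring
  have := pow_val_eq w h4 (mul_ne_zero hs0 (inv_ne_zero hx)) (by rw [hm]; omega)
  rw [hm] at this
  have h5 : (q : ℤ) ∣ w.val (a + a⁻¹) := by
    have h6 : w.val (a + a⁻¹) = q * w.val al4 + w.val x := by omega
    rw [h6]
    exact dvd_add (dvd_mul_right _ _) hxd
  rcases hs2 with h | h
  · rwa [h] at h5
  · rw [h] at h5; exact (dvd_neg.1 h5)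

end loc

open Polynomial in
/-- norm compatibility with base change of a power basis -/
theorem norm_base_change {L E M N : Type} [Field L] [Field E] [Field M] [Field N] [Algebra L E] [Algebra L M] [Algebra E N]
    [Algebra M N] [Algebra L N] [IsScalarTower L E N] [IsScalarTower L M N] (P : PowerBasis L M) (Q : PowerBasis E N)
    (hd : P.dim = Q.dim) (hg : algebraMap M N P.gen = Q.gen) (y : M) :
    Algebra.norm E (algebraMap M N y) = algebraMap L E (Algebra.norm L y) := by
  classical
  let b := P.basis
  let b' := Q.basis.reindex (finCongr hd.symm)
  have hbb : ∀ i, algebraMap M N (b i) = b' i := by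
    intro i
    simp [b, b', hg]
  have hrep : ∀ z : M, ∀ i, b'.repr (algebraMap M N z) i = algebraMap L E (b.repr z i) := by
    intro z i
    have : algebraMap M N z = ∑ j, algebraMap L E (b.repr z j) • b' j := by
      conv_lhs => rw [← b.sum_repr z]
      rw [map_sum]
      refine Finset.sum_congr rfl fun j _ => ?_
      rw [Algebra.smul_def, map_mul, hbb, Algebra.smul_def, ← IsScalarTower.algebraMap_apply, ← IsScalarTower.algebraMap_apply]
    rw [this, b'.repr_sum_self]
  rw [Algebra.norm_eq_matrix_det b, Algebra.norm_eq_matrix_det b', RingHom.map_det]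
  congr 1
  ext i j
  rw [RingHom.mapMatrix_apply, Matrix.map_apply, Algebra.leftMulMatrix_eq_repr_mul, Algebra.leftMulMatrix_eq_repr_mul, ← hbb, ← map_mul, hrep]

open Polynomial in
theorem kummer_norm (p : ℕ) [Fact p.Prime] {q : ℕ} (hq : q.Prime) {L E N : Type} [Field L] [Field E] [Field N] [Algebra L E] [Algebra E N] [Algebra (ZMod p) L] [GFF p L]
    (ζ : L) (hζ : IsPrimitiveRoot ζ q) (a c : L) (ha0 : a ≠ 0) (hc0 : c ≠ 0)
    (ha : ∀ w : FFPrime L, (q : ℤ) ∣ w.val a) (hc : ∀ w : FFPrime L, (q : ℤ) ∣ w.val c)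
    (hna : ∀ b : E, b ^ q ≠ algebraMap L E a)
    (α : N) (hα : α ^ q = algebraMap E N (algebraMap L E a)) (htop : IntermediateField.adjoin E {α} = ⊤) :
    ∃ y : N, Algebra.norm E y = algebraMap L E c := by
  have hirrE : Irreducible (X ^ q - C (algebraMap L E a)) := X_pow_sub_C_irreducible_of_prime hq hna
  have hirr : Irreducible (X ^ q - C a) := X_pow_sub_C_irreducible_of_prime hq fun b hb => hna (algebraMap L E b) (by rw [← map_pow, hb])
  have hm : minpoly E α = X ^ q - C (algebraMap L E a) := by
    refine (minpoly.eq_of_irreducible_of_monic hirrE (by simp [hα]) (monic_X_pow_sub_C _ hq.ne_zero)).symm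
  have hInt : IsIntegral E α := ⟨_, monic_X_pow_sub_C (algebraMap L E a) hq.ne_zero, by simp [hα]⟩
  have htop' : Algebra.adjoin E {α} = ⊤ := by
    rw [← IntermediateField.adjoin_simple_toSubalgebra_of_isAlgebraic hInt.isAlgebraic, htop]; rfl
  let Q : PowerBasis E N := PowerBasis.ofAdjoinEqTop hInt htop'
  have hQg : Q.gen = α := PowerBasis.ofAdjoinEqTop_gen _ _
  have hQd : Q.dim = q := by
    rw [PowerBasis.ofAdjoinEqTop_dim, hm, natDegree_X_pow_sub_C]
  have hfact : Fact (Irreducible (X ^ q - C a)) := ⟨hirr⟩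
  let M := AdjoinRoot (X ^ q - C a)
  have hne : (X ^ q - C a) ≠ 0 := hirr.ne_zero
  let P : PowerBasis L M := AdjoinRoot.powerBasis hne
  have hPd : P.dim = q := by
    rw [AdjoinRoot.powerBasis_dim, natDegree_X_pow_sub_C]
  have hfd : FiniteDimensional L M := P.finite
  have _ : GFF p M := GFF.extend p (L := L) M
  have hroot : (AdjoinRoot.root (X ^ q - C a)) ^ q = algebraMap L M a := root_X_pow_sub_C_pow q a
  have _ : NeZero q := ⟨hq.ne_zero⟩
  let U : UK q L M :=
    { hq := hq
      σ := autAdjoinRootXPowSubC q a hζ.toRootsOfUnity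
      hσ := by
        rw [← map_pow]
        have : hζ.toRootsOfUnity ^ q = 1 := by
          ext
          simp [hζ.pow_eq_one]
        rw [this, map_one]
      ζ := ζ
      hζ := hζ
      α := AdjoinRoot.root _
      a := a
      ha := hroot
      ha0 := ha0
      hα := by
        rw [autAdjoinRootXPowSubC_root, Algebra.smul_def]
        simp
        exact Or.inl rfl
      hrank := by rw [P.finrank, hPd]
      hunr := ha }
  obtain ⟨y, hy⟩ := U.is_norm p hc0 hc
  let _ : Algebra L N := ((algebraMap E N).comp (algebraMap L E)).toAlgebra
  have _ : IsScalarTower L E N := IsScalarTower.of_algebraMap_eq fun _ => rfl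
  let g : M →+* N := AdjoinRoot.lift (algebraMap L N) α (by
    simp only [eval₂_sub, eval₂_X_pow, eval₂_C, hα]
    exact sub_self _)
  let _ : Algebra M N := g.toAlgebra
  have _ : IsScalarTower L M N := IsScalarTower.of_algebraMap_eq fun r => by
    change _ = g (algebraMap L M r)
    rw [AdjoinRoot.algebraMap_eq]
    exact (AdjoinRoot.lift_of _).symm
  refine ⟨algebraMap M N y, ?_⟩
  rw [norm_base_change P Q (hPd.trans hQd.symm) ?_ y, hy]
  rw [hQg, AdjoinRoot.powerBasis_gen]
  exact AdjoinRoot.lift_root _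

end

noncomputable section

/-- a Kummer generator whose power is a `q`-th power lies in the base field -/
theorem kummer_trivial {q : ℕ} (hq : q.Prime) {E N : Type} [Field E] [Field N] [Algebra E N] (ζ : E) (hζ : IsPrimitiveRoot ζ q)
    (α : N) (b : E) (hα : α ^ q = algebraMap E N (b ^ q)) (htop : IntermediateField.adjoin E {α} = ⊤) (c : E) :
    ∃ y : N, Algebra.norm E y = c := by
  have hmem : ∃ z : E, algebraMap E N z = α := by
    rw [map_pow] at hα
    have hζ' : IsPrimitiveRoot (algebraMap E N ζ) q := hζ.map_of_injective (algebraMap E N).injective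
    by_cases hb : b = 0
    · refine ⟨0, ?_⟩
      rw [hb, map_zero, zero_pow hq.ne_zero] at hα
      rw [map_zero, eq_zero_of_pow_eq_zero hα]
    · have hb' : algebraMap E N b ≠ 0 := by simpa using hb
      have h1 : (α / algebraMap E N b) ^ q = 1 := by
        rw [div_pow, hα, div_self (pow_ne_zero _ hb')]
      have : NeZero q := ⟨hq.ne_zero⟩
      obtain ⟨i, -, hi⟩ := hζ'.eq_pow_of_pow_eq_one h1
      refine ⟨ζ ^ i * b, ?_⟩
      rw [map_mul, map_pow, hi, div_mul_cancel₀ _ hb']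
  obtain ⟨z, rfl⟩ := hmem
  have hbot : (⊤ : IntermediateField E N) = ⊥ := by
    rw [← htop, IntermediateField.adjoin_simple_eq_bot_iff]
    exact IntermediateField.algebraMap_mem _ _
  have hr : Module.finrank E N = 1 := by
    rw [← IntermediateField.finrank_top', hbot, IntermediateField.finrank_bot]
  exact ⟨algebraMap E N c, by rw [Algebra.norm_algebraMap, hr, pow_one]⟩

theorem forward_core (p : ℕ) [Fact p.Prime] {q : ℕ} (hq : q.Prime) {K E N : Type} [Field K] [Field E] [Field N] [Algebra K E] [Algebra E N]
    [Algebra.IsAlgebraic K E] [Algebra (ZMod p) K] [GFF p K] (ζ : K) (hζ : IsPrimitiveRoot ζ q)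
    (a b x c al1 al3 al4 : E) (ha0 : a ≠ 0) (hx : x ≠ 0) (hc : c = b * x ^ q + b ^ q) (hc0 : c ≠ 0)
    (h1 : al1 ^ q = 1 + c⁻¹) (h3 : al3 ^ q = 1 + x⁻¹) (h4 : al4 ^ q = 1 + (a + a⁻¹) * x⁻¹)
    (hcond : ∀ (v : FFPrime K) (V : FFVal E) (r : ℚ), 0 < r → (∀ z : K, V.val (algebraMap K E z) = r * v.val z) →
      0 ≤ V.val x ∨ (V.val b = 0 ∧ V.val a = 0))
    (α : N) (hα : α ^ q = algebraMap E N a) (htop : IntermediateField.adjoin E {α} = ⊤) :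
    ∃ y : N, Algebra.norm E y = c := by
  by_cases hpow : ∃ b : E, b ^ q = a
  · obtain ⟨b, rfl⟩ := hpow
    exact kummer_trivial hq (algebraMap K E ζ) (hζ.map_of_injective (algebraMap K E).injective) α b hα htop c
  push Not at hpow
  have hb : b ≠ 0 := by
    rintro rfl
    simp [hq.ne_zero] at hc
    exact hc0 hc
  let L : IntermediateField K E := IntermediateField.adjoin K {a, b, x, al1, al3, al4}
  have hfd : FiniteDimensional K L :=
    IntermediateField.finiteDimensional_adjoin fun y _ => Algebra.IsIntegral.isIntegral y
  have hsub : ∀ y ∈ ({a, b, x, al1, al3, al4} : Set E), y ∈ L := fun y hy => IntermediateField.subset_adjoin K _ hy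
  let a' : L := ⟨a, hsub a (by simp)⟩
  let b' : L := ⟨b, hsub b (by simp)⟩
  let x' : L := ⟨x, hsub x (by simp)⟩
  let al1' : L := ⟨al1, hsub al1 (by simp)⟩
  let al3' : L := ⟨al3, hsub al3 (by simp)⟩
  let al4' : L := ⟨al4, hsub al4 (by simp)⟩
  let c' : L := b' * x' ^ q + b' ^ q
  have hcc : algebraMap L E c' = c := by rw [hc]; rfl
  have inj : Function.Injective (algebraMap L E) := (algebraMap L E).injective
  have ha0' : a' ≠ 0 := fun h => ha0 (congrArg (algebraMap L E) h)
  have hb0' : b' ≠ 0 := fun h => hb (congrArg (algebraMap L E) h)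
  have hx0' : x' ≠ 0 := fun h => hx (congrArg (algebraMap L E) h)
  have hc0' : c' ≠ 0 := fun h => hc0 (by rw [← hcc, h, map_zero])
  have h1' : al1' ^ q = 1 + c'⁻¹ := inj (by
    rw [map_pow, map_add, map_one, map_inv₀, hcc]; exact h1)
  have h3' : al3' ^ q = 1 + x'⁻¹ := inj (by
    rw [map_pow, map_add, map_one, map_inv₀]; exact h3)
  have h4' : al4' ^ q = 1 + (a' + a'⁻¹) * x'⁻¹ := inj (by
    rw [map_pow, map_add, map_one, map_mul, map_add, map_inv₀, map_inv₀]; exact h4)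
  have key : ∀ w : FFPrime L, 0 ≤ w.val x' ∨ (w.val b' = 0 ∧ w.val a' = 0) := by
    intro w
    obtain ⟨v, e, he, hv⟩ := w.exists_restrict (F := K)
    obtain ⟨A, hA⟩ := exists_subring (E := E) w
    obtain ⟨V, hV, -⟩ := exists_ffval_of_subring w A hA
    have := hcond v V e (by exact_mod_cast he) (fun z => by
      rw [IsScalarTower.algebraMap_apply K L E, hV, hv]; push_cast; rfl)
    have e1 : V.val x = w.val x' := hV x'
    have e2 : V.val b = w.val b' := hV b'
    have e3 : V.val a = w.val a' := hV a'
    rw [e1, e2, e3] at this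
    exact_mod_cast this
  let _ : Algebra (ZMod p) L := ((algebraMap K L).comp (algebraMap (ZMod p) K)).toAlgebra
  have _ : IsScalarTower (ZMod p) K L := IsScalarTower.of_algebraMap_eq fun _ => rfl
  have _ : GFF p L := GFF.extend p (L := K) L
  have := kummer_norm p hq (L := L) (E := E) (N := N) (algebraMap K L ζ) (hζ.map_of_injective (algebraMap K L).injective) a' c' ha0' hc0'
    (fun w => loc_a w ha0' hx0' h3' h4' ((key w).imp id (·.2)))
    (fun w => loc_c w hq.two_le hb0' hx0' rfl hc0' h1' ((key w).imp id (·.1)))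
    (fun b h => hpow b h) α hα htop
  rwa [hcc] at this

/-- the rational function field is a global function field -/
theorem gff_ratFunc (p : ℕ) [Fact p.Prime] : GFF p (RatFunc (ZMod p)) where
  ess := by
    have : Algebra.EssFiniteType (Polynomial (ZMod p)) (RatFunc (ZMod p)) :=
      Algebra.EssFiniteType.of_isLocalization (RatFunc (ZMod p)) (nonZeroDivisors (Polynomial (ZMod p)))
    exact .comp _ (Polynomial (ZMod p)) _
  trdeg := by
    have : Algebra.IsAlgebraic (Polynomial (ZMod p)) (RatFunc (ZMod p)) :=
      IsLocalization.isAlgebraic (R := Polynomial (ZMod p)) (RatFunc (ZMod p)) (nonZeroDivisors (Polynomial (ZMod p)))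
    rw [← trdeg_add_eq (ZMod p) (Polynomial (ZMod p)), trdeg_eq_zero (R := Polynomial (ZMod p)), add_zero]
    exact Polynomial.trdeg_of_isDomain

theorem FFVal.val_nonneg_of_monic {K E : Type} [Field K] [Field E] [Algebra K E] (V : FFVal E) (v : FFPrime K) (r : ℚ) (hr : 0 < r)
    (hV : ∀ z : K, V.val (algebraMap K E z) = r * v.val z) (x : E) (hx : x ∈ valIntegralClosure v E) : 0 ≤ V.val x := by
  obtain ⟨P, hP, hc, h0⟩ := hx
  by_contra hneg
  push Not at hneg
  have hx0 : x ≠ 0 := by rintro rfl; simp at hneg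
  rw [Polynomial.aeval_eq_sum_range, Finset.sum_range_succ, Polynomial.coeff_natDegree, hP, one_smul, add_comm] at h0
  refine (V.val_add_eq (pow_ne_zero P.natDegree hx0) ?_).1 h0
  refine V.val_sum_lt _ _ _ ?_
  intro i hi
  by_cases hz : P.coeff i = 0
  · left; simp [hz]
  right
  have hz' : algebraMap K E (P.coeff i) ≠ 0 := by simpa using hz
  rw [Algebra.smul_def, V.val_mul hz' (pow_ne_zero _ hx0), V.val_pow, V.val_pow, hV]
  have h1 : 0 ≤ v.val (P.coeff i) := v.zero_le_ord.1 (hc i)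
  have h1' : (0 : ℚ) ≤ v.val (P.coeff i) := by exact_mod_cast h1
  have h2 := Finset.mem_range.1 hi
  have h3 : (i : ℚ) + 1 ≤ P.natDegree := by exact_mod_cast h2
  nlinarith [mul_nonneg hr.le h1']

/-- pull back of a valuation -/
def FFVal.comap {B E : Type} [Field B] [Field E] (V : FFVal E) (φ : B →+* E) (h : ∃ x : B, V.ord (φ x) ≠ 0 ∧ V.ord (φ x) ≠ ⊤) : FFVal B where
  ord := fun x => V.ord (φ x)
  ord_zero := by rw [map_zero, V.ord_zero]
  ord_ne_top := fun x hx => V.ord_ne_top _ (by simpa using hx)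
  ord_one := by rw [map_one, V.ord_one]
  ord_mul := fun x y => by rw [map_mul, V.ord_mul]
  ord_add := fun x y => by rw [map_add]; exact V.ord_add _ _
  nontrivial := h

theorem FFVal.comap_val {B E : Type} [Field B] [Field E] (V : FFVal E) (φ : B →+* E) (h) (x : B) : (V.comap φ h).val x = V.val (φ x) := rfl

theorem FFVal.exists_comap {K B E : Type} [Field K] [Field B] [Field E] [Algebra K B] [Algebra B E] [Algebra K E] [IsScalarTower K B E]
    (V : FFVal E) (v : FFPrime K) (r : ℚ) (hr : 0 < r) (hV : ∀ z : K, V.val (algebraMap K E z) = r * v.val z) :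
    ∃ V' : FFVal B, (∀ x, V'.val x = V.val (algebraMap B E x)) ∧ V'.RestrictsTo v (algebraMap K B) := by
  obtain ⟨t, ht, ht1⟩ := v.val_surj 1
  have hne : algebraMap K E t ≠ 0 := by simpa using ht
  refine ⟨V.comap (algebraMap B E) ⟨algebraMap K B t, ?_, ?_⟩, fun _ => rfl, ?_⟩
  · rw [← IsScalarTower.algebraMap_apply K B E, V.ord_eq hne, hV, ht1]
    simpa using hr.ne'
  · rw [← IsScalarTower.algebraMap_apply K B E]
    exact V.ord_ne_top _ hne
  · rw [ffval_restricts_iff]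
    exact ⟨r, hr, fun z => by rw [FFVal.comap_val, ← IsScalarTower.algebraMap_apply K B E, hV]⟩

theorem alg_step {q : ℕ} (hq : q.Prime) {K F M : Type} [Field K] [Field F] [Field M] [Algebra K F] [Algebra F M] [Algebra K M] [IsScalarTower K F M]
    [Algebra.IsAlgebraic K F] (α : M) (s : F) (h : α ^ q = algebraMap F M s) (htop : IntermediateField.adjoin F {α} = ⊤) :
    Algebra.IsAlgebraic K M := by
  have hInt : IsIntegral F α := ⟨_, Polynomial.monic_X_pow_sub_C s hq.ne_zero, by simp [h]⟩
  have : Algebra.IsAlgebraic F (IntermediateField.adjoin F {α}) := IntermediateField.isAlgebraic_adjoin_simple hInt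
  have : Algebra.IsAlgebraic F M := by
    rw [htop] at this
    exact IntermediateField.topEquiv.isAlgebraic_iff.1 this
  exact Algebra.IsAlgebraic.trans K F M

theorem forward_dir (p q : ℕ) [Fact p.Prime] (hq : q.Prime)
    (K : Type) [Field K] [Algebra (RatFunc (ZMod p)) K]
    [FiniteDimensional (RatFunc (ZMod p)) K]
    (ζ : K) (hζ : IsPrimitiveRoot ζ q)
    (BK : Type) [Field BK] [Algebra K BK] [Algebra.IsAlgebraic K BK]
    (S : Set (FFPrime K)) (x : BK) (hx : x ≠ 0) (hxS : x ∈ sIntegralClosure S BK)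
    (a b : BK) (ha : a ∈ onesAtS S BK) (hb : b ∈ unitsAtS S BK)
    (ha0 : a ≠ 0) (hc0 : b * x ^ q + b ^ q ≠ 0) : NormTower4Solvable q BK a b x := by
  intro M1 _ _ al1 h1 t1 M3 _ _ al3 h3 t3 M4 _ _ al4 h4 t4 M5 _ _ al5 h5 t5
  let _ : Algebra K M1 := ((algebraMap BK M1).comp (algebraMap K BK)).toAlgebra
  have _ : IsScalarTower K BK M1 := IsScalarTower.of_algebraMap_eq fun _ => rfl
  have _ : Algebra.IsAlgebraic K M1 := alg_step hq al1 _ h1 t1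
  let _ : Algebra K M3 := ((algebraMap M1 M3).comp (algebraMap K M1)).toAlgebra
  have _ : IsScalarTower K M1 M3 := IsScalarTower.of_algebraMap_eq fun _ => rfl
  have _ : Algebra.IsAlgebraic K M3 := alg_step hq al3 _ h3 t3
  let _ : Algebra K M4 := ((algebraMap M3 M4).comp (algebraMap K M3)).toAlgebra
  have _ : IsScalarTower K M3 M4 := IsScalarTower.of_algebraMap_eq fun _ => rfl
  have _ : Algebra.IsAlgebraic K M4 := alg_step hq al4 _ h4 t4
  let _ : Algebra BK M4 := ((algebraMap M3 M4).comp ((algebraMap M1 M3).comp (algebraMap BK M1))).toAlgebra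
  have _ : IsScalarTower K BK M4 := IsScalarTower.of_algebraMap_eq fun _ => rfl
  let _ : Algebra (ZMod p) K := ((algebraMap (RatFunc (ZMod p)) K).comp (algebraMap (ZMod p) (RatFunc (ZMod p)))).toAlgebra
  have _ : IsScalarTower (ZMod p) (RatFunc (ZMod p)) K := IsScalarTower.of_algebraMap_eq fun _ => rfl
  have _ := gff_ratFunc p
  have _ : GFF p K := GFF.extend p (L := RatFunc (ZMod p)) K
  have inj := (algebraMap BK M4).injective
  set φ := algebraMap BK M4 with hφ
  refine forward_core p hq (K := K) (E := M4) (N := M5) ζ hζ (φ a) (φ b) (φ x) (φ (b * x ^ q + b ^ q))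
    (algebraMap M3 M4 (algebraMap M1 M3 al1)) (algebraMap M3 M4 al3) al4 (by simpa using ha0) (by simpa using hx) (by simp)
    (by rwa [ne_eq, map_eq_zero]) ?_ ?_ ?_ ?_ al5 h5 t5
  · rw [← map_pow, ← map_pow, h1]
    change φ _ = _
    rw [map_add, map_one, map_inv₀]
  · rw [← map_pow, h3]
    change φ _ = _
    rw [map_add, map_one, map_inv₀]
  · rw [h4]
    change φ _ = _
    rw [map_add, map_one, map_mul, map_add, map_inv₀, map_inv₀]
  · intro v V r hr hV
    obtain ⟨V', hV', hres⟩ := V.exists_comap (B := BK) v r hr hV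
    by_cases hv : v ∈ S
    · right
      have e1 := hb V' ⟨v, hv, hres⟩
      have e2 := ha V' ⟨v, hv, hres⟩
      refine ⟨by rw [← hV']; exact V'.val_of_ord e1, ?_⟩
      rw [← hV']
      rw [V'.ord_pos_iff] at e2
      have := V'.val_add_eq (x := 1) (y := a - 1) one_ne_zero (e2.imp id (by simp))
      rw [add_sub_cancel] at this
      simpa using this.2
    · left
      obtain ⟨P, hP, hc, h0⟩ := hxS
      rw [← hV']
      obtain ⟨r', hr', hres'⟩ := (ffval_restricts_iff _ _ _).1 hres
      exact V'.val_nonneg_of_monic v r' hr' hres' x ⟨P, hP, fun n => hc n v hv, h0⟩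

end

noncomputable section

namespace FFVal
variable {L : Type} [Field L] (V : FFVal L)

/-- valuation ring -/
def vsub : ValuationSubring L where
  carrier := {x | 0 ≤ V.ord x}
  zero_mem' := by simp [V.ord_zero]
  one_mem' := by simp [V.ord_one]
  add_mem' {x y} hx hy := (le_min hx hy).trans (V.ord_add x y)
  mul_mem' {x y} hx hy := by
    have hx : 0 ≤ V.ord x := hx
    have hy : 0 ≤ V.ord y := hy
    change 0 ≤ V.ord (x * y)
    rw [V.ord_mul]; exact add_nonneg hx hy
  neg_mem' {x} hx := by
    have hx : 0 ≤ V.ord x := hx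
    change 0 ≤ V.ord (-x)
    rwa [V.ord_neg]
  mem_or_inv_mem' x := by
    change 0 ≤ V.ord x ∨ 0 ≤ V.ord x⁻¹
    rw [V.zero_le_ord, V.zero_le_ord, V.val_inv]
    rcases le_total 0 (V.val x) with h | h
    · exact Or.inl h
    · exact Or.inr (by linarith)

theorem mem_vsub {x : L} : x ∈ V.vsub ↔ 0 ≤ V.ord x := Iff.rfl

/-- residue field -/
abbrev rf : Type := IsLocalRing.ResidueField V.vsub

open Classical in
/-- residue map, extended by zero -/
def res (x : L) : V.rf := if h : x ∈ V.vsub then IsLocalRing.residue V.vsub ⟨x, h⟩ else 0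

theorem res_of_mem {x : L} (h : x ∈ V.vsub) : V.res x = IsLocalRing.residue V.vsub ⟨x, h⟩ := dif_pos h

theorem mem_max {x : L} (h : x ∈ V.vsub) : (⟨x, h⟩ : V.vsub) ∈ IsLocalRing.maximalIdeal V.vsub ↔ 0 < V.ord x := by
  rw [IsLocalRing.mem_maximalIdeal, mem_nonunits_iff]
  by_cases hx : x = 0
  · subst hx
    have : (⟨0, h⟩ : V.vsub) = 0 := rfl
    rw [this]
    simp [V.ord_zero]
  constructor
  · intro hu
    by_contra hc
    apply hu
    rw [V.mem_vsub] at h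
    have h0 : V.ord x = 0 := le_antisymm (not_lt.1 hc) h
    have hi : x⁻¹ ∈ V.vsub := by
      rw [V.mem_vsub, V.zero_le_ord, V.val_inv, V.val_of_ord h0]; simp
    exact IsUnit.of_mul_eq_one ⟨x⁻¹, hi⟩ (Subtype.ext (mul_inv_cancel₀ hx))
  · intro hpos hu
    obtain ⟨y, hy⟩ := hu.exists_right_inv
    have h1 : x * (y : L) = 1 := congrArg Subtype.val hy
    have h2 := V.ord_mul x y
    rw [h1, V.ord_one] at h2
    have h3 : 0 ≤ V.ord (y : L) := y.2
    have : 0 < V.ord x + V.ord (y : L) := add_pos_of_pos_of_nonneg hpos h3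
    rw [← h2] at this
    exact lt_irrefl _ this

theorem res_eq_zero {x : L} (h : 0 ≤ V.ord x) : V.res x = 0 ↔ 0 < V.ord x := by
  rw [V.res_of_mem h, IsLocalRing.residue_eq_zero_iff]
  exact V.mem_max h

theorem res_add {x y : L} (hx : 0 ≤ V.ord x) (hy : 0 ≤ V.ord y) : V.res (x + y) = V.res x + V.res y := by
  rw [V.res_of_mem hx, V.res_of_mem hy, V.res_of_mem (add_mem (S := ValuationSubring L) hx hy), ← map_add]; rfl

theorem res_neg {x : L} (hx : 0 ≤ V.ord x) : V.res (-x) = - V.res x := by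
  rw [V.res_of_mem hx, V.res_of_mem (neg_mem (S := ValuationSubring L) hx), ← map_neg]; rfl

theorem res_sub {x y : L} (hx : 0 ≤ V.ord x) (hy : 0 ≤ V.ord y) : V.res (x - y) = V.res x - V.res y := by
  rw [sub_eq_add_neg, V.res_add hx (by rwa [V.ord_neg]), V.res_neg hy, ← sub_eq_add_neg]

theorem res_mul {x y : L} (hx : 0 ≤ V.ord x) (hy : 0 ≤ V.ord y) : V.res (x * y) = V.res x * V.res y := by
  rw [V.res_of_mem hx, V.res_of_mem hy, V.res_of_mem (mul_mem (S := ValuationSubring L) hx hy), ← map_mul]; rfl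

theorem res_one : V.res 1 = 1 := by
  rw [V.res_of_mem (one_mem _)]; exact map_one _

theorem res_pow {x : L} (hx : 0 ≤ V.ord x) (n : ℕ) : V.res (x ^ n) = V.res x ^ n := by
  rw [V.res_of_mem hx, V.res_of_mem (pow_mem (show x ∈ V.vsub from hx) n), ← map_pow]; rfl

theorem res_natCast (n : ℕ) : V.res (n : L) = n := by
  rw [V.res_of_mem (natCast_mem V.vsub n)]; exact map_natCast (IsLocalRing.residue V.vsub) n

theorem pow_nonneg' {x : L} (hx : 0 ≤ V.ord x) (n : ℕ) : 0 ≤ V.ord (x ^ n) := by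
  have : x ^ n ∈ V.vsub := pow_mem (show x ∈ V.vsub from hx) n
  exact this

theorem mul_nonneg' {x y : L} (hx : 0 ≤ V.ord x) (hy : 0 ≤ V.ord y) : 0 ≤ V.ord (x * y) := by
  have : x * y ∈ V.vsub := mul_mem (show x ∈ V.vsub from hx) hy
  exact this

theorem sum_nonneg' {ι : Type*} (s : Finset ι) (f : ι → L) (h : ∀ i ∈ s, 0 ≤ V.ord (f i)) : 0 ≤ V.ord (∑ i ∈ s, f i) := by
  have : ∑ i ∈ s, f i ∈ V.vsub := sum_mem (fun i hi => show f i ∈ V.vsub from h i hi)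
  exact this

theorem res_sum {ι : Type*} (s : Finset ι) (f : ι → L) (h : ∀ i ∈ s, 0 ≤ V.ord (f i)) : V.res (∑ i ∈ s, f i) = ∑ i ∈ s, V.res (f i) := by
  classical
  induction s using Finset.induction_on with
  | empty =>
    simp only [Finset.sum_empty]
    rw [V.res_eq_zero (by simp [V.ord_zero])]; simp [V.ord_zero]
  | insert i s hi ih =>
    rw [Finset.sum_insert hi, Finset.sum_insert hi, V.res_add (h i (by simp)) (V.sum_nonneg' _ _ fun j hj => h j (by simp [hj])),
      ih fun j hj => h j (by simp [hj])]

theorem res_surj (z : V.rf) : ∃ x : L, 0 ≤ V.ord x ∧ V.res x = z := by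
  obtain ⟨x, rfl⟩ := IsLocalRing.residue_surjective z
  exact ⟨x, x.2, V.res_of_mem x.2⟩

theorem res_eq_iff {x y : L} (hx : 0 ≤ V.ord x) (hy : 0 ≤ V.ord y) : V.res x = V.res y ↔ 0 < V.ord (x - y) := by
  rw [← sub_eq_zero, ← V.res_sub hx hy, V.res_eq_zero]
  have : x - y ∈ V.vsub := sub_mem (show x ∈ V.vsub from hx) hy
  exact this

variable {M : Type} [Field M] (W : FFVal M)

/-- functoriality of residue fields -/
theorem exists_rmap (φ : L →+* M) (h : ∀ x, 0 ≤ V.ord x → 0 ≤ W.ord (φ x)) (h' : ∀ x, 0 < V.ord x → 0 < W.ord (φ x)) :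
    ∃ g : V.rf →+* W.rf, ∀ x, 0 ≤ V.ord x → g (V.res x) = W.res (φ x) := by
  let f : V.vsub →+* W.vsub := (φ.comp V.vsub.subtype).codRestrict W.vsub.toSubring fun x => h x x.2
  have hf : ∀ x ∈ IsLocalRing.maximalIdeal V.vsub, ((IsLocalRing.residue W.vsub).comp f) x = 0 := by
    intro x hx
    rw [RingHom.comp_apply, IsLocalRing.residue_eq_zero_iff]
    exact (W.mem_max _).2 (h' x ((V.mem_max x.2).1 hx))
  refine ⟨Ideal.Quotient.lift _ ((IsLocalRing.residue W.vsub).comp f) hf, fun x hx => ?_⟩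
  rw [V.res_of_mem hx, W.res_of_mem (h x hx)]
  exact Ideal.Quotient.lift_mk _ _ _

end FFVal

/-- a prime as a rational valuation -/
theorem FFPrime.residueCard_iff {L : Type} [Field L] (v : FFPrime L) (V : FFVal L) (c : ℚ) (hc : 0 < c) (hV : ∀ x, V.val x = c * v.val x) (n : ℕ) (hn : 0 < n) :
    v.HasResidueCard n ↔ Nat.card V.rf = n := by
  have h1 : ∀ x, 0 ≤ v.ord x ↔ 0 ≤ V.ord x := fun x => by
    rw [v.zero_le_ord, V.zero_le_ord, hV, mul_nonneg_iff_of_pos_left hc]; exact_mod_cast Iff.rfl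
  have h2 : ∀ x, 0 < v.ord x ↔ 0 < V.ord x := fun x => by
    rw [v.ord_pos_iff, V.ord_pos_iff, hV, mul_pos_iff_of_pos_left hc]; exact_mod_cast Iff.rfl
  classical
  unfold FFPrime.HasResidueCard
  simp only [h1, h2]
  constructor
  · rintro ⟨s, hs, h3, h4, h5⟩
    have : Function.Bijective (fun x : s => V.res (x : L)) := by
      constructor
      · intro x y hxy
        by_contra hne
        exact h4 x x.2 y y.2 (fun h => hne (Subtype.ext h)) ((V.res_eq_iff (h3 x x.2) (h3 y y.2)).1 hxy)
      · intro z
        obtain ⟨x, hx, rfl⟩ := V.res_surj z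
        obtain ⟨y, hy, hxy⟩ := h5 x hx
        exact ⟨⟨y, hy⟩, ((V.res_eq_iff hx (h3 y hy)).2 hxy).symm⟩
    rw [← Nat.card_eq_of_bijective _ this]
    simp [hs]
  · intro h
    have hfin : Finite V.rf := Nat.finite_of_card_ne_zero (by omega)
    have := Fintype.ofFinite V.rf
    choose g hg1 hg2 using V.res_surj
    have hinj : Function.Injective g := fun x y hxy => by rw [← hg2 x, ← hg2 y, hxy]
    refine ⟨Finset.univ.image g, ?_, ?_, ?_, ?_⟩
    · rw [Finset.card_image_of_injective _ hinj, Finset.card_univ, ← Nat.card_eq_fintype_card, h]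
    · simp only [Finset.mem_image, Finset.mem_univ, true_and]
      rintro x ⟨z, rfl⟩
      exact hg1 z
    · simp only [Finset.mem_image, Finset.mem_univ, true_and]
      rintro x ⟨z, rfl⟩ y ⟨z', rfl⟩ hne hlt
      rw [← V.res_eq_iff (hg1 _) (hg1 _), hg2, hg2] at hlt
      exact hne (by rw [hlt])
    · intro z hz
      exact ⟨g (V.res z), by simp, by rw [← V.res_eq_iff hz (hg1 _), hg2]⟩

theorem FFPrime.finite_rf (p : ℕ) [Fact p.Prime] {L : Type} [Field L] [Algebra (ZMod p) L] [GFF p L] (w : FFPrime L) (V : FFVal L)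
    (c : ℚ) (hc : 0 < c) (hV : ∀ x, V.val x = c * w.val x) : Finite V.rf := by
  have h1 : ∀ x, 0 ≤ w.ord x ↔ 0 ≤ V.ord x := fun x => by
    rw [w.zero_le_ord, V.zero_le_ord, hV, mul_nonneg_iff_of_pos_left hc]; exact_mod_cast Iff.rfl
  have h2 : ∀ x, 0 < w.ord x ↔ 0 < V.ord x := fun x => by
    rw [w.ord_pos_iff, V.ord_pos_iff, hV, mul_pos_iff_of_pos_left hc]; exact_mod_cast Iff.rfl
  have hlen : Module.length (ZMod p) (w.rq p 1) = w.deg p := (w.coe_deg p).symm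
  have hfd : Module.Finite (ZMod p) (w.rq p 1) := by
    have h := Module.length_ne_top_iff (R := ZMod p) (M := w.rq p 1)
    have h2 : IsFiniteLength (ZMod p) (w.rq p 1) := h.1 (by rw [hlen]; simp)
    have h3 := (isFiniteLength_iff_isNoetherian_isArtinian.1 h2).1
    infer_instance
  have hfin : Finite (w.rq p 1) := Module.finite_of_finite (ZMod p)
  choose g hg1 hg2 using V.res_surj
  have hm : ∀ z, g z ∈ w.ball p 0 := fun z => (h1 _).2 (hg1 z)
  refine Finite.of_injective (fun z => w.rqm p 1 ⟨g z, hm z⟩) ?_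
  intro x y hxy
  have h3 : w.rqm p 1 (⟨g x, hm x⟩ - ⟨g y, hm y⟩) = 0 := by rw [map_sub, sub_eq_zero]; exact hxy
  rw [w.rqm_eq_zero p] at h3
  have h4 : 0 < w.ord (g x - g y) := by
    rw [w.ord_pos_iff_one_le]; exact h3
  rw [h2, ← V.res_eq_iff (hg1 _) (hg1 _), hg2, hg2] at h4
  exact h4

theorem FFPrime.resDeg_eq {K L : Type} [Field K] [Field L] (w : FFPrime L) (v : FFPrime K) (V : FFVal L) (V' : FFVal K) (c c' : ℚ) (hc : 0 < c) (hc' : 0 < c')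
    (hV : ∀ x, V.val x = c * w.val x) (hV' : ∀ x, V'.val x = c' * v.val x) [Finite V.rf] [Finite V'.rf] (f : ℕ) (hf : 0 < f)
    (h : Nat.card V.rf = Nat.card V'.rf ^ f) : w.resDeg v = f := by
  have hpos : 0 < Nat.card V.rf := Nat.card_pos
  have hone : 1 < Nat.card V'.rf := Finite.one_lt_card
  have hex : ∃ f : ℕ, 0 < f ∧ ∃ m n : ℕ, 1 < m ∧ v.HasResidueCard m ∧ w.HasResidueCard n ∧ n = m ^ f :=
    ⟨f, hf, _, _, hone, (v.residueCard_iff V' c' hc' hV' _ (by omega)).2 rfl, (w.residueCard_iff V c hc hV _ hpos).2 rfl, h⟩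
  unfold FFPrime.resDeg
  rw [dif_pos hex]
  obtain ⟨-, m, n, hm, h1, h2, h3⟩ := hex.choose_spec
  rw [v.residueCard_iff V' c' hc' hV' m (by omega)] at h1
  have hn : 0 < n := by rw [h3]; positivity
  rw [w.residueCard_iff V c hc hV n hn] at h2
  subst h1 h2
  rw [h] at h3
  exact (Nat.pow_right_injective hone h3).symm

theorem FFPrime.ramIdx_eq {K L : Type} [Field K] [Field L] (w : FFPrime L) (v : FFPrime K) (φ : K →+* L) (e : ℕ) (he : 0 < e)
    (h : ∀ x, w.val (φ x) = e * v.val x) : w.ramIdx v φ = e := by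
  have hex : ∃ e : ℕ, w.LiesOverWith v φ e := ⟨e, (ffprime_liesOverWith_iff _ _ _ _).2 ⟨he, h⟩⟩
  unfold FFPrime.ramIdx
  rw [dif_pos hex]
  obtain ⟨-, h2⟩ := (ffprime_liesOverWith_iff _ _ _ _).1 hex.choose_spec
  obtain ⟨t, ht, ht1⟩ := v.val_surj 1
  have h3 := h t
  rw [h2 t, ht1] at h3
  simpa using h3

theorem card_rf_pow {k k' : Type} [Field k] [Field k'] [Finite k'] [Finite k] (g : k →+* k') : ∃ f : ℕ, 0 < f ∧ Nat.card k' = Nat.card k ^ f := by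
  let _ := g.toAlgebra
  have : Module.Finite k k' := Module.Finite.of_finite
  exact ⟨Module.finrank k k', Module.finrank_pos, Module.natCard_eq_pow_finrank⟩

end

noncomputable section

namespace FFVal
variable {E : Type} [Field E] (V : FFVal E)

theorem le_add {r : WithTop ℚ} {x y : E} (hx : r ≤ V.ord x) (hy : r ≤ V.ord y) : r ≤ V.ord (x + y) := (le_min hx hy).trans (V.ord_add x y)

theorem lt_add {r : WithTop ℚ} {x y : E} (hx : r < V.ord x) (hy : r < V.ord y) : r < V.ord (x + y) := (lt_min hx hy).trans_le (V.ord_add x y)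

theorem ord_sub_comm (x y : E) : V.ord (x - y) = V.ord (y - x) := by rw [← V.ord_neg, neg_sub]

theorem le_sub {r : WithTop ℚ} {x y : E} (hx : r ≤ V.ord x) (hy : r ≤ V.ord y) : r ≤ V.ord (x - y) := by
  rw [sub_eq_add_neg]; exact V.le_add hx (by rwa [V.ord_neg])

theorem lt_sub {r : WithTop ℚ} {x y : E} (hx : r < V.ord x) (hy : r < V.ord y) : r < V.ord (x - y) := by
  rw [sub_eq_add_neg]; exact V.lt_add hx (by rwa [V.ord_neg])

theorem le_sum {ι : Type*} {r : WithTop ℚ} (s : Finset ι) (f : ι → E) (h : ∀ i ∈ s, r ≤ V.ord (f i)) : r ≤ V.ord (∑ i ∈ s, f i) := by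
  classical
  induction s using Finset.induction_on with
  | empty => simp [V.ord_zero]
  | insert i s hi ih =>
    rw [Finset.sum_insert hi]
    exact V.le_add (h i (by simp)) (ih fun j hj => h j (by simp [hj]))

theorem one_le_of {ε : ℚ} (hε : 0 < ε) {u : E} (hu : (ε : WithTop ℚ) ≤ V.ord (u - 1)) : 0 ≤ V.ord u := by
  have h1 : u = (u - 1) + 1 := by ring
  rw [h1]
  exact V.le_add (le_trans (by exact_mod_cast hε.le) hu) (by rw [V.ord_one])

theorem one_mul_of {ε : ℚ} (hε : 0 < ε) {u v : E} (hu : (ε : WithTop ℚ) ≤ V.ord (u - 1)) (hv : (ε : WithTop ℚ) ≤ V.ord (v - 1)) :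
    (ε : WithTop ℚ) ≤ V.ord (u * v - 1) := by
  have h1 : u * v - 1 = (u - 1) * v + (v - 1) := by ring
  rw [h1]
  refine V.le_add ?_ hv
  rw [V.ord_mul]
  exact le_add_of_le_of_nonneg hu (V.one_le_of hε hv)

theorem one_pow_of {ε : ℚ} (hε : 0 < ε) {u : E} (hu : (ε : WithTop ℚ) ≤ V.ord (u - 1)) (n : ℕ) : (ε : WithTop ℚ) ≤ V.ord (u ^ n - 1) := by
  induction n with
  | zero => simp [V.ord_zero]
  | succ n ih => rw [pow_succ]; exact V.one_mul_of hε ih hu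

variable {F : Type} [Field F] [Algebra F E]

theorem newton {q : ℕ} (hq : V.ord (q : E) = 0) {ε : ℚ} (hε : 0 < ε) (α : E) (hα : (ε : WithTop ℚ) ≤ V.ord (α - 1)) (A : F)
    (hA : α ^ q = algebraMap F E A) (n : ℕ) : ∃ θ : F, (((n + 1) * ε : ℚ) : WithTop ℚ) ≤ V.ord (algebraMap F E θ - α) := by
  have hq0 : (q : E) ≠ 0 := by
    intro h; rw [h, V.ord_zero] at hq; simp at hq
  induction n with
  | zero => exact ⟨1, by rw [map_one, V.ord_sub_comm]; simpa using hα⟩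
  | succ n ih =>
    obtain ⟨θ, hθ⟩ := ih
    refine ⟨θ - (θ ^ q - A) / q, ?_⟩
    set t := algebraMap F E θ with ht
    have hθ1 : (ε : WithTop ℚ) ≤ V.ord (t - 1) := by
      have : t - 1 = (t - α) + (α - 1) := by ring
      rw [this]
      refine V.le_add (le_trans ?_ hθ) hα
      have : ε ≤ (n + 1) * ε := by nlinarith [show (0 : ℚ) ≤ n from Nat.cast_nonneg n]
      exact_mod_cast this
    set G := ∑ i ∈ Finset.range q, t ^ i * α ^ (q - 1 - i) with hG
    have hGe : G * (t - α) = t ^ q - α ^ q := (Commute.all t α).geom_sum₂_mul q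
    have h1 : algebraMap F E (θ - (θ ^ q - A) / q) - α = (t - α) * ((q - G) * (q : E)⁻¹) := by
      rw [map_sub, map_div₀, map_sub, map_pow, ← hA, map_natCast, ← ht, ← hGe]
      field_simp
      ring
    have h2 : (ε : WithTop ℚ) ≤ V.ord ((q : E) - G) := by
      have : (q : E) - G = - ∑ i ∈ Finset.range q, (t ^ i * α ^ (q - 1 - i) - 1) := by
        rw [Finset.sum_sub_distrib, ← hG]; simp
      rw [this, V.ord_neg]
      exact V.le_sum _ _ fun i _ => V.one_mul_of hε (V.one_pow_of hε hθ1 _) (V.one_pow_of hε hα _)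
    have h3 : V.ord (q : E)⁻¹ = 0 := by
      rw [V.ord_eq (inv_ne_zero hq0), V.val_inv, V.val_of_ord hq]; simp
    rw [h1, V.ord_mul, V.ord_mul, h3, add_zero]
    have h4 : (((((n + 1 : ℕ) : ℚ) + 1) * ε : ℚ) : WithTop ℚ) = (((n + 1) * ε : ℚ) : WithTop ℚ) + (ε : WithTop ℚ) := by
      rw [← WithTop.coe_add]; congr 1; push_cast; ring
    rw [h4]
    exact add_le_add hθ h2

theorem close {q : ℕ} (hq0 : 0 < q) (hq : V.ord (q : E) = 0) (α : E) (hα : 0 < V.ord (α - 1)) (A : F)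
    (hA : α ^ q = algebraMap F E A) (y : E) (hy : y ∈ IntermediateField.adjoin F {α}) (hy0 : y ≠ 0) :
    ∃ z : F, V.ord y < V.ord (y - algebraMap F E z) := by
  obtain ⟨ε, hε, hαε⟩ : ∃ ε : ℚ, 0 < ε ∧ (ε : WithTop ℚ) ≤ V.ord (α - 1) := by
    by_cases h1 : α - 1 = 0
    · exact ⟨1, one_pos, by rw [h1, V.ord_zero]; exact le_top⟩
    · rw [V.ord_eq h1] at hα ⊢
      exact ⟨_, by exact_mod_cast hα, le_rfl⟩
  have hInt : IsIntegral F α := ⟨_, Polynomial.monic_X_pow_sub_C A hq0.ne', by simp [hA]⟩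
  obtain ⟨P, rfl⟩ : ∃ P : Polynomial F, Polynomial.aeval α P = y := by
    rw [← IntermediateField.mem_toSubalgebra, IntermediateField.adjoin_simple_toSubalgebra_of_isAlgebraic hInt.isAlgebraic,
      Algebra.adjoin_singleton_eq_range_aeval] at hy
    exact hy
  set B : ℚ := ∑ i ∈ Finset.range (P.natDegree + 1), |V.val (algebraMap F E (P.coeff i))| with hB
  have hBi : ∀ i ∈ Finset.range (P.natDegree + 1), ((-B : ℚ) : WithTop ℚ) ≤ V.ord (algebraMap F E (P.coeff i)) := by
    intro i hi
    rw [V.coe_le_ord]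
    right
    have h1 : |V.val (algebraMap F E (P.coeff i))| ≤ B :=
      Finset.single_le_sum (f := fun i => |V.val (algebraMap F E (P.coeff i))|) (fun j _ => abs_nonneg _) hi
    have := neg_abs_le (V.val (algebraMap F E (P.coeff i)))
    linarith
  obtain ⟨n, hn⟩ := exists_nat_gt ((V.val (Polynomial.aeval α P) + B) / ε)
  obtain ⟨θ, hθ⟩ := V.newton hq hε α hαε A hA n
  refine ⟨P.eval θ, ?_⟩
  set t := algebraMap F E θ with ht
  have hθ1 : 0 ≤ V.ord t := by
    have : t = (t - α) + α := by ring
    rw [this]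
    refine V.le_add (le_trans ?_ hθ) (V.one_le_of hε hαε)
    have : 0 ≤ (n + 1) * ε := by positivity
    exact_mod_cast this
  have hα1 := V.one_le_of hε hαε
  have hpow : ∀ i : ℕ, (((n + 1) * ε : ℚ) : WithTop ℚ) ≤ V.ord (α ^ i - t ^ i) := by
    intro i
    rw [← (Commute.all α t).geom_sum₂_mul i, V.ord_mul, V.ord_sub_comm α t]
    refine le_add_of_nonneg_of_le ?_ hθ
    exact V.sum_nonneg' _ _ fun j _ => V.mul_nonneg' (V.pow_nonneg' hα1 _) (V.pow_nonneg' hθ1 _)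
  have hdiff : Polynomial.aeval α P - algebraMap F E (P.eval θ) =
      ∑ i ∈ Finset.range (P.natDegree + 1), algebraMap F E (P.coeff i) * (α ^ i - t ^ i) := by
    rw [← Polynomial.aeval_algebraMap_apply_eq_algebraMap_eval, Polynomial.aeval_eq_sum_range, Polynomial.aeval_eq_sum_range, ← Finset.sum_sub_distrib]
    refine Finset.sum_congr rfl fun i _ => ?_
    rw [Algebra.smul_def, Algebra.smul_def, mul_sub]
  rw [hdiff]
  refine lt_of_lt_of_le ?_ (V.le_sum (r := ((-B + (n + 1) * ε : ℚ) : WithTop ℚ)) _ _ fun i hi => ?_)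
  · rw [V.ord_eq hy0]
    rw [div_lt_iff₀ hε] at hn
    have : V.val (Polynomial.aeval α P) < -B + (n + 1) * ε := by nlinarith
    exact_mod_cast this
  · rw [V.ord_mul, WithTop.coe_add]
    exact add_le_add (hBi i hi) (hpow i)

/-- the two local non-power conditions -/
def NP (F : Type) [Field F] [Algebra F E] (q : ℕ) (a c : E) : Prop :=
  (∀ y : F, y ≠ 0 → q * V.val (algebraMap F E y) ≠ V.val c) ∧ (∀ y : F, ¬ 0 < V.ord ((algebraMap F E y) ^ q - a))

theorem np_step {q : ℕ} (hq0 : 0 < q) (hq : V.ord (q : E) = 0) (α : E) (hα : 0 < V.ord (α - 1)) (A : F)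
    (hA : α ^ q = algebraMap F E A) {a c : E} (ha : V.ord a = 0) (h : V.NP F q a c) : V.NP (IntermediateField.adjoin F {α}) q a c := by
  constructor
  · intro y hy
    have hy' : (y : E) ≠ 0 := fun h => hy (Subtype.ext h)
    obtain ⟨z, hz⟩ := V.close hq0 hq α hα A hA y y.2 hy'
    have h1 := V.val_add_eq (x := (y : E)) (y := algebraMap F E z - y) hy' (by
      rw [V.ord_sub_comm, V.ord_eq hy', V.coe_lt_ord] at hz; exact hz)
    rw [add_sub_cancel] at h1
    have hz0 : z ≠ 0 := by rintro rfl; simp at h1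
    have := h.1 z hz0
    rw [h1.2] at this
    exact this
  · intro y hy
    by_cases hy0 : y = 0
    · refine h.2 0 ?_
      rw [hy0] at hy
      rwa [map_zero] at hy ⊢
    have hy' : (y : E) ≠ 0 := fun h => hy0 (Subtype.ext h)
    obtain ⟨z, hz⟩ := V.close hq0 hq α hα A hA y y.2 hy'
    have hy : 0 < V.ord ((y : E) ^ q - a) := hy
    have hyq : 0 ≤ V.ord ((y : E) ^ q) := by
      have : (y : E) ^ q = ((y : E) ^ q - a) + a := by ring
      rw [this]; exact V.le_add hy.le ha.ge
    have hy0 : 0 ≤ V.ord (y : E) := by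
      rw [V.zero_le_ord] at hyq ⊢
      rw [V.val_pow] at hyq
      exact nonneg_of_mul_nonneg_right hyq (by exact_mod_cast hq0)
    set t := algebraMap F E z with ht
    have hzy : 0 < V.ord ((y : E) - t) := lt_of_le_of_lt hy0 hz
    have ht0 : 0 ≤ V.ord t := by
      have : t = y - (y - t) := by ring
      rw [this]; exact V.le_sub hy0 hzy.le
    refine h.2 z ?_
    have e1 : t ^ q - a = ((y : E) ^ q - a) - ((y : E) ^ q - t ^ q) := by ring
    rw [← ht, e1]
    refine V.lt_sub hy ?_
    rw [← (Commute.all (y : E) t).geom_sum₂_mul q, V.ord_mul]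
    refine lt_of_lt_of_le hzy (le_add_of_nonneg_left ?_)
    exact V.sum_nonneg' _ _ fun j _ => V.mul_nonneg' (V.pow_nonneg' hy0 _) (V.pow_nonneg' ht0 _)

end FFVal

end

noncomputable section

open Polynomial in
theorem val_lin {q : ℕ} (hq : q.Prime) {F M : Type} [Field F] [Field M] [Algebra F M] (V0 : FFVal F) (V : FFVal M)
    (h : ∀ x : F, V0.ord x = V.ord (algebraMap F M x)) (α : M) (a : F) (hα : α ^ q = algebraMap F M a) (ha : V0.ord a = 0)
    (hnp : ∀ z : F, ¬ 0 < V0.ord (z ^ q - a)) (P : F[X]) (hdeg : P.natDegree < q) (hP : ∀ i, 0 ≤ V0.ord (P.coeff i)) (m : ℕ)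
    (hm : V0.ord (P.coeff m) = 0) : V.ord (aeval α P) = 0 := by
  obtain ⟨g, hg⟩ := V0.exists_rmap V (algebraMap F M) (fun x hx => by rwa [← h]) (fun x hx => by rwa [← h])
  have hα0 : 0 ≤ V.ord α := by
    have : 0 ≤ V.ord (α ^ q) := by rw [hα, ← h, ha]
    rw [V.zero_le_ord] at this ⊢
    rw [V.val_pow] at this
    exact nonneg_of_mul_nonneg_right this (by exact_mod_cast hq.pos)
  let _ := g.toAlgebra
  have hgm : ∀ z, algebraMap V0.rf V.rf z = g z := fun _ => rfl
  have hirr : Irreducible (X ^ q - C (V0.res a)) := by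
    refine X_pow_sub_C_irreducible_of_prime hq fun b hb => ?_
    obtain ⟨z, hz, rfl⟩ := V0.res_surj b
    rw [← V0.res_pow hz, V0.res_eq_iff (V0.pow_nonneg' hz _) ha.ge] at hb
    exact hnp z hb
  have hmin : minpoly V0.rf (V.res α) = X ^ q - C (V0.res a) := by
    refine (minpoly.eq_of_irreducible_of_monic hirr ?_ (monic_X_pow_sub_C _ hq.ne_zero)).symm
    rw [map_sub, map_pow, aeval_X, aeval_C, hgm, hg a ha.ge, ← hα, V.res_pow hα0, sub_self]
  let Q : V0.rf[X] := ∑ i ∈ Finset.range q, C (V0.res (P.coeff i)) * X ^ i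
  have hQc : Q.coeff m = V0.res (P.coeff m) := by
    have hmq : m < q := by
      by_contra hc
      rw [coeff_eq_zero_of_natDegree_lt (by omega), V0.ord_zero] at hm
      simp at hm
    simp only [Q, finsetSum_coeff, coeff_C_mul, coeff_X_pow]
    simp [hmq]
  have hQ0 : Q ≠ 0 := by
    intro h0
    rw [h0, coeff_zero] at hQc
    have := (V0.res_eq_zero (hP m)).1 hQc.symm
    rw [hm] at this
    exact lt_irrefl _ this
  have hpos : ∀ i ∈ Finset.range q, 0 ≤ V.ord (algebraMap F M (P.coeff i) * α ^ i) := fun i _ =>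
    V.mul_nonneg' (by rw [← h]; exact hP i) (V.pow_nonneg' hα0 i)
  have hPe : aeval α P = ∑ i ∈ Finset.range q, algebraMap F M (P.coeff i) * α ^ i := by
    rw [aeval_eq_sum_range' hdeg]
    exact Finset.sum_congr rfl fun i _ => Algebra.smul_def _ _
  have hPpos : 0 ≤ V.ord (aeval α P) := by rw [hPe]; exact V.sum_nonneg' _ _ hpos
  have hQe : aeval (V.res α) Q = V.res (aeval α P) := by
    rw [hPe, V.res_sum _ _ hpos, map_sum]
    refine Finset.sum_congr rfl fun i _ => ?_
    rw [map_mul, map_pow, aeval_X, aeval_C, hgm, hg _ (hP i), V.res_mul (by rw [← h]; exact hP i) (V.pow_nonneg' hα0 i), V.res_pow hα0]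
  by_contra hne
  have hlt : 0 < V.ord (aeval α P) := lt_of_le_of_ne hPpos (Ne.symm hne)
  rw [← V.res_eq_zero hPpos, ← hQe] at hlt
  have hdvd := minpoly.dvd _ _ hlt
  rw [hmin] at hdvd
  have h1 := natDegree_le_of_dvd hdvd hQ0
  rw [natDegree_X_pow_sub_C] at h1
  have h2 : Q.degree < q := by
    refine lt_of_le_of_lt (degree_sum_le _ _) ?_
    rw [Finset.sup_lt_iff (by simp)]
    intro i hi
    refine lt_of_le_of_lt (degree_C_mul_X_pow_le _ _) ?_
    exact_mod_cast Finset.mem_range.1 hi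
  rw [degree_eq_natDegree hQ0] at h2
  have h3 : Q.natDegree < q := by exact_mod_cast h2
  omega

open Polynomial in
theorem exists_val_lin {q : ℕ} (hq : q.Prime) {F M : Type} [Field F] [Field M] [Algebra F M] (V0 : FFVal F)
    (α : M) (a : F) (hα : α ^ q = algebraMap F M a) (ha : V0.ord a = 0) (htop : IntermediateField.adjoin F {α} = ⊤)
    (hnp : ∀ z : F, ¬ 0 < V0.ord (z ^ q - a)) (y : M) (hy : y ≠ 0) :
    ∃ m : F, m ≠ 0 ∧ ∀ V : FFVal M, (∀ x : F, V0.ord x = V.ord (algebraMap F M x)) → V.val y = V0.val m := by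
  have hInt : IsIntegral F α := ⟨_, monic_X_pow_sub_C a hq.ne_zero, by simp [hα]⟩
  obtain ⟨P, hPd, rfl⟩ : ∃ P : F[X], P.natDegree < q ∧ aeval α P = y := by
    have hyt : y ∈ IntermediateField.adjoin F {α} := by rw [htop]; trivial
    rw [← IntermediateField.mem_toSubalgebra, IntermediateField.adjoin_simple_toSubalgebra_of_isAlgebraic hInt.isAlgebraic,
      Algebra.adjoin_singleton_eq_range_aeval] at hyt
    obtain ⟨P, hP⟩ := hyt
    have hmon := monic_X_pow_sub_C a hq.ne_zero
    refine ⟨P %ₘ (X ^ q - C a), ?_, ?_⟩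
    · have := natDegree_modByMonic_lt P hmon (by
        intro h1
        have := congrArg natDegree h1
        rw [natDegree_X_pow_sub_C, natDegree_one] at this
        exact hq.ne_zero this)
      rwa [natDegree_X_pow_sub_C] at this
    · rw [← hP]
      conv_rhs => rw [← modByMonic_add_div P (X ^ q - C a)]
      simp [hα]
  have hP0 : P ≠ 0 := by rintro rfl; simp at hy
  obtain ⟨m, hm, hmin⟩ := Finset.exists_min_image P.support (fun i => V0.val (P.coeff i)) (by simpa using hP0)
  have hm0 : P.coeff m ≠ 0 := by simpa using hm
  refine ⟨P.coeff m, hm0, fun V hV => ?_⟩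
  have key := val_lin hq V0 V hV α a hα ha hnp (C (P.coeff m)⁻¹ * P) (lt_of_le_of_lt (natDegree_C_mul_le _ _) hPd) (fun i => by
    rw [coeff_C_mul, V0.zero_le_ord]
    by_cases hi : P.coeff i = 0
    · simp [hi]
    rw [V0.val_mul (inv_ne_zero hm0) hi, V0.val_inv]
    have := hmin i (by simpa using hi)
    linarith) m (by rw [coeff_C_mul, inv_mul_cancel₀ hm0, V0.ord_one])
  rw [map_mul, aeval_C] at key
  have h1 := V.val_of_ord key
  have h2 : V.val (algebraMap F M (P.coeff m)⁻¹) = V0.val (P.coeff m)⁻¹ := by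
    rw [FFVal.val, FFVal.val, hV]
  rw [V.val_mul (by simpa using hm0) hy, h2, V0.val_inv] at h1
  linarith

theorem val_aut {F M : Type} [Field F] [Field M] [Algebra F M] (V : FFVal M) (V0 : FFVal F) (hV : ∀ x : F, V0.ord x = V.ord (algebraMap F M x))
    (y : M) (r : ℚ) (hm : ∀ V : FFVal M, (∀ x : F, V0.ord x = V.ord (algebraMap F M x)) → V.val y = r) (σ : M ≃ₐ[F] M) : V.val (σ y) = r := by
  obtain ⟨t, ht1, ht2⟩ := V0.nontrivial
  have h0 : ∀ x, (σ : M →+* M) (algebraMap F M x) = algebraMap F M x := fun x => σ.commutes x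
  have h1 : ∃ x : M, V.ord ((σ : M →+* M) x) ≠ 0 ∧ V.ord ((σ : M →+* M) x) ≠ ⊤ :=
    ⟨algebraMap F M t, by rw [h0, ← hV]; exact ht1, by rw [h0, ← hV]; exact ht2⟩
  exact hm (V.comap (σ : M →+* M) h1) (fun x => by
    change V0.ord x = V.ord ((σ : M →+* M) (algebraMap F M x))
    rw [h0, hV])

theorem val_prod_const {M ι : Type} [Field M] (V : FFVal M) (f : ι → M) (hf : ∀ i, f i ≠ 0) (r : ℚ) (h : ∀ i, V.val (f i) = r) (s : Finset ι) :
    V.val (∏ i ∈ s, f i) = s.card * r := by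
  classical
  induction s using Finset.induction_on with
  | empty => simp
  | insert i s hi ih =>
    rw [Finset.prod_insert hi, V.val_mul (hf i) (Finset.prod_ne_zero_iff.2 fun j _ => hf j), ih, h, Finset.card_insert_of_notMem hi]
    push_cast; ring

theorem kummer_galois {q : ℕ} (hq : q.Prime) {F M : Type} [Field F] [Field M] [Algebra F M] (ζ : F) (hζ : IsPrimitiveRoot ζ q)
    (α : M) (a : F) (hα : α ^ q = algebraMap F M a) (htop : IntermediateField.adjoin F {α} = ⊤) (hne : ∀ b : F, b ^ q ≠ a) :
    IsGalois F M ∧ Module.finrank F M = q := by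
  have hirr := X_pow_sub_C_irreducible_of_prime hq hne
  have hprim : (primitiveRoots q F).Nonempty := ⟨ζ, (mem_primitiveRoots hq.pos).2 hζ⟩
  have hmin : minpoly F α = Polynomial.X ^ q - Polynomial.C a :=
    (minpoly.eq_of_irreducible_of_monic hirr (by simp [hα]) (Polynomial.monic_X_pow_sub_C _ hq.ne_zero)).symm
  have hInt : IsIntegral F α := ⟨_, Polynomial.monic_X_pow_sub_C a hq.ne_zero, by simp [hα]⟩
  have hfr : Module.finrank F M = q := by
    rw [← IntermediateField.finrank_top', ← htop, IntermediateField.adjoin.finrank hInt, hmin, Polynomial.natDegree_X_pow_sub_C]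
  have hfd : FiniteDimensional F M := Module.finite_of_finrank_pos (by rw [hfr]; exact hq.pos)
  have hsp : Polynomial.IsSplittingField F M (Polynomial.X ^ q - Polynomial.C a) := by
    have := isSplittingField_X_pow_sub_C_of_root_adjoin_eq_top (K := F) (L := M) (a := a) (α := α) (by rw [hfr]; exact hprim) (by rw [hfr]; exact hα) htop
    rwa [hfr] at this
  exact ⟨isGalois_of_isSplittingField_X_pow_sub_C hprim hirr M, hfr⟩

/-- norms from the residually inert Kummer extension have value divisible by `q` -/
theorem norm_val_dvd {q : ℕ} (hq : q.Prime) {F M : Type} [Field F] [Field M] [Algebra F M] (ζ : F) (hζ : IsPrimitiveRoot ζ q)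
    (V : FFVal M) (V0 : FFVal F) (hV : ∀ x : F, V0.ord x = V.ord (algebraMap F M x))
    (α : M) (a : F) (hα : α ^ q = algebraMap F M a) (ha : V0.ord a = 0) (htop : IntermediateField.adjoin F {α} = ⊤)
    (hnp : ∀ z : F, ¬ 0 < V0.ord (z ^ q - a)) (y : M) (hy : y ≠ 0) : ∃ m : F, m ≠ 0 ∧ V0.val (Algebra.norm F y) = q * V0.val m := by
  obtain ⟨m, hm0, hm⟩ := exists_val_lin hq V0 α a hα ha htop hnp y hy
  refine ⟨m, hm0, ?_⟩
  have hne : ∀ b : F, b ^ q ≠ a := by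
    intro b hb
    apply hnp b
    rw [hb, sub_self, V0.ord_zero]
    exact WithTop.coe_lt_top 0
  obtain ⟨hgal, hfr⟩ := kummer_galois hq ζ hζ α a hα htop hne
  have hfd : FiniteDimensional F M := Module.finite_of_finrank_pos (by rw [hfr]; exact hq.pos)
  have h1 : V0.val (Algebra.norm F y) = V.val (algebraMap F M (Algebra.norm F y)) := by
    unfold FFVal.val; rw [hV]
  rw [h1, Algebra.norm_eq_prod_automorphisms, val_prod_const V _ (fun σ => (map_ne_zero σ).2 hy) _ (val_aut V V0 hV y _ hm),
    Finset.card_univ, ← Nat.card_eq_fintype_card, IsGalois.card_aut_eq_finrank, hfr]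

end

noncomputable section

theorem FFVal.ord_natCast {E : Type} [Field E] (V : FFVal E) {p q : ℕ} (hp : p.Prime) (hq : q.Prime) (hqp : q ≠ p) (hE : (p : E) = 0) :
    (q : V.rf) ≠ 0 ∧ V.ord (q : E) = 0 := by
  have h1 : (q : V.rf) ≠ 0 := by
    intro h
    have hp0 : (p : V.rf) = 0 := by
      rw [← V.res_natCast, hE, V.res_eq_zero (by simp [V.ord_zero])]; simp [V.ord_zero]
    have hcop : Nat.Coprime q p := (Nat.coprime_primes hq hp).2 hqp
    have h2 := Nat.isCoprime_iff_coprime.2 hcop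
    obtain ⟨u, w, huw⟩ := h2
    have h3 := congrArg (Int.cast (R := V.rf)) huw
    push_cast at h3
    rw [h, hp0] at h3
    simp at h3
  refine ⟨h1, ?_⟩
  have h0 : 0 ≤ V.ord (q : E) := natCast_mem V.vsub q
  by_contra hne
  apply h1
  rw [← V.res_natCast, V.res_eq_zero h0]
  exact lt_of_le_of_ne h0 (Ne.symm hne)

section
variable {F0 B : Type} [Field F0] [Field B] [Algebra F0 B] [Algebra.IsAlgebraic F0 B] (V : FFVal B) (v0 : FFPrime F0) (c0 : ℚ) (hc0 : 0 < c0)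
  (hV : ∀ x : F0, V.val (algebraMap F0 B x) = c0 * v0.val x)

theorem exists_sub_prime (hc0 : 0 < c0) (hV : ∀ x : F0, V.val (algebraMap F0 B x) = c0 * v0.val x) (L : IntermediateField F0 B) [FiniteDimensional F0 L] :
    ∃ (W : FFVal L) (vL : FFPrime L) (c : ℚ) (e : ℕ), 0 < c ∧ 0 < e ∧ (∀ x : L, W.ord x = V.ord (x : B)) ∧ (∀ x : L, W.val x = c * vL.val x) ∧
      (∀ x : L, V.val (x : B) = c * vL.val x) ∧ c0 = c * e ∧ vL.ramIdx v0 (algebraMap F0 L) = e ∧ V.RestrictsTo vL L.val.toRingHom := by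
  obtain ⟨t, ht, ht1⟩ := v0.val_surj 1
  have htB : algebraMap F0 B t ≠ 0 := by simpa using ht
  have hex : ∃ x : L, V.ord (L.val.toRingHom x) ≠ 0 ∧ V.ord (L.val.toRingHom x) ≠ ⊤ := by
    refine ⟨algebraMap F0 L t, ?_, ?_⟩
    · change V.ord (algebraMap F0 B t) ≠ 0
      rw [V.ord_eq htB, hV, ht1]
      simpa using hc0.ne'
    · change V.ord (algebraMap F0 B t) ≠ ⊤
      exact V.ord_ne_top _ htB
  let W := V.comap L.val.toRingHom hex
  have hW : ∀ x : L, W.val x = V.val (x : B) := fun x => rfl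
  obtain ⟨vL, c, hc, hvL⟩ := W.exists_prime_of_base v0 c0 hc0 (fun x => by rw [hW]; exact hV x)
  have hbase : ∀ x : F0, c * vL.val (algebraMap F0 L x) = c0 * v0.val x := fun x => by
    rw [← hvL, hW]; exact hV x
  have h1 := hbase t
  rw [ht1] at h1
  have hpos : 0 < vL.val (algebraMap F0 L t) := by
    have : 0 < c * vL.val (algebraMap F0 L t) := by rw [h1]; simpa using hc0
    exact_mod_cast pos_of_mul_pos_right this hc.le
  obtain ⟨e, he⟩ := Int.eq_ofNat_of_zero_le hpos.le
  have he0 : 0 < e := by omega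
  have hce : c0 = c * e := by
    rw [he] at h1; push_cast at h1; linarith
  refine ⟨W, vL, c, e, hc, he0, fun x => rfl, hvL, fun x => by rw [← hW, hvL], hce, ?_, ?_⟩
  · refine vL.ramIdx_eq v0 _ e he0 fun x => ?_
    have h2 := hbase x
    rw [hce, mul_assoc] at h2
    have := mul_left_cancel₀ hc.ne' h2
    exact_mod_cast this
  · rw [ffval_restricts_iff]
    exact ⟨c, hc, fun x => hvL x⟩

theorem exists_ram {q : ℕ} (hq : q.Prime) (hqb : IsQBounded q F0 B) (hc0 : 0 < c0) (hV : ∀ x : F0, V.val (algebraMap F0 B x) = c0 * v0.val x) :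
    ∃ π : B, π ≠ 0 ∧ ∀ y : B, y ≠ 0 → q * V.val y ≠ V.val π := by
  by_contra hcon
  push Not at hcon
  have := Fact.mk hq
  have key : ∀ n : ℕ, ∃ L : IntermediateField F0 B, FiniteDimensional F0 L ∧ ∃ (vL : FFPrime L) (c : ℚ) (e : ℕ), 0 < c ∧ 0 < e ∧
      (∀ x : L, V.val (x : B) = c * vL.val x) ∧ c0 = c * e ∧ vL.ramIdx v0 (algebraMap F0 L) = e ∧ V.RestrictsTo vL L.val.toRingHom ∧ n ≤ padicValNat q e := by
    intro n
    induction n with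
    | zero =>
      have hfd : FiniteDimensional F0 (⊥ : IntermediateField F0 B) := inferInstance
      obtain ⟨W, vL, c, e, h1, h2, h3, h4, h5, h6, h7, h8⟩ := exists_sub_prime V v0 c0 hc0 hV ⊥
      exact ⟨⊥, hfd, vL, c, e, h1, h2, h5, h6, h7, h8, Nat.zero_le _⟩
    | succ n ih =>
      obtain ⟨L, hfd, vL, c, e, h1, h2, h5, h6, h7, h8, h9⟩ := ih
      obtain ⟨π, hπ, hπ1⟩ := vL.val_surj 1
      obtain ⟨y, hy, hyπ⟩ := hcon π (by simpa using hπ)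
      have hfy : FiniteDimensional F0 (IntermediateField.adjoin F0 {y}) :=
        IntermediateField.adjoin.finiteDimensional (Algebra.IsIntegral.isIntegral y)
      let L' : IntermediateField F0 B := L ⊔ IntermediateField.adjoin F0 {y}
      have hfd' : FiniteDimensional F0 L' := IntermediateField.finiteDimensional_sup L _
      obtain ⟨W, vL', c', e', i1, i2, i3, i4, i5, i6, i7, i8⟩ := exists_sub_prime V v0 c0 hc0 hV L'
      have hyL : y ∈ L' := (le_sup_right : _ ≤ L') (IntermediateField.mem_adjoin_simple_self F0 y)
      refine ⟨L', hfd', vL', c', e', i1, i2, i5, i6, i7, i8, ?_⟩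
      have j1 := i5 ⟨y, hyL⟩
      rw [h5, hπ1] at hyπ
      simp only at j1
      rw [j1] at hyπ
      set m := vL'.val ⟨y, hyL⟩ with hm
      have j2 : (e' : ℚ) = q * m * e := by
        have : c' * e' = c' * (q * m * e) := by rw [← i6, h6]; push_cast at hyπ; linear_combination (-(e : ℚ)) * hyπ
        exact mul_left_cancel₀ i1.ne' this
      have hmpos : 0 < m := by
        by_contra hneg
        push Not at hneg
        have k1 : (0 : ℚ) < e' := by exact_mod_cast i2
        rw [j2] at k1
        have k2 : (m : ℚ) ≤ 0 := by exact_mod_cast hneg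
        have k3 : (0 : ℚ) ≤ q * e := by positivity
        nlinarith [mul_nonneg k3 (neg_nonneg.2 k2)]
      obtain ⟨m', hm'⟩ := Int.eq_ofNat_of_zero_le hmpos.le
      have hm0 : m' ≠ 0 := by omega
      have j3 : e' = q * m' * e := by rw [hm'] at j2; exact_mod_cast j2
      rw [j3, padicValNat.mul (mul_ne_zero hq.ne_zero hm0) h2.ne', padicValNat.mul hq.ne_zero hm0, padicValNat_self]
      omega
  obtain ⟨C, hC⟩ := hqb V
  obtain ⟨L, hfd, vL, c, e, h1, h2, h5, h6, h7, h8, h9⟩ := key (C + 1)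
  have := (hC L hfd v0 vL ((ffval_restricts_iff _ _ _).2 ⟨c0, hc0, hV⟩) h8).1
  rw [h7] at this
  omega

end

theorem q_dvd_of_gen {k k' : Type} [Field k] [Field k'] [Finite k] [Finite k'] (φ : k →+* k') {q : ℕ} (hq : q.Prime) (ζ : k) (hζ : ζ ^ q = 1) (hζ1 : ζ ≠ 1)
    (g : k) (hg0 : g ≠ 0) (hg : ∀ z : k, z ≠ 0 → ∃ n : ℕ, g ^ n = z) (y : k') (hy : y ^ q = φ g) (h : ℕ) (hh : Nat.card k' = Nat.card k ^ h) : q ∣ h := by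
  set N := Nat.card k with hN
  have hN1 : 1 < N := Finite.one_lt_card
  have hord : orderOf g = N - 1 := by
    have hgu : orderOf (Units.mk0 g hg0) = Nat.card kˣ := by
      refine orderOf_eq_card_of_forall_mem_zpowers fun z => ?_
      obtain ⟨n, hn⟩ := hg z z.ne_zero
      exact ⟨n, Units.ext (by simpa using hn)⟩
    rw [Nat.card_units] at hgu
    rw [← hgu, ← orderOf_units]
    rfl
  have := Fact.mk hq
  have hζo : orderOf ζ = q := orderOf_eq_prime hζ hζ1
  have hpow : ∀ z : k, z ≠ 0 → z ^ (N - 1) = 1 := by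
    intro z hz
    have : (Units.mk0 z hz) ^ (Nat.card kˣ) = 1 := pow_card_eq_one'
    rw [Nat.card_units] at this
    simpa using congrArg Units.val this
  have hpow' : ∀ z : k', z ≠ 0 → z ^ (N ^ h - 1) = 1 := by
    intro z hz
    have : (Units.mk0 z hz) ^ (Nat.card k'ˣ) = 1 := pow_card_eq_one'
    rw [Nat.card_units, hh] at this
    simpa using congrArg Units.val this
  have hζ0 : ζ ≠ 0 := by rintro rfl; rw [zero_pow hq.ne_zero] at hζ; exact zero_ne_one hζ
  have hqN : q ∣ N - 1 := by rw [← hζo]; exact orderOf_dvd_of_pow_eq_one (hpow ζ hζ0)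
  have hgeom : N ^ h - 1 = (∑ i ∈ Finset.range h, N ^ i) * (N - 1) := by
    have := Nat.geomSum_eq hN1 h
    rw [this]
    refine (Nat.div_mul_cancel ?_).symm
    simpa using Nat.sub_dvd_pow_sub_pow N 1 h
  obtain ⟨s, hs⟩ := hqN
  have hy0 : y ≠ 0 := by
    rintro rfl
    rw [zero_pow hq.ne_zero] at hy
    exact hg0 ((map_eq_zero φ).1 hy.symm)
  have h1 := hpow' y hy0
  set G := ∑ i ∈ Finset.range h, N ^ i with hG
  have h2 : g ^ (G * s) = 1 := by
    apply φ.injective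
    rw [map_pow, ← hy, map_one, ← pow_mul, ← h1, hgeom, hs]
    congr 1; ring
  have h3 := orderOf_dvd_of_pow_eq_one h2
  rw [hord, hs] at h3
  have hs0 : 0 < s := by
    rcases Nat.eq_zero_or_pos s with h | h
    · rw [h] at hs; omega
    · exact h
  have h4 : q ∣ G := Nat.dvd_of_mul_dvd_mul_right hs0 h3
  have h5 : G ≡ h [MOD q] := by
    have hNq : N ≡ 1 [MOD q] := ((Nat.modEq_iff_dvd' hN1.le).2 ⟨s, hs⟩).symm
    have : G ≡ ∑ i ∈ Finset.range h, 1 [MOD q] := by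
      rw [hG]
      refine Nat.ModEq.sum fun i _ => ?_
      simpa using hNq.pow i
    simpa using this
  exact (Nat.modEq_zero_iff_dvd.1 (h5.symm.trans (Nat.modEq_zero_iff_dvd.2 h4)))

theorem exists_gen (k : Type) [Field k] [Finite k] : ∃ g : k, g ≠ 0 ∧ ∀ z : k, z ≠ 0 → ∃ n : ℕ, g ^ n = z := by
  obtain ⟨g, hg⟩ := IsCyclic.exists_generator (α := kˣ)
  refine ⟨g, g.ne_zero, fun z hz => ?_⟩
  have := hg (Units.mk0 z hz)
  rw [← mem_powers_iff_mem_zpowers] at this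
  obtain ⟨n, hn⟩ := this
  exact ⟨n, by simpa using congrArg Units.val hn⟩

theorem exists_res (p : ℕ) [Fact p.Prime] {F0 B : Type} [Field F0] [Field B] [Algebra F0 B] [Algebra.IsAlgebraic F0 B] [Algebra (ZMod p) F0]
    [Algebra (ZMod p) B] [IsScalarTower (ZMod p) F0 B] [GFF p F0] (V : FFVal B) (v0 : FFPrime F0) (c0 : ℚ)
    {q : ℕ} (hq : q.Prime) (hqp : q ≠ p) (hqb : IsQBounded q F0 B) (hc0 : 0 < c0) (hV : ∀ x : F0, V.val (algebraMap F0 B x) = c0 * v0.val x)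
    (ζ : B) (hζ : IsPrimitiveRoot ζ q) :
    ∃ a : B, V.ord a = 0 ∧ ∀ y : B, ¬ 0 < V.ord (y ^ q - a) := by
  by_contra hcon
  push Not at hcon
  have := Fact.mk hq
  obtain ⟨t, ht, ht1⟩ := v0.val_surj 1
  have htB : algebraMap F0 B t ≠ 0 := by simpa using ht
  let W0 : FFVal F0 := V.comap (algebraMap F0 B) ⟨t, by
      rw [V.ord_eq htB, hV, ht1]
      simpa using hc0.ne', V.ord_ne_top _ htB⟩
  have hW0 : ∀ x, W0.val x = c0 * v0.val x := hV
  have hfin0 : Finite W0.rf := v0.finite_rf p W0 c0 hc0 hW0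
  have hpB : (p : B) = 0 := by
    rw [← map_natCast (algebraMap (ZMod p) B)]; simp
  have key : ∀ n : ℕ, ∃ L : IntermediateField F0 B, FiniteDimensional F0 L ∧ ζ ∈ L ∧ ∃ (W : FFVal L) (vL : FFPrime L) (c : ℚ) (f : ℕ), 0 < c ∧ 0 < f ∧
      (∀ x : L, W.ord x = V.ord (x : B)) ∧ Finite W.rf ∧ Nat.card W.rf = Nat.card W0.rf ^ f ∧ vL.resDeg v0 = f ∧
      V.RestrictsTo vL L.val.toRingHom ∧ n ≤ padicValNat q f := by
    have step : ∀ L : IntermediateField F0 B, FiniteDimensional F0 L → ∃ (W : FFVal L) (vL : FFPrime L) (c : ℚ) (f : ℕ), 0 < c ∧ 0 < f ∧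
      (∀ x : L, W.ord x = V.ord (x : B)) ∧ Finite W.rf ∧ Nat.card W.rf = Nat.card W0.rf ^ f ∧ vL.resDeg v0 = f ∧
      V.RestrictsTo vL L.val.toRingHom := by
      intro L hfd
      obtain ⟨W, vL, c, e, h1, h2, h3, h4, h5, h6, h7, h8⟩ := exists_sub_prime V v0 c0 hc0 hV L
      have hG : GFF p L := GFF.extend p (L := F0) L
      have hfin : Finite W.rf := vL.finite_rf p W c h1 h4
      obtain ⟨g, -⟩ := W0.exists_rmap W (algebraMap F0 L) (fun x hx => by rw [h3]; exact hx) (fun x hx => by rw [h3]; exact hx)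
      obtain ⟨f, hf, hcard⟩ := card_rf_pow g
      exact ⟨W, vL, c, f, h1, hf, h3, hfin, hcard, vL.resDeg_eq v0 W W0 c c0 h1 hc0 h4 hW0 f hf hcard, h8⟩
    intro n
    induction n with
    | zero =>
      have hfd : FiniteDimensional F0 (IntermediateField.adjoin F0 {ζ}) :=
        IntermediateField.adjoin.finiteDimensional (Algebra.IsIntegral.isIntegral ζ)
      obtain ⟨W, vL, c, f, h1, h2, h3, h4, h5, h6, h7⟩ := step _ hfd
      exact ⟨_, hfd, IntermediateField.mem_adjoin_simple_self F0 ζ, W, vL, c, f, h1, h2, h3, h4, h5, h6, h7, Nat.zero_le _⟩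
    | succ n ih =>
      obtain ⟨L, hfd, hζL, W, vL, c, f, h1, h2, h3, h4, h5, h6, h7, h8⟩ := ih
      obtain ⟨g, hg0, hg⟩ := exists_gen W.rf
      obtain ⟨a0, ha0, rfl⟩ := W.res_surj g
      have ha1 : W.ord a0 = 0 := by
        by_contra hne
        exact hg0 ((W.res_eq_zero ha0).2 (lt_of_le_of_ne ha0 (Ne.symm hne)))
      obtain ⟨y, hy⟩ := hcon a0 (by rw [← h3, ha1])
      have hfy : FiniteDimensional F0 (IntermediateField.adjoin F0 {y}) :=
        IntermediateField.adjoin.finiteDimensional (Algebra.IsIntegral.isIntegral y)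
      let L' : IntermediateField F0 B := L ⊔ IntermediateField.adjoin F0 {y}
      have hfd' : FiniteDimensional F0 L' := IntermediateField.finiteDimensional_sup L _
      have hyL : y ∈ L' := (le_sup_right : _ ≤ L') (IntermediateField.mem_adjoin_simple_self F0 y)
      have hLL : L ≤ L' := le_sup_left
      obtain ⟨W', vL', c', f', i1, i2, i3, i4, i5, i6, i7⟩ := step L' hfd'
      refine ⟨L', hfd', hLL hζL, W', vL', c', f', i1, i2, i3, i4, i5, i6, i7, ?_⟩
      have hinc : ∀ x : L, W'.ord (IntermediateField.inclusion hLL x) = W.ord x := fun x => by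
        rw [i3, h3]; rfl
      obtain ⟨φ, hφ⟩ := W.exists_rmap W' (IntermediateField.inclusion hLL : L →+* L') (fun x hx => by
        change 0 ≤ W'.ord (IntermediateField.inclusion hLL x); rw [hinc]; exact hx) (fun x hx => by
        change 0 < W'.ord (IntermediateField.inclusion hLL x); rw [hinc]; exact hx)
      obtain ⟨h, hh0, hh⟩ := card_rf_pow φ
      -- the root of unity
      let z : L := ⟨ζ, hζL⟩
      have hz : IsPrimitiveRoot z q := by
        refine IsPrimitiveRoot.of_map_of_injective (f := L.val) ?_ L.val.injective
        exact hζ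
      have hz0 : 0 ≤ W.ord z := by
        have : 0 ≤ W.ord (z ^ q) := by rw [hz.pow_eq_one, W.ord_one]
        rw [W.zero_le_ord] at this ⊢
        rw [W.val_pow] at this
        exact nonneg_of_mul_nonneg_right this (by exact_mod_cast hq.pos)
      have hzr : W.res z ^ q = 1 := by rw [← W.res_pow hz0, hz.pow_eq_one, W.res_one]
      have hzr1 : W.res z ≠ 1 := by
        intro h
        have hpL : (p : L) = 0 := by
          apply Subtype.ext; simpa using hpB
        apply (W.ord_natCast (Fact.out : p.Prime) hq hqp hpL).1
        have := hz.geom_sum_eq_zero hq.one_lt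
        have h0 := congrArg W.res this
        rw [W.res_sum _ _ fun i _ => W.pow_nonneg' hz0 i, (W.res_eq_zero (by simp [W.ord_zero])).2 (by simp [W.ord_zero])] at h0
        simpa [W.res_pow hz0, h] using h0
      let y' : L' := ⟨y, hyL⟩
      have hya : 0 < W'.ord (y' ^ q - IntermediateField.inclusion hLL a0) := by
        rw [i3]; exact hy
      have ha' : W'.ord (IntermediateField.inclusion hLL a0) = 0 := by rw [hinc, ha1]
      have hy0 : 0 ≤ W'.ord y' := by
        have h0 : 0 ≤ W'.ord (y' ^ q) := by
          have : y' ^ q = (y' ^ q - IntermediateField.inclusion hLL a0) + IntermediateField.inclusion hLL a0 := by ring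
          rw [this]
          exact W'.le_add hya.le ha'.ge
        rw [W'.zero_le_ord] at h0 ⊢
        rw [W'.val_pow] at h0
        exact nonneg_of_mul_nonneg_right h0 (by exact_mod_cast hq.pos)
      have hyr : W'.res y' ^ q = φ (W.res a0) := by
        rw [hφ a0 ha0, ← W'.res_pow hy0]
        exact (W'.res_eq_iff (W'.pow_nonneg' hy0 q) ha'.ge).2 hya
      have hdvd := q_dvd_of_gen φ hq (W.res z) hzr hzr1 (W.res a0) hg0 hg (W'.res y') hyr h hh
      have hff : f' = f * h := by
        rw [i5, h5, ← pow_mul] at hh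
        exact Nat.pow_right_injective (Finite.one_lt_card (α := W0.rf)) hh
      obtain ⟨h', rfl⟩ := hdvd
      have hh' : h' ≠ 0 := by rintro rfl; simp at hh0
      rw [hff, padicValNat.mul h2.ne' hh0.ne', padicValNat.mul hq.ne_zero hh', padicValNat_self]
      omega
  obtain ⟨C, hC⟩ := hqb V
  obtain ⟨L, hfd, hζL, W, vL, c, f, h1, h2, h3, h4, h5, h6, h7, h8⟩ := key (C + 1)
  have := (hC L hfd v0 vL ((ffval_restricts_iff _ _ _).2 ⟨c0, hc0, hV⟩) h7).2
  rw [h6] at this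
  omega

end

noncomputable section

theorem exists_bad_prime {K B : Type} [Field K] [Field B] [Algebra K B] (S : Set (FFPrime K)) (x : B) (hxalg : IsIntegral K x)
    (hx : x ∉ sIntegralClosure S B) :
    ∃ v : FFPrime K, v ∉ S ∧ x ∉ valIntegralClosure v B := by
  by_contra hcon
  push Not at hcon
  apply hx
  refine ⟨minpoly K x, minpoly.monic hxalg, fun n v hv => ?_, minpoly.aeval K x⟩
  obtain ⟨P, hP, hc, h0⟩ := hcon v hv
  obtain ⟨A, hA⟩ := exists_subring (F := K) (E := K) v
  have hA' : ∀ z : K, z ∈ A ↔ 0 ≤ v.val z := hA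
  let _ : Algebra A B := ((algebraMap K B).comp A.subtype).toAlgebra
  have hst : IsScalarTower A K B := IsScalarTower.of_algebraMap_eq fun _ => rfl
  have hInt : IsIntegral A x := by
    have hl : P ∈ Polynomial.lifts A.subtype := by
      rw [Polynomial.lifts_iff_coeff_lifts]
      intro n
      exact ⟨⟨P.coeff n, (hA' _).2 (v.zero_le_ord.1 (hc n))⟩, rfl⟩
    obtain ⟨Q, hQ, -, hQm⟩ := Polynomial.lifts_and_natDegree_eq_and_monic hl hP
    refine ⟨Q, hQm, ?_⟩
    change Polynomial.eval₂ ((algebraMap K B).comp A.subtype) x Q = 0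
    rw [← Polynomial.eval₂_map, hQ]
    exact h0
  rw [minpoly.isIntegrallyClosed_eq_field_fractions' K hInt, Polynomial.coeff_map]
  exact v.zero_le_ord.2 ((hA' _).1 ((minpoly A x).coeff n).2)

theorem FFVal.ord_zero_of_one {E : Type} [Field E] (V : FFVal E) {a : E} (h : 0 < V.ord (a - 1)) : V.ord a = 0 := by
  rw [V.ord_pos_iff] at h
  have := V.val_add_eq (x := 1) (y := a - 1) one_ne_zero (h.imp id (by simp))
  rw [add_sub_cancel] at this
  rw [V.ord_eq this.1, this.2]; simp

theorem FFVal.exists_root_near_one {E : Type} [Field E] [IsAlgClosed E] (V : FFVal E) {q : ℕ} (hq : q.Prime) (ζ : E) (hζ : IsPrimitiveRoot ζ q)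
    (s : E) (hs : 0 < V.ord s) : ∃ α : E, α ^ q = 1 + s ∧ 0 < V.ord (α - 1) := by
  obtain ⟨z, hz⟩ := IsAlgClosed.exists_pow_nat_eq (1 + s) hq.pos
  have hprod := congrArg (Polynomial.eval z) (X_pow_sub_C_eq_prod hζ hq.pos (α := 1) (a := 1) (one_pow q))
  rw [Polynomial.eval_prod] at hprod
  simp only [mul_one, Polynomial.eval_sub, Polynomial.eval_pow, Polynomial.eval_X, Polynomial.eval_C] at hprod
  rw [hz, add_sub_cancel_left] at hprod
  have hζ0 : ζ ≠ 0 := hζ.ne_zero hq.ne_zero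
  have hζv : V.val ζ = 0 := by
    have h1 : V.val (ζ ^ q) = 0 := by rw [hζ.pow_eq_one]; simp
    rw [V.val_pow] at h1
    exact (mul_eq_zero.1 h1).resolve_left (by exact_mod_cast hq.ne_zero)
  have hzpos : 0 ≤ V.ord z := by
    have : 0 ≤ V.ord (z ^ q) := by
      rw [hz]; exact V.le_add V.ord_one.ge hs.le
    rw [V.zero_le_ord] at this ⊢
    rw [V.val_pow] at this
    exact nonneg_of_mul_nonneg_right this (by exact_mod_cast hq.pos)
  have hζi : ∀ i : ℕ, V.ord (ζ ^ i) = 0 := fun i => by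
    rw [V.ord_eq (pow_ne_zero _ hζ0), V.val_pow, hζv]; simp
  obtain ⟨i, hi⟩ : ∃ i : ℕ, 0 < V.ord (z - ζ ^ i) := by
    by_contra hcon
    push Not at hcon
    have h0 : ∀ i, V.ord (z - ζ ^ i) = 0 := fun i => le_antisymm (hcon i) (V.le_sub hzpos (hζi i).ge)
    have : ∀ s : Finset ℕ, V.ord (∏ i ∈ s, (z - ζ ^ i)) = 0 := by
      intro s
      induction s using Finset.induction_on with
      | empty => simp [V.ord_one]
      | insert i s hi ih => rw [Finset.prod_insert hi, V.ord_mul, h0, ih, add_zero]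
    rw [hprod, this] at hs
    exact lt_irrefl _ hs
  refine ⟨z * (ζ ^ i)⁻¹, ?_, ?_⟩
  · rw [mul_pow, hz, inv_pow, ← pow_mul, mul_comm i, pow_mul, hζ.pow_eq_one, one_pow, inv_one, mul_one]
  · have e1 : z * (ζ ^ i)⁻¹ - 1 = (z - ζ ^ i) * (ζ ^ i)⁻¹ := by
      rw [sub_mul, mul_inv_cancel₀ (pow_ne_zero _ hζ0)]
    have e2 : V.ord (ζ ^ i)⁻¹ = 0 := by
      rw [V.ord_eq (inv_ne_zero (pow_ne_zero _ hζ0)), V.val_inv, V.val_of_ord (hζi i)]; simp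
    rw [e1, V.ord_mul, e2, add_zero]
    exact hi

theorem gen_pow {F E : Type} [Field F] [Field E] [Algebra F E] {q : ℕ} {α : E} {A : F} (h : α ^ q = algebraMap F E A) :
    (IntermediateField.AdjoinSimple.gen F α) ^ q = algebraMap F (IntermediateField.adjoin F {α}) A := Subtype.ext h

theorem gen_top {F E : Type} [Field F] [Field E] [Algebra F E] (α : E) :
    IntermediateField.adjoin F {IntermediateField.AdjoinSimple.gen F α} = ⊤ := by
  apply IntermediateField.lift_injective
  rw [IntermediateField.lift_adjoin_simple, IntermediateField.lift_top, IntermediateField.AdjoinSimple.coe_gen]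

theorem isIntegral_of_pow {F E : Type} [Field F] [Field E] [Algebra F E] {q : ℕ} (hq : q ≠ 0) {α : E} {A : F}
    (h : α ^ q = algebraMap F E A) : IsIntegral F α := ⟨_, Polynomial.monic_X_pow_sub_C A hq, by simp [h]⟩

theorem exists_adjoin {F Ω : Type} [Field F] [Field Ω] [Algebra F Ω] {q : ℕ} (hq : q ≠ 0) (α : Ω) (A : F) (h : α ^ q = algebraMap F Ω A) :
    ∃ (M : Type) (_ : Field M) (_ : Algebra F M) (_ : Algebra M Ω) (_ : IsScalarTower F M Ω) (g : M),
      g ^ q = algebraMap F M A ∧ IntermediateField.adjoin F {g} = ⊤ ∧ FiniteDimensional F M :=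
  ⟨IntermediateField.adjoin F {α}, inferInstance, inferInstance, inferInstance, inferInstance, IntermediateField.AdjoinSimple.gen F α, gen_pow h,
    gen_top α, IntermediateField.adjoin.finiteDimensional (isIntegral_of_pow hq h)⟩

theorem FFVal.tower_step {F Ω : Type} [Field F] [Field Ω] [Algebra F Ω] (V : FFVal Ω) {q : ℕ} (hq : q.Prime) (hqV : V.ord (q : Ω) = 0)
    (α : Ω) (n : 0 < V.ord (α - 1)) (A : F) (h : α ^ q = algebraMap F Ω A) {a c : Ω} (ha : V.ord a = 0) (np : V.NP F q a c) :
    ∃ (M : Type) (_ : Field M) (_ : Algebra F M) (_ : Algebra M Ω) (_ : IsScalarTower F M Ω) (g : M),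
      g ^ q = algebraMap F M A ∧ IntermediateField.adjoin F {g} = ⊤ ∧ V.NP M q a c :=
  ⟨IntermediateField.adjoin F {α}, inferInstance, inferInstance, inferInstance, inferInstance, IntermediateField.AdjoinSimple.gen F α, gen_pow h,
    gen_top α, V.np_step hq.pos hqV α n _ h ha np⟩

theorem tower_unsolvable {B Ω : Type} [Field B] [Field Ω] [Algebra B Ω] [IsAlgClosed Ω] (V : FFVal Ω) {q : ℕ} (hq : q.Prime)
    (hqV : V.ord (q : Ω) = 0) (ζ : B) (hζ : IsPrimitiveRoot ζ q) (V0 : FFVal B) (hV0 : ∀ z : B, V0.ord z = V.ord (algebraMap B Ω z))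
    (a b x : B) (ha : V0.ord a = 0) (hx : V0.val x < 0) (hc : V0.val (b * x ^ q + b ^ q) < 0)
    (hnp1 : ∀ y : B, y ≠ 0 → q * V0.val y ≠ V0.val (b * x ^ q + b ^ q))
    (hnp2 : ∀ y : B, ¬ 0 < V0.ord (y ^ q - a)) : ¬ NormTower4Solvable q B a b x := by
  intro hsolv
  set c := b * x ^ q + b ^ q with hcdef
  have hval : ∀ z : B, V0.val z = V.val (algebraMap B Ω z) := fun z => by unfold FFVal.val; rw [hV0]
  have hinv : ∀ z : B, V0.val z < 0 → 0 < V0.ord z⁻¹ := fun z hz => by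
    rw [V0.ord_pos_iff, V0.val_inv]; right; linarith
  have hζΩ : IsPrimitiveRoot (algebraMap B Ω ζ) q := hζ.map_of_injective (algebraMap B Ω).injective
  have ha' : V.ord (algebraMap B Ω a) = 0 := by rw [← hV0, ha]
  have s1 : 0 < V.ord (algebraMap B Ω c⁻¹) := by rw [← hV0]; exact hinv c hc
  have s3 : 0 < V.ord (algebraMap B Ω x⁻¹) := by rw [← hV0]; exact hinv x hx
  have s4 : 0 < V.ord (algebraMap B Ω ((a + a⁻¹) * x⁻¹)) := by
    rw [← hV0, V0.ord_mul]
    refine lt_of_lt_of_le (hinv x hx) (le_add_of_nonneg_left (V0.le_add ha.ge ?_))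
    rw [V0.zero_le_ord, V0.val_inv, V0.val_of_ord ha]; simp
  obtain ⟨α1, h1, n1⟩ := V.exists_root_near_one hq _ hζΩ _ s1
  obtain ⟨α3, h3, n3⟩ := V.exists_root_near_one hq _ hζΩ _ s3
  obtain ⟨α4, h4, n4⟩ := V.exists_root_near_one hq _ hζΩ _ s4
  obtain ⟨α5, h5⟩ := IsAlgClosed.exists_pow_nat_eq (algebraMap B Ω a) hq.pos
  have h1' : α1 ^ q = algebraMap B Ω (1 + c⁻¹) := by rw [h1, map_add, map_one]
  have np0 : V.NP B q (algebraMap B Ω a) (algebraMap B Ω c) :=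
    ⟨fun y hy => by rw [← hval, ← hval]; exact hnp1 y hy, fun y => by rw [← map_pow, ← map_sub, ← hV0]; exact hnp2 y⟩
  obtain ⟨M1, _, _, _, _, g1, hg1, ht1, np1⟩ := V.tower_step hq hqV α1 n1 _ h1' ha' np0
  have h3' : α3 ^ q = algebraMap M1 Ω (algebraMap B M1 (1 + x⁻¹)) := by
    rw [← IsScalarTower.algebraMap_apply B M1 Ω, h3, map_add, map_one]
  obtain ⟨M3, _, _, _, _, g3, hg3, ht3, np3⟩ := V.tower_step (F := M1) hq hqV α3 n3 _ h3' ha' np1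
  have h4' : α4 ^ q = algebraMap M3 Ω (algebraMap M1 M3 (algebraMap B M1 (1 + (a + a⁻¹) * x⁻¹))) := by
    rw [← IsScalarTower.algebraMap_apply M1 M3 Ω, ← IsScalarTower.algebraMap_apply B M1 Ω, h4, map_add, map_one]
  obtain ⟨M4, _, _, _, _, g4, hg4, ht4, np4⟩ := V.tower_step (F := M3) hq hqV α4 n4 _ h4' ha' np3
  have e4 : ∀ z : B, algebraMap M4 Ω (algebraMap M3 M4 (algebraMap M1 M3 (algebraMap B M1 z))) = algebraMap B Ω z := fun z => by
    rw [← IsScalarTower.algebraMap_apply M3 M4 Ω, ← IsScalarTower.algebraMap_apply M1 M3 Ω, ← IsScalarTower.algebraMap_apply B M1 Ω]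
  obtain ⟨M5, _, _, _, _, g5, hg5, ht5, hfd⟩ := exists_adjoin (F := M4) hq.ne_zero α5 _ (h5.trans (e4 a).symm)
  obtain ⟨y, hy⟩ := hsolv M1 g1 hg1 ht1 M3 g3 hg3 ht3 M4 g4 hg4 ht4 M5 g5 hg5 ht5
  obtain ⟨t, ht1, ht2⟩ := V0.nontrivial
  rw [hV0, ← e4] at ht1 ht2
  let W4 : FFVal M4 := V.comap (algebraMap M4 Ω) ⟨_, ht1, ht2⟩
  rw [IsScalarTower.algebraMap_apply M4 M5 Ω] at ht1 ht2
  let W5 : FFVal M5 := V.comap (algebraMap M5 Ω) ⟨_, ht1, ht2⟩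
  have hc0 : c ≠ 0 := by intro h; rw [h] at hc; simp at hc
  have hy0 : y ≠ 0 := by
    rintro rfl
    rw [Algebra.norm_zero] at hy
    have := hy.symm
    simp only [map_eq_zero] at this
    exact hc0 this
  obtain ⟨m, hm0, hm⟩ := norm_val_dvd (F := M4) (M := M5) hq (algebraMap M3 M4 (algebraMap M1 M3 (algebraMap B M1 ζ)))
    (((hζ.map_of_injective (algebraMap B M1).injective).map_of_injective (algebraMap M1 M3).injective).map_of_injective (algebraMap M3 M4).injective)
    W5 W4 (fun z => by
      change V.ord _ = V.ord _
      rw [← IsScalarTower.algebraMap_apply M4 M5 Ω]) g5 _ hg5 (by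
      change V.ord _ = _
      rw [e4, ha']) ht5 (fun z => by
      change ¬ 0 < V.ord _
      rw [map_sub, e4, map_pow]
      exact np4.2 z) y hy0
  rw [hy] at hm
  have hm' : V.val _ = q * V.val _ := hm
  rw [e4] at hm'
  exact np4.1 m hm0 hm'.symm

end

noncomputable section

theorem FFPrime.eq_of_mul_val {K : Type} [Field K] (v v' : FFPrime K) (r r' : ℚ) (hr : 0 < r) (hr' : 0 < r')
    (h : ∀ z : K, r * v.val z = r' * v'.val z) : v = v' := by
  obtain ⟨s, hs, hs1⟩ := v.val_surj 1
  obtain ⟨t, ht, ht1⟩ := v'.val_surj 1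
  have h1 := h s
  have h2 := h t
  rw [hs1] at h1
  rw [ht1] at h2
  have hle : ∀ (m : ℤ) (a b : ℚ), 0 < a → 0 < b → a * ((1 : ℤ) : ℚ) = b * m → b ≤ a := by
    intro m a b ha hb he
    push_cast at he
    have hm : 0 < (m : ℚ) := pos_of_mul_pos_right (by rw [← he]; linarith) hb.le
    have hm1 : (1 : ℚ) ≤ m := by exact_mod_cast (show (0 : ℤ) < m by exact_mod_cast hm)
    nlinarith
  have e : r = r' := le_antisymm (hle _ _ _ hr' hr h2.symm) (hle _ _ _ hr hr' h1)
  subst e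
  refine FFPrime.ext_val fun z _ => ?_
  exact_mod_cast mul_left_cancel₀ hr.ne' (h z)

theorem finite_over (p : ℕ) [Fact p.Prime] {K L : Type} [Field K] [Field L] [Algebra K L] [Algebra (ZMod p) L] [GFF p L]
    (S : Set (FFPrime K)) (hS : S.Finite) :
    {w : FFPrime L | ∃ v ∈ S, ∃ e : ℚ, 0 < e ∧ ∀ z : K, (w.val (algebraMap K L z) : ℚ) = e * v.val z}.Finite := by
  choose t ht ht1 using fun v : FFPrime K => v.val_surj (-1)
  refine (hS.biUnion fun v _ => finite_poles p (algebraMap K L (t v))).subset ?_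
  rintro w ⟨v, hv, e, he, h⟩
  refine Set.mem_biUnion hv ?_
  have h1 := h (t v)
  rw [ht1] at h1
  have : (w.val (algebraMap K L (t v)) : ℚ) < 0 := by rw [h1]; push_cast; linarith
  exact_mod_cast this

theorem exists_ab (p : ℕ) [Fact p.Prime] {K B : Type} [Field K] [Field B] [Algebra K B] [Algebra.IsAlgebraic K B] [Algebra (ZMod p) K]
    [Algebra (ZMod p) B] [IsScalarTower (ZMod p) K B] [GFF p K] (S : Set (FFPrime K)) (hS : S.Finite) (V : FFVal B) (v : FFPrime K) (hv : v ∉ S)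
    (hV : ∀ z : K, V.val (algebraMap K B z) = v.val z) {q : ℕ} (hq : q.Prime) (x : B) (hx : V.val x < 0)
    (π : B) (hπ0 : π ≠ 0) (hπ : ∀ y : B, y ≠ 0 → q * V.val y ≠ V.val π)
    (a0 : B) (ha0 : V.ord a0 = 0) (ha1 : ∀ y : B, ¬ 0 < V.ord (y ^ q - a0)) :
    ∃ a b : B, a ∈ onesAtS S B ∧ b ∈ unitsAtS S B ∧ a ≠ 0 ∧ b * x ^ q + b ^ q ≠ 0 ∧ V.val (b * x ^ q + b ^ q) < 0 ∧
      (∀ y : B, y ≠ 0 → q * V.val y ≠ V.val (b * x ^ q + b ^ q)) ∧ V.ord a = 0 ∧ ∀ y : B, ¬ 0 < V.ord (y ^ q - a) := by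
  classical
  have hx0 : x ≠ 0 := by rintro rfl; simp at hx
  let L : IntermediateField K B := IntermediateField.adjoin K {x, π, a0}
  have hfd : FiniteDimensional K L := IntermediateField.finiteDimensional_adjoin fun z _ => Algebra.IsIntegral.isIntegral z
  have hG : GFF p L := GFF.extend p (L := K) L
  have hxL : x ∈ L := IntermediateField.subset_adjoin _ _ (by simp)
  have hπL : π ∈ L := IntermediateField.subset_adjoin _ _ (by simp)
  have haL : a0 ∈ L := IntermediateField.subset_adjoin _ _ (by simp)
  obtain ⟨W, vL, c, e, hc, he, hW, -, hVL, hce, -, -⟩ := exists_sub_prime V v 1 one_pos (fun z => by rw [hV, one_mul]) L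
  set WS := {w : FFPrime L | ∃ v ∈ S, ∃ e : ℚ, 0 < e ∧ ∀ z : K, (w.val (algebraMap K L z) : ℚ) = e * v.val z} with hWS
  have hWfin : WS.Finite := finite_over p S hS
  have hvL : vL ∉ WS := by
    rintro ⟨v', hv', e', he', h'⟩
    apply hv
    have : v = v' := by
      refine v.eq_of_mul_val v' 1 (c * e') one_pos (by positivity) fun z => ?_
      rw [mul_assoc, ← h', ← hVL, one_mul, ← hV]
      rfl
    rwa [this]
  -- any valuation over a prime of `S` sees an element of `WS`
  have hsee : ∀ V' : FFVal B, (∃ v' ∈ S, V'.RestrictsTo v' (algebraMap K B)) → ∃ w ∈ WS, ∃ c' : ℚ, 0 < c' ∧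
      ∀ z : L, V'.val (z : B) = c' * w.val z := by
    rintro V' ⟨v', hv', hres⟩
    obtain ⟨r, hr, hres⟩ := (ffval_restricts_iff _ _ _).1 hres
    obtain ⟨W', w, c', e', hc', he', -, -, h1, h2, -, -⟩ := exists_sub_prime V' v' r hr hres L
    refine ⟨w, ⟨v', hv', e', by exact_mod_cast he', fun z => ?_⟩, c', hc', h1⟩
    have h3 := h1 (algebraMap K L z)
    have h4 : V'.val (algebraMap K B z) = c' * w.val (algebraMap K L z) := h3
    rw [hres, h2, mul_assoc] at h4
    exact (mul_left_cancel₀ hc'.ne' h4).symm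
  have hpos : ∀ z : L, ∀ (V' : FFVal B) (w : FFPrime L) (c' : ℚ), 0 < c' → (∀ z : L, V'.val (z : B) = c' * w.val z) → ∀ m : ℤ,
      (m : WithTop ℤ) ≤ w.ord z → ((c' * m : ℚ) : WithTop ℚ) ≤ V'.ord (z : B) := by
    intro z V' w c' hc' h m hm
    rw [w.coe_le_ord] at hm
    rw [V'.coe_le_ord]
    rcases hm with rfl | hm
    · left; rfl
    · right
      rw [h]
      exact mul_le_mul_of_nonneg_left (by exact_mod_cast hm) hc'.le
  let F : Finset (FFPrime L) := insert vL hWfin.toFinset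
  have hF1 : vL ∈ F := Finset.mem_insert_self _ _
  have hF2 : ∀ w ∈ WS, w ∈ F := fun w hw => Finset.mem_insert_of_mem (by simpa using hw)
  have hne : ∀ w ∈ WS, w ≠ vL := fun w hw h => hvL (h ▸ hw)
  have happ : ∀ (b1 : L) (N : ℤ), 0 < N → ∃ b : L, (∀ V' : FFVal B, (∃ v' ∈ S, V'.RestrictsTo v' (algebraMap K B)) → 0 < V'.ord ((b : B) - 1)) ∧
      ((c * N : ℚ) : WithTop ℚ) ≤ V.ord ((b : B) - b1) := by
    intro b1 N hN
    obtain ⟨b, hb⟩ := FFPrime.weak_approx F (fun w => if w = vL then b1 else 1) N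
    refine ⟨b, fun V' hV' => ?_, ?_⟩
    · obtain ⟨w, hw, c', hc', h⟩ := hsee V' hV'
      have h1 := hb w (hF2 w hw)
      rw [if_neg (hne w hw)] at h1
      refine lt_of_lt_of_le ?_ (hpos (b - 1) V' w c' hc' h N h1)
      have : (0 : ℚ) < c' * N := mul_pos hc' (by exact_mod_cast hN)
      exact_mod_cast this
    · have h1 := hb vL hF1
      simp only [if_true] at h1
      exact hpos (b - b1) V vL c hc hVL N h1
  -- the element `b`
  let xL : L := ⟨x, hxL⟩
  let πL : L := ⟨π, hπL⟩
  have hxL0 : xL ≠ 0 := fun h => hx0 (congrArg Subtype.val h)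
  have hπL0 : πL ≠ 0 := fun h => hπ0 (congrArg Subtype.val h)
  have hxv : vL.val xL < 0 := by
    have h1 : V.val x = c * vL.val xL := hVL xL
    rw [h1] at hx
    have : (vL.val xL : ℚ) < 0 := by
      by_contra hcon
      push Not at hcon
      exact absurd (mul_nonneg hc.le hcon) (not_le.2 hx)
    exact_mod_cast this
  have hqpos : (0 : ℤ) < q := by exact_mod_cast hq.pos
  set D : ℤ := q * (- vL.val xL) with hD
  have hD0 : 0 < D := mul_pos hqpos (by linarith)
  set n := vL.val πL with hn
  set k := n / D with hk
  let b1 : L := πL * (xL ^ k) ^ q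
  have hb10 : b1 ≠ 0 := mul_ne_zero hπL0 (pow_ne_zero _ (zpow_ne_zero _ hxL0))
  have hb1v : vL.val b1 = n % D := by
    rw [vL.val_mul hπL0 (pow_ne_zero _ (zpow_ne_zero _ hxL0)), vL.val_pow, vL.val_zpow, ← hn, Int.emod_def, ← hk, hD]
    ring
  have hm0 : 0 ≤ vL.val b1 := by rw [hb1v]; exact Int.emod_nonneg _ hD0.ne'
  have hmD : vL.val b1 < D := by rw [hb1v]; exact Int.emod_lt_of_pos _ hD0
  obtain ⟨b, hbS, hbV⟩ := happ b1 (vL.val b1 + 1) (by linarith)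
  obtain ⟨a, haS, haV⟩ := happ ⟨a0, haL⟩ 1 one_pos
  have hb1B0 : (b1 : B) ≠ 0 := fun h => hb10 (Subtype.ext h)
  have hVb1 : V.val (b1 : B) = c * vL.val b1 := hVL b1
  have hb2 := V.val_add_eq (x := (b1 : B)) (y := (b : B) - b1) hb1B0 (by
    rw [V.coe_le_ord] at hbV
    refine hbV.imp id fun h => lt_of_lt_of_le ?_ h
    rw [hVb1]
    push_cast
    nlinarith)
  rw [add_sub_cancel] at hb2
  obtain ⟨hb0, hVb⟩ := hb2
  have hVx : V.val x = c * vL.val xL := hVL xL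
  have hVbn : 0 ≤ V.val (b : B) := by
    rw [hVb, hVb1]; exact mul_nonneg hc.le (by exact_mod_cast hm0)
  have hVbD : V.val (b : B) + q * V.val x < 0 := by
    rw [hVb, hVb1, hVx]
    have : (vL.val b1 : ℚ) < D := by exact_mod_cast hmD
    rw [hD] at this
    push_cast at this
    nlinarith
  have hqQ : (0 : ℚ) ≤ q := by positivity
  have hc1 := V.val_add_eq (x := (b : B) * x ^ q) (y := (b : B) ^ q) (mul_ne_zero hb0 (pow_ne_zero _ hx0)) (by
    right
    rw [V.val_mul hb0 (pow_ne_zero _ hx0), V.val_pow, V.val_pow]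
    exact lt_of_lt_of_le hVbD (mul_nonneg hqQ hVbn))
  rw [V.val_mul hb0 (pow_ne_zero _ hx0), V.val_pow] at hc1
  have haV' : 0 < V.ord ((a : B) - a0) := by
    refine lt_of_lt_of_le ?_ haV
    have : (0 : ℚ) < c * ((1 : ℤ) : ℚ) := by push_cast; linarith
    exact_mod_cast this
  have haord : V.ord (a : B) = 0 := by
    have ha00 : a0 ≠ 0 := by rintro rfl; rw [V.ord_zero] at ha0; simp at ha0
    have h1 := V.val_add_eq (x := a0) (y := (a : B) - a0) ha00 (by
      rw [V.val_of_ord ha0]; exact V.ord_pos_iff.1 haV')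
    rw [add_sub_cancel, V.val_of_ord ha0] at h1
    rw [V.ord_eq h1.1, h1.2]; simp
  refine ⟨a, b, fun V' h => haS V' h, fun V' h => V'.ord_zero_of_one (hbS V' h), ?_, hc1.1, by rw [hc1.2]; exact hVbD, ?_, haord, ?_⟩
  · intro h; rw [h, V.ord_zero] at haord; simp at haord
  · intro y hy h
    rw [hc1.2, hVb] at h
    let xk : B := ((xL ^ k : L) : B)
    have hxk : xk ≠ 0 := fun h => zpow_ne_zero k hxL0 (Subtype.ext h)
    have hb1e : (b1 : B) = π * xk ^ q := rfl
    rw [hb1e, V.val_mul hπ0 (pow_ne_zero _ hxk), V.val_pow] at h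
    refine hπ (y / (x * xk)) (div_ne_zero hy (mul_ne_zero hx0 hxk)) ?_
    rw [V.val_div hy (mul_ne_zero hx0 hxk), V.val_mul hx0 hxk]
    linarith
  · intro y hy
    apply ha1 y
    have : y ^ q - a0 = (y ^ q - a) + (a - a0) := by ring
    rw [this]
    exact V.lt_add hy haV'

theorem reverse_dir (p q : ℕ) [Fact p.Prime] (hq : q.Prime) (hqp : q ≠ p)
    (K : Type) [Field K] [Algebra (RatFunc (ZMod p)) K]
    [FiniteDimensional (RatFunc (ZMod p)) K]
    (ζ : K) (hζ : IsPrimitiveRoot ζ q)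
    (BK : Type) [Field BK] [Algebra K BK] [Algebra.IsAlgebraic K BK]
    [Algebra (RatFunc (ZMod p)) BK] [IsScalarTower (RatFunc (ZMod p)) K BK]
    (hqb : IsQBounded q (RatFunc (ZMod p)) BK)
    (S : Set (FFPrime K)) (hSfin : S.Finite)
    (x : BK) (hx : x ≠ 0)
    (h : ∀ a b : BK, a ∈ onesAtS S BK → b ∈ unitsAtS S BK →
        a ≠ 0 → b * x ^ q + b ^ q ≠ 0 →
        NormTower4Solvable q BK a b x) : x ∈ sIntegralClosure S BK := by
  by_contra hxS
  let _ : Algebra (ZMod p) K := ((algebraMap (RatFunc (ZMod p)) K).comp (algebraMap (ZMod p) (RatFunc (ZMod p)))).toAlgebra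
  have _ : IsScalarTower (ZMod p) (RatFunc (ZMod p)) K := IsScalarTower.of_algebraMap_eq fun _ => rfl
  let _ : Algebra (ZMod p) BK := ((algebraMap (RatFunc (ZMod p)) BK).comp (algebraMap (ZMod p) (RatFunc (ZMod p)))).toAlgebra
  have _ : IsScalarTower (ZMod p) (RatFunc (ZMod p)) BK := IsScalarTower.of_algebraMap_eq fun _ => rfl
  have _ : IsScalarTower (ZMod p) K BK := IsScalarTower.of_algebraMap_eq fun z => by
    change algebraMap (RatFunc (ZMod p)) BK _ = algebraMap K BK (algebraMap (RatFunc (ZMod p)) K _)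
    exact IsScalarTower.algebraMap_apply (RatFunc (ZMod p)) K BK _
  have _ := gff_ratFunc p
  have _ : GFF p K := GFF.extend p (L := RatFunc (ZMod p)) K
  have _ : Algebra.IsAlgebraic (RatFunc (ZMod p)) BK := Algebra.IsAlgebraic.trans _ K BK
  obtain ⟨v, hv, hxv⟩ := exists_bad_prime S x (Algebra.IsIntegral.isIntegral x) hxS
  have hxΩ : algebraMap BK (AlgebraicClosure BK) x ∉ valIntegralClosure v (AlgebraicClosure BK) := by
    rintro ⟨P, hP, hc, h0⟩
    refine hxv ⟨P, hP, hc, ?_⟩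
    rw [Polynomial.aeval_algebraMap_apply] at h0
    simpa using h0
  have _ : Algebra.IsAlgebraic K (AlgebraicClosure BK) := Algebra.IsAlgebraic.trans K BK _
  obtain ⟨A, hA, hxA⟩ := exists_subring_notMem (F := K) (E := AlgebraicClosure BK) v _ hxΩ
  obtain ⟨V, hV, hVA⟩ := exists_ffval_of_subring v A hA
  have hxne : algebraMap BK (AlgebraicClosure BK) x ≠ 0 := by simpa using hx
  have hVx : V.val (algebraMap BK (AlgebraicClosure BK) x) < 0 := by
    rw [hVA _ hxne] at hxA; exact not_le.1 hxA
  let V0 : FFVal BK := V.comap (algebraMap BK (AlgebraicClosure BK)) ⟨x, by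
    rw [V.ord_eq hxne]; exact_mod_cast hVx.ne, V.ord_ne_top _ hxne⟩
  have hV0K : ∀ z : K, V0.val (algebraMap K BK z) = v.val z := fun z => by
    rw [← hV z, IsScalarTower.algebraMap_apply K BK (AlgebraicClosure BK)]; rfl
  obtain ⟨v0, e, he, hv0⟩ := FFPrime.exists_restrict (F := RatFunc (ZMod p)) v
  have heQ : (0 : ℚ) < e := by exact_mod_cast he
  have hV00 : ∀ z : RatFunc (ZMod p), V0.val (algebraMap (RatFunc (ZMod p)) BK z) = (e : ℚ) * v0.val z := fun z => by
    rw [IsScalarTower.algebraMap_apply (RatFunc (ZMod p)) K BK, hV0K, hv0]; push_cast; rfl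
  have hζB : IsPrimitiveRoot (algebraMap K BK ζ) q := hζ.map_of_injective (algebraMap K BK).injective
  obtain ⟨π, hπ0, hπ⟩ := exists_ram V0 v0 e hq hqb heQ hV00
  obtain ⟨a0, ha0, ha1⟩ := exists_res p V0 v0 e hq hqp hqb heQ hV00 _ hζB
  obtain ⟨a, b, haS, hbS, hane, hcne, hcv, hcq, haord, haq⟩ := exists_ab p S hSfin V0 v hv hV0K hq x hVx π hπ0 hπ a0 ha0 ha1
  have hpΩ : (p : AlgebraicClosure BK) = 0 := by
    rw [← map_natCast (algebraMap BK (AlgebraicClosure BK)), ← map_natCast (algebraMap (ZMod p) BK)]; simp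
  have hqV := (V.ord_natCast (Fact.out : p.Prime) hq hqp hpΩ).2
  exact tower_unsolvable V hq hqV _ hζB V0 (fun _ => rfl) a b x haord hVx hcv hcq haq (h a b haS hbS hane hcne)

end

/-- For a `q`-bounded algebraic extension `BK` of a global function
field `K` containing a primitive `q`-th root of unity and a nonempty finite set `S` of
primes of `K`, an element `x ∈ BK^×` lies in `O_{BK,S}` if and only if for all
`a ∈ 𝒱_{BK,S}` and `b ∈ U_{BK,S}` (with the inverted elements nonzero) the norm
equation `N_{L₄(a^{1/q})/L₄}(y) = b x^q + b^q` is solvable over `BK`. -/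
theorem statement2 (p q : ℕ) [Fact p.Prime] (hq : q.Prime) (hqp : q ≠ p)
    (K : Type) [Field K] [Algebra (RatFunc (ZMod p)) K]
    [FiniteDimensional (RatFunc (ZMod p)) K]
    (ζ : K) (hζ : IsPrimitiveRoot ζ q)
    (BK : Type) [Field BK] [Algebra K BK] [Algebra.IsAlgebraic K BK]
    [Algebra (RatFunc (ZMod p)) BK] [IsScalarTower (RatFunc (ZMod p)) K BK]
    (hqb : IsQBounded q (RatFunc (ZMod p)) BK)
    (S : Set (FFPrime K)) (hSfin : S.Finite) (hSne : S.Nonempty)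
    (x : BK) (hx : x ≠ 0) :
    x ∈ sIntegralClosure S BK ↔
      ∀ a b : BK, a ∈ onesAtS S BK → b ∈ unitsAtS S BK →
        a ≠ 0 → b * x ^ q + b ^ q ≠ 0 →
        NormTower4Solvable q BK a b x := by
  exact ⟨fun hxS a b ha hb ha0 hc0 => forward_dir p q hq K ζ hζ BK S x hx hxS a b ha hb ha0 hc0,
    fun h => reverse_dir p q hq hqp K ζ hζ BK hqb S hSfin x hx h⟩
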